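/- Let n ≥ 1, let g be a holomorphic function on B_n, let 0 < p < ∞ and 0 < t < ∞, and fix an aperture α > 1. Then g ∈ H^{pt} if and only if ∫_{S_n} ( ∫_{Γ_α(ζ)} |g(z)|^{2t−2} |∇̃g(z)|² dλ_n(z) )^{p/2} dσ(ζ) < ∞, where ∇̃g is the invariant gradient of g. -/

import Mathlib

open MeasureTheory Metric Set Filter
open scoped ENNReal NNReal Topology

noncomputable section

/-- ℂⁿ with its Euclidean (Hermitian) structure. -/
abbrev En (n : ℕ) := EuclideanSpace ℂ (Fin n)

instance (n : ℕ) : MeasurableSpace (En n) := borel _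
instance (n : ℕ) : BorelSpace (En n) := ⟨rfl⟩

/-- The open unit ball `B_n` of ℂⁿ. -/
def Bn (n : ℕ) : Set (En n) := Metric.ball 0 1

/-- The unit sphere `S_n = ∂B_n`. -/
def Sn (n : ℕ) : Set (En n) := Metric.sphere 0 1

/-- The Hermitian inner product `⟨z,w⟩ = ∑ z_k * conj (w_k)`. -/
def herm {n : ℕ} (z w : En n) : ℂ := ∑ k, z k * (starRingEnd ℂ) (w k)

/-- The surface measure on the unit sphere, normalized so that `σ(S_n) = 1`
(the `(2n-1)`-dimensional Hausdorff measure restricted to the sphere, normalized). -/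
def sigmaS (n : ℕ) : Measure (En n) :=
  ((μH[(2 * n - 1 : ℝ)] (Sn n))⁻¹) • (μH[(2 * n - 1 : ℝ)]).restrict (Sn n)

/-- Lebesgue measure on the unit ball, normalized so that `v(B_n) = 1`. -/
def volN (n : ℕ) : Measure (En n) :=
  ((volume (Bn n))⁻¹) • volume.restrict (Bn n)

/-- The radial derivative `Rg(z) = ∑ z_k ∂g/∂z_k (z) = (Dg)(z)[z]`. -/
def radD {n : ℕ} (g : En n → ℂ) (z : En n) : ℂ := fderiv ℂ g z z

/-- The Volterra-type integration operator `J_g f(z) = ∫₀¹ f(tz) Rg(tz) dt/t`. -/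
def J {n : ℕ} (g f : En n → ℂ) (z : En n) : ℂ :=
  ∫ t in Set.Ioo (0 : ℝ) 1, f (t • z) * radD g (t • z) / (t : ℂ)

/-- The Hardy space quasinorm `‖f‖_{H^p}`, with values in `ℝ≥0∞`:
`‖f‖_{H^p}^p = sup_{0<r<1} ∫_{S_n} |f(rζ)|^p dσ(ζ)`. -/
def hNorm (n : ℕ) (p : ℝ) (f : En n → ℂ) : ℝ≥0∞ :=
  (⨆ r ∈ Set.Ioo (0 : ℝ) 1,
    ∫⁻ ζ, (‖f (r • ζ)‖₊ : ℝ≥0∞) ^ p ∂(sigmaS n)) ^ (1 / p)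

/-- Membership in the Hardy space `H^p(B_n)`. -/
def MemHp (n : ℕ) (p : ℝ) (f : En n → ℂ) : Prop :=
  DifferentiableOn ℂ f (Bn n) ∧ hNorm n p f < ⊤

/-- The Carleson box `B_δ(ζ) = {z ∈ B_n : |1 - ⟨z,ζ⟩| < δ}`. -/
def cBox {n : ℕ} (ζ : En n) (δ : ℝ) : Set (En n) :=
  {z ∈ Bn n | ‖(1 : ℂ) - herm z ζ‖ < δ}

/-- The measure `dμ_g(z) = |Rg(z)|²(1-|z|²) dv(z)`. -/
def muJ (n : ℕ) (g : En n → ℂ) : Measure (En n) :=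
  (volN n).withDensity
    (fun z => (‖radD g z‖₊ : ℝ≥0∞) ^ 2 * ENNReal.ofReal (1 - ‖z‖ ^ 2))

/-- The admissible approach region `Γ_α(ζ) = {z ∈ B_n : |1-⟨z,ζ⟩| < (α/2)(1-|z|²)}`. -/
def Gam {n : ℕ} (α : ℝ) (ζ : En n) : Set (En n) :=
  {z ∈ Bn n | ‖(1 : ℂ) - herm z ζ‖ < α / 2 * (1 - ‖z‖ ^ 2)}

open Classical in
/-- The involutive automorphism `φ_a` of the unit ball interchanging `0` and `a`:
`φ_a(z) = (a - P_a z - √(1-|a|²) (z - P_a z)) / (1 - ⟨z,a⟩)`, where `P_a` is the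
orthogonal projection onto `ℂa`. -/
def mob {n : ℕ} (a z : En n) : En n :=
  if a = 0 then -z
  else ((1 : ℂ) - herm z a)⁻¹ •
    ((a - (herm z a / herm a a) • a) -
      ((Real.sqrt (1 - ‖a‖ ^ 2) : ℂ)) • (z - (herm z a / herm a a) • a))

/-- The norm of the invariant (real) gradient `∇̃f(z) = ∇(f ∘ φ_z)(0)`. -/
def invGrad {n : ℕ} {F : Type*} [NormedAddCommGroup F] [NormedSpace ℝ F]
    (f : En n → F) (z : En n) : ℝ :=
  ‖fderiv ℝ (fun w => f (mob z w)) 0‖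

/-- The invariant measure `dλ_n(z) = (1-|z|²)^{-(n+1)} dv(z)`. -/
def lamN (n : ℕ) : Measure (En n) :=
  (volN n).withDensity (fun z => ENNReal.ofReal ((1 - ‖z‖ ^ 2) ^ (-(n + 1 : ℝ))))

/-- The invariant Poisson integral `u_φ(z) = ∫_{S_n} φ(ζ) (1-|z|²)ⁿ/|1-⟨z,ζ⟩|^{2n} dσ(ζ)`. -/
def poisson (n : ℕ) (φ : En n → ℝ) (z : En n) : ℝ :=
  ∫ ζ, φ ζ * ((1 - ‖z‖ ^ 2) ^ n / ‖(1 : ℂ) - herm z ζ‖ ^ (2 * n)) ∂(sigmaS n)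

/-- The function `μ̃(ζ) = ∫_{Γ_α(ζ)} (1-|z|²)^{-n} dμ(z)`. -/
def tildeMu (n : ℕ) (α : ℝ) (μ : Measure (En n)) (ζ : En n) : ℝ≥0∞ :=
  ∫⁻ z in Gam α ζ, ENNReal.ofReal ((1 - ‖z‖ ^ 2) ^ (-(n : ℝ))) ∂μ

/-- The `L^{p/(p-s)}(S_n)`-norm of `μ̃`. -/
def tildeMuNorm (n : ℕ) (α p s : ℝ) (μ : Measure (En n)) : ℝ≥0∞ :=
  (∫⁻ ζ, tildeMu n α μ ζ ^ (p / (p - s)) ∂(sigmaS n)) ^ ((p - s) / p)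

set_option linter.unusedVariables false
set_option linter.unusedSimpArgs false
set_option linter.unusedSectionVars false

section SphereMeasure
variable {E : Type*} [NormedAddCommGroup E] [InnerProductSpace ℝ E] [FiniteDimensional ℝ E]
  [MeasurableSpace E] [BorelSpace E]

/-- The surface measure on the unit sphere, as a measure on the ambient space. -/
def tau (E : Type*) [NormedAddCommGroup E] [InnerProductSpace ℝ E] [FiniteDimensional ℝ E]
    [MeasurableSpace E] [BorelSpace E] : Measure E :=
  (volume : Measure E).toSphere.map Subtype.val

instance : IsFiniteMeasure (tau E) := by unfold tau; infer_instance

lemma tau_ae_norm : ∀ᵐ z ∂(tau E), ‖z‖ = 1 := by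
  have h : Measurable (Subtype.val : sphere (0 : E) 1 → E) := measurable_subtype_coe
  refine (ae_map_iff h.aemeasurable ?_).2 (Eventually.of_forall fun z => by simp)
  exact (measurable_norm (measurableSet_singleton 1))

lemma tau_apply {K : Set E} (hK : MeasurableSet K) :
    tau E K = Module.finrank ℝ E *
      volume {z : E | z ∈ ball (0 : E) 1 ∧ z ≠ 0 ∧ ‖z‖⁻¹ • z ∈ K} := by
  rw [tau, Measure.map_apply measurable_subtype_coe hK,
    Measure.toSphere_apply' _ (measurable_subtype_coe hK)]
  congr 2
  ext z
  constructor
  · rintro ⟨r, hr, u, ⟨⟨u, hu⟩, huK, rfl⟩, rfl⟩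
    have hu1 : ‖u‖ = 1 := by simpa using hu
    have hu0 : u ≠ 0 := by rintro rfl; simp at hu1
    refine ⟨?_, smul_ne_zero hr.1.ne' hu0, ?_⟩
    · simp [norm_smul, hu1, abs_of_pos hr.1, hr.2]
    · have : ‖r • u‖⁻¹ • r • u = u := by
        rw [norm_smul, hu1, smul_smul]; simp [abs_of_pos hr.1, hr.1.ne']
      simpa [this] using huK
  · rintro ⟨h1, h0, hK⟩
    have hz : 0 < ‖z‖ := norm_pos_iff.2 h0
    refine ⟨‖z‖, ⟨hz, by simpa using h1⟩, ‖z‖⁻¹ • z, ⟨⟨‖z‖⁻¹ • z, by simp [norm_smul, hz.ne']⟩, hK, rfl⟩, ?_⟩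
    simp [smul_smul, hz.ne']

lemma tau_isometry (R : E ≃ₗᵢ[ℝ] E) : MeasurePreserving R (tau E) (tau E) := by
  refine ⟨R.continuous.measurable, ?_⟩
  ext K hK
  rw [Measure.map_apply R.continuous.measurable hK, tau_apply hK,
    tau_apply (R.continuous.measurable hK)]
  congr 1
  have h := (LinearIsometryEquiv.measurePreserving R).measure_preimage_emb
    R.toHomeomorph.measurableEmbedding {z : E | z ∈ ball (0 : E) 1 ∧ z ≠ 0 ∧ ‖z‖⁻¹ • z ∈ K}
  rw [← h]
  congr 1
  ext z
  simp [R.norm_map]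

lemma lintegral_polar [Nontrivial E] {F : E → ℝ≥0∞} (hF : Measurable F) :
    ∫⁻ z, F z = ∫⁻ r in Ioi (0 : ℝ), ENNReal.ofReal (r ^ (Module.finrank ℝ E - 1)) *
      ∫⁻ ζ, F (r • ζ) ∂(tau E) := by
  have h1 : ∫⁻ z, F z = ∫⁻ z in ({0}ᶜ : Set E), F z := by
    rw [restrict_compl_singleton]
  rw [h1, ← lintegral_subtype_comap (measurableSet_singleton (0 : E)).compl]
  have h2 := (volume : Measure E).measurePreserving_homeomorphUnitSphereProd.lintegral_comp_emb
    (Homeomorph.measurableEmbedding _) (fun x => F ((x.2 : ℝ) • (x.1 : E)))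
  have h3 : ∀ z : ({0}ᶜ : Set E), ((homeomorphUnitSphereProd E z).2 : ℝ) •
      ((homeomorphUnitSphereProd E z).1 : E) = z := by
    intro z
    have hz : ‖(z : E)‖ ≠ 0 := norm_ne_zero_iff.2 z.2
    simp [smul_smul, hz]
  simp only [h3] at h2
  have hm : Measurable fun x : sphere (0 : E) 1 × Ioi (0 : ℝ) => F ((x.2 : ℝ) • (x.1 : E)) :=
    hF.comp ((measurable_subtype_coe.comp measurable_snd).smul
      (measurable_subtype_coe.comp measurable_fst))
  rw [h2, lintegral_prod_symm _ hm.aemeasurable, Measure.volumeIoiPow,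
    lintegral_withDensity_eq_lintegral_mul _ (by fun_prop) hm.lintegral_prod_left',
    ← lintegral_subtype_comap measurableSet_Ioi]
  refine lintegral_congr fun r => ?_
  simp only [Pi.mul_apply]
  congr 1
  rw [tau, lintegral_map (by fun_prop) measurable_subtype_coe]

lemma lintegral_polar_ball [Nontrivial E] {F : E → ℝ≥0∞} (hF : Measurable F) :
    ∫⁻ z in ball (0 : E) 1, F z = ∫⁻ r in Ioo (0 : ℝ) 1,
      ENNReal.ofReal (r ^ (Module.finrank ℝ E - 1)) * ∫⁻ ζ, F (r • ζ) ∂(tau E) := by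
  rw [← lintegral_indicator measurableSet_ball, lintegral_polar (hF.indicator measurableSet_ball),
    ← Ioi_inter_Iio, inter_comm, ← Measure.restrict_restrict measurableSet_Iio,
    ← lintegral_indicator measurableSet_Iio]
  refine setLIntegral_congr_fun measurableSet_Ioi fun r hr => ?_
  have hr : 0 < r := hr
  by_cases h : r < 1
  · rw [indicator_of_mem (by exact h)]
    congr 1
    refine lintegral_congr_ae ?_
    filter_upwards [tau_ae_norm (E := E)] with z hz
    rw [indicator_of_mem]
    simp [norm_smul, hz, abs_of_pos hr, h]
  · rw [indicator_of_notMem (by exact h)]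
    rw [lintegral_congr_ae (g := 0)]
    · simp
    filter_upwards [tau_ae_norm (E := E)] with z hz
    rw [indicator_of_notMem]
    · rfl
    simpa [norm_smul, hz, abs_of_pos hr] using h

lemma volume_shell [Nontrivial E] {K : Set E} (hK : MeasurableSet K) {h : ℝ} (h0 : 0 < h)
    (h1 : h ≤ 1) :
    volume {z : E | z ∈ ball (0 : E) 1 ∧ 1 - h < ‖z‖ ∧ ‖z‖⁻¹ • z ∈ K} =
      (∫⁻ r in Ioo (1 - h) 1, ENNReal.ofReal (r ^ (Module.finrank ℝ E - 1))) * tau E K := by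
  have hm : MeasurableSet {z : E | 1 - h < ‖z‖ ∧ ‖z‖⁻¹ • z ∈ K} := by
    refine (measurableSet_lt measurable_const measurable_norm).inter ?_
    exact (measurable_norm.inv.smul measurable_id) hK
  have e : {z : E | z ∈ ball (0 : E) 1 ∧ 1 - h < ‖z‖ ∧ ‖z‖⁻¹ • z ∈ K} =
      {z : E | 1 - h < ‖z‖ ∧ ‖z‖⁻¹ • z ∈ K} ∩ ball 0 1 := by
    ext z; simp; tauto
  rw [e, ← Measure.restrict_apply hm, ← lintegral_indicator_one hm,
    lintegral_polar_ball (measurable_one.indicator hm), ← lintegral_mul_const _ (by fun_prop)]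
  have : Ioo (1 - h) 1 = Ioi (1 - h) ∩ Ioo 0 1 := by
    ext r; simp only [mem_Ioo, mem_inter_iff, mem_Ioi]
    constructor
    · rintro ⟨a, b⟩; exact ⟨a, by linarith, b⟩
    · rintro ⟨a, b, c⟩; exact ⟨a, c⟩
  rw [this, ← Measure.restrict_restrict measurableSet_Ioi, ← lintegral_indicator measurableSet_Ioi]
  refine setLIntegral_congr_fun measurableSet_Ioo fun r hr => ?_
  have key : ∀ᵐ ζ ∂(tau E), ({z : E | 1 - h < ‖z‖ ∧ ‖z‖⁻¹ • z ∈ K}.indicator (1 : E → ℝ≥0∞) (r • ζ)) =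
      if 1 - h < r then K.indicator 1 ζ else 0 := by
    filter_upwards [tau_ae_norm (E := E)] with z hz
    have e1 : ‖r • z‖ = r := by simp [norm_smul, hz, abs_of_pos hr.1]
    have e2 : r⁻¹ • r • z = z := by rw [smul_smul, inv_mul_cancel₀ hr.1.ne', one_smul]
    by_cases h2 : 1 - h < r <;> by_cases h3 : z ∈ K <;>
      simp [indicator, e1, e2, h2, h3]
  rw [lintegral_congr_ae key]
  by_cases h2 : 1 - h < r
  · simp [indicator, h2]
    congr 1
    rw [← lintegral_indicator_one hK]
    rfl
  · simp [indicator, h2]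

lemma volume_shell_le [Nontrivial E] {K : Set E} (hK : MeasurableSet K) {h : ℝ} (h0 : 0 < h)
    (h1 : h ≤ 1) :
    volume {z : E | z ∈ ball (0 : E) 1 ∧ 1 - h < ‖z‖ ∧ ‖z‖⁻¹ • z ∈ K} ≤
      ENNReal.ofReal h * tau E K := by
  rw [volume_shell hK h0 h1]
  gcongr
  calc _ ≤ ∫⁻ r in Ioo (1 - h) 1, 1 := by
        refine setLIntegral_mono measurable_const fun r hr => ?_
        rw [ENNReal.ofReal_le_one]
        exact pow_le_one₀ (by linarith [hr.1]) hr.2.le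
    _ = _ := by simp

lemma le_volume_shell [Nontrivial E] {K : Set E} (hK : MeasurableSet K) {h : ℝ} (h0 : 0 < h)
    (h1 : h ≤ 1) :
    ENNReal.ofReal h * tau E K ≤ Module.finrank ℝ E *
    volume {z : E | z ∈ ball (0 : E) 1 ∧ 1 - h < ‖z‖ ∧ ‖z‖⁻¹ • z ∈ K} := by
  rw [volume_shell hK h0 h1, ← mul_assoc]
  gcongr
  have hd : 0 < Module.finrank ℝ E := Module.finrank_pos
  rw [← ofReal_integral_eq_lintegral_ofReal, ← integral_Ioc_eq_integral_Ioo,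
    ← intervalIntegral.integral_of_le (by linarith), integral_pow, Nat.sub_add_cancel hd,
    ← ENNReal.ofReal_natCast, ← ENNReal.ofReal_mul (by positivity)]
  · refine ENNReal.ofReal_le_ofReal ?_
    have h3 : (1 - h) ^ Module.finrank ℝ E ≤ 1 - h :=
      pow_le_of_le_one (by linarith) (by linarith) hd.ne'
    have : ((Module.finrank ℝ E - 1 : ℕ) : ℝ) + 1 = Module.finrank ℝ E := by
      rw [Nat.cast_pred hd]; ring
    rw [this]
    field_simp
    rw [one_pow]; linarith
  · have : Continuous fun r : ℝ => r ^ (Module.finrank ℝ E - 1) := by fun_prop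
    exact (this.integrableOn_Icc (a := 1 - h) (b := 1)).mono_set Ioo_subset_Icc_self
  · filter_upwards [ae_restrict_mem measurableSet_Ioo] with r hr
    exact pow_nonneg (by linarith [hr.1]) _

end SphereMeasure

lemma herm_eq_inner {n : ℕ} (z w : En n) : herm z w = inner ℂ w z := by
  simp [herm, PiLp.inner_apply]

/-- The Koranyi gauge `|1 - ⟨z, w⟩|`. -/
def dk {n : ℕ} (z w : En n) : ℝ := ‖(1 : ℂ) - inner ℂ w z‖

/-- The Koranyi ball with centre `η` and radius `δ`. -/
def KB {n : ℕ} (η : En n) (δ : ℝ) : Set (En n) := {z | dk z η < δ}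

section Koranyi
variable {n : ℕ}

lemma dk_nonneg (z w : En n) : 0 ≤ dk z w := norm_nonneg _

lemma dk_comm (z w : En n) : dk z w = dk w z := by
  unfold dk
  rw [← inner_conj_symm, ← Complex.norm_conj]
  simp

lemma dk_self {z : En n} (hz : ‖z‖ = 1) : dk z z = 0 := by
  unfold dk
  rw [inner_self_eq_norm_sq_to_K, hz]; simp

lemma continuous_dk : Continuous fun p : En n × En n => dk p.1 p.2 := by
  unfold dk; fun_prop

lemma isOpen_KB (η : En n) (δ : ℝ) : IsOpen (KB η δ) := by
  have : Continuous fun z : En n => dk z η := by unfold dk; fun_prop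
  exact isOpen_lt this continuous_const

lemma measurableSet_KB (η : En n) (δ : ℝ) : MeasurableSet (KB η δ) := (isOpen_KB η δ).measurableSet

lemma one_sub_le_dk {z w : En n} (hw : ‖w‖ ≤ 1) : 1 - ‖z‖ ≤ dk z w := by
  unfold dk
  have h1 : ‖inner ℂ w z‖ ≤ ‖z‖ := (norm_inner_le_norm w z).trans (by
    nlinarith [norm_nonneg z, norm_nonneg w])
  have := norm_sub_norm_le (1 : ℂ) (inner ℂ w z)
  simp at this
  linarith

lemma dk_le_two {z w : En n} (hz : ‖z‖ ≤ 1) (hw : ‖w‖ ≤ 1) : dk z w ≤ 2 := by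
  unfold dk
  have h1 : ‖inner ℂ w z‖ ≤ 1 := (norm_inner_le_norm w z).trans (by
    nlinarith [norm_nonneg z, norm_nonneg w])
  have := norm_sub_le (1 : ℂ) (inner ℂ w z)
  simp at this
  linarith

lemma norm_sub_sq_le_dk {z w : En n} (hz : ‖z‖ ≤ 1) (hw : ‖w‖ ≤ 1) : ‖z - w‖ ^ 2 ≤ 2 * dk z w := by
  have h := norm_sub_sq (𝕜 := ℂ) w z
  have h2 : (1 : ℝ) - RCLike.re (inner ℂ w z) ≤ dk z w := by
    have := Complex.re_le_norm ((1 : ℂ) - inner ℂ w z)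
    simpa [dk] using this
  rw [norm_sub_rev, h]
  nlinarith [norm_nonneg z, norm_nonneg w]

lemma dk_triangle {z w ξ : En n} (hz : ‖z‖ ≤ 1) (hw : ‖w‖ ≤ 1) (hξ : ‖ξ‖ = 1) :
    dk z w ≤ 2 * (dk z ξ + dk ξ w) := by
  have e : (1 : ℂ) - inner ℂ w z = (1 - inner ℂ ξ z) + (1 - inner ℂ w ξ) +
      inner ℂ (ξ - w) (z - ξ) := by
    simp only [inner_sub_left, inner_sub_right]
    rw [inner_self_eq_norm_sq_to_K, hξ]; push_cast; ring
  have h1 := norm_sub_sq_le_dk hz hξ.le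
  have h2 := norm_sub_sq_le_dk hξ.le hw
  have h3 : ‖inner ℂ (ξ - w) (z - ξ)‖ ≤ ‖ξ - w‖ * ‖z - ξ‖ := norm_inner_le_norm _ _
  have h4 : dk z w ≤ dk z ξ + dk ξ w + ‖inner ℂ (ξ - w) (z - ξ)‖ := by
    unfold dk; rw [e]; exact norm_add₃_le
  nlinarith [sq_nonneg (‖ξ - w‖ - ‖z - ξ‖)]

/-- Moving a point of the ball radially to the sphere. -/
lemma dk_normalize {z w : En n} (hz : z ≠ 0) (hz1 : ‖z‖ ≤ 1) (hw : ‖w‖ ≤ 1) :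
    dk (‖z‖⁻¹ • z) w ≤ dk z w + (1 - ‖z‖) := by
  have hz0 : 0 < ‖z‖ := norm_pos_iff.2 hz
  have e : (1 : ℂ) - inner ℂ w (‖z‖⁻¹ • z) = (1 - inner ℂ w z) + (1 - (‖z‖⁻¹ : ℝ)) * inner ℂ w z := by
    rw [RCLike.real_smul_eq_coe_smul (K := ℂ), inner_smul_right]; simp; ring
  have h1 : ‖inner ℂ w z‖ ≤ ‖z‖ := (norm_inner_le_norm w z).trans (by
    nlinarith [norm_nonneg z, norm_nonneg w])
  have h2 : ‖((1 : ℂ) - (‖z‖⁻¹ : ℝ))‖ = ‖z‖⁻¹ - 1 := by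
    rw [← Complex.ofReal_one, ← Complex.ofReal_sub, Complex.norm_real, Real.norm_eq_abs, abs_sub_comm,
      abs_of_nonneg]
    rw [sub_nonneg]; exact (one_le_inv₀ hz0).2 hz1
  unfold dk
  rw [e]
  refine (norm_add_le _ _).trans ?_
  rw [norm_mul, h2]
  have h3 : 0 ≤ ‖z‖⁻¹ - 1 := by rw [sub_nonneg]; exact (one_le_inv₀ hz0).2 hz1
  have : (‖z‖⁻¹ - 1) * ‖inner ℂ w z‖ ≤ (‖z‖⁻¹ - 1) * ‖z‖ := by gcongr
  have h4 : (‖z‖⁻¹ - 1) * ‖z‖ = 1 - ‖z‖ := by field_simp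
  linarith

lemma dk_smul_le {z w : En n} {r : ℝ} (h0 : 0 ≤ r) (h1 : r ≤ 1) :
    dk (r • z) w ≤ (1 - r) + r * dk z w := by
  have e : (1 : ℂ) - inner ℂ w (r • z) = ((1 - r : ℝ) : ℂ) + (r : ℂ) * (1 - inner ℂ w z) := by
    rw [RCLike.real_smul_eq_coe_smul (K := ℂ), inner_smul_right]; simp; ring
  unfold dk
  rw [e]
  refine (norm_add_le _ _).trans ?_
  rw [norm_mul, Complex.norm_real, Complex.norm_real, Real.norm_of_nonneg h0,
    Real.norm_of_nonneg (by linarith)]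

/-- The non-isotropic dilation `c√s (√s P + Q)`, with `P` the projection to the line of `η`. -/
def ani (c s : ℝ) (η : En n) : En n →ₗ[ℂ] En n :=
  ((c * √s : ℝ) : ℂ) • LinearMap.transvection
    (((√s - 1 : ℝ) : ℂ) • (innerSL ℂ η : En n →ₗ[ℂ] ℂ)) η

lemma ani_apply (c s : ℝ) (η w : En n) :
    ani c s η w = ((c * √s : ℝ) : ℂ) • (w + (((√s - 1 : ℝ) : ℂ) * inner ℂ η w) • η) := by
  simp [ani, LinearMap.transvection.apply]

lemma ani_det {c s : ℝ} (hs : 0 ≤ s) {η : En n} (hη : ‖η‖ = 1) :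
    LinearMap.det ((ani c s η).restrictScalars ℝ) = c ^ (2 * n) * s ^ (n + 1) := by
  rw [LinearMap.det_restrictScalars, Algebra.norm_complex_apply, ani, LinearMap.det_smul,
    LinearMap.transvection.det]
  have : (1 : ℂ) + (((√s - 1 : ℝ) : ℂ) • (innerSL ℂ η : En n →ₗ[ℂ] ℂ)) η = ((√s : ℝ) : ℂ) := by
    simp [inner_self_eq_norm_sq_to_K, hη]
  rw [this, ← Complex.ofReal_pow, ← Complex.ofReal_mul, Complex.normSq_ofReal]
  simp only [finrank_euclideanSpace, Fintype.card_fin]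
  have h : √s * √s = s := Real.mul_self_sqrt hs
  calc _ = c ^ (2 * n) * ((√s * √s) ^ n * (√s * √s)) := by ring
    _ = _ := by rw [h]; ring

lemma volume_ani_ball {c s : ℝ} (hc : 0 < c) (hs : 0 ≤ s) {η : En n} (hη : ‖η‖ = 1) (a : En n) :
    volume ((fun w => a + ani c s η w) '' ball 0 1) =
      ENNReal.ofReal (c ^ (2 * n) * s ^ (n + 1)) * volume (ball (0 : En n) 1) := by
  have : (fun w => a + ani c s η w) '' ball 0 1 =
      (fun w => a + w) '' (((ani c s η).restrictScalars ℝ) '' ball 0 1) := by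
    rw [image_image]; rfl
  rw [this, image_add_left, measure_preimage_add, Measure.addHaar_image_linearMap, ani_det hs hη,
    abs_of_nonneg (by positivity)]

end Koranyi

section Koranyi
variable {n : ℕ}

lemma norm_sq_decomp {η : En n} (hη : ‖η‖ = 1) (z : En n) :
    ‖z‖ ^ 2 = ‖inner ℂ η z‖ ^ 2 + ‖z - (inner ℂ η z : ℂ) • η‖ ^ 2 := by
  have h := norm_add_sq (𝕜 := ℂ) ((inner ℂ η z : ℂ) • η) (z - (inner ℂ η z : ℂ) • η)
  have h2 : inner ℂ ((inner ℂ η z : ℂ) • η) (z - (inner ℂ η z : ℂ) • η) = 0 := by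
    rw [inner_smul_left, inner_sub_right, inner_smul_right, inner_self_eq_norm_sq_to_K, hη]
    simp
  rw [h2] at h
  simp only [add_sub_cancel, map_zero, mul_zero, add_zero] at h
  rw [h, norm_smul, hη, mul_one]

lemma inner_add_ani {a c s : ℝ} (hs : 0 ≤ s) {η : En n} (hη : ‖η‖ = 1) (w : En n) :
    inner ℂ η (a • η + ani c s η w) = (a : ℂ) + (c * s : ℝ) * inner ℂ η w := by
  rw [ani_apply, inner_add_right, inner_smul_right, inner_add_right, inner_smul_right,
    RCLike.real_smul_eq_coe_smul (K := ℂ), inner_smul_right, inner_self_eq_norm_sq_to_K, hη]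
  have h : √s * √s = s := Real.mul_self_sqrt hs
  have h' : ((√s : ℝ) : ℂ) * ((√s : ℝ) : ℂ) = s := by rw [← Complex.ofReal_mul, h]
  simp
  linear_combination (c * inner ℂ η w) * h'

lemma norm_sq_add_ani {a c s : ℝ} (hs : 0 ≤ s) {η : En n} (hη : ‖η‖ = 1) (w : En n) :
    ‖a • η + ani c s η w‖ ^ 2 = ‖(a : ℂ) + (c * s : ℝ) * inner ℂ η w‖ ^ 2 +
      c ^ 2 * s * ‖w - (inner ℂ η w : ℂ) • η‖ ^ 2 := by
  rw [norm_sq_decomp hη, inner_add_ani hs hη]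
  congr 1
  have : a • η + ani c s η w - ((a : ℂ) + (c * s : ℝ) * inner ℂ η w) • η =
      ((c * √s : ℝ) : ℂ) • (w - (inner ℂ η w : ℂ) • η) := by
    have h : √s * √s = s := Real.mul_self_sqrt hs
    have h' : ((√s : ℝ) : ℂ) * ((√s : ℝ) : ℂ) = s := by rw [← Complex.ofReal_mul, h]
    rw [ani_apply, RCLike.real_smul_eq_coe_smul (K := ℂ)]
    ext i
    simp
    linear_combination (c * inner ℂ η w * η i) * h'
  rw [this, norm_smul, Complex.norm_real, mul_pow, Real.norm_eq_abs, sq_abs, mul_pow,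
    Real.sq_sqrt hs]

lemma ellipsoid_bounds {h : ℝ} (h0 : 0 < h) (h1 : h ≤ 1) {η : En n} (hη : ‖η‖ = 1) {w : En n}
    (hw : ‖w‖ < 1) : ‖(1 - h / 2) • η + ani (1 / 8) h η w‖ < 1 ∧
      1 - 5 / 8 * h ≤ ‖(1 - h / 2) • η + ani (1 / 8) h η w‖ ∧
      dk ((1 - h / 2) • η + ani (1 / 8) h η w) η ≤ 5 / 8 * h := by
  have e := inner_add_ani (a := 1 - h / 2) (c := 1 / 8) h0.le hη w
  have e2 := norm_sq_add_ani (a := 1 - h / 2) (c := 1 / 8) h0.le hη w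
  have d := norm_sq_decomp hη w
  set z := (1 - h / 2) • η + ani (1 / 8) h η w
  set w1 := inner ℂ η w
  have hw1 : ‖w1‖ ≤ 1 := by
    have := norm_inner_le_norm (𝕜 := ℂ) η w
    rw [hη, one_mul] at this
    linarith
  have k1 : dk z η ≤ 5 / 8 * h := by
    unfold dk
    rw [e]
    have : (1 : ℂ) - (((1 - h / 2 : ℝ) : ℂ) + ((1 / 8 * h : ℝ) : ℂ) * w1) =
        ((h / 2 : ℝ) : ℂ) - ((1 / 8 * h : ℝ) : ℂ) * w1 := by push_cast; ring
    rw [this]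
    refine (norm_sub_le _ _).trans ?_
    rw [norm_mul, Complex.norm_real, Complex.norm_real, Real.norm_of_nonneg (by positivity),
      Real.norm_of_nonneg (by positivity)]
    nlinarith
  refine ⟨?_, ?_, k1⟩
  · have k2 : ‖((1 - h / 2 : ℝ) : ℂ) + ((1 / 8 * h : ℝ) : ℂ) * w1‖ ≤ 1 - 3 / 8 * h := by
      refine (norm_add_le _ _).trans ?_
      rw [norm_mul, Complex.norm_real, Complex.norm_real, Real.norm_of_nonneg (by linarith),
        Real.norm_of_nonneg (by positivity)]
      nlinarith
    have k3 : ‖w - w1 • η‖ ^ 2 ≤ 1 := by nlinarith [sq_nonneg ‖w1‖, norm_nonneg w]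
    have k4 : ‖((1 - h / 2 : ℝ) : ℂ) + ((1 / 8 * h : ℝ) : ℂ) * w1‖ ^ 2 ≤ (1 - 3 / 8 * h) ^ 2 := by
      gcongr
    have : ‖z‖ ^ 2 < 1 := by
      rw [e2]
      nlinarith
    nlinarith [norm_nonneg z]
  · have := one_sub_le_dk (z := z) hη.le
    linarith

lemma dk_normalize_ellipsoid {h : ℝ} (h0 : 0 < h) (h1 : h ≤ 1) {η : En n} (hη : ‖η‖ = 1) {w : En n}
    (hw : ‖w‖ < 1) : dk (‖(1 - h / 2) • η + ani (1 / 8) h η w‖⁻¹ •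
      ((1 - h / 2) • η + ani (1 / 8) h η w)) η < 4 * h := by
  obtain ⟨k1, k2, k3⟩ := ellipsoid_bounds h0 h1 hη hw
  have hz : (1 - h / 2) • η + ani (1 / 8) h η w ≠ 0 := by
    intro h; rw [h] at k2; simp at k2; linarith
  have := dk_normalize hz k1.le hη.le
  linarith

instance [NeZero n] : Nontrivial (En n) := by
  have : Nonempty (Fin n) := ⟨0⟩
  infer_instance

lemma finrank_En : Module.finrank ℝ (En n) = 2 * n := by
  rw [finrank_real_of_complex]; simp

/-- Lower bound for the measure of Koranyi balls. -/
lemma exists_le_tau_KB (n : ℕ) [NeZero n] : ∃ c : ℝ, 0 < c ∧ ∀ (η : En n) (δ : ℝ), ‖η‖ = 1 → 0 < δ → δ ≤ 4 →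
    ENNReal.ofReal (c * δ ^ n) ≤ tau (En n) (KB η δ) := by
  set V := (volume (ball (0 : En n) 1)).toReal
  have hV' : volume (ball (0 : En n) 1) ≠ ⊤ := measure_ball_lt_top.ne
  have hV : 0 < V := ENNReal.toReal_pos (measure_ball_pos _ _ one_pos).ne' hV'
  refine ⟨(1 / 8) ^ (2 * n) * (1 / 4) ^ n * V, by positivity, fun η δ hη h0 h4 => ?_⟩
  set h := δ / 4
  have hh0 : 0 < h := by positivity
  have hh1 : h ≤ 1 := by simp only [h]; linarith
  have hsub : (fun w => (1 - h / 2) • η + ani (1 / 8) h η w) '' ball 0 1 ⊆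
      {z : En n | z ∈ ball (0 : En n) 1 ∧ 1 - h < ‖z‖ ∧ ‖z‖⁻¹ • z ∈ KB η δ} := by
    rintro _ ⟨w, hw, rfl⟩
    have hw : ‖w‖ < 1 := by simpa using hw
    obtain ⟨k1, k2, k3⟩ := ellipsoid_bounds hh0 hh1 hη hw
    refine ⟨by simpa using k1, by simp only; linarith, ?_⟩
    have := dk_normalize_ellipsoid hh0 hh1 hη hw
    have e : 4 * h = δ := by simp only [h]; ring
    rw [e] at this
    exact this
  have h2 := measure_mono (μ := volume) hsub
  rw [volume_ani_ball (by norm_num) hh0.le hη] at h2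
  have h3 := h2.trans (volume_shell_le (measurableSet_KB η δ) hh0 hh1)
  rw [← ENNReal.ofReal_toReal hV', ← ENNReal.ofReal_mul (by positivity)] at h3
  have h4 : ENNReal.ofReal ((1 / 8) ^ (2 * n) * h ^ (n + 1) * V) =
      ENNReal.ofReal h * ENNReal.ofReal ((1 / 8) ^ (2 * n) * (1 / 4) ^ n * V * δ ^ n) := by
    rw [← ENNReal.ofReal_mul hh0.le]
    congr 1
    have : δ = 4 * h := by simp only [h]; ring
    rw [this, mul_pow, pow_succ]
    have : (1 / 4 : ℝ) ^ n * 4 ^ n = 1 := by rw [← mul_pow]; norm_num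
    linear_combination -((1 / 8) ^ (2 * n) * h ^ (n + 1) * V) * this
  have h3' : ENNReal.ofReal ((1 / 8) ^ (2 * n) * h ^ (n + 1) * V) ≤ _ := h3
  rw [h4] at h3'
  exact (ENNReal.mul_le_mul_iff_right (ENNReal.ofReal_pos.2 hh0).ne' ENNReal.ofReal_ne_top).1 h3'

lemma mem_image_ani {c s : ℝ} (hc : 0 < c) (hs : 0 < s) {η : En n} (hη : ‖η‖ = 1) {z : En n}
    (h : ‖(1 : ℂ) - inner ℂ η z‖ ^ 2 / (c * s) ^ 2 +
      ‖z - (inner ℂ η z : ℂ) • η‖ ^ 2 / (c ^ 2 * s) < 1) :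
    z ∈ (fun w => η + ani c s η w) '' ball 0 1 := by
  set q := z - (inner ℂ η z : ℂ) • η
  set u := (1 : ℂ) - inner ℂ η z
  have hq : inner ℂ η q = 0 := by
    simp only [q]
    rw [inner_sub_right, inner_smul_right, inner_self_eq_norm_sq_to_K, hη]
    simp
  have hss : 0 < √s := Real.sqrt_pos.2 hs
  set w : En n := (-(((c * s : ℝ) : ℂ)⁻¹ * u)) • η + (((c * √s : ℝ) : ℂ)⁻¹) • q
  have hw1 : inner ℂ η w = -(((c * s : ℝ) : ℂ)⁻¹ * u) := by
    simp only [w]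
    rw [inner_add_right, inner_smul_right, inner_smul_right, hq, inner_self_eq_norm_sq_to_K, hη]
    simp
  refine ⟨w, ?_, ?_⟩
  · have := norm_sq_decomp hη w
    rw [hw1] at this
    have e : w - (-(((c * s : ℝ) : ℂ)⁻¹ * u)) • η = (((c * √s : ℝ) : ℂ)⁻¹) • q := by simp [w]
    rw [e, norm_neg, norm_mul, norm_smul, norm_inv, norm_inv, Complex.norm_real,
      Complex.norm_real, Real.norm_of_nonneg (by positivity), Real.norm_of_nonneg (by positivity),
      mul_pow, mul_pow, inv_pow, inv_pow, mul_pow c (√s), Real.sq_sqrt hs.le] at this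
    have k : ‖w‖ ^ 2 < 1 := by
      rw [this]; convert h using 1; ring
    have : ‖w‖ < 1 := by nlinarith [norm_nonneg w]
    simpa using this
  · have h' : ((√s : ℝ) : ℂ) * ((√s : ℝ) : ℂ) = s := by
      rw [← Complex.ofReal_mul, Real.mul_self_sqrt hs.le]
    have hs' : ((√s : ℝ) : ℂ) ≠ 0 := by exact_mod_cast hss.ne'
    have hsc : (s : ℂ) ≠ 0 := by exact_mod_cast hs.ne'
    have hc' : (c : ℂ) ≠ 0 := by exact_mod_cast hc.ne'
    simp only
    rw [ani_apply, hw1]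
    simp only [w]
    have hz : z = q + (1 - u) • η := by simp [q, u]
    rw [hz]
    ext i
    simp
    field_simp
    linear_combination (-(η i * u)) * h'

lemma ENNReal.le_of_ofReal_mul_le {a b : ℝ} {x : ℝ≥0∞} (ha : 0 < a)
    (h : ENNReal.ofReal a * x ≤ ENNReal.ofReal (a * b)) : x ≤ ENNReal.ofReal b := by
  rw [ENNReal.ofReal_mul ha.le] at h
  exact (ENNReal.mul_le_mul_iff_right (ENNReal.ofReal_pos.2 ha).ne' ENNReal.ofReal_ne_top).1 h

/-- Upper bound for the measure of Koranyi balls. -/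
lemma exists_tau_KB_le (n : ℕ) [NeZero n] : ∃ C : ℝ, 0 < C ∧ ∀ (η : En n) (δ : ℝ), ‖η‖ = 1 → 0 < δ →
    tau (En n) (KB η δ) ≤ ENNReal.ofReal (C * δ ^ n) := by
  set V := (volume (ball (0 : En n) 1)).toReal
  have hV' : volume (ball (0 : En n) 1) ≠ ⊤ := measure_ball_lt_top.ne
  have hV : 0 < V := ENNReal.toReal_pos (measure_ball_pos _ _ one_pos).ne' hV'
  have hn : 0 < n := NeZero.pos n
  have main : ∀ (η : En n) (δ : ℝ), ‖η‖ = 1 → 0 < δ → δ ≤ 1 →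
    tau (En n) (KB η δ) ≤ ENNReal.ofReal (2 * n * 3 ^ (2 * n) * V * δ ^ n) := by
    intro η δ hη h0 h1
    have hsub : {z : En n | z ∈ ball (0 : En n) 1 ∧ 1 - δ < ‖z‖ ∧ ‖z‖⁻¹ • z ∈ KB η δ} ⊆
        (fun w => η + ani 3 δ η w) '' ball 0 1 := by
      rintro z ⟨hz1, hz2, hz3⟩
      have hz1 : ‖z‖ < 1 := by simpa using hz1
      have hz0 : 0 < ‖z‖ := by linarith
      apply mem_image_ani (by norm_num) h0 hη
      have k := dk_smul_le (z := ‖z‖⁻¹ • z) (w := η) hz0.le hz1.le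
      rw [smul_smul, mul_inv_cancel₀ hz0.ne', one_smul] at k
      have hz3 : dk (‖z‖⁻¹ • z) η < δ := hz3
      have k1 : dk z η < 2 * δ := by nlinarith [dk_nonneg (‖z‖⁻¹ • z) η]
      have k2 := norm_sq_decomp hη z
      have k3 : 1 - 2 * δ ≤ ‖inner ℂ η z‖ := by
        have := norm_sub_norm_le (1 : ℂ) ((1 : ℂ) - inner ℂ η z)
        simp only [norm_one, sub_sub_cancel] at this
        unfold dk at k1
        linarith
      have k4 : ‖z - (inner ℂ η z : ℂ) • η‖ ^ 2 ≤ 4 * δ := by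
        have : ‖z‖ ^ 2 ≤ 1 := by nlinarith
        rcases le_or_gt (1 - 2 * δ) 0 with h | h
        · nlinarith [sq_nonneg ‖inner ℂ η z‖]
        · nlinarith [norm_nonneg (inner ℂ η z)]
      have k5 : ‖(1 : ℂ) - inner ℂ η z‖ ^ 2 ≤ 4 * δ ^ 2 := by
        have : dk z η ^ 2 ≤ (2 * δ) ^ 2 := by
          have := dk_nonneg z η
          gcongr
        unfold dk at this
        linarith
      calc _ ≤ 4 * δ ^ 2 / (3 * δ) ^ 2 + 4 * δ / (3 ^ 2 * δ) := by gcongr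
        _ < 1 := by field_simp; norm_num
    have h2 := measure_mono (μ := volume) hsub
    rw [volume_ani_ball (by norm_num) h0.le hη] at h2
    have h3 := le_volume_shell (measurableSet_KB η δ) h0 h1
    apply ENNReal.le_of_ofReal_mul_le h0
    refine h3.trans ?_
    rw [finrank_En]
    refine (mul_le_mul_right h2 _).trans ?_
    rw [← ENNReal.ofReal_toReal hV', ← ENNReal.ofReal_mul (by positivity), ← ENNReal.ofReal_natCast,
      ← ENNReal.ofReal_mul (by positivity)]
    apply ENNReal.ofReal_le_ofReal
    apply le_of_eq
    push_cast
    ring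
  set T := (tau (En n) univ).toReal
  refine ⟨2 * n * 3 ^ (2 * n) * V + T, by positivity, fun η δ hη h0 => ?_⟩
  rcases le_or_gt δ 1 with h | h
  · refine (main η δ hη h0 h).trans (ENNReal.ofReal_le_ofReal ?_)
    gcongr
    simp only [T]
    linarith [ENNReal.toReal_nonneg (a := tau (En n) univ)]
  · refine (measure_mono (subset_univ _)).trans ?_
    rw [← ENNReal.ofReal_toReal (measure_ne_top (tau (En n)) univ)]
    apply ENNReal.ofReal_le_ofReal
    have : 1 ≤ δ ^ n := one_le_pow₀ h.le
    have h5 : 0 ≤ T := ENNReal.toReal_nonneg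
    have : 0 < 2 * n * 3 ^ (2 * n) * V := by positivity
    change T ≤ _
    nlinarith

end Koranyi

section Hausdorff
variable {E : Type*} [NormedAddCommGroup E] [InnerProductSpace ℝ E] [FiniteDimensional ℝ E]
  [MeasurableSpace E] [BorelSpace E]

lemma norm_inv_smul_sub {z : E} (hz : z ≠ 0) (hz1 : ‖z‖ ≤ 1) : ‖‖z‖⁻¹ • z - z‖ = 1 - ‖z‖ := by
  have h0 : 0 < ‖z‖ := norm_pos_iff.2 hz
  have : ‖z‖⁻¹ • z - z = (‖z‖⁻¹ - 1) • z := by rw [sub_smul, one_smul]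
  rw [this, norm_smul, Real.norm_of_nonneg, sub_mul, inv_mul_cancel₀ h0.ne', one_mul]
  rw [sub_nonneg]; exact (one_le_inv₀ h0).2 hz1

lemma exists_le_tau_ball (E : Type*) [NormedAddCommGroup E] [InnerProductSpace ℝ E]
    [FiniteDimensional ℝ E] [MeasurableSpace E] [BorelSpace E] [Nontrivial E] :
    ∃ c : ℝ, 0 < c ∧ ∀ (η : E) (r : ℝ), ‖η‖ = 1 → 0 < r → r ≤ 1 →
    ENNReal.ofReal (c * r ^ (Module.finrank ℝ E - 1)) ≤ tau E (ball η r) := by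
  set V := (volume (ball (0 : E) 1)).toReal
  have hV' : volume (ball (0 : E) 1) ≠ ⊤ := measure_ball_lt_top.ne
  have hV : 0 < V := ENNReal.toReal_pos (measure_ball_pos _ _ one_pos).ne' hV'
  have hd : 0 < Module.finrank ℝ E := Module.finrank_pos
  obtain ⟨m, hm⟩ : ∃ m, Module.finrank ℝ E = m + 1 := ⟨_, (Nat.sub_add_cancel hd).symm⟩
  refine ⟨(1 / 4) ^ (m + 1) * 2 * V, by positivity, fun η r hη h0 h1 => ?_⟩
  set h := r / 2 with hh
  have hh0 : 0 < h := by positivity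
  have hh1 : h ≤ 1 := by simp only [h]; linarith
  have hsub : ball ((1 - h / 2) • η) (h / 2) ⊆
      {z : E | z ∈ ball (0 : E) 1 ∧ 1 - h < ‖z‖ ∧ ‖z‖⁻¹ • z ∈ ball η r} := by
    intro z hz
    rw [mem_ball, dist_eq_norm] at hz
    have ha : ‖(1 - h / 2) • η‖ = 1 - h / 2 := by
      rw [norm_smul, hη, mul_one, Real.norm_of_nonneg (by linarith)]
    have k1 : ‖z‖ < 1 := by have := norm_sub_norm_le z ((1 - h / 2) • η); linarith
    have k2 : 1 - h < ‖z‖ := by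
      have := norm_sub_norm_le ((1 - h / 2) • η) z; rw [norm_sub_rev] at this; linarith
    refine ⟨by simpa using k1, k2, ?_⟩
    have hz0 : z ≠ 0 := by rintro rfl; simp at k2; linarith
    have k3 := norm_inv_smul_sub hz0 k1.le
    have k4 : ‖(1 - h / 2) • η - η‖ = h / 2 := by
      have : (1 - h / 2) • η - η = -((h / 2) • η) := by rw [sub_smul, one_smul]; abel
      rw [this, norm_neg, norm_smul, hη, mul_one, Real.norm_of_nonneg (by linarith)]
    rw [mem_ball, dist_eq_norm]
    calc _ = ‖(‖z‖⁻¹ • z - z) + (z - (1 - h / 2) • η) + ((1 - h / 2) • η - η)‖ := by congr 1; abel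
      _ ≤ _ := norm_add₃_le
      _ < r := by rw [k3, k4]; simp only [h] at *; linarith
  have h2 := measure_mono (μ := volume) hsub
  rw [Measure.addHaar_ball_of_pos _ _ (by positivity)] at h2
  have h3 := h2.trans (volume_shell_le measurableSet_ball hh0 hh1)
  rw [← ENNReal.ofReal_toReal hV', ← ENNReal.ofReal_mul (by positivity)] at h3
  have h4 : ENNReal.ofReal ((h / 2) ^ Module.finrank ℝ E * V) =
      ENNReal.ofReal h * ENNReal.ofReal ((1 / 4) ^ (m + 1) * 2 * V * r ^ (Module.finrank ℝ E - 1)) := by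
    rw [← ENNReal.ofReal_mul hh0.le, hm]
    congr 1
    simp only [h, Nat.add_sub_cancel]
    have : r / 2 / 2 = (1 / 4) * r := by ring
    rw [this, mul_pow]; ring
  have h3' : ENNReal.ofReal ((h / 2) ^ Module.finrank ℝ E * V) ≤ _ := h3
  rw [h4] at h3'
  exact (ENNReal.mul_le_mul_iff_right (ENNReal.ofReal_pos.2 hh0).ne' ENNReal.ofReal_ne_top).1 h3'

lemma exists_tau_ball_le (E : Type*) [NormedAddCommGroup E] [InnerProductSpace ℝ E]
    [FiniteDimensional ℝ E] [MeasurableSpace E] [BorelSpace E] [Nontrivial E] :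
    ∃ C : ℝ, 0 < C ∧ ∀ (η : E) (r : ℝ), ‖η‖ = 1 → 0 < r → r ≤ 1 →
    tau E (ball η r) ≤ ENNReal.ofReal (C * r ^ (Module.finrank ℝ E - 1)) := by
  set V := (volume (ball (0 : E) 1)).toReal
  have hV' : volume (ball (0 : E) 1) ≠ ⊤ := measure_ball_lt_top.ne
  have hV : 0 < V := ENNReal.toReal_pos (measure_ball_pos _ _ one_pos).ne' hV'
  have hd : 0 < Module.finrank ℝ E := Module.finrank_pos
  obtain ⟨m, hm⟩ : ∃ m, Module.finrank ℝ E = m + 1 := ⟨_, (Nat.sub_add_cancel hd).symm⟩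
  refine ⟨(m + 1) * 2 ^ (m + 1) * V, by positivity, fun η r hη h0 h1 => ?_⟩
  have hsub : {z : E | z ∈ ball (0 : E) 1 ∧ 1 - r < ‖z‖ ∧ ‖z‖⁻¹ • z ∈ ball η r} ⊆
      ball η (2 * r) := by
    rintro z ⟨hz1, hz2, hz3⟩
    have hz1 : ‖z‖ < 1 := by simpa using hz1
    have hz0 : z ≠ 0 := by rintro rfl; simp at hz2; linarith
    have k3 := norm_inv_smul_sub hz0 hz1.le
    rw [mem_ball, dist_eq_norm] at *
    calc _ = ‖-(‖z‖⁻¹ • z - z) + (‖z‖⁻¹ • z - η)‖ := by congr 1; abel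
      _ ≤ _ := norm_add_le _ _
      _ < 2 * r := by rw [norm_neg, k3]; linarith
  have h2 := measure_mono (μ := volume) hsub
  rw [Measure.addHaar_ball_of_pos _ _ (by positivity)] at h2
  apply ENNReal.le_of_ofReal_mul_le h0
  refine (le_volume_shell measurableSet_ball h0 h1).trans ?_
  refine (mul_le_mul_right h2 _).trans ?_
  rw [← ENNReal.ofReal_toReal hV', ← ENNReal.ofReal_mul (by positivity), ← ENNReal.ofReal_natCast,
      ← ENNReal.ofReal_mul (by positivity), hm, Nat.add_sub_cancel]
  apply ENNReal.ofReal_le_ofReal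
  apply le_of_eq
  push_cast
  change ((m:ℝ) + 1) * ((2 * r) ^ (m + 1) * V) = _
  ring

lemma tau_le_hausdorff (E : Type*) [NormedAddCommGroup E] [InnerProductSpace ℝ E]
    [FiniteDimensional ℝ E] [MeasurableSpace E] [BorelSpace E] [Nontrivial E] :
    ∃ C : ℝ, 0 < C ∧ tau E ≤ ENNReal.ofReal C • μH[((Module.finrank ℝ E - 1 : ℕ) : ℝ)] := by
  obtain ⟨C, hC, h⟩ := exists_tau_ball_le E
  refine ⟨C, hC, ?_⟩
  set d := Module.finrank ℝ E - 1
  have key : (ENNReal.ofReal C)⁻¹ • tau E ≤ μH[(d : ℝ)] := by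
    refine Measure.le_hausdorffMeasure _ _ (1 / 2) (by simp) fun s hs => ?_
    have hfin : ediam s ≠ ⊤ := ne_top_of_le_ne_top (by simp) hs
    rw [Measure.smul_apply, smul_eq_mul, ENNReal.inv_mul_le_iff (by simpa using hC) (by simp)]
    by_cases hne : (s ∩ sphere (0 : E) 1).Nonempty
    · obtain ⟨η, hη, hη1⟩ := hne
      have hη1 : ‖η‖ = 1 := by simpa using hη1
      set D := (ediam s).toReal
      have hD : D ≤ 1 / 2 := by
        have := ENNReal.toReal_mono (by simp) hs
        simpa using this
      have hD0 : 0 ≤ D := ENNReal.toReal_nonneg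
      have b : ∀ᶠ r in 𝓝[>] D, tau E s ≤ ENNReal.ofReal (C * r ^ d) := by
        filter_upwards [Ioo_mem_nhdsGT (show D < 1 by linarith)] with r hr
        refine (measure_mono ?_).trans (h η r hη1 (by linarith [hr.1]) hr.2.le)
        intro x hx
        rw [mem_ball, dist_edist]
        refine lt_of_le_of_lt (ENNReal.toReal_mono hfin (edist_le_ediam_of_mem hx hη)) hr.1
      have lim : Tendsto (fun r : ℝ => ENNReal.ofReal (C * r ^ d)) (𝓝[>] D)
          (𝓝 (ENNReal.ofReal (C * D ^ d))) := by
        refine (ENNReal.continuous_ofReal.comp ?_).continuousAt.tendsto.mono_left nhdsWithin_le_nhds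
        fun_prop
      refine (ge_of_tendsto lim b).trans ?_
      rw [ENNReal.ofReal_mul hC.le, ENNReal.rpow_natCast, ENNReal.ofReal_pow hD0,
        ENNReal.ofReal_toReal hfin]
    · have : tau E s = 0 := by
        refine measure_mono_null ?_ (ae_iff.1 (tau_ae_norm (E := E)))
        intro x hx hx1
        exact hne ⟨x, hx, by simpa using hx1⟩
      simp [this]
  intro s
  have := key s
  rw [Measure.smul_apply, smul_eq_mul, ENNReal.inv_mul_le_iff (by simpa using hC) (by simp)] at this
  simpa using this

lemma hausdorff_le_tau (E : Type*) [NormedAddCommGroup E] [InnerProductSpace ℝ E]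
    [FiniteDimensional ℝ E] [MeasurableSpace E] [BorelSpace E] [Nontrivial E] :
    ∃ C : ℝ, 0 < C ∧ (μH[((Module.finrank ℝ E - 1 : ℕ) : ℝ)]).restrict (sphere (0 : E) 1) ≤
      ENNReal.ofReal C • tau E := by
  obtain ⟨c, hc, h⟩ := exists_le_tau_ball E
  set d := Module.finrank ℝ E - 1
  refine ⟨10 ^ d / c, by positivity, ?_⟩
  refine Measure.le_iff.2 fun A hA => ?_
  rw [Measure.restrict_apply hA, Measure.smul_apply, smul_eq_mul]
  refine ENNReal.le_of_forall_pos_le_add fun ε hε _ => ?_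
  set K : ℝ≥0∞ := ENNReal.ofReal (10 ^ d / c)
  have hK0 : K ≠ 0 := by simp only [K]; rw [Ne, ENNReal.ofReal_eq_zero, not_le]; positivity
  have hK1 : K ≠ ⊤ := ENNReal.ofReal_ne_top
  obtain ⟨U, hAU, hU, hUm⟩ := A.exists_isOpen_lt_add (μ := tau E) (measure_ne_top _ _)
    (ε := ε / K) (ENNReal.div_ne_zero.2 ⟨by exact_mod_cast hε.ne', hK1⟩)
  have hUm' : K * tau E U ≤ K * tau E A + ε := by
    refine (mul_le_mul_right hUm.le K).trans ?_
    rw [mul_add, ENNReal.mul_div_cancel hK0 hK1]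
  refine le_trans ?_ hUm'
  have step : ∀ k : ℕ, ∃ (u : Set E) (ρ : E → ℝ), u.Countable ∧ (∀ x ∈ u, 0 < ρ x ∧ ρ x ≤ 1 / (k + 1)) ∧
      (A ∩ sphere 0 1 ⊆ ⋃ x ∈ u, closedBall x (5 * ρ x)) ∧
      (∑' x : u, ENNReal.ofReal (10 ^ d * ρ x ^ d)) ≤ K * tau E U := by
    intro k
    have : ∀ x : E, ∃ r : ℝ, x ∈ A → 0 < r ∧ r ≤ 1 / (k + 1) ∧ closedBall x r ⊆ U := by
      intro x
      by_cases hx : x ∈ A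
      · obtain ⟨r, hr, hr2⟩ := Metric.nhds_basis_closedBall.mem_iff.1 (hU.mem_nhds (hAU hx))
        refine ⟨min r (1 / (k + 1)), fun _ => ⟨by positivity, min_le_right _ _, ?_⟩⟩
        exact (closedBall_subset_closedBall (min_le_left _ _)).trans hr2
      · exact ⟨0, fun h => absurd h hx⟩
    choose ρ hρ using this
    obtain ⟨u, hu, hdisj, hcov⟩ := Vitali.exists_disjoint_subfamily_covering_enlargement_closedBall
      (A ∩ sphere (0 : E) 1) (fun x => x) ρ (1 / (k + 1)) (fun x hx => (hρ x hx.1).2.1) 5 (by norm_num)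
    have hcount : u.Countable := by
      refine hdisj.countable_of_nonempty_interior fun x hx => ?_
      have := (hρ x (hu hx).1).1
      exact ⟨x, ball_subset_interior_closedBall (mem_ball_self this)⟩
    refine ⟨u, ρ, hcount, fun x hx => ⟨(hρ x (hu hx).1).1, (hρ x (hu hx).1).2.1⟩, ?_, ?_⟩
    · intro x hx
      obtain ⟨y, hy, hy2⟩ := hcov x hx
      exact mem_biUnion hy (hy2 (mem_closedBall_self (hρ x hx.1).1.le))
    · have : Countable u := hcount.to_subtype
      calc ∑' x : u, ENNReal.ofReal (10 ^ d * ρ x ^ d)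
          ≤ ∑' x : u, K * tau E (closedBall (x : E) (ρ x)) := by
            refine ENNReal.tsum_le_tsum fun x => ?_
            have hx := hu x.2
            have h1 := hρ x hx.1
            have h2 := h x (ρ x) (by simpa using hx.2) h1.1 (h1.2.1.trans (by
              rw [div_le_one (by positivity)]; linarith [Nat.cast_nonneg (α := ℝ) k]))
            calc _ = K * ENNReal.ofReal (c * ρ x ^ d) := by
                  simp only [K]
                  rw [← ENNReal.ofReal_mul (by positivity)]
                  congr 1; field_simp
              _ ≤ _ := by
                  gcongr
                  exact h2.trans (measure_mono ball_subset_closedBall)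
        _ = K * ∑' x : u, tau E (closedBall (x : E) (ρ x)) := ENNReal.tsum_mul_left
        _ = K * tau E (⋃ x : u, closedBall (x : E) (ρ x)) := by
            rw [measure_iUnion]
            · intro x y hxy
              exact hdisj x.2 y.2 (fun h => hxy (Subtype.ext h))
            · intro x; exact isClosed_closedBall.measurableSet
        _ ≤ _ := by
            gcongr
            exact iUnion_subset fun x => (hρ x (hu x.2).1).2.2
  choose u ρ hu1 hu2 hu3 hu4 using step
  have hcnt : ∀ k, Countable (u k) := fun k => (hu1 k).to_subtype
  have hdiam : ∀ k (x : u k), ediam (closedBall (x : E) (5 * ρ k x)) ≤ ENNReal.ofReal (10 * ρ k x) := by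
    intro k x
    have := (hu2 k x x.2).1
    refine ediam_le fun y hy z hz => ?_
    rw [edist_dist]
    apply ENNReal.ofReal_le_ofReal
    have := dist_triangle_right y z x
    rw [mem_closedBall] at hy hz
    linarith
  have := Measure.hausdorffMeasure_le_liminf_tsum (ι := fun k => u k) (d : ℝ) (A ∩ sphere (0 : E) 1) (l := atTop)
    (fun k : ℕ => ENNReal.ofReal (10 * (1 / (k + 1)))) (by
      rw [← ENNReal.ofReal_zero]
      refine (ENNReal.continuous_ofReal.tendsto _).comp ?_
      rw [← mul_zero (10:ℝ)]
      exact tendsto_one_div_add_atTop_nhds_zero_nat.const_mul 10)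
    (fun k x => closedBall (x : E) (5 * ρ k x))
    (Eventually.of_forall fun k x => (hdiam k x).trans (ENNReal.ofReal_le_ofReal (by
      gcongr; exact (hu2 k x x.2).2)))
    (Eventually.of_forall fun k => by rw [iUnion_subtype]; exact hu3 k)
  refine this.trans (liminf_le_of_frequently_le' (Frequently.of_forall fun k => ?_))
  refine le_trans (ENNReal.tsum_le_tsum fun x => ?_) (hu4 k)
  have h0 := (hu2 k x x.2).1
  calc _ ≤ ENNReal.ofReal (10 * ρ k x) ^ (d : ℝ) := by gcongr; exact hdiam k x
    _ = _ := by rw [ENNReal.rpow_natCast, ← ENNReal.ofReal_pow (by positivity), mul_pow]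

end Hausdorff

lemma sigmaS_tau (n : ℕ) [NeZero n] : ∃ C : ℝ≥0∞, C ≠ ⊤ ∧ C ≠ 0 ∧ sigmaS n ≤ C • tau (En n) ∧
    tau (En n) ≤ C • sigmaS n := by
  obtain ⟨C1, hC1, h1⟩ := tau_le_hausdorff (En n)
  obtain ⟨C2, hC2, h2⟩ := hausdorff_le_tau (En n)
  have hn : 0 < n := NeZero.pos n
  have e : ((Module.finrank ℝ (En n) - 1 : ℕ) : ℝ) = 2 * n - 1 := by
    rw [finrank_En, Nat.cast_sub (by omega)]; push_cast; ring
  rw [e] at h1 h2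
  set m := (μH[(2 * n - 1 : ℝ)] : Measure (En n)).restrict (Sn n) with hm
  have h1' : tau (En n) ≤ ENNReal.ofReal C1 • m := by
    refine Measure.le_iff.2 fun s hs => ?_
    have : tau (En n) s = tau (En n) (s ∩ Sn n) := by
      refine measure_congr ?_
      filter_upwards [tau_ae_norm (E := En n)] with z hz
      have : z ∈ Sn n := by simpa [Sn] using hz
      apply propext
      constructor
      · intro h; exact ⟨h, this⟩
      · intro h; exact h.1
    rw [this]
    refine (h1 _).trans ?_
    simp [hm, Measure.restrict_apply hs]
  have hT0 : tau (En n) univ ≠ 0 := by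
    have : ∃ η : En n, ‖η‖ = 1 := by
      obtain ⟨x, hx⟩ := exists_ne (0 : En n)
      exact ⟨‖x‖⁻¹ • x, by simp [norm_smul, norm_ne_zero_iff.2 hx]⟩
    obtain ⟨η, hη⟩ := this
    obtain ⟨c, hc, h⟩ := exists_le_tau_ball (En n)
    have h3 := (h η 1 hη one_pos le_rfl).trans (measure_mono (subset_univ _))
    intro h4
    rw [h4] at h3
    simp at h3
    linarith
  have hu1 := h1' univ
  have hu2 := h2 univ
  have hH : μH[(2 * n - 1 : ℝ)] (Sn n) = m univ := by simp [hm]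
  have hm0 : m univ ≠ 0 := by
    intro h; simp [h] at hu1; exact hT0 (by simpa using hu1)
  have hmt : m univ ≠ ⊤ := by
    refine ne_top_of_le_ne_top ?_ hu2
    simp only [Measure.smul_apply, smul_eq_mul]
    exact ENNReal.mul_ne_top ENNReal.ofReal_ne_top (measure_ne_top _ _)
  have hs : sigmaS n = (m univ)⁻¹ • m := by rw [sigmaS, hH]
  refine ⟨(m univ)⁻¹ * ENNReal.ofReal C2 + ENNReal.ofReal C1 * m univ, ?_, ?_, ?_, ?_⟩
  · exact ENNReal.add_ne_top.2 ⟨ENNReal.mul_ne_top (ENNReal.inv_ne_top.2 hm0) ENNReal.ofReal_ne_top,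
      ENNReal.mul_ne_top ENNReal.ofReal_ne_top hmt⟩
  · intro h
    rw [add_eq_zero] at h
    have := h.2
    simp [hm0] at this
    linarith
  · rw [hs]
    refine Measure.le_iff.2 fun s _ => ?_
    simp only [Measure.smul_apply, smul_eq_mul]
    calc _ ≤ (m univ)⁻¹ * (ENNReal.ofReal C2 * tau (En n) s) := by gcongr; exact h2 s
      _ = ((m univ)⁻¹ * ENNReal.ofReal C2) * tau (En n) s := by rw [mul_assoc]
      _ ≤ _ := by gcongr; exact le_self_add
  · rw [hs]
    refine Measure.le_iff.2 fun s _ => ?_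
    simp only [Measure.smul_apply, smul_eq_mul]
    calc _ ≤ ENNReal.ofReal C1 * m s := h1' s
      _ = (ENNReal.ofReal C1 * m univ) * ((m univ)⁻¹ * m s) := by
        rw [mul_assoc, ← mul_assoc (m univ), ENNReal.mul_inv_cancel hm0 hmt, one_mul]
      _ ≤ _ := by gcongr; exact le_add_self

section LayerCake

lemma lintegral_rpow_Ioo {r a : ℝ} (hr : 0 < r) (ha : 0 ≤ a) :
    ∫⁻ s in Ioo (0 : ℝ) a, ENNReal.ofReal (r * s ^ (r - 1)) = ENNReal.ofReal (a ^ r) := by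
  rw [← ofReal_integral_eq_lintegral_ofReal, ← integral_Ioc_eq_integral_Ioo,
    ← intervalIntegral.integral_of_le ha, intervalIntegral.integral_const_mul,
    integral_rpow (Or.inl (by linarith))]
  · congr 1
    rw [sub_add_cancel, Real.zero_rpow hr.ne', sub_zero]; field_simp
  · have := (intervalIntegral.intervalIntegrable_rpow' (a := 0) (b := a) (r := r - 1)
      (by linarith)).const_mul r
    rw [intervalIntegrable_iff_integrableOn_Ioc_of_le ha] at this
    exact this.mono_set Ioo_subset_Ioc_self
  · filter_upwards [ae_restrict_mem measurableSet_Ioo] with s hs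
    have := Real.rpow_nonneg hs.1.le (r - 1)
    positivity

lemma ennreal_rpow_eq_lintegral {r : ℝ} (hr : 0 < r) (x : ℝ≥0∞) :
    x ^ r = ∫⁻ s in Ioi (0 : ℝ), ENNReal.ofReal (r * s ^ (r - 1)) *
      (if ENNReal.ofReal s < x then 1 else 0) := by
  have main : ∀ a : ℝ, 0 ≤ a → ∫⁻ s in Ioi (0 : ℝ), ENNReal.ofReal (r * s ^ (r - 1)) *
      (if s < a then 1 else 0) = ENNReal.ofReal (a ^ r) := by
    intro a ha
    rw [← lintegral_rpow_Ioo hr ha, ← Ioi_inter_Iio, inter_comm,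
      ← Measure.restrict_restrict measurableSet_Iio, ← lintegral_indicator measurableSet_Iio]
    refine lintegral_congr fun s => ?_
    by_cases h : s < a <;> simp [indicator, h]
  induction x with
  | top =>
    rw [ENNReal.top_rpow_of_pos hr, eq_comm]
    refine ENNReal.eq_top_of_forall_nnreal_le fun b => ?_
    have := main ((b : ℝ) ^ (1 / r)) (by positivity)
    rw [← Real.rpow_mul b.coe_nonneg, one_div_mul_cancel hr.ne', Real.rpow_one, ENNReal.ofReal_coe_nnreal] at this
    rw [← this]
    refine lintegral_mono fun s => ?_
    gcongr
    split_ifs with h1 h2 <;> simp at *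
  | coe a =>
    rw [← ENNReal.ofReal_coe_nnreal, ENNReal.ofReal_rpow_of_nonneg a.coe_nonneg hr.le, ← main a a.coe_nonneg]
    refine setLIntegral_congr_fun measurableSet_Ioi fun s hs => ?_
    have : ENNReal.ofReal s < ENNReal.ofReal a ↔ s < a := by
      constructor
      · intro h; exact lt_of_not_ge fun h' => absurd (ENNReal.ofReal_le_ofReal h') (not_le.2 h)
      · intro h; exact ENNReal.ofReal_lt_ofReal_iff_of_nonneg hs.le |>.2 h
    rw [ENNReal.ofReal_coe_nnreal] at this
    simp [this]

lemma lintegral_rpow_layer {X : Type*} [MeasurableSpace X] (μ : Measure X) [SFinite μ] {r : ℝ}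
    (hr : 0 < r) {F : X → ℝ≥0∞} (hF : Measurable F) :
    ∫⁻ x, F x ^ r ∂μ = ∫⁻ s in Ioi (0 : ℝ), ENNReal.ofReal (r * s ^ (r - 1)) *
      μ {x | ENNReal.ofReal s < F x} := by
  simp_rw [ennreal_rpow_eq_lintegral hr (F _)]
  have hm : MeasurableSet {p : X × ℝ | ENNReal.ofReal p.2 < F p.1} :=
    measurableSet_lt (by fun_prop) (hF.comp measurable_fst)
  rw [lintegral_lintegral_swap]
  · refine lintegral_congr fun s => ?_
    have hs : MeasurableSet {x | ENNReal.ofReal s < F x} := measurableSet_lt measurable_const hF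
    rw [lintegral_const_mul _ (Measurable.ite hs measurable_const measurable_const)]
    congr 1
    rw [← lintegral_indicator_one hs]
    exact lintegral_congr fun x => by simp [indicator]
  · refine Measurable.aemeasurable ?_
    refine Measurable.mul (by fun_prop) ?_
    exact Measurable.ite hm measurable_const measurable_const

end LayerCake

section Maximal
variable {n : ℕ}

/-- A Vitali covering lemma for Koranyi balls on the sphere. -/
lemma vitali_KB [NeZero n] (t : Set (En n × ℝ)) (R : ℝ) (ht : ∀ p ∈ t, ‖p.1‖ = 1 ∧ 0 < p.2 ∧ p.2 ≤ R) :
    ∃ u ⊆ t, u.Countable ∧ u.PairwiseDisjoint (fun p => KB p.1 p.2 ∩ sphere (0 : En n) 1) ∧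
      ∀ a ∈ t, ∃ b ∈ u, a.2 ≤ 2 * b.2 ∧ ∀ z : En n, ‖z‖ ≤ 1 → dk z a.1 < a.2 → dk z b.1 < 18 * b.2 := by
  obtain ⟨u, hu, hd, hc⟩ := Vitali.exists_disjoint_subfamily_covering_enlargement
    (fun p : En n × ℝ => KB p.1 p.2 ∩ sphere (0 : En n) 1) t (fun p => p.2) 2 (by norm_num)
    (fun a ha => (ht a ha).2.1.le) R (fun a ha => (ht a ha).2.2) (fun a ha => ⟨a.1, by
      change dk a.1 a.1 < a.2
      rw [dk_self (ht a ha).1]; exact (ht a ha).2.1, by simpa using (ht a ha).1⟩)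
  refine ⟨u, hu, ?_, hd, ?_⟩
  · obtain ⟨c, hc, hlow⟩ := exists_le_tau_KB n
    have := Measure.countable_meas_pos_of_disjoint_iUnion (μ := tau (En n)) (ι := u)
      (As := fun p => KB p.1.1 p.1.2 ∩ sphere (0 : En n) 1)
      (fun p => (measurableSet_KB _ _).inter isClosed_sphere.measurableSet)
      (fun p q hpq => hd p.2 q.2 (fun h => hpq (Subtype.ext h)))
    have e : {i : u | 0 < tau (En n) (KB i.1.1 i.1.2 ∩ sphere (0 : En n) 1)} = univ := by
      ext p
      simp only [mem_univ, iff_true]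
      have hp := ht p (hu p.2)
      have h1 := hlow p.1.1 (min p.1.2 4) hp.1 (lt_min hp.2.1 (by norm_num)) (min_le_right _ _)
      have h2 : tau (En n) (KB p.1.1 p.1.2 ∩ sphere (0 : En n) 1) = tau (En n) (KB p.1.1 p.1.2) := by
        refine measure_congr ?_
        filter_upwards [tau_ae_norm (E := En n)] with z hz
        apply propext
        exact ⟨fun h => h.1, fun h => ⟨h, by simpa using hz⟩⟩
      rw [mem_ofPred_eq, h2]
      refine lt_of_lt_of_le ?_ (h1.trans (measure_mono ?_))
      · rw [ENNReal.ofReal_pos]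
        have : 0 < min p.1.2 4 := lt_min hp.2.1 (by norm_num)
        positivity
      · intro z hz
        have hz : dk z p.1.1 < min p.1.2 4 := hz
        exact lt_of_lt_of_le hz (min_le_left _ _)
    rw [e] at this
    exact countable_univ_iff.1 this
  · intro a ha
    obtain ⟨b, hb, ⟨ξ, ⟨h1, h3⟩, h2, -⟩, h4⟩ := hc a ha
    refine ⟨b, hb, h4, fun z hz hza => ?_⟩
    have hξ : ‖ξ‖ = 1 := by simpa using h3
    have hA := (ht a ha)
    have hB := ht b (hu hb)
    have h1 : dk ξ a.1 < a.2 := h1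
    have h2 : dk ξ b.1 < b.2 := h2
    have k1 := dk_triangle hz hξ.le hA.1
    have k2 := dk_triangle hz hB.1.le hξ
    rw [dk_comm a.1 ξ] at k1
    linarith

/-- The (uncentred) Hardy-Littlewood maximal function for Koranyi balls. -/
def MM (U : En n → ℝ≥0∞) (ζ : En n) : ℝ≥0∞ :=
  ⨆ (p : En n × ℝ) (_ : ‖p.1‖ = 1 ∧ 0 < p.2 ∧ ζ ∈ KB p.1 p.2),
    ENNReal.ofReal (p.2 ^ n)⁻¹ * ∫⁻ ξ in KB p.1 p.2, U ξ ∂(tau (En n))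

lemma le_MM (U : En n → ℝ≥0∞) {ζ η : En n} {δ : ℝ} (hη : ‖η‖ = 1) (hδ : 0 < δ) (h : dk ζ η < δ) :
    ∫⁻ ξ in KB η δ, U ξ ∂(tau (En n)) ≤ ENNReal.ofReal (δ ^ n) * MM U ζ := by
  have h1 : ENNReal.ofReal (δ ^ n)⁻¹ * ∫⁻ ξ in KB η δ, U ξ ∂(tau (En n)) ≤ MM U ζ :=
    le_iSup₂_of_le (f := fun (p : En n × ℝ) (_ : ‖p.1‖ = 1 ∧ 0 < p.2 ∧ ζ ∈ KB p.1 p.2) =>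
      ENNReal.ofReal (p.2 ^ n)⁻¹ * ∫⁻ ξ in KB p.1 p.2, U ξ ∂(tau (En n))) (η, δ) ⟨hη, hδ, h⟩ le_rfl
  have hp : 0 < δ ^ n := by positivity
  rw [ENNReal.ofReal_inv_of_pos hp] at h1
  rwa [ENNReal.inv_mul_le_iff (by simpa using hp) (by simp)] at h1

lemma isOpen_lt_MM (U : En n → ℝ≥0∞) (s : ℝ≥0∞) : IsOpen {ζ | s < MM U ζ} := by
  have : {ζ | s < MM U ζ} = ⋃ (p : En n × ℝ) (_ : ‖p.1‖ = 1 ∧ 0 < p.2 ∧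
      s < ENNReal.ofReal (p.2 ^ n)⁻¹ * ∫⁻ ξ in KB p.1 p.2, U ξ ∂(tau (En n))), KB p.1 p.2 := by
    ext ζ
    simp only [MM, mem_ofPred_eq, lt_iSup_iff, mem_iUnion, exists_prop]
    constructor
    · rintro ⟨p, ⟨h1, h2, h3⟩, h4⟩; exact ⟨p, ⟨h1, h2, h4⟩, h3⟩
    · rintro ⟨p, ⟨h1, h2, h4⟩, h3⟩; exact ⟨p, ⟨h1, h2, h3⟩, h4⟩
  rw [this]
  exact isOpen_biUnion fun p _ => isOpen_KB _ _

lemma measurable_MM (U : En n → ℝ≥0∞) : Measurable (MM U) :=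
  measurable_of_Ioi fun s => (isOpen_lt_MM U s).measurableSet

lemma weak_MM (n : ℕ) [NeZero n] : ∃ C : ℝ, 0 < C ∧ ∀ (U : En n → ℝ≥0∞) (s : ℝ), 0 < s →
    tau (En n) {ζ | ENNReal.ofReal s < MM U ζ} ≤ ENNReal.ofReal (C / s) * ∫⁻ ζ, U ζ ∂(tau (En n)) := by
  obtain ⟨C, hC, hup⟩ := exists_tau_KB_le n
  refine ⟨C * 18 ^ n, by positivity, fun U s hs => ?_⟩
  by_cases hfin : ∫⁻ ζ, U ζ ∂(tau (En n)) = ⊤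
  · rw [hfin, ENNReal.mul_top]
    · exact le_top
    · rw [Ne, ENNReal.ofReal_eq_zero, not_le]; positivity
  set I := ∫⁻ ζ, U ζ ∂(tau (En n)) with hI
  set t : Set (En n × ℝ) := {p | ‖p.1‖ = 1 ∧ 0 < p.2 ∧
      ENNReal.ofReal (s * p.2 ^ n) ≤ ∫⁻ ξ in KB p.1 p.2, U ξ ∂(tau (En n))} with ht
  have hn : n ≠ 0 := NeZero.ne n
  have hR : ∀ p ∈ t, p.2 ≤ max 1 (I.toReal / s) := by
    rintro ⟨η, δ⟩ ⟨h1, h2, h3⟩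
    by_contra hcon
    push Not at hcon
    simp only at h1 h2 h3 hcon
    have k1 : 1 < δ := lt_of_le_of_lt (le_max_left _ _) hcon
    have k2 : I.toReal / s < δ := lt_of_le_of_lt (le_max_right _ _) hcon
    have k3 : ENNReal.ofReal (s * δ ^ n) ≤ I := h3.trans (setLIntegral_le_lintegral _ _)
    have k4 : s * δ ^ n ≤ I.toReal := (ENNReal.ofReal_le_iff_le_toReal hfin).1 k3
    have k5 : δ ≤ δ ^ n := le_self_pow₀ k1.le hn
    rw [div_lt_iff₀ hs] at k2
    nlinarith
  obtain ⟨u, hut, hcount, hdisj, hcov⟩ := vitali_KB t _ (fun p hp => ⟨hp.1, hp.2.1, hR p hp⟩)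
  have : Countable u := hcount.to_subtype
  have hsub : {ζ | ENNReal.ofReal s < MM U ζ} ∩ sphere 0 1 ⊆ ⋃ p : u, KB p.1.1 (18 * p.1.2) := by
    rintro ζ ⟨h1, h2⟩
    have hζ : ‖ζ‖ = 1 := by simpa using h2
    simp only [MM, mem_ofPred_eq, lt_iSup_iff, exists_prop] at h1
    obtain ⟨p, ⟨h3, h4, h5⟩, h6⟩ := h1
    have hp : 0 < p.2 ^ n := by positivity
    have hpt : p ∈ t := by
      refine ⟨h3, h4, ?_⟩
      rw [ENNReal.ofReal_inv_of_pos hp] at h6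
      have h8 := mul_le_mul_right h6.le (ENNReal.ofReal (p.2 ^ n))
      rw [← mul_assoc, ENNReal.mul_inv_cancel (by simpa using hp) (by simp), one_mul] at h8
      rwa [mul_comm, ENNReal.ofReal_mul hp.le]
    obtain ⟨b, hb, -, h7⟩ := hcov p hpt
    exact mem_iUnion.2 ⟨⟨b, hb⟩, h7 ζ hζ.le h5⟩
  have hmeas : ∀ A : Set (En n), tau (En n) A = tau (En n) (A ∩ sphere 0 1) := by
    intro A
    refine measure_congr ?_
    filter_upwards [tau_ae_norm (E := En n)] with z hz
    apply propext
    exact ⟨fun h => ⟨h, by simpa using hz⟩, fun h => h.1⟩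
  rw [hmeas]
  calc _ ≤ tau (En n) (⋃ p : u, KB p.1.1 (18 * p.1.2)) := measure_mono hsub
    _ ≤ ∑' p : u, tau (En n) (KB p.1.1 (18 * p.1.2)) := measure_iUnion_le _
    _ ≤ ∑' p : u, ENNReal.ofReal (C * 18 ^ n / s) *
        ∫⁻ ξ in KB p.1.1 p.1.2 ∩ sphere 0 1, U ξ ∂(tau (En n)) := by
        refine ENNReal.tsum_le_tsum fun p => ?_
        have hp := hut p.2
        have e : ∫⁻ ξ in KB p.1.1 p.1.2 ∩ sphere 0 1, U ξ ∂(tau (En n)) =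
            ∫⁻ ξ in KB p.1.1 p.1.2, U ξ ∂(tau (En n)) := by
          refine setLIntegral_congr ?_
          filter_upwards [tau_ae_norm (E := En n)] with z hz
          apply propext
          exact ⟨fun h => h.1, fun h => ⟨h, by simpa using hz⟩⟩
        rw [e]
        refine (hup p.1.1 (18 * p.1.2) hp.1 (by linarith [hp.2.1])).trans ?_
        refine le_trans ?_ (mul_le_mul_right hp.2.2 _)
        have := hp.2.1
        rw [← ENNReal.ofReal_mul (by positivity)]
        apply ENNReal.ofReal_le_ofReal
        apply le_of_eq
        rw [mul_pow]
        field_simp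
    _ = ENNReal.ofReal (C * 18 ^ n / s) * ∑' p : u,
        ∫⁻ ξ in KB p.1.1 p.1.2 ∩ sphere 0 1, U ξ ∂(tau (En n)) := ENNReal.tsum_mul_left
    _ = ENNReal.ofReal (C * 18 ^ n / s) *
        ∫⁻ ξ in ⋃ p : u, KB p.1.1 p.1.2 ∩ sphere 0 1, U ξ ∂(tau (En n)) := by
        rw [lintegral_iUnion]
        · exact fun p => (measurableSet_KB _ _).inter isClosed_sphere.measurableSet
        · exact fun p q hpq => hdisj p.2 q.2 (fun h => hpq (Subtype.ext h))
    _ ≤ _ := by gcongr; exact setLIntegral_le_lintegral _ _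

lemma strong_MM (n : ℕ) [NeZero n] {r : ℝ} (hr : 1 < r) : ∃ C : ℝ, 0 < C ∧ ∀ U : En n → ℝ≥0∞,
    Measurable U → ∫⁻ ζ, MM U ζ ^ r ∂(tau (En n)) ≤ ENNReal.ofReal C * ∫⁻ ζ, U ζ ^ r ∂(tau (En n)) := by
  obtain ⟨C1, hC1, hup⟩ := exists_tau_KB_le n
  obtain ⟨C2, hC2, hweak⟩ := weak_MM n
  set K : ℝ := 2 * C1 with hK
  have hK0 : 0 < K := by positivity
  refine ⟨r / (r - 1) * (2 * C2) * K ^ (r - 1), by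
    have : 0 < r - 1 := by linarith
    positivity, fun U hU => ?_⟩
  have step : ∀ s : ℝ, 0 < s → tau (En n) {ζ | ENNReal.ofReal s < MM U ζ} ≤
      ENNReal.ofReal (2 * C2 / s) *
        (tau (En n)).withDensity U {x | ENNReal.ofReal s < ENNReal.ofReal K * U x} := by
    intro s hs
    set A := {x | ENNReal.ofReal s < ENNReal.ofReal K * U x}
    have hA : MeasurableSet A := measurableSet_lt measurable_const (by fun_prop)
    have h1 : ∀ ζ, MM U ζ ≤ MM (A.indicator U) ζ + ENNReal.ofReal (s / 2) := by
      intro ζ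
      refine iSup₂_le fun p hp => ?_
      have hpos : 0 < p.2 ^ n := pow_pos hp.2.1 n
      rw [ENNReal.ofReal_inv_of_pos hpos, ENNReal.inv_mul_le_iff (by simpa using hpos) (by simp),
        mul_add]
      have k1 := le_MM (A.indicator U) hp.1 hp.2.1 hp.2.2
      have k2 : ∫⁻ ξ in KB p.1 p.2, U ξ ∂(tau (En n)) ≤
          ∫⁻ ξ in KB p.1 p.2, (A.indicator U ξ + ENNReal.ofReal (s / K)) ∂(tau (En n)) := by
        refine lintegral_mono fun ξ => ?_
        by_cases h : ξ ∈ A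
        · simp [h]
        · simp only [h, not_false_eq_true, indicator_of_notMem, zero_add]
          have h : ENNReal.ofReal K * U ξ ≤ ENNReal.ofReal s := not_lt.1 h
          rw [ENNReal.ofReal_div_of_pos hK0, ENNReal.le_div_iff_mul_le (by simp [hK0]) (by simp), mul_comm]
          exact h
      refine k2.trans ?_
      rw [lintegral_add_right _ measurable_const, setLIntegral_const]
      refine add_le_add k1 ?_
      refine (mul_le_mul_right (hup p.1 p.2 hp.1 hp.2.1) _).trans ?_
      rw [← ENNReal.ofReal_mul (by positivity), ← ENNReal.ofReal_mul (by positivity)]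
      apply ENNReal.ofReal_le_ofReal
      apply le_of_eq
      simp only [hK]
      field_simp
    have h2 : {ζ | ENNReal.ofReal s < MM U ζ} ⊆ {ζ | ENNReal.ofReal (s / 2) < MM (A.indicator U) ζ} := by
      intro ζ hζ
      have hζ : ENNReal.ofReal s < MM U ζ := hζ
      have := lt_of_lt_of_le hζ (h1 ζ)
      by_contra hcon
      have hcon : MM (A.indicator U) ζ ≤ ENNReal.ofReal (s / 2) := not_lt.1 hcon
      have h3 : ENNReal.ofReal s = ENNReal.ofReal (s / 2) + ENNReal.ofReal (s / 2) := by
        rw [← ENNReal.ofReal_add (by positivity) (by positivity)]; congr 1; ring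
      rw [h3] at this
      exact absurd this (not_lt.2 (by gcongr))
    refine (measure_mono h2).trans ((hweak _ (s / 2) (by positivity)).trans ?_)
    rw [withDensity_apply _ hA, lintegral_indicator hA]
    apply le_of_eq
    congr 2
    field_simp
  have hr1 : 0 < r - 1 := by linarith
  rw [lintegral_rpow_layer _ (by linarith) (measurable_MM U)]
  have h3 := lintegral_rpow_layer ((tau (En n)).withDensity U) hr1 (F := fun x => ENNReal.ofReal K * U x)
    (by fun_prop)
  rw [lintegral_withDensity_eq_lintegral_mul _ hU (by fun_prop)] at h3
  calc _ ≤ ∫⁻ s in Ioi (0 : ℝ), ENNReal.ofReal (r / (r - 1) * (2 * C2)) *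
      (ENNReal.ofReal ((r - 1) * s ^ (r - 1 - 1)) *
        (tau (En n)).withDensity U {x | ENNReal.ofReal s < ENNReal.ofReal K * U x}) := by
        refine setLIntegral_mono' measurableSet_Ioi fun s hs => ?_
        have hs : 0 < s := hs
        refine (mul_le_mul_right (step s hs) _).trans (le_of_eq ?_)
        rw [← mul_assoc, ← mul_assoc, ← ENNReal.ofReal_mul (by positivity), ← ENNReal.ofReal_mul (by positivity)]
        congr 2
        rw [Real.rpow_sub_one hs.ne' (r - 1)]
        field_simp
    _ = ENNReal.ofReal (r / (r - 1) * (2 * C2)) * ∫⁻ x, U x * (ENNReal.ofReal K * U x) ^ (r - 1) ∂(tau (En n)) := by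
        rw [lintegral_const_mul' _ _ ENNReal.ofReal_ne_top, ← h3]
        rfl
    _ = ENNReal.ofReal (r / (r - 1) * (2 * C2)) * (ENNReal.ofReal (K ^ (r - 1)) * ∫⁻ x, U x ^ r ∂(tau (En n))) := by
        congr 1
        rw [← lintegral_const_mul' _ _ ENNReal.ofReal_ne_top]
        refine lintegral_congr fun x => ?_
        rw [ENNReal.mul_rpow_of_nonneg _ _ hr1.le, ENNReal.ofReal_rpow_of_nonneg hK0.le hr1.le,
          mul_left_comm]
        congr 1
        conv_rhs => rw [show r = 1 + (r - 1) by ring, ENNReal.rpow_add_of_nonneg _ _ zero_le_one hr1.le,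
          ENNReal.rpow_one]
    _ = _ := by
        rw [← mul_assoc, ← ENNReal.ofReal_mul (by positivity)]

end Maximal

section Holomorphic
variable {E : Type*} [NormedAddCommGroup E] [NormedSpace ℂ E]
  {F : Type*} [NormedAddCommGroup F] [NormedSpace ℂ F] 

lemma hasDerivAt_slice {f : E → F} {z v : E} {w : ℂ} (h : DifferentiableAt ℂ f (z + w • v)) :
    HasDerivAt (fun w : ℂ => f (z + w • v)) (fderiv ℂ f (z + w • v) v) w := by
  have h1 : HasDerivAt (fun w : ℂ => z + w • v) v w := by
    simpa using ((hasDerivAt_id w).smul_const v).const_add z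
  exact h.hasFDerivAt.comp_hasDerivAt w h1

lemma norm_fderiv_le_of_bound {f : E → F} {z : E} {r M : ℝ} (hr : 0 < r)
    (hf : DifferentiableOn ℂ f (ball z (2 * r))) (hM : ∀ w ∈ ball z (2 * r), ‖f w‖ ≤ M) :
    ‖fderiv ℂ f z‖ ≤ M / r := by
  have hM0 : 0 ≤ M := (norm_nonneg _).trans (hM z (mem_ball_self (by linarith)))
  refine ContinuousLinearMap.opNorm_le_bound _ (by positivity) fun v => ?_
  by_cases hv : v = 0
  · simp [hv]
  have hv' : 0 < ‖v‖ := norm_pos_iff.2 hv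
  have key : ∀ w : ℂ, ‖w‖ < 2 * r / ‖v‖ → z + w • v ∈ ball z (2 * r) := by
    intro w hw
    rw [mem_ball, dist_eq_norm, add_sub_cancel_left, norm_smul]
    rwa [lt_div_iff₀ hv'] at hw
  have hd : ∀ w : ℂ, ‖w‖ < 2 * r / ‖v‖ → HasDerivAt (fun w : ℂ => f (z + w • v)) (fderiv ℂ f (z + w • v) v) w :=
    fun w hw => hasDerivAt_slice ((hf _ (key w hw)).differentiableAt (isOpen_ball.mem_nhds (key w hw)))
  have hR : 0 < r / ‖v‖ := by positivity
  have hlt : ∀ w : ℂ, ‖w‖ ≤ r / ‖v‖ → ‖w‖ < 2 * r / ‖v‖ := by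
    intro w hw
    have : 2 * r / ‖v‖ = r / ‖v‖ + r / ‖v‖ := by ring
    linarith
  have := Complex.norm_deriv_le_of_forall_mem_sphere_norm_le (f := fun w : ℂ => f (z + w • v)) (c := 0)
    (R := r / ‖v‖) (C := M) hR ?_ ?_
  · rw [(hd 0 (by simp; positivity)).deriv] at this
    simp only [zero_smul, add_zero] at this
    refine this.trans (le_of_eq ?_)
    field_simp
  · refine DifferentiableOn.diffContOnCl ?_
    rw [closure_ball _ hR.ne']
    intro w hw
    refine (hd w (hlt w (by simpa using hw))).differentiableAt.differentiableWithinAt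
  · intro w hw
    exact hM _ (key w (hlt w (by simpa using (mem_sphere.1 hw).le)))

lemma differentiableOn_of_clm_apply {D : Type*} [NormedAddCommGroup D] [NormedSpace ℂ D]
    [FiniteDimensional ℂ E] {f : D → E →L[ℂ] F} {s : Set D}
    (h : ∀ y, DifferentiableOn ℂ (fun x => f x y) s) : DifferentiableOn ℂ f s := by
  let d := Module.finrank ℂ E
  have hd : d = Module.finrank ℂ (Fin d → ℂ) := (Module.finrank_fin_fun ℂ).symm
  let e₁ := ContinuousLinearEquiv.ofFinrankEq hd
  let e₂ := (e₁.arrowCongr (1 : F ≃L[ℂ] F)).trans (ContinuousLinearEquiv.piRing (Fin d))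
  rw [← Function.id_comp f, ← e₂.symm_comp_self]
  exact e₂.symm.differentiable.comp_differentiableOn (differentiableOn_pi.mpr fun i => h _)

variable [FiniteDimensional ℂ E] [CompleteSpace F] [SecondCountableTopology F]

lemma differentiableOn_fderiv_of_isOpen {f : E → F} {s : Set E} (hs : IsOpen s)
    (hf : DifferentiableOn ℂ f s) : DifferentiableOn ℂ (fderiv ℂ f) s := by
  borelize E
  borelize F
  have : ProperSpace E := FiniteDimensional.proper ℂ E
  have hsec : SecondCountableTopology (E →L[ℂ] F) := by infer_instance
  refine differentiableOn_of_clm_apply fun v z0 hz0 => ?_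
  apply DifferentiableAt.differentiableWithinAt
  by_cases hv : v = 0
  · subst hv; simp
  obtain ⟨r', hr', hball⟩ := Metric.isOpen_iff.1 hs z0 hz0
  set r := r' / 6 with hr
  have hr0 : 0 < r := by positivity
  have hv' : 0 < ‖v‖ := norm_pos_iff.2 hv
  have hcl : closedBall z0 (5 * r) ⊆ s := (closedBall_subset_ball (by linarith)).trans hball
  obtain ⟨M, hM⟩ := ((isCompact_closedBall z0 (5 * r)).exists_bound_of_continuousOn
    (hf.continuousOn.mono hcl))
  set ρ := r / ‖v‖ with hρ
  have hρ0 : 0 < ρ := by positivity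
  set γ : ℝ → ℂ := fun θ => circleMap 0 ρ θ with hγ
  have hγn : ∀ θ, ‖γ θ • v‖ = r := by
    intro θ
    rw [norm_smul, hγ]
    simp only [norm_circleMap_zero]
    rw [abs_of_pos hρ0, hρ]; field_simp
  have hmem : ∀ z ∈ ball z0 r, ∀ w : ℂ, ‖w • v‖ ≤ r → z + w • v ∈ ball z0 (2 * r) := by
    intro z hz w hw
    rw [mem_ball, dist_eq_norm] at *
    calc ‖z + w • v - z0‖ = ‖(z - z0) + w • v‖ := by congr 1; abel
      _ ≤ ‖z - z0‖ + ‖w • v‖ := norm_add_le _ _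
      _ < 2 * r := by linarith
  have hsub : ball z0 (2 * r) ⊆ s := fun z hz => hcl (mem_closedBall.2 (by
    have := mem_ball.1 hz; linarith))
  have hdiff : ∀ z ∈ ball z0 (2 * r), DifferentiableAt ℂ f z := fun z hz =>
    (hf z (hsub hz)).differentiableAt (hs.mem_nhds (hsub hz))
  have hbd : ∀ z ∈ ball z0 (2 * r), ‖fderiv ℂ f z‖ ≤ M / r := by
    intro z hz
    have hs2 : ball z (2 * r) ⊆ closedBall z0 (5 * r) := by
      intro w hw
      rw [mem_closedBall]
      have := mem_ball.1 hz
      have := mem_ball.1 hw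
      linarith [dist_triangle w z z0]
    exact norm_fderiv_le_of_bound hr0 (hf.mono (hs2.trans hcl)) (fun w hw => hM w (hs2 hw))
  -- the Cauchy formula for the derivative in direction `v`
  have hrep : ∀ z ∈ ball z0 r, fderiv ℂ f z v =
      (2 * Real.pi * Complex.I : ℂ)⁻¹ • ∫ θ in (0 : ℝ)..2 * Real.pi,
        (deriv (circleMap 0 ρ) θ * ((γ θ) ^ 2)⁻¹) • f (z + γ θ • v) := by
    intro z hz
    have hk : ∀ w : ℂ, ‖w‖ ≤ ρ → ‖w • v‖ ≤ r := by
      intro w hw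
      rw [norm_smul]
      calc ‖w‖ * ‖v‖ ≤ ρ * ‖v‖ := by gcongr
        _ = r := by rw [hρ]; field_simp
    have h1 : HasDerivAt (fun w : ℂ => f (z + w • v)) (fderiv ℂ f z v) 0 := by
      have := hasDerivAt_slice (f := f) (z := z) (v := v) (w := 0) (hdiff _ (hmem z hz 0 (by simp [hr0.le])))
      simpa using this
    have h2 : DiffContOnCl ℂ (fun w : ℂ => f (z + w • v)) (ball 0 ρ) := by
      refine DifferentiableOn.diffContOnCl ?_
      rw [closure_ball _ hρ0.ne']
      intro w hw
      exact (hasDerivAt_slice (hdiff _ (hmem z hz w (hk w (by simpa using hw))))).differentiableAt.differentiableWithinAt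
    have h3 := h2.deriv_eq_smul_circleIntegral hρ0
    rw [h1.deriv] at h3
    rw [eq_inv_smul_iff₀ (by simp [Real.pi_ne_zero]), ← h3, circleIntegral]
    refine intervalIntegral.integral_congr fun θ _ => ?_
    simp [hγ, smul_smul]
  have hev : (fun z => fderiv ℂ f z v) =ᶠ[𝓝 z0] fun z => (2 * Real.pi * Complex.I : ℂ)⁻¹ • ∫ θ in (0 : ℝ)..2 * Real.pi,
        (deriv (circleMap 0 ρ) θ * ((γ θ) ^ 2)⁻¹) • f (z + γ θ • v) := by
    filter_upwards [ball_mem_nhds z0 hr0] with z hz using hrep z hz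
  refine DifferentiableAt.congr_of_eventuallyEq ?_ hev
  refine DifferentiableAt.const_smul ?_ _
  have hcont_c : Continuous fun θ => deriv (circleMap 0 ρ) θ * ((γ θ) ^ 2)⁻¹ := by
    have e : (fun θ => deriv (circleMap 0 ρ) θ * ((γ θ) ^ 2)⁻¹) = fun θ => circleMap 0 ρ θ * Complex.I * ((circleMap 0 ρ θ) ^ 2)⁻¹ := by
      ext θ; simp [hγ]
    rw [e]
    refine ((continuous_circleMap 0 ρ).mul continuous_const).mul (Continuous.inv₀ (by fun_prop) ?_)
    intro θ
    have : circleMap 0 ρ θ ≠ 0 := circleMap_ne_center hρ0.ne'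
    positivity
  have hγc : Continuous γ := continuous_circleMap 0 ρ
  have hnc : ∀ θ, ‖deriv (circleMap 0 ρ) θ * ((γ θ) ^ 2)⁻¹‖ = ρ⁻¹ := by
    intro θ
    simp [hγ, abs_of_pos hρ0]
    field_simp
  have hc0 : ∀ z ∈ ball z0 r, Continuous fun θ => (deriv (circleMap 0 ρ) θ * ((γ θ) ^ 2)⁻¹) • f (z + γ θ • v) := by
    intro z hz
    refine hcont_c.smul ?_
    refine (hf.continuousOn.mono hsub).comp_continuous (by fun_prop) fun θ => hmem z hz _ (hγn θ).le
  have hder := intervalIntegral.hasFDerivAt_integral_of_dominated_of_fderiv_le (𝕜 := ℂ) (μ := volume)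
    (a := 0) (b := 2 * Real.pi) (bound := fun _ => ρ⁻¹ * (M / r))
    (F := fun z θ => (deriv (circleMap 0 ρ) θ * ((γ θ) ^ 2)⁻¹) • f (z + γ θ • v))
    (F' := fun z θ => (deriv (circleMap 0 ρ) θ * ((γ θ) ^ 2)⁻¹) • fderiv ℂ f (z + γ θ • v))
    (x₀ := z0) (s := ball z0 r) (ball_mem_nhds z0 hr0) ?_ ?_ ?_ ?_ ?_ ?_
  · exact hder.differentiableAt
  · filter_upwards [ball_mem_nhds z0 hr0] with z hz
    exact (hc0 z hz).aestronglyMeasurable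
  · exact (hc0 z0 (mem_ball_self hr0)).intervalIntegrable _ _
  · refine AEStronglyMeasurable.smul hcont_c.aestronglyMeasurable ?_
    refine Measurable.aestronglyMeasurable ?_
    exact (measurable_fderiv ℂ f).comp (by fun_prop : Continuous fun θ => z0 + γ θ • v).measurable
  · refine Eventually.of_forall fun θ _ z hz => ?_
    rw [norm_smul, hnc]
    gcongr
    exact hbd _ (hmem z hz _ (hγn θ).le)
  · exact intervalIntegrable_const
  · refine Eventually.of_forall fun θ _ z hz => ?_
    have h1 : HasFDerivAt (fun z => z + γ θ • v) (ContinuousLinearMap.id ℂ E) z :=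
      (hasFDerivAt_id z).add_const _
    have h2 := (hdiff _ (hmem z hz _ (hγn θ).le)).hasFDerivAt.comp z h1
    exact h2.const_smul _

lemma contDiffOn_two_of_isOpen {f : E → F} {s : Set E} (hs : IsOpen s)
    (hf : DifferentiableOn ℂ f s) : ContDiffOn ℂ 2 f s := by
  have h1 := differentiableOn_fderiv_of_isOpen hs hf
  have h2 := differentiableOn_fderiv_of_isOpen hs h1
  rw [show (2 : WithTop ℕ∞) = 1 + 1 by norm_num, contDiffOn_succ_iff_fderiv_of_isOpen hs]
  refine ⟨hf, by simp, ?_⟩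
  rw [show (1 : WithTop ℕ∞) = 0 + 1 by norm_num, contDiffOn_succ_iff_fderiv_of_isOpen hs]
  refine ⟨h1, by simp, ?_⟩
  rw [contDiffOn_zero]
  exact h2.continuousOn

end Holomorphic

section Levi
variable {E : Type*} [NormedAddCommGroup E] [NormedSpace ℝ E]

/-- The second Fréchet derivative of a real function. -/
def D2 (U : E → ℝ) (z v w : E) : ℝ := fderiv ℝ (fderiv ℝ U) z v w

lemma hasDerivAt_line {F : Type*} [NormedAddCommGroup F] [NormedSpace ℝ F] {U : E → F} {z v : E} {s : ℝ}
    (h : DifferentiableAt ℝ U (z + s • v)) :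
    HasDerivAt (fun s : ℝ => U (z + s • v)) (fderiv ℝ U (z + s • v) v) s := by
  have h1 : HasDerivAt (fun s : ℝ => z + s • v) v s := by
    simpa using ((hasDerivAt_id s).smul_const v).const_add z
  exact h.hasFDerivAt.comp_hasDerivAt s h1

lemma tendsto_line (z v : E) : Tendsto (fun s : ℝ => z + s • v) (𝓝 0) (𝓝 z) := by
  have : Continuous fun s : ℝ => z + s • v := by fun_prop
  simpa using this.tendsto 0

lemma ContDiffAt.eventually_differentiableAt_of_two {U : E → ℝ} {z : E} (hU : ContDiffAt ℝ 2 U z) :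
    ∀ᶠ w in 𝓝 z, DifferentiableAt ℝ U w := by
  filter_upwards [hU.eventually (by simp)] with w hw using hw.differentiableAt (by simp)

lemma ContDiffAt.differentiableAt_fderiv_of_two {U : E → ℝ} {z : E} (hU : ContDiffAt ℝ 2 U z) :
    DifferentiableAt ℝ (fderiv ℝ U) z :=
  (hU.fderiv_right (m := 1) (by norm_num)).differentiableAt (by simp)

lemma hasDerivAt_fderiv_line {U : E → ℝ} {z v : E} (hU : ContDiffAt ℝ 2 U z) :
    HasDerivAt (fun s : ℝ => fderiv ℝ U (z + s • v) v) (D2 U z v v) 0 := by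
  have h : DifferentiableAt ℝ (fderiv ℝ U) (z + (0 : ℝ) • v) := by
    simpa using hU.differentiableAt_fderiv_of_two
  have h1 := (hasDerivAt_line h).clm_apply (hasDerivAt_const (0 : ℝ) v)
  simpa [D2] using h1

lemma D2_eq_of_line {U : E → ℝ} {z v : E} (hU : ContDiffAt ℝ 2 U z) {k1 : ℝ → ℝ} {k2 : ℝ}
    (h1 : ∀ᶠ s in 𝓝 (0 : ℝ), HasDerivAt (fun s : ℝ => U (z + s • v)) (k1 s) s)
    (h2 : HasDerivAt k1 k2 0) : D2 U z v v = k2 := by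
  have h3 := hasDerivAt_fderiv_line (v := v) hU
  refine h3.unique (h2.congr_of_eventuallyEq ?_)
  filter_upwards [h1, (tendsto_line z v).eventually hU.eventually_differentiableAt_of_two] with s hs hd
  exact (hasDerivAt_line hd).unique hs

variable [NormedSpace ℂ E] [IsScalarTower ℝ ℂ E]

/-- Four times the Levi form of `U`: the Laplacian of `U` along the complex line through `z`
with direction `v`. -/
def levi (U : E → ℝ) (z v : E) : ℝ := D2 U z v v + D2 U z (Complex.I • v) (Complex.I • v)

lemma levi_add {U V : E → ℝ} {z v : E} (hU : ContDiffAt ℝ 2 U z) (hV : ContDiffAt ℝ 2 V z) :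
    levi (fun w => U w + V w) z v = levi U z v + levi V z v := by
  have key : ∀ v, D2 (fun w => U w + V w) z v v = D2 U z v v + D2 V z v v := by
    intro v
    refine D2_eq_of_line (hU.add hV) (k1 := fun s => fderiv ℝ U (z + s • v) v + fderiv ℝ V (z + s • v) v) ?_
      ((hasDerivAt_fderiv_line hU).add (hasDerivAt_fderiv_line hV))
    filter_upwards [(tendsto_line z v).eventually hU.eventually_differentiableAt_of_two,
      (tendsto_line z v).eventually hV.eventually_differentiableAt_of_two] with s h1 h2
    exact (hasDerivAt_line h1).add (hasDerivAt_line h2)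
  rw [levi, levi, levi, key, key]; ring

lemma levi_comp_le {y : E → ℝ} {Φ Φ1 : ℝ → ℝ} {Φ2 : ℝ} {z v : E} (hy : ContDiffAt ℝ 2 y z)
    (hΦ : ContDiff ℝ 2 Φ) (h1 : ∀ x, HasDerivAt Φ (Φ1 x) x) (h2 : HasDerivAt Φ1 Φ2 (y z)) (h3 : Φ2 ≤ 0) :
    levi (fun w => Φ (y w)) z v ≤ Φ1 (y z) * levi y z v := by
  have key : ∀ v, D2 (fun w => Φ (y w)) z v v = Φ2 * (fderiv ℝ y z v) ^ 2 + Φ1 (y z) * D2 y z v v := by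
    intro v
    refine D2_eq_of_line (hΦ.contDiffAt.comp z hy)
      (k1 := fun s => Φ1 (y (z + s • v)) * fderiv ℝ y (z + s • v) v) ?_ ?_
    · filter_upwards [(tendsto_line z v).eventually hy.eventually_differentiableAt_of_two] with s hs
      exact (h1 _).comp s (hasDerivAt_line hs)
    · have hd : DifferentiableAt ℝ y (z + (0 : ℝ) • v) := by
        simpa using hy.differentiableAt (by simp)
      have h4 : HasDerivAt (fun s : ℝ => Φ1 (y (z + s • v))) (Φ2 * fderiv ℝ y (z + (0 : ℝ) • v) v) 0 := by
        refine HasDerivAt.comp (h₂ := Φ1) (0 : ℝ) ?_ (hasDerivAt_line hd)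
        simpa using h2
      have h5 := h4.mul (hasDerivAt_fderiv_line (v := v) hy)
      simp only [zero_smul, add_zero] at h5
      exact h5.congr_deriv (by ring)
  rw [levi, levi, key, key]
  nlinarith [mul_nonneg (neg_nonneg.2 h3) (sq_nonneg (fderiv ℝ y z v)),
    mul_nonneg (neg_nonneg.2 h3) (sq_nonneg (fderiv ℝ y z (Complex.I • v)))]

section Hol
variable {f : E → ℂ} {z : E}

lemma hasDerivAt_line_holo {v : E} {s : ℝ} {F : Type*} [NormedAddCommGroup F] [NormedSpace ℂ F]
    [NormedSpace ℝ F] [IsScalarTower ℝ ℂ F] {f : E → F} (h : DifferentiableAt ℂ f (z + s • v)) :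
    HasDerivAt (fun s : ℝ => f (z + s • v)) (fderiv ℂ f (z + s • v) v) s := by
  have h1 : HasDerivAt (fun s : ℝ => z + s • v) v s := by
    simpa using ((hasDerivAt_id s).smul_const v).const_add z
  exact (h.hasFDerivAt.restrictScalars ℝ).comp_hasDerivAt s h1

lemma ContDiffAt.eventually_differentiableAt_of_two' (hf : ContDiffAt ℂ 2 f z) :
    ∀ᶠ w in 𝓝 z, DifferentiableAt ℂ f w := by
  filter_upwards [hf.eventually (by simp)] with w hw using hw.differentiableAt (by simp)

lemma hasDerivAt_fderiv_line_holo {v : E} (hf : ContDiffAt ℂ 2 f z) :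
    HasDerivAt (fun s : ℝ => fderiv ℂ f (z + s • v) v) (fderiv ℂ (fderiv ℂ f) z v v) 0 := by
  have h : DifferentiableAt ℂ (fderiv ℂ f) (z + (0 : ℝ) • v) := by
    simpa using (hf.fderiv_right (m := 1) (by norm_num)).differentiableAt (by simp)
  have h1 := hasDerivAt_line_holo h
  simp only [zero_smul, add_zero] at h1
  let ev : (E →L[ℂ] ℂ) →L[ℝ] ℂ := (ContinuousLinearMap.apply ℂ ℂ v).restrictScalars ℝ
  exact ev.hasFDerivAt.comp_hasDerivAt (0 : ℝ) h1

lemma levi_re (hf : ContDiffAt ℂ 2 f z) (v : E) : levi (fun w => (f w).re) z v = 0 := by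
  have hre : ContDiffAt ℝ 2 (fun w => (f w).re) z :=
    Complex.reCLM.contDiff.contDiffAt.comp z (hf.restrict_scalars ℝ)
  have key : ∀ v, D2 (fun w => (f w).re) z v v = (fderiv ℂ (fderiv ℂ f) z v v).re := by
    intro v
    refine D2_eq_of_line hre (k1 := fun s => (fderiv ℂ f (z + s • v) v).re) ?_ ?_
    · filter_upwards [(tendsto_line z v).eventually hf.eventually_differentiableAt_of_two'] with s hs
      exact Complex.reCLM.hasFDerivAt.comp_hasDerivAt s (hasDerivAt_line_holo hs)
    · exact Complex.reCLM.hasFDerivAt.comp_hasDerivAt (0 : ℝ) (hasDerivAt_fderiv_line_holo hf)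
  rw [levi, key, key]
  simp [← mul_assoc]

lemma hasDerivAt_normSq {k : ℝ → ℂ} {k' : ℂ} {s : ℝ} (h : HasDerivAt k k' s) :
    HasDerivAt (fun s => ‖k s‖ ^ 2) (2 * (k s * (starRingEnd ℂ) k').re) s := by
  have h1 := (Complex.reCLM.hasFDerivAt.comp_hasDerivAt s h)
  have h2 := (Complex.imCLM.hasFDerivAt.comp_hasDerivAt s h)
  have h3 := (h1.pow 2).add (h2.pow 2)
  have e : (fun s => ‖k s‖ ^ 2) = fun s => (k s).re ^ 2 + (k s).im ^ 2 := by
    ext s; rw [← Complex.normSq_eq_norm_sq, Complex.normSq_apply]; ring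
  rw [e]
  refine h3.congr_deriv ?_
  simp; ring

lemma levi_normSq {h h1 : ℝ → ℝ} {h2 : ℝ} (hf : ContDiffAt ℂ 2 f z) (v : E)
    (hU : ContDiffAt ℝ 2 (fun w => h (‖f w‖ ^ 2)) z)
    (hh1 : ∀ᶠ x in 𝓝 (‖f z‖ ^ 2), HasDerivAt h (h1 x) x) (hh2 : HasDerivAt h1 h2 (‖f z‖ ^ 2)) :
    levi (fun w => h (‖f w‖ ^ 2)) z v = 4 * (h1 (‖f z‖ ^ 2) + ‖f z‖ ^ 2 * h2) * ‖fderiv ℂ f z v‖ ^ 2 := by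
  have hcont : ContinuousAt (fun w => ‖f w‖ ^ 2) z := (hf.continuousAt.norm).pow 2
  have key : ∀ v, D2 (fun w => h (‖f w‖ ^ 2)) z v v =
      h2 * (2 * (f z * (starRingEnd ℂ) (fderiv ℂ f z v)).re) ^ 2 +
      h1 (‖f z‖ ^ 2) * (2 * ‖fderiv ℂ f z v‖ ^ 2 + 2 * (f z * (starRingEnd ℂ) (fderiv ℂ (fderiv ℂ f) z v v)).re) := by
    intro v
    refine D2_eq_of_line hU (k1 := fun s => h1 (‖f (z + s • v)‖ ^ 2) *
      (2 * (f (z + s • v) * (starRingEnd ℂ) (fderiv ℂ f (z + s • v) v)).re)) ?_ ?_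
    · filter_upwards [(tendsto_line z v).eventually hf.eventually_differentiableAt_of_two',
        (hcont.tendsto.comp (tendsto_line z v)).eventually hh1] with s hs hs1
      exact HasDerivAt.comp s hs1 (hasDerivAt_normSq (hasDerivAt_line_holo hs))
    · have hd : DifferentiableAt ℂ f (z + (0 : ℝ) • v) := by
        simpa using hf.differentiableAt (by simp)
      have a1 := hasDerivAt_line_holo (s := 0) hd
      have a2 := hasDerivAt_fderiv_line_holo (v := v) hf
      have a3 : HasDerivAt (fun s : ℝ => (starRingEnd ℂ) (fderiv ℂ f (z + s • v) v))
          ((starRingEnd ℂ) (fderiv ℂ (fderiv ℂ f) z v v)) 0 :=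
        (Complex.conjCLE : ℂ →L[ℝ] ℂ).hasFDerivAt.comp_hasDerivAt (0 : ℝ) a2
      have a4 := (Complex.reCLM.hasFDerivAt.comp_hasDerivAt (0 : ℝ) (a1.mul a3)).const_mul (2 : ℝ)
      have a5 : HasDerivAt (fun s : ℝ => h1 (‖f (z + s • v)‖ ^ 2)) _ 0 :=
        HasDerivAt.comp (h₂ := h1) (0 : ℝ) (by simpa using hh2) (hasDerivAt_normSq a1)
      have a6 := a5.mul a4
      refine a6.congr_deriv ?_
      simp only [zero_smul, add_zero, Complex.reCLM_apply, Function.comp_apply, Complex.mul_conj, Complex.add_re, Pi.mul_apply,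
        Complex.ofReal_re, Complex.normSq_eq_norm_sq]
      ring
  have hsq : ∀ a b : ℂ, (a * (starRingEnd ℂ) b).re ^ 2 + (a * (starRingEnd ℂ) (Complex.I * b)).re ^ 2 = ‖a‖ ^ 2 * ‖b‖ ^ 2 := by
    intro a b
    rw [← Complex.normSq_eq_norm_sq, ← Complex.normSq_eq_norm_sq, Complex.normSq_apply, Complex.normSq_apply]
    simp
    ring
  have e1 : fderiv ℂ (fderiv ℂ f) z (Complex.I • v) (Complex.I • v) = - fderiv ℂ (fderiv ℂ f) z v v := by
    simp [← mul_assoc]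
  have e2 : fderiv ℂ f z (Complex.I • v) = Complex.I * fderiv ℂ f z v := by simp
  have e3 := hsq (f z) (fderiv ℂ f z v)
  rw [levi, key, key, e1, e2, map_neg, mul_neg, Complex.neg_re, norm_mul, Complex.norm_I, one_mul]
  linear_combination (4 * h2) * e3

end Hol
end Levi

section SphereCalc
variable {E : Type*} [NormedAddCommGroup E] [InnerProductSpace ℝ E] [FiniteDimensional ℝ E]
  [MeasurableSpace E] [BorelSpace E]

lemma tau_restrict_sphere : (tau E).restrict (sphere 0 1) = tau E := by
  refine Measure.restrict_eq_self_of_ae_mem ?_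
  filter_upwards [tau_ae_norm (E := E)] with z hz
  simpa using hz

lemma ContinuousOn.aestronglyMeasurable_tau {f : E → ℝ} (hf : ContinuousOn f (sphere 0 1)) :
    AEStronglyMeasurable f (tau E) := by
  rw [← tau_restrict_sphere]
  exact hf.aestronglyMeasurable isClosed_sphere.measurableSet

lemma ContinuousOn.integrable_tau {f : E → ℝ} (hf : ContinuousOn f (sphere 0 1)) :
    Integrable f (tau E) := by
  obtain ⟨C, hC⟩ := (isCompact_sphere (0 : E) 1).exists_bound_of_continuousOn hf
  refine Integrable.of_bound hf.aestronglyMeasurable_tau C ?_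
  filter_upwards [tau_ae_norm (E := E)] with z hz
  exact hC z (by simpa using hz)

lemma hasDerivAt_integral_sphere {F F' : ℝ → E → ℝ} {J : Set ℝ} (hJ : IsOpen J)
    (h : ∀ s ∈ J, ∀ ζ, ‖ζ‖ = 1 → HasDerivAt (fun s => F s ζ) (F' s ζ) s)
    (hF : ∀ s ∈ J, ContinuousOn (F s) (sphere 0 1))
    (hF' : ContinuousOn (Function.uncurry F') (J ×ˢ sphere 0 1)) {s0 : ℝ} (hs0 : s0 ∈ J) :
    HasDerivAt (fun s => ∫ ζ, F s ζ ∂(tau E)) (∫ ζ, F' s0 ζ ∂(tau E)) s0 := by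
  obtain ⟨ε, hε, hb⟩ := Metric.nhds_basis_closedBall.mem_iff.1 (hJ.mem_nhds hs0)
  obtain ⟨C, hC⟩ := ((isCompact_closedBall s0 ε).prod (isCompact_sphere (0 : E) 1)).exists_bound_of_continuousOn
    (hF'.mono (prod_mono hb Subset.rfl))
  refine (hasDerivAt_integral_of_dominated_loc_of_deriv_le (bound := fun _ => C) (s := ball s0 ε)
    (ball_mem_nhds s0 hε) ?_ (hF s0 hs0).integrable_tau ?_ ?_ (integrable_const C) ?_).2
  · filter_upwards [hJ.mem_nhds hs0] with s hs using (hF s hs).aestronglyMeasurable_tau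
  · refine ContinuousOn.aestronglyMeasurable_tau ?_
    exact hF'.comp (f := fun ζ => (s0, ζ)) (by fun_prop) fun ζ hζ => ⟨hs0, hζ⟩
  · filter_upwards [tau_ae_norm (E := E)] with ζ hζ s hs
    exact hC (s, ζ) ⟨ball_subset_closedBall hs, by simpa using hζ⟩
  · filter_upwards [tau_ae_norm (E := E)] with ζ hζ s hs
    exact h s (hb (ball_subset_closedBall hs)) ζ hζ

section Rot
variable {B : E →L[ℝ] E}

lemma norm_rot (hB : ∀ x, inner ℝ (B x) x = 0) (hB3 : ∀ x, B (B (B x)) = - B x) (s : ℝ) (x : E) :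
    ‖x + Real.sin s • B x + (1 - Real.cos s) • B (B x)‖ = ‖x‖ := by
  have hskew : ∀ x y, inner ℝ (B x) y = - inner ℝ x (B y) := by
    intro x y
    have := hB (x + y)
    simp only [map_add, inner_add_left, inner_add_right, hB] at this
    rw [real_inner_comm (B y) x] at *
    linarith
  have h1 : inner ℝ x (B x) = 0 := by rw [real_inner_comm]; exact hB x
  have h2 : inner ℝ x (B (B x)) = - inner ℝ (B x) (B x) := by
    have := hskew x (B x); linarith
  have h3 : inner ℝ (B x) (B (B x)) = 0 := by rw [real_inner_comm]; exact hB _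
  have h4 : inner ℝ (B (B x)) (B (B x)) = inner ℝ (B x) (B x) := by
    have := hskew (B x) (B (B x))
    rw [hB3, inner_neg_right] at this; linarith
  have key : ‖x + Real.sin s • B x + (1 - Real.cos s) • B (B x)‖ ^ 2 = ‖x‖ ^ 2 := by
    rw [← real_inner_self_eq_norm_sq, ← real_inner_self_eq_norm_sq]
    simp only [inner_add_left, inner_add_right, inner_smul_left, inner_smul_right, RCLike.conj_to_real,
      real_inner_comm x (B x), real_inner_comm x (B (B x)), real_inner_comm (B x) (B (B x)), h1, h2, h3, h4]
    have := Real.sin_sq_add_cos_sq s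
    linear_combination (inner ℝ (B x) (B x)) * this
  exact (pow_left_inj₀ (norm_nonneg _) (norm_nonneg _) two_ne_zero).1 key

/-- The rotation group generated by a skew operator with `B³ = -B`. -/
def rot (hB : ∀ x, inner ℝ (B x) x = 0) (hB3 : ∀ x, B (B (B x)) = - B x) (s : ℝ) : E ≃ₗᵢ[ℝ] E :=
  LinearIsometry.toLinearIsometryEquiv
    { toLinearMap := LinearMap.id + Real.sin s • (B : E →ₗ[ℝ] E) + (1 - Real.cos s) • ((B : E →ₗ[ℝ] E) ∘ₗ (B : E →ₗ[ℝ] E))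
      norm_map' := fun x => by simpa using norm_rot hB hB3 s x } rfl

lemma rot_apply (hB : ∀ x, inner ℝ (B x) x = 0) (hB3 : ∀ x, B (B (B x)) = - B x) (s : ℝ) (x : E) :
    rot hB hB3 s x = x + Real.sin s • B x + (1 - Real.cos s) • B (B x) := rfl

lemma smul_sphere_mem_ball {R r : ℝ} (hr : |r| < R) {ζ : E} (hζ : ‖ζ‖ = 1) : r • ζ ∈ ball (0 : E) R := by
  simpa [norm_smul, hζ] using hr

lemma integral_fderiv_rot (hB : ∀ x, inner ℝ (B x) x = 0) (hB3 : ∀ x, B (B (B x)) = - B x) {V : E → ℝ} {R r : ℝ}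
    (hV : ContDiffOn ℝ 1 V (ball 0 R)) (hr : |r| < R) :
    ∫ ζ, fderiv ℝ V (r • ζ) (B (r • ζ)) ∂(tau E) = 0 := by
  have hdV : ContinuousOn (fderiv ℝ V) (ball 0 R) := hV.continuousOn_fderiv_of_isOpen isOpen_ball le_rfl
  have hmem : ∀ s ζ, ‖ζ‖ = 1 → rot hB hB3 s (r • ζ) ∈ ball (0 : E) R := by
    intro s ζ hζ
    rw [mem_ball_zero_iff, LinearIsometryEquiv.norm_map, norm_smul, hζ]; simpa using hr
  have hcr : Continuous fun q : ℝ × E => rot hB hB3 q.1 (r • q.2) := by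
    simp only [rot_apply]; fun_prop
  have h1 := hasDerivAt_integral_sphere (E := E) (J := univ) (s0 := 0)
    (F := fun s ζ => V (rot hB hB3 s (r • ζ)))
    (F' := fun s ζ => fderiv ℝ V (rot hB hB3 s (r • ζ)) (Real.cos s • B (r • ζ) + Real.sin s • B (B (r • ζ))))
    isOpen_univ ?_ ?_ ?_ (mem_univ _)
  · have h2 : ∀ s, ∫ ζ, V (rot hB hB3 s (r • ζ)) ∂(tau E) = ∫ ζ, V (r • ζ) ∂(tau E) := by
      intro s
      simp_rw [map_smul]
      exact (tau_isometry (rot hB hB3 s)).integral_comp'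
        (f := (rot hB hB3 s).toMeasurableEquiv) (g := fun ζ => V (r • ζ))
    simp_rw [h2] at h1
    have h3 := h1.unique (hasDerivAt_const _ _)
    simpa [rot_apply] using h3
  · intro s _ ζ hζ
    have hd : DifferentiableAt ℝ V (rot hB hB3 s (r • ζ)) :=
      ((hV.differentiableOn (by simp)) _ (hmem s ζ hζ)).differentiableAt (isOpen_ball.mem_nhds (hmem s ζ hζ))
    have h2 : HasDerivAt (fun s => rot hB hB3 s (r • ζ)) (Real.cos s • B (r • ζ) + Real.sin s • B (B (r • ζ))) s := by
      simp only [rot_apply]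
      have := (((Real.hasDerivAt_sin s).smul_const (B (r • ζ))).const_add (r • ζ)).add
        (((Real.hasDerivAt_cos s).const_sub 1).smul_const (B (B (r • ζ))))
      exact this.congr_deriv (by simp)
    exact hd.hasFDerivAt.comp_hasDerivAt s h2
  · intro s _
    exact hV.continuousOn.comp (by simp only [rot_apply]; fun_prop) fun ζ hζ => hmem s ζ (by simpa using hζ)
  · refine ContinuousOn.clm_apply ?_ (by fun_prop)
    exact hdV.comp hcr.continuousOn fun q hq => hmem q.1 q.2 (by simpa using hq.2)

lemma integral_D2_rot (hB : ∀ x, inner ℝ (B x) x = 0) (hB3 : ∀ x, B (B (B x)) = - B x) {U : E → ℝ} {R r : ℝ}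
    (hU : ContDiffOn ℝ 2 U (ball 0 R)) (hr : |r| < R) :
    ∫ ζ, (D2 U (r • ζ) (B (r • ζ)) (B (r • ζ)) + fderiv ℝ U (r • ζ) (B (B (r • ζ)))) ∂(tau E) = 0 := by
  have h1 : ContDiffOn ℝ 1 (fderiv ℝ U) (ball 0 R) := hU.fderiv_of_isOpen isOpen_ball (by norm_num)
  have h2 : ContDiffOn ℝ 1 (fun z => fderiv ℝ U z (B z)) (ball 0 R) := h1.clm_apply B.contDiff.contDiffOn
  rw [← integral_fderiv_rot hB hB3 h2 hr]
  refine integral_congr_ae ?_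
  filter_upwards [tau_ae_norm (E := E)] with ζ hζ
  have hm := smul_sphere_mem_ball hr hζ
  have hd : DifferentiableAt ℝ (fderiv ℝ U) (r • ζ) :=
    (h1.differentiableOn (by simp) _ hm).differentiableAt (isOpen_ball.mem_nhds hm)
  have := hd.hasFDerivAt.clm_apply B.hasFDerivAt
  rw [this.fderiv]
  simp [D2]
  ring

end Rot

/-- The integral of `U` over the sphere of radius `r`. -/
def Mm (U : E → ℝ) (r : ℝ) : ℝ := ∫ ζ, U (r • ζ) ∂(tau E)

/-- The integral of the radial derivative of `U` over the sphere of radius `r`. -/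
def pp (U : E → ℝ) (r : ℝ) : ℝ := ∫ ζ, fderiv ℝ U (r • ζ) (r • ζ) ∂(tau E)

lemma hasDerivAt_integral_dilate {V : E → ℝ} {R r : ℝ} (hV : ContDiffOn ℝ 1 V (ball 0 R)) (hr : |r| < R) :
    HasDerivAt (fun r => ∫ ζ, V (r • ζ) ∂(tau E)) (∫ ζ, fderiv ℝ V (r • ζ) ζ ∂(tau E)) r := by
  have hdV : ContinuousOn (fderiv ℝ V) (ball 0 R) := hV.continuousOn_fderiv_of_isOpen isOpen_ball le_rfl
  refine hasDerivAt_integral_sphere (J := {s | |s| < R}) (F := fun s ζ => V (s • ζ)) (F' := fun s ζ => fderiv ℝ V (s • ζ) ζ)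
    (isOpen_lt continuous_abs continuous_const) ?_ ?_ ?_ hr
  · intro s hs ζ hζ
    have hm := smul_sphere_mem_ball hs hζ
    have hd : DifferentiableAt ℝ V (s • ζ) :=
      ((hV.differentiableOn (by simp)) _ hm).differentiableAt (isOpen_ball.mem_nhds hm)
    exact hd.hasFDerivAt.comp_hasDerivAt s (by simpa using (hasDerivAt_id s).smul_const ζ)
  · intro s hs
    exact hV.continuousOn.comp (by fun_prop) fun ζ hζ => smul_sphere_mem_ball hs (by simpa using hζ)
  · refine ContinuousOn.clm_apply ?_ (by fun_prop)
    exact hdV.comp (f := fun q : ℝ × E => q.1 • q.2) (by fun_prop) fun q hq => smul_sphere_mem_ball hq.1 (by simpa using hq.2)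

lemma hasDerivAt_Mm {U : E → ℝ} {R r : ℝ} (hU : ContDiffOn ℝ 1 U (ball 0 R)) (hr : |r| < R) (hr0 : r ≠ 0) :
    HasDerivAt (Mm U) (pp U r / r) r := by
  have := hasDerivAt_integral_dilate hU hr
  refine this.congr_deriv ?_
  rw [pp]
  simp_rw [map_smul, smul_eq_mul]
  rw [integral_const_mul]
  field_simp

lemma continuousOn_Mm {U : E → ℝ} {R : ℝ} (hU : ContDiffOn ℝ 1 U (ball 0 R)) :
    ContinuousOn (Mm U) (Ioo (-R) R) :=
  fun r hr => (hasDerivAt_integral_dilate hU (abs_lt.2 hr)).continuousAt.continuousWithinAt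

lemma contDiffOn_fderiv_self {U : E → ℝ} {R : ℝ} (hU : ContDiffOn ℝ 2 U (ball 0 R)) :
    ContDiffOn ℝ 1 (fun z => fderiv ℝ U z z) (ball 0 R) :=
  (hU.fderiv_of_isOpen isOpen_ball (by norm_num)).clm_apply contDiffOn_id

lemma continuousOn_pp {U : E → ℝ} {R : ℝ} (hU : ContDiffOn ℝ 2 U (ball 0 R)) :
    ContinuousOn (pp U) (Ioo (-R) R) := continuousOn_Mm (contDiffOn_fderiv_self hU)

lemma continuousOn_D2 {U : E → ℝ} {R : ℝ} (hU : ContDiffOn ℝ 2 U (ball 0 R)) {v w : E → E}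
    (hv : ContinuousOn v (ball 0 R)) (hw : ContinuousOn w (ball 0 R)) :
    ContinuousOn (fun z => D2 U z (v z) (w z)) (ball 0 R) := by
  have h1 : ContDiffOn ℝ 1 (fderiv ℝ U) (ball 0 R) := hU.fderiv_of_isOpen isOpen_ball (by norm_num)
  exact ((h1.continuousOn_fderiv_of_isOpen isOpen_ball le_rfl).clm_apply hv).clm_apply hw

lemma continuousOn_fderiv_two {U : E → ℝ} {R : ℝ} (hU : ContDiffOn ℝ 2 U (ball 0 R)) {v : E → E}
    (hv : ContinuousOn v (ball 0 R)) :
    ContinuousOn (fun z => fderiv ℝ U z (v z)) (ball 0 R) :=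
  (hU.continuousOn_fderiv_of_isOpen isOpen_ball (by norm_num)).clm_apply hv

lemma ContinuousOn.comp_dilate {V : E → ℝ} {R r : ℝ} (hV : ContinuousOn V (ball 0 R)) (hr : |r| < R) :
    ContinuousOn (fun ζ => V (r • ζ)) (sphere 0 1) :=
  hV.comp (by fun_prop) fun ζ hζ => smul_sphere_mem_ball hr (by simpa using hζ)

end SphereCalc

section Cplx
variable {E : Type*} [NormedAddCommGroup E] [InnerProductSpace ℝ E] [FiniteDimensional ℝ E]
  [MeasurableSpace E] [BorelSpace E] [InnerProductSpace ℂ E] [IsScalarTower ℝ ℂ E]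

/-- Multiplication by `i` as a real operator. -/
def mulI : E →L[ℝ] E := (Complex.I • ContinuousLinearMap.id ℂ E).restrictScalars ℝ

lemma mulI_apply (x : E) : mulI x = Complex.I • x := rfl

lemma real_inner_self_I_smul (x : E) : inner ℝ (Complex.I • x) x = 0 := by
  rw [real_inner_eq_norm_add_mul_self_sub_norm_mul_self_sub_norm_mul_self_div_two]
  have h1 : ‖Complex.I • x + x‖ = ‖(Complex.I + 1 : ℂ)‖ * ‖x‖ := by rw [← norm_smul, add_smul, one_smul]
  have h2 : ‖(Complex.I + 1 : ℂ)‖ ^ 2 = 2 := by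
    rw [← Complex.normSq_eq_norm_sq, Complex.normSq_apply]; norm_num
  rw [h1, norm_smul, Complex.norm_I]
  linear_combination (‖x‖ ^ 2 / 2) * h2

lemma integral_levi_self {U : E → ℝ} {R r : ℝ} (hU : ContDiffOn ℝ 2 U (ball 0 R)) (hr : |r| < R) :
    ∫ ζ, levi U (r • ζ) (r • ζ) ∂(tau E) =
      ∫ ζ, (D2 U (r • ζ) (r • ζ) (r • ζ) + fderiv ℝ U (r • ζ) (r • ζ)) ∂(tau E) := by
  have h := integral_D2_rot (E := E) (B := mulI) (fun x => real_inner_self_I_smul x)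
    (fun x => by simp only [mulI_apply, smul_smul]; simp [← mul_assoc]) hU hr
  have c1 := (continuousOn_D2 hU (v := fun z => z) (w := fun z => z) (by fun_prop) (by fun_prop)).comp_dilate hr
  have c2 := (continuousOn_fderiv_two hU (v := fun z => z) (by fun_prop)).comp_dilate hr
  have c3 := (continuousOn_D2 hU (v := fun z => mulI z) (w := fun z => mulI z) (by fun_prop) (by fun_prop)).comp_dilate hr
  have e : ∀ ζ : E, levi U (r • ζ) (r • ζ) = (D2 U (r • ζ) (r • ζ) (r • ζ) + fderiv ℝ U (r • ζ) (r • ζ)) +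
      (D2 U (r • ζ) (mulI (r • ζ)) (mulI (r • ζ)) + fderiv ℝ U (r • ζ) (mulI (mulI (r • ζ)))) := by
    intro ζ
    have : mulI (mulI (r • ζ)) = - (r • ζ) := by simp only [mulI_apply, smul_smul]; simp [← mul_assoc]
    rw [this, map_neg, levi, mulI_apply]; ring
  have c4 : ContinuousOn (fun ζ : E => fderiv ℝ U (r • ζ) (mulI (mulI (r • ζ)))) (sphere 0 1) :=
    (continuousOn_fderiv_two hU (v := fun z => mulI (mulI z)) (by fun_prop)).comp_dilate hr
  simp_rw [e]
  rw [integral_add, h, add_zero]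
  · exact (c1.add c2).integrable_tau
  · exact (c3.add c4).integrable_tau

lemma hasDerivAt_pp {U : E → ℝ} {R r : ℝ} (hU : ContDiffOn ℝ 2 U (ball 0 R)) (hr : |r| < R) (hr0 : r ≠ 0) :
    HasDerivAt (pp U) ((∫ ζ, levi U (r • ζ) (r • ζ) ∂(tau E)) / r) r := by
  have h1 := hasDerivAt_Mm (contDiffOn_fderiv_self hU) hr hr0
  refine h1.congr_deriv ?_
  rw [integral_levi_self hU hr, pp]
  congr 1
  refine integral_congr_ae ?_
  filter_upwards [tau_ae_norm (E := E)] with ζ hζ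
  have hm := smul_sphere_mem_ball hr hζ
  have hd : DifferentiableAt ℝ (fderiv ℝ U) (r • ζ) :=
    ((hU.fderiv_of_isOpen isOpen_ball (m := 1) (by norm_num)).differentiableOn (by simp) _ hm).differentiableAt
      (isOpen_ball.mem_nhds hm)
  have := hd.hasFDerivAt.clm_apply (hasFDerivAt_id (r • ζ))
  simp only [id_eq] at this
  rw [this.fderiv]
  simp [D2]
  ring

end Cplx

section Tangential
variable {n : ℕ}

/-- Complex tangential vector fields of the sphere, as conjugate linear operators. -/
def tang (c : ℂ) (j k : Fin n) : En n →L[ℝ] En n :=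
  LinearMap.toContinuousLinearMap
    { toFun := fun z => c • (EuclideanSpace.single j ((starRingEnd ℂ) (z k)) -
        EuclideanSpace.single k ((starRingEnd ℂ) (z j)))
      map_add' := fun x y => by
        ext i; simp [Pi.single_apply]; split_ifs <;> ring
      map_smul' := fun a x => by
        ext i; simp [Pi.single_apply]; split_ifs <;> ring }

lemma tang_apply (c : ℂ) (j k : Fin n) (z : En n) : tang c j k z =
    c • (EuclideanSpace.single j ((starRingEnd ℂ) (z k)) - EuclideanSpace.single k ((starRingEnd ℂ) (z j))) := rfl

lemma tang_apply_apply (c : ℂ) (j k : Fin n) (z : En n) (i : Fin n) : tang c j k z i =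
    c * ((if i = j then (starRingEnd ℂ) (z k) else 0) - (if i = k then (starRingEnd ℂ) (z j) else 0)) := by
  simp [tang_apply, Pi.single_apply]

lemma tang_I (j k : Fin n) (z : En n) : tang Complex.I j k z = Complex.I • tang 1 j k z := by
  simp [tang_apply]

lemma tang_smul (c : ℂ) (j k : Fin n) (z : En n) : tang c j k z = c • tang 1 j k z := by
  simp [tang_apply]

lemma tang_one_smul (c : ℂ) (j k : Fin n) (z : En n) :
    tang 1 j k (c • z) = (starRingEnd ℂ) c • tang 1 j k z := by
  ext i
  simp only [tang_apply_apply, PiLp.smul_apply, smul_eq_mul, map_mul]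
  split_ifs <;> ring

lemma tang_sq {c : ℂ} (hc : c * (starRingEnd ℂ) c = 1) (j k : Fin n) (z : En n) :
    tang c j k (tang c j k z) = tang 1 j k (tang 1 j k z) := by
  rw [tang_smul c, tang_smul c j k z, tang_one_smul, smul_smul, hc, one_smul]

lemma tang_cube_one (j k : Fin n) (z : En n) :
    tang 1 j k (tang 1 j k (tang 1 j k z)) = - tang 1 j k z := by
  ext i
  simp only [tang_apply_apply, PiLp.neg_apply]
  by_cases hjk : j = k
  · subst hjk; simp
  · by_cases h1 : i = j
    · subst h1; simp [hjk, Ne.symm hjk]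
    · by_cases h2 : i = k
      · subst h2; simp [hjk, h1]
      · simp [h1, h2]

lemma tang_cube {c : ℂ} (hc : c * (starRingEnd ℂ) c = 1) (j k : Fin n) (z : En n) :
    tang c j k (tang c j k (tang c j k z)) = - tang c j k z := by
  rw [tang_sq hc, tang_smul c j k z, tang_one_smul, tang_one_smul, tang_cube_one]
  simp

lemma inner_tang (c : ℂ) (j k : Fin n) (z : En n) : inner ℝ (tang c j k z) z = 0 := by
  have h : inner ℂ (tang c j k z) z = 0 := by
    rw [tang_apply, inner_smul_left, inner_sub_left]
    simp [EuclideanSpace.inner_single_left]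
    right; ring
  have h2 : inner ℝ (tang c j k z) z = (inner ℂ (tang c j k z) z : ℂ).re := by
    simp [PiLp.inner_apply, Complex.inner]
  rw [h2, h]; rfl

lemma sum_tang_sq (z : En n) :
    ∑ j, ∑ k, tang 1 j k (tang 1 j k z) = (-(2 * ((n : ℝ) - 1))) • z := by
  ext i
  simp only [WithLp.ofLp_sum, Finset.sum_apply, PiLp.smul_apply]
  have h : ∀ j k, (tang 1 j k (tang 1 j k z)) i
      = ((if i = j then (if k = j then z k else 0) - z j else 0) +
        (if i = k then (if j = k then z j else 0) - z k else 0)) := by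
    intro j k
    simp only [tang_apply_apply]
    by_cases hjk : j = k
    · subst hjk; simp
    · by_cases h1 : i = j
      · subst h1; simp [hjk, Ne.symm hjk]
      · by_cases h2 : i = k
        · subst h2; simp [hjk, h1]
        · simp [h1, h2]
  simp only [h, Finset.sum_add_distrib]
  rw [Finset.sum_comm]
  simp [Finset.sum_sub_distrib]
  ring

lemma clm_eq_sum (l : En n →L[ℂ] ℂ) (z : En n) : l z = ∑ j, z j * l (EuclideanSpace.single j 1) := by
  conv_lhs => rw [← (EuclideanSpace.basisFun (Fin n) ℂ).sum_repr z]
  simp [map_sum]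

lemma norm_sq_clm (l : En n →L[ℂ] ℂ) : ‖l‖ ^ 2 = ∑ j, ‖l (EuclideanSpace.single j 1)‖ ^ 2 := by
  obtain ⟨w, rfl⟩ := (InnerProductSpace.toDual ℂ (En n)).surjective l
  rw [LinearIsometryEquiv.norm_map, EuclideanSpace.norm_sq_eq]
  simp [InnerProductSpace.toDual_apply_apply, EuclideanSpace.inner_single_right]

lemma sum_norm_tang (l : En n →L[ℂ] ℂ) (z : En n) :
    ∑ j, ∑ k, ‖l (tang 1 j k z)‖ ^ 2 = 2 * (‖z‖ ^ 2 * ‖l‖ ^ 2 - ‖l z‖ ^ 2) := by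
  set L : Fin n → ℂ := fun j => l (EuclideanSpace.single j 1) with hL
  have h1 : ∀ j k, l (tang 1 j k z) = (starRingEnd ℂ) (z k) * L j - (starRingEnd ℂ) (z j) * L k := by
    intro j k
    rw [tang_apply, one_smul, map_sub]
    have : ∀ (m : Fin n) (a : ℂ), EuclideanSpace.single m a = a • (EuclideanSpace.single m (1 : ℂ) : En n) := by
      intro m a; ext i; simp [Pi.single_apply]
    rw [this j, this k, map_smul, map_smul, smul_eq_mul, smul_eq_mul]
  rw [norm_sq_clm, EuclideanSpace.norm_sq_eq, clm_eq_sum]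
  simp only [h1]
  apply Complex.ofReal_injective
  push_cast
  simp only [← Complex.conj_mul', map_sub, map_mul, map_sum, Complex.conj_conj]
  change _ = 2 * ((∑ x, _) * (∑ x, (starRingEnd ℂ) (L x) * L x) - (∑ x, _ * (starRingEnd ℂ) (L x)) * ∑ x, _ * L x)
  rw [Finset.sum_mul_sum, Finset.sum_mul_sum]
  have e : ∀ j k, (z k * (starRingEnd ℂ) (L j) - z j * (starRingEnd ℂ) (L k)) *
      ((starRingEnd ℂ) (z k) * L j - (starRingEnd ℂ) (z j) * L k)
      = ((starRingEnd ℂ) (z k) * z k * ((starRingEnd ℂ) (L j) * L j)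
        - (starRingEnd ℂ) (z k) * (starRingEnd ℂ) (L k) * (z j * L j))
        + ((starRingEnd ℂ) (z j) * z j * ((starRingEnd ℂ) (L k) * L k)
        - (starRingEnd ℂ) (z j) * (starRingEnd ℂ) (L j) * (z k * L k)) := by
    intro j k; ring
  simp only [e]
  simp only [Finset.sum_add_distrib, Finset.sum_sub_distrib]
  rw [Finset.sum_comm (f := fun j k => (starRingEnd ℂ) (z k) * z k * ((starRingEnd ℂ) (L j) * L j)),
    Finset.sum_comm (f := fun j k => (starRingEnd ℂ) (z k) * (starRingEnd ℂ) (L k) * (z j * L j))]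
  ring

end Tangential

section Tang2
variable {n : ℕ}

lemma integral_levi_tang {U : En n → ℝ} {R r : ℝ} (hU : ContDiffOn ℝ 2 U (ball 0 R)) (hr : |r| < R) :
    ∫ ζ, ∑ j, ∑ k, levi U (r • ζ) (tang 1 j k (r • ζ)) ∂(tau (En n)) = 4 * ((n : ℝ) - 1) * pp U r := by
  have hc1 : (1 : ℂ) * (starRingEnd ℂ) 1 = 1 := by simp
  have hcI : Complex.I * (starRingEnd ℂ) Complex.I = 1 := by simp
  have hD : ∀ c j k, ContinuousOn (fun ζ : En n => D2 U (r • ζ) (tang c j k (r • ζ)) (tang c j k (r • ζ))) (sphere 0 1) :=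
    fun c j k => (continuousOn_D2 hU (v := fun z => tang c j k z) (w := fun z => tang c j k z)
      (by fun_prop) (by fun_prop)).comp_dilate hr
  have hF : ∀ c j k, ContinuousOn (fun ζ : En n => fderiv ℝ U (r • ζ) (tang c j k (tang c j k (r • ζ)))) (sphere 0 1) :=
    fun c j k => (continuousOn_fderiv_two hU (v := fun z => tang c j k (tang c j k z)) (by fun_prop)).comp_dilate hr
  have key : ∀ j k, ∫ ζ, (levi U (r • ζ) (tang 1 j k (r • ζ)) +
      2 * fderiv ℝ U (r • ζ) (tang 1 j k (tang 1 j k (r • ζ)))) ∂(tau (En n)) = 0 := by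
    intro j k
    have a1 := integral_D2_rot (B := tang 1 j k) (inner_tang 1 j k) (tang_cube hc1 j k) hU hr
    have a2 := integral_D2_rot (B := tang Complex.I j k) (inner_tang _ j k) (tang_cube hcI j k) hU hr
    have := integral_add ((hD 1 j k).add (hF 1 j k)).integrable_tau
      ((hD Complex.I j k).add (hF Complex.I j k)).integrable_tau
    simp only [Pi.add_apply] at this
    rw [a1, a2, add_zero] at this
    rw [← this]
    refine integral_congr_ae (Eventually.of_forall fun ζ => ?_)
    simp only [levi, tang_sq hcI, ← tang_I]
    ring
  have hL : ∀ j k, ContinuousOn (fun ζ : En n => levi U (r • ζ) (tang 1 j k (r • ζ))) (sphere 0 1) := by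
    intro j k
    have := (hD 1 j k).add (hD Complex.I j k)
    refine this.congr fun ζ _ => ?_
    simp only [levi, tang_I, Pi.add_apply]
  have s1 : ∫ ζ, ∑ j, ∑ k, (levi U (r • ζ) (tang 1 j k (r • ζ)) +
      2 * fderiv ℝ U (r • ζ) (tang 1 j k (tang 1 j k (r • ζ)))) ∂(tau (En n)) = 0 := by
    have hi : ∀ j k, Integrable (fun ζ => levi U (r • ζ) (tang 1 j k (r • ζ)) +
      2 * fderiv ℝ U (r • ζ) (tang 1 j k (tang 1 j k (r • ζ)))) (tau (En n)) := fun j k =>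
      ((hL j k).add (continuousOn_const.mul (hF 1 j k))).integrable_tau
    rw [integral_finsetSum _ fun j _ => integrable_finsetSum _ fun k _ => hi j k]
    refine Finset.sum_eq_zero fun j _ => ?_
    rw [integral_finsetSum _ fun k _ => hi j k]
    exact Finset.sum_eq_zero fun k _ => key j k
  have hf : ContinuousOn (fun ζ : En n => fderiv ℝ U (r • ζ) (r • ζ)) (sphere 0 1) :=
    (continuousOn_fderiv_two hU (v := fun z => z) (by fun_prop)).comp_dilate hr
  have e : ∀ ζ : En n, ∑ j, ∑ k, (levi U (r • ζ) (tang 1 j k (r • ζ)) +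
      2 * fderiv ℝ U (r • ζ) (tang 1 j k (tang 1 j k (r • ζ)))) =
      (∑ j, ∑ k, levi U (r • ζ) (tang 1 j k (r • ζ))) - 4 * ((n : ℝ) - 1) * fderiv ℝ U (r • ζ) (r • ζ) := by
    intro ζ
    simp only [Finset.sum_add_distrib, ← Finset.mul_sum, ← map_sum, sum_tang_sq, map_smul, smul_eq_mul]
    ring
  simp_rw [e] at s1
  have hs : ContinuousOn (fun ζ : En n => ∑ j, ∑ k, levi U (r • ζ) (tang 1 j k (r • ζ))) (sphere 0 1) :=
    continuousOn_finsetSum _ fun j _ => continuousOn_finsetSum _ fun k _ => hL j k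
  rw [integral_sub hs.integrable_tau (hf.integrable_tau.const_mul _), integral_const_mul] at s1
  rw [pp]; linarith

end Tang2

/-- The smooth approximation of `|g|^(2q)`. -/
def Ue {E : Type*} (g : E → ℂ) (ε q : ℝ) (z : E) : ℝ := (‖g z‖ ^ 2 + ε) ^ q

/-- A quarter of the coefficient of `|Dg|^2` in the Levi form of `Ue g ε q`. -/
def cUe (ε q x : ℝ) : ℝ := q * (x + ε) ^ (q - 2) * (q * x + ε)

lemma cUe_nonneg {ε q x : ℝ} (hε : 0 < ε) (hq : 0 < q) (hx : 0 ≤ x) : 0 ≤ cUe ε q x := by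
  unfold cUe; positivity

lemma le_cUe {ε q x : ℝ} (hε : 0 < ε) (hq : 0 < q) (hx : 0 ≤ x) :
    q * min q 1 * (x + ε) ^ (q - 1) ≤ cUe ε q x := by
  unfold cUe
  have h : (x + ε) ^ (q - 1) = (x + ε) ^ (q - 2) * (x + ε) := by
    rw [← Real.rpow_add_one (by positivity)]; congr 1; ring
  have h2 : min q 1 * (x + ε) ≤ q * x + ε := by
    nlinarith [min_le_left q 1, min_le_right q 1]
  have : 0 ≤ q * (x + ε) ^ (q - 2) := by positivity
  rw [h]
  nlinarith [mul_le_mul_of_nonneg_left h2 this]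

section UeSec
variable {E : Type*} [NormedAddCommGroup E] [NormedSpace ℂ E] [NormedSpace ℝ E] [IsScalarTower ℝ ℂ E]
  [FiniteDimensional ℂ E] {g : E → ℂ} {R : ℝ}

lemma contDiffOn_Ue {s : Set E} (hs : IsOpen s) (hg : DifferentiableOn ℂ g s) {ε q : ℝ} (hε : 0 < ε) :
    ContDiffOn ℝ 2 (Ue g ε q) s := by
  have h := (contDiffOn_two_of_isOpen hs hg).restrict_scalars ℝ
  have : ContDiffOn ℝ 2 (fun z => ‖g z‖ ^ 2 + ε) s := (h.norm_sq ℝ).add contDiffOn_const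
  exact this.rpow_const_of_ne fun z _ => by positivity

lemma levi_Ue {s : Set E} (hs : IsOpen s) (hg : DifferentiableOn ℂ g s) {ε q : ℝ} (hε : 0 < ε) {z : E} (hz : z ∈ s) (v : E) :
    levi (Ue g ε q) z v = 4 * cUe ε q (‖g z‖ ^ 2) * ‖fderiv ℂ g z v‖ ^ 2 := by
  have h0 : 0 ≤ ‖g z‖ ^ 2 := by positivity
  have hpos : ∀ᶠ x in 𝓝 (‖g z‖ ^ 2), 0 < x + ε := by
    have : Tendsto (fun x : ℝ => x + ε) (𝓝 (‖g z‖ ^ 2)) (𝓝 (‖g z‖ ^ 2 + ε)) := by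
      exact tendsto_id.add_const ε
    exact this.eventually (lt_mem_nhds (by positivity))
  have hd : ∀ (b x : ℝ), 0 < x + ε → HasDerivAt (fun x => (x + ε) ^ b) (b * (x + ε) ^ (b - 1)) x := by
    intro b x hx
    have := ((hasDerivAt_id x).add_const ε).rpow_const (p := b) (Or.inl (by simpa using hx.ne'))
    exact this.congr_deriv (by simp)
  have := levi_normSq (h := fun x => (x + ε) ^ q) (h1 := fun x => q * (x + ε) ^ (q - 1))
    (h2 := q * ((q - 1) * (‖g z‖ ^ 2 + ε) ^ (q - 1 - 1)))
    ((contDiffOn_two_of_isOpen hs hg).contDiffAt (hs.mem_nhds hz)) v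
    ((contDiffOn_Ue hs hg hε (q := q)).contDiffAt (hs.mem_nhds hz))
    (hpos.mono fun x hx => hd q x hx) ((hd (q - 1) _ (by positivity)).const_mul q)
  change levi (fun w => (‖g w‖ ^ 2 + ε) ^ q) z v = _
  rw [this]
  congr 1
  have h : (‖g z‖ ^ 2 + ε) ^ (q - 1) = (‖g z‖ ^ 2 + ε) ^ (q - 2) * (‖g z‖ ^ 2 + ε) := by
    rw [← Real.rpow_add_one (by positivity)]; congr 1; ring
  have h' : q - 1 - 1 = q - 2 := by ring
  rw [cUe, h', h]
  ring

end UeSec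

section Mono
variable {E : Type*} [NormedAddCommGroup E] [InnerProductSpace ℝ E] [FiniteDimensional ℝ E]
  [MeasurableSpace E] [BorelSpace E] [InnerProductSpace ℂ E] [IsScalarTower ℝ ℂ E]
  {U : E → ℝ} {R : ℝ} {g : E → ℂ}

lemma pp_zero : pp U 0 = 0 := by simp [pp]

lemma pp_nonneg (hU : ContDiffOn ℝ 2 U (ball 0 R)) (hl : ∀ z ∈ ball (0 : E) R, 0 ≤ levi U z z) {r : ℝ}
    (h0 : 0 ≤ r) (hr : r < R) : 0 ≤ pp U r := by
  have hm : MonotoneOn (pp U) (Ico 0 R) := by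
    refine monotoneOn_of_deriv_nonneg (convex_Ico 0 R)
      ((continuousOn_pp hU).mono fun x hx => ⟨by linarith [hx.1, hx.2], hx.2⟩) ?_ ?_
    · rw [interior_Ico]
      exact fun x hx => (hasDerivAt_pp hU (by rw [abs_of_pos hx.1]; exact hx.2) hx.1.ne').differentiableAt.differentiableWithinAt
    · rw [interior_Ico]
      intro x hx
      have hx' : |x| < R := by rw [abs_of_pos hx.1]; exact hx.2
      rw [(hasDerivAt_pp hU hx' hx.1.ne').deriv]
      refine div_nonneg (integral_nonneg_of_ae ?_) hx.1.le
      filter_upwards [tau_ae_norm (E := E)] with ζ hζ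
      exact hl _ (smul_sphere_mem_ball hx' hζ)
  have := hm (a := 0) ⟨le_rfl, h0.trans_lt hr⟩ ⟨h0, hr⟩ h0
  rwa [pp_zero] at this

lemma monotoneOn_Mm (hU : ContDiffOn ℝ 2 U (ball 0 R)) (hl : ∀ z ∈ ball (0 : E) R, 0 ≤ levi U z z) :
    MonotoneOn (Mm U) (Ico 0 R) := by
  have hU1 : ContDiffOn ℝ 1 U (ball 0 R) := hU.of_le (by norm_num)
  refine monotoneOn_of_deriv_nonneg (convex_Ico 0 R)
      ((continuousOn_Mm hU1).mono fun x hx => ⟨by linarith [hx.1, hx.2], hx.2⟩) ?_ ?_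
  · rw [interior_Ico]
    exact fun x hx => (hasDerivAt_Mm hU1 (by rw [abs_of_pos hx.1]; exact hx.2) hx.1.ne').differentiableAt.differentiableWithinAt
  · rw [interior_Ico]
    intro x hx
    rw [(hasDerivAt_Mm hU1 (by rw [abs_of_pos hx.1]; exact hx.2) hx.1.ne').deriv]
    exact div_nonneg (pp_nonneg hU hl hx.1.le hx.2) hx.1.le

lemma Ue_nonneg {ε q : ℝ} (hε : 0 < ε) (z : E) : 0 ≤ Ue g ε q z := by unfold Ue; positivity

lemma levi_Ue_nonneg [FiniteDimensional ℂ E] (hg : DifferentiableOn ℂ g (ball 0 R)) {ε q : ℝ} (hε : 0 < ε) (hq : 0 < q) :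
    ∀ z ∈ ball (0 : E) R, 0 ≤ levi (Ue g ε q) z z := by
  intro z hz
  rw [levi_Ue isOpen_ball hg hε hz]
  have := cUe_nonneg hε hq (x := ‖g z‖ ^ 2) (by positivity)
  positivity

lemma ofReal_Mm_Ue [FiniteDimensional ℂ E] (hg : DifferentiableOn ℂ g (ball 0 R)) {ε q r : ℝ} (hε : 0 < ε) (hr : |r| < R) :
    ENNReal.ofReal (Mm (Ue g ε q) r) = ∫⁻ ζ, ENNReal.ofReal (Ue g ε q (r • ζ)) ∂(tau E) := by
  rw [Mm, ofReal_integral_eq_lintegral_ofReal]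
  · exact ((contDiffOn_Ue isOpen_ball hg hε).continuousOn.comp_dilate hr).integrable_tau
  · exact Eventually.of_forall fun ζ => Ue_nonneg hε _

lemma tendsto_ofReal_rpow (w : ℂ) (b : ℝ) :
    Tendsto (fun k : ℕ => ENNReal.ofReal ((‖w‖ ^ 2 + 1 / ((k : ℝ) + 1)) ^ b)) atTop (𝓝 (‖w‖ₑ ^ (2 * b))) := by
  have h1 : Tendsto (fun k : ℕ => ENNReal.ofReal (‖w‖ ^ 2 + 1 / ((k : ℝ) + 1))) atTop (𝓝 (ENNReal.ofReal (‖w‖ ^ 2))) := by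
    have := (tendsto_const_nhds (x := ‖w‖ ^ 2)).add (tendsto_one_div_add_atTop_nhds_zero_nat (𝕜 := ℝ))
    rw [add_zero] at this
    exact (ENNReal.continuous_ofReal.tendsto _).comp this
  have h2 := (ENNReal.continuous_rpow_const (y := b)).continuousAt.tendsto.comp h1
  have h3 : ENNReal.ofReal (‖w‖ ^ 2) ^ b = ‖w‖ₑ ^ (2 * b) := by
    rw [ENNReal.rpow_mul, ENNReal.ofReal_pow (norm_nonneg _), ofReal_norm]
    norm_num
  rw [h3] at h2
  refine h2.congr fun k => ?_
  simp only [Function.comp]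
  rw [ENNReal.ofReal_rpow_of_pos (by positivity)]

lemma tendsto_lintegral_Ue [FiniteDimensional ℂ E] (hg : DifferentiableOn ℂ g (ball 0 R)) {q r : ℝ} (hq : 0 < q) (hr : |r| < R) :
    Tendsto (fun k : ℕ => ENNReal.ofReal (Mm (Ue g (1 / ((k : ℝ) + 1)) q) r)) atTop
      (𝓝 (∫⁻ ζ, ‖g (r • ζ)‖ₑ ^ (2 * q) ∂(tau E))) := by
  have hk : ∀ k : ℕ, (0 : ℝ) < 1 / ((k : ℝ) + 1) := fun k => by positivity
  simp_rw [ofReal_Mm_Ue hg (hk _) hr]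
  have hgc : ContinuousOn (fun ζ : E => g (r • ζ)) (sphere 0 1) :=
    hg.continuousOn.comp (by fun_prop) fun ζ hζ => smul_sphere_mem_ball hr (by simpa using hζ)
  obtain ⟨C, hC⟩ := (isCompact_sphere (0 : E) 1).exists_bound_of_continuousOn hgc
  refine tendsto_lintegral_of_dominated_convergence' (fun _ => ENNReal.ofReal ((C ^ 2 + 1) ^ q)) ?_ ?_ ?_ ?_
  · intro k
    exact (((contDiffOn_Ue isOpen_ball hg (hk k)).continuousOn.comp_dilate hr).aestronglyMeasurable_tau).aemeasurable.ennreal_ofReal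
  · intro k
    filter_upwards [tau_ae_norm (E := E)] with ζ hζ
    have := hC ζ (by simpa using hζ)
    have h1 : 1 / ((k : ℝ) + 1) ≤ 1 := by
      rw [div_le_one (by positivity)]; linarith [(k.cast_nonneg : (0 : ℝ) ≤ k)]
    refine ENNReal.ofReal_le_ofReal (Real.rpow_le_rpow (by have := hk k; positivity) ?_ hq.le)
    gcongr
  · rw [lintegral_const]
    exact ENNReal.mul_ne_top ENNReal.ofReal_ne_top (measure_ne_top _ _)
  · exact Eventually.of_forall fun ζ => tendsto_ofReal_rpow _ _

/-- Integral means of a holomorphic function increase. -/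
lemma lintegral_mono_dilate [FiniteDimensional ℂ E] (hg : DifferentiableOn ℂ g (ball 0 R)) {s r r' : ℝ} (hs : 0 < s) (h0 : 0 ≤ r)
    (hrr : r ≤ r') (hr : r' < R) :
    ∫⁻ ζ, ‖g (r • ζ)‖ₑ ^ s ∂(tau E) ≤ ∫⁻ ζ, ‖g (r' • ζ)‖ₑ ^ s ∂(tau E) := by
  have hk : ∀ k : ℕ, (0 : ℝ) < 1 / ((k : ℝ) + 1) := fun k => by positivity
  have t1 := tendsto_lintegral_Ue hg (q := s / 2) (by positivity) (r := r) (by rw [abs_of_nonneg h0]; linarith)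
  have t2 := tendsto_lintegral_Ue hg (q := s / 2) (by positivity) (r := r') (by rw [abs_of_nonneg (by linarith)]; linarith)
  rw [mul_div_cancel₀ _ (by norm_num)] at t1 t2
  refine le_of_tendsto_of_tendsto' t1 t2 fun k => ENNReal.ofReal_le_ofReal ?_
  exact monotoneOn_Mm (contDiffOn_Ue isOpen_ball hg (hk k)) (levi_Ue_nonneg hg (hk k) (by positivity))
    ⟨h0, by linarith⟩ ⟨by linarith, hr⟩ hrr

/-- Sub-mean value property of `|g|^s`. -/
lemma sub_mean [FiniteDimensional ℂ E] (hg : DifferentiableOn ℂ g (ball 0 R)) {s r : ℝ} (hs : 0 < s) (h0 : 0 ≤ r) (hr : r < R) :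
    tau E univ * ‖g 0‖ₑ ^ s ≤ ∫⁻ ζ, ‖g (r • ζ)‖ₑ ^ s ∂(tau E) := by
  refine le_trans ?_ (lintegral_mono_dilate hg hs le_rfl h0 hr)
  simp [mul_comm]

end Mono

lemma ContinuousOn.measurable_indicator {X Y : Type*} [TopologicalSpace X] [MeasurableSpace X] [BorelSpace X]
    [TopologicalSpace Y] [MeasurableSpace Y] [BorelSpace Y] [Zero Y] {s : Set X} (hs : MeasurableSet s) {f : X → Y}
    (hf : ContinuousOn f s) : Measurable (s.indicator f) := by
  classical
  rw [← piecewise_eq_indicator]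
  exact hf.measurable_piecewise continuousOn_const hs

lemma lintegral_deriv_le {P P' : ℝ → ℝ} (hc : ContinuousOn P (Icc 0 1)) (hd : ∀ x ∈ Ioo (0 : ℝ) 1, HasDerivAt P (P' x) x)
    (hP' : ∀ x ∈ Ioo (0 : ℝ) 1, 0 ≤ P' x) :
    ∫⁻ r in Ioo (0 : ℝ) 1, ENNReal.ofReal (P' r) ≤ ENNReal.ofReal (P 1 - P 0) := by
  have hi : IntegrableOn P' (Ioc 0 1) := intervalIntegral.integrableOn_deriv_of_nonneg hc hd hP'
  have hi' : IntegrableOn P' (Ioo 0 1) := hi.mono_set Ioo_subset_Ioc_self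
  rw [← ofReal_integral_eq_lintegral_ofReal hi' ((ae_restrict_iff' measurableSet_Ioo).2 (Eventually.of_forall hP')),
    ← integral_Ioc_eq_integral_Ioo, ← intervalIntegral.integral_of_le zero_le_one,
    intervalIntegral.integral_eq_sub_of_hasDerivAt_of_le zero_le_one hc hd
      ((intervalIntegrable_iff_integrableOn_Ioc_of_le zero_le_one).2 hi)]

/-- The square of the invariant gradient, up to the factor `1-|z|^2`. -/
def N2 {n : ℕ} (g : En n → ℂ) (z : En n) : ℝ := ‖fderiv ℂ g z‖ ^ 2 - ‖fderiv ℂ g z z‖ ^ 2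

section F1
variable {n : ℕ} {g : En n → ℂ} {R : ℝ}

lemma N2_nonneg {z : En n} (hz : ‖z‖ ≤ 1) : 0 ≤ N2 g z := by
  have h1 := (fderiv ℂ g z).le_opNorm z
  have h2 : ‖fderiv ℂ g z‖ * ‖z‖ ≤ ‖fderiv ℂ g z‖ := mul_le_of_le_one_right (norm_nonneg _) hz
  have := pow_le_pow_left₀ (norm_nonneg _) (h1.trans h2) 2
  unfold N2; linarith

lemma continuousOn_N2 {s : Set (En n)} (hs : IsOpen s) (hg : DifferentiableOn ℂ g s) : ContinuousOn (N2 g) s := by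
  have h := (differentiableOn_fderiv_of_isOpen hs hg).continuousOn
  unfold N2
  exact (h.norm.pow 2).sub ((h.clm_apply continuousOn_id).norm.pow 2)

lemma continuousOn_cUe {s : Set (En n)} (hs : IsOpen s) (hg : DifferentiableOn ℂ g s) {ε q : ℝ} (hε : 0 < ε) :
    ContinuousOn (fun z => cUe ε q (‖g z‖ ^ 2)) s := by
  have h := (hg.continuousOn.norm.pow 2)
  unfold cUe
  refine ContinuousOn.mul (continuousOn_const.mul ?_) ((continuousOn_const.mul h).add continuousOn_const)
  exact (h.add continuousOn_const).rpow_const fun z _ => Or.inl (by have : 0 ≤ ‖g z‖ ^ 2 := by positivity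
                                                                    simp only [Pi.add_apply, Pi.pow_apply]; positivity)

lemma integral_N2 (hg : DifferentiableOn ℂ g (ball 0 R)) {ε q r : ℝ} (hε : 0 < ε) (hr : |r| < R) :
    r ^ 2 * ∫ ζ, 4 * cUe ε q (‖g (r • ζ)‖ ^ 2) * N2 g (r • ζ) ∂(tau (En n)) =
      2 * ((n : ℝ) - 1) * pp (Ue g ε q) r + (1 - r ^ 2) * ∫ ζ, levi (Ue g ε q) (r • ζ) (r • ζ) ∂(tau (En n)) := by
  have h1 := integral_levi_tang (contDiffOn_Ue isOpen_ball hg hε (q := q)) hr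
  have hgd := (differentiableOn_fderiv_of_isOpen isOpen_ball hg).continuousOn
  have hc := continuousOn_cUe isOpen_ball hg hε (q := q)
  have e1 : ∫ ζ, ∑ j, ∑ k, levi (Ue g ε q) (r • ζ) (tang 1 j k (r • ζ)) ∂(tau (En n)) =
      ∫ ζ, (2 * r ^ 2 * (4 * cUe ε q (‖g (r • ζ)‖ ^ 2) * N2 g (r • ζ)) -
        2 * (1 - r ^ 2) * levi (Ue g ε q) (r • ζ) (r • ζ)) ∂(tau (En n)) := by
    refine integral_congr_ae ?_
    filter_upwards [tau_ae_norm (E := En n)] with ζ hζ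
    have hm := smul_sphere_mem_ball hr hζ
    simp_rw [levi_Ue isOpen_ball hg hε hm, ← Finset.mul_sum, sum_norm_tang, N2]
    have : ‖r • ζ‖ ^ 2 = r ^ 2 := by rw [norm_smul, hζ]; simp
    rw [this]; ring
  have i1 : Integrable (fun ζ => 4 * cUe ε q (‖g (r • ζ)‖ ^ 2) * N2 g (r • ζ)) (tau (En n)) :=
    (((continuousOn_const.mul hc).mul (continuousOn_N2 isOpen_ball hg)).comp_dilate hr).integrable_tau
  have i2 : Integrable (fun ζ => levi (Ue g ε q) (r • ζ) (r • ζ)) (tau (En n)) := by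
    have hl : ContinuousOn (fun z => levi (Ue g ε q) z z) (ball 0 R) := by
      refine (((continuousOn_const (c := (4 : ℝ))).mul hc).mul ((hgd.clm_apply continuousOn_id).norm.pow 2)).congr fun z hz => ?_
      simp [levi_Ue isOpen_ball hg hε hz]
    exact (hl.comp_dilate hr).integrable_tau
  rw [e1, integral_sub (i1.const_mul _) (i2.const_mul _), integral_const_mul, integral_const_mul] at h1
  linarith

lemma lintegral_N2_Ue [NeZero n] (hg : DifferentiableOn ℂ g (ball 0 R)) (hR : 1 < R) {ε q : ℝ} (hε : 0 < ε) (hq : 0 < q) :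
    ∫⁻ z in ball 0 1, ENNReal.ofReal (4 * cUe ε q (‖g z‖ ^ 2) * N2 g z) ≤
      ENNReal.ofReal (2 * n * Mm (Ue g ε q) 1) := by
  obtain ⟨m, rfl⟩ : ∃ m, n = m + 1 := ⟨n - 1, (Nat.succ_pred_eq_of_ne_zero (NeZero.ne n)).symm⟩
  have hU := contDiffOn_Ue isOpen_ball hg hε (q := q)
  have hU1 : ContDiffOn ℝ 1 (Ue g ε q) (ball 0 R) := hU.of_le (by norm_num)
  have hl := levi_Ue_nonneg hg hε hq
  set p := pp (Ue g ε q) with hp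
  set M := Mm (Ue g ε q) with hM
  set L : ℝ → ℝ := fun r => ∫ ζ, levi (Ue g ε q) (r • ζ) (r • ζ) ∂(tau (En (m + 1))) with hL
  set A : ℝ → ℝ := fun r => ∫ ζ, 4 * cUe ε q (‖g (r • ζ)‖ ^ 2) * N2 g (r • ζ) ∂(tau (En (m + 1))) with hA
  have hfc : ContinuousOn (fun z => 4 * cUe ε q (‖g z‖ ^ 2) * N2 g z) (ball 0 R) :=
    (continuousOn_const.mul (continuousOn_cUe isOpen_ball hg hε)).mul (continuousOn_N2 isOpen_ball hg)
  have hA0 : ∀ r ∈ Ioo (0 : ℝ) 1, 0 ≤ A r := by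
    intro r hr
    refine integral_nonneg_of_ae ?_
    filter_upwards [tau_ae_norm (E := En (m + 1))] with ζ hζ
    have : ‖r • ζ‖ ≤ 1 := by rw [norm_smul, hζ, Real.norm_of_nonneg hr.1.le]; linarith [hr.2]
    exact mul_nonneg (mul_nonneg (by norm_num) (cUe_nonneg hε hq (by positivity))) (N2_nonneg this)
  -- the fundamental derivative
  set P : ℝ → ℝ := fun r => r ^ (2 * m) * ((1 - r ^ 2) * p r) + 2 * (m + 1) * M r with hP
  set P' : ℝ → ℝ := fun r => (2 * m : ℕ) * r ^ (2 * m - 1) * ((1 - r ^ 2) * p r) +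
    r ^ (2 * m) * ((-(2 * r)) * p r + (1 - r ^ 2) * (L r / r)) + 2 * (m + 1) * (p r / r) with hP'
  have hd : ∀ r ∈ Ioo (0 : ℝ) 1, HasDerivAt P (P' r) r := by
    intro r hr
    have hr' : |r| < R := by rw [abs_of_pos hr.1]; linarith [hr.2]
    have d1 := hasDerivAt_pp hU hr' hr.1.ne'
    have d2 := hasDerivAt_Mm hU1 hr' hr.1.ne'
    have d3 : HasDerivAt (fun r : ℝ => 1 - r ^ 2) (-(2 * r)) r := by
      simpa using (hasDerivAt_pow 2 r).const_sub 1
    exact ((hasDerivAt_pow (2 * m) r).mul (d3.mul d1)).add (d2.const_mul _)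
  have key : ∀ r ∈ Ioo (0 : ℝ) 1, r ^ (2 * m + 1) * A r ≤ P' r := by
    intro r hr
    have hr' : |r| < R := by rw [abs_of_pos hr.1]; linarith [hr.2]
    have h1 := integral_N2 hg hε hr' (q := q)
    push_cast at h1
    have hpn : 0 ≤ p r := pp_nonneg hU hl hr.1.le (by linarith [hr.2])
    have h2 : r * P' r = 2 * m * r ^ (2 * m) * ((1 - r ^ 2) * p r) + r ^ (2 * m) * (-(2 * r ^ 2) * p r + (1 - r ^ 2) * L r)
        + 2 * (m + 1) * p r := by
      have : (2 * m : ℕ) * r ^ (2 * m - 1) * r = 2 * m * r ^ (2 * m) := by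
        rcases Nat.eq_zero_or_pos m with h | h
        · subst h; simp
        · rw [mul_assoc, pow_sub_one_mul (by omega)]; push_cast; ring
      simp only [hP']
      have hr0 := hr.1.ne'
      calc _ = ((2 * m : ℕ) * r ^ (2 * m - 1) * r) * ((1 - r ^ 2) * p r) + r ^ (2 * m) * (-(2 * r ^ 2) * p r + (1 - r ^ 2) * (L r / r * r))
        + 2 * (m + 1) * (p r / r * r) := by ring
        _ = _ := by rw [this, div_mul_cancel₀ _ hr0, div_mul_cancel₀ _ hr0]
    have h3 : r * (r ^ (2 * m + 1) * A r) = r ^ (2 * m) * (2 * m * p r + (1 - r ^ 2) * L r) := by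
      have : r ^ 2 * A r = 2 * m * p r + (1 - r ^ 2) * L r := by rw [h1]; ring
      rw [← this]; ring
    have h4 : r ^ (2 * m) * r ^ 2 ≤ 1 := by
      rw [← pow_add]; exact pow_le_one₀ hr.1.le hr.2.le
    refine le_of_mul_le_mul_left ?_ hr.1
    rw [h2, h3]
    have : 0 ≤ (m + 1 : ℝ) * p r := by positivity
    nlinarith [mul_le_mul_of_nonneg_left h4 this]
  have hc : ContinuousOn P (Icc 0 1) := by
    have s1 : Icc (0 : ℝ) 1 ⊆ Ioo (-R) R := fun x hx => ⟨by linarith [hx.1], by linarith [hx.2]⟩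
    have c1 : ContinuousOn p (Icc 0 1) := (continuousOn_pp hU).mono s1
    have c2 : ContinuousOn M (Icc 0 1) := (continuousOn_Mm hU1).mono s1
    simp only [hP]; fun_prop
  have fin := lintegral_deriv_le hc hd fun r hr => le_trans (mul_nonneg (by have := hr.1.le; positivity) (hA0 r hr)) (key r hr)
  have hM0 : 0 ≤ M 0 := integral_nonneg fun ζ => Ue_nonneg hε _
  have hPP : P 1 - P 0 ≤ 2 * (m + 1 : ℕ) * M 1 := by
    have h0 : p 0 = 0 := pp_zero
    have : 0 ≤ 2 * (m + 1 : ℝ) * M 0 := by positivity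
    simp only [hP, h0]; push_cast; simp; linarith
  refine le_trans ?_ (fin.trans (ENNReal.ofReal_le_ofReal hPP))
  classical
  set F : En (m + 1) → ℝ≥0∞ := (ball 0 1).indicator fun z => ENNReal.ofReal (4 * cUe ε q (‖g z‖ ^ 2) * N2 g z) with hF
  have hFm : Measurable F := ContinuousOn.measurable_indicator measurableSet_ball
    (ENNReal.continuous_ofReal.comp_continuousOn (hfc.mono (ball_subset_ball hR.le)))
  rw [setLIntegral_congr_fun (g := F) measurableSet_ball fun z hz => by simp [hF, hz], lintegral_polar_ball hFm]
  refine setLIntegral_mono' measurableSet_Ioo fun r hr => ?_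
  have hr' : |r| < R := by rw [abs_of_pos hr.1]; linarith [hr.2]
  have e : ∫⁻ ζ, F (r • ζ) ∂(tau (En (m + 1))) = ENNReal.ofReal (A r) := by
    rw [hA, ofReal_integral_eq_lintegral_ofReal (hfc.comp_dilate hr').integrable_tau]
    · refine lintegral_congr_ae ?_
      filter_upwards [tau_ae_norm (E := En (m + 1))] with ζ hζ
      have : ‖r • ζ‖ < 1 := by rw [norm_smul, hζ, Real.norm_of_nonneg hr.1.le]; linarith [hr.2]
      simp [hF, indicator, this]
    · filter_upwards [tau_ae_norm (E := En (m + 1))] with ζ hζ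
      have : ‖r • ζ‖ ≤ 1 := by rw [norm_smul, hζ, Real.norm_of_nonneg hr.1.le]; linarith [hr.2]
      exact mul_nonneg (mul_nonneg (by norm_num) (cUe_nonneg hε hq (by positivity))) (N2_nonneg this)
  rw [e, ← ENNReal.ofReal_mul (by have := hr.1.le; positivity), finrank_En]
  refine ENNReal.ofReal_le_ofReal ((le_of_eq ?_).trans (key r hr))
  rw [show 2 * (m + 1) - 1 = 2 * m + 1 by omega]

/-- The basic square function estimate on the ball. -/
lemma lintegral_N2_le [NeZero n] (hg : DifferentiableOn ℂ g (ball 0 R)) (hR : 1 < R) {s : ℝ} (hs : 0 < s) :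
    ∫⁻ z in ball 0 1, ‖g z‖ₑ ^ (s - 2) * ENNReal.ofReal (N2 g z) ≤
      ENNReal.ofReal (2 * n / (4 * (s / 2) * min (s / 2) 1)) * ∫⁻ ζ, ‖g ζ‖ₑ ^ s ∂(tau (En n)) := by
  have hk : ∀ k : ℕ, (0 : ℝ) < 1 / ((k : ℝ) + 1) := fun k => by positivity
  set q := s / 2 with hq
  have hq0 : 0 < q := by positivity
  have h2q : 2 * q = s := by rw [hq]; ring
  set κ : ℝ := 4 * q * min q 1 with hκ
  have hκ0 : 0 < κ := by have : 0 < min q 1 := lt_min hq0 one_pos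
                         positivity
  have hmeas : ∀ k : ℕ, AEMeasurable (fun z => ENNReal.ofReal ((‖g z‖ ^ 2 + 1 / ((k : ℝ) + 1)) ^ (q - 1)) * ENNReal.ofReal (N2 g z))
      (volume.restrict (ball (0 : En n) 1)) := by
    intro k
    have c1 : ContinuousOn (fun z => (‖g z‖ ^ 2 + 1 / ((k : ℝ) + 1)) ^ (q - 1)) (ball 0 R) :=
      (contDiffOn_Ue isOpen_ball hg (hk k) (q := q - 1)).continuousOn
    have c2 := (c1.mul (continuousOn_N2 isOpen_ball hg)).mono (ball_subset_ball hR.le)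
    refine ((ENNReal.continuous_ofReal.comp_continuousOn c2).aemeasurable measurableSet_ball).congr ?_
    refine Eventually.of_forall fun z => ?_
    have := hk k
    exact ENNReal.ofReal_mul (by positivity)
  have lim : ∀ z, Tendsto (fun k : ℕ => ENNReal.ofReal ((‖g z‖ ^ 2 + 1 / ((k : ℝ) + 1)) ^ (q - 1)) * ENNReal.ofReal (N2 g z))
      atTop (𝓝 (‖g z‖ₑ ^ (s - 2) * ENNReal.ofReal (N2 g z))) := by
    intro z
    have := tendsto_ofReal_rpow (g z) (q - 1)
    rw [show 2 * (q - 1) = s - 2 by rw [← h2q]; ring] at this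
    exact ENNReal.Tendsto.mul_const this (Or.inr ENNReal.ofReal_ne_top)
  have bound : ∀ k : ℕ, ∫⁻ z in ball 0 1, ENNReal.ofReal ((‖g z‖ ^ 2 + 1 / ((k : ℝ) + 1)) ^ (q - 1)) * ENNReal.ofReal (N2 g z) ≤
      ENNReal.ofReal (2 * n / κ) * ENNReal.ofReal (Mm (Ue g (1 / ((k : ℝ) + 1)) q) 1) := by
    intro k
    have h1 := lintegral_N2_Ue hg hR (hk k) hq0
    have h2 : ∫⁻ z in ball 0 1, ENNReal.ofReal κ * (ENNReal.ofReal ((‖g z‖ ^ 2 + 1 / ((k : ℝ) + 1)) ^ (q - 1)) * ENNReal.ofReal (N2 g z)) ≤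
        ENNReal.ofReal (2 * n * Mm (Ue g (1 / ((k : ℝ) + 1)) q) 1) := by
      refine le_trans (setLIntegral_mono' measurableSet_ball fun z hz => ?_) h1
      have hz' : ‖z‖ ≤ 1 := by have := mem_ball_zero_iff.1 hz; exact this.le
      have := hk k
      rw [← ENNReal.ofReal_mul (by positivity), ← ENNReal.ofReal_mul hκ0.le]
      refine ENNReal.ofReal_le_ofReal ?_
      have h3 := le_cUe (hk k) hq0 (x := ‖g z‖ ^ 2) (by positivity)
      have := mul_le_mul_of_nonneg_right h3 (N2_nonneg (g := g) hz')
      rw [hκ]; linarith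
    rw [lintegral_const_mul' _ _ ENNReal.ofReal_ne_top] at h2
    have h4 : ENNReal.ofReal (2 * n / κ) = (ENNReal.ofReal κ)⁻¹ * ENNReal.ofReal (2 * n) := by
      rw [← ENNReal.ofReal_inv_of_pos hκ0, ← ENNReal.ofReal_mul (by positivity)]; congr 1; ring
    rw [h4, mul_assoc, ← ENNReal.ofReal_mul (by positivity)]
    have := mul_le_mul_right h2 (ENNReal.ofReal κ)⁻¹
    rwa [← mul_assoc, ENNReal.inv_mul_cancel (by simpa using hκ0) ENNReal.ofReal_ne_top, one_mul] at this
  have t := tendsto_lintegral_Ue hg hq0 (r := 1) (by simpa using hR)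
  simp only [one_smul, h2q] at t
  calc ∫⁻ z in ball 0 1, ‖g z‖ₑ ^ (s - 2) * ENNReal.ofReal (N2 g z)
      = ∫⁻ z in ball 0 1, liminf (fun k : ℕ => ENNReal.ofReal ((‖g z‖ ^ 2 + 1 / ((k : ℝ) + 1)) ^ (q - 1)) * ENNReal.ofReal (N2 g z)) atTop :=
        lintegral_congr fun z => (lim z).liminf_eq.symm
    _ ≤ liminf (fun k : ℕ => ∫⁻ z in ball 0 1, ENNReal.ofReal ((‖g z‖ ^ 2 + 1 / ((k : ℝ) + 1)) ^ (q - 1)) * ENNReal.ofReal (N2 g z)) atTop :=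
        lintegral_liminf_le' hmeas
    _ ≤ liminf (fun k : ℕ => ENNReal.ofReal (2 * n / κ) * ENNReal.ofReal (Mm (Ue g (1 / ((k : ℝ) + 1)) q) 1)) atTop :=
        liminf_le_liminf (Eventually.of_forall bound)
    _ = _ := (ENNReal.Tendsto.const_mul t (Or.inr ENNReal.ofReal_ne_top)).liminf_eq

end F1

section Growth
variable {n : ℕ} [NeZero n] {g : En n → ℂ} {R s : ℝ}

lemma sub_mean_ball (hg : DifferentiableOn ℂ g (ball 0 1)) (hs : 0 < s) :
    volume (ball (0 : En n) 1) * ‖g 0‖ₑ ^ s ≤ ∫⁻ z in ball 0 1, ‖g z‖ₑ ^ s := by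
  have hFm : Measurable ((ball (0 : En n) 1).indicator fun z => ‖g z‖ₑ ^ s) :=
    ContinuousOn.measurable_indicator measurableSet_ball
      (ENNReal.continuous_rpow_const.comp_continuousOn hg.continuousOn.enorm)
  have h1 : volume (ball (0 : En n) 1) * ‖g 0‖ₑ ^ s = ∫⁻ z in ball (0 : En n) 1, ‖g 0‖ₑ ^ s := by
    simp [mul_comm]
  rw [h1, lintegral_polar_ball measurable_const,
    setLIntegral_congr_fun (g := (ball (0 : En n) 1).indicator fun z => ‖g z‖ₑ ^ s) measurableSet_ball
      fun z hz => by simp [hz], lintegral_polar_ball hFm]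
  refine setLIntegral_mono' measurableSet_Ioo fun r hr => ?_
  refine mul_le_mul_right ?_ _
  have := sub_mean hg hs hr.1.le hr.2
  rw [lintegral_const, mul_comm]
  refine this.trans (le_of_eq (lintegral_congr_ae ?_))
  filter_upwards [tau_ae_norm (E := En n)] with ζ hζ
  have : ‖r • ζ‖ < 1 := by rw [norm_smul, hζ, Real.norm_of_nonneg hr.1.le]; linarith [hr.2]
  simp [indicator, this]

lemma lintegral_shell_le (hg : DifferentiableOn ℂ g (ball 0 R)) (hR : 1 < R) (hs : 0 < s) {κ : ℝ} (hκ : 0 ≤ κ) :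
    ∫⁻ z in ball 0 1 ∩ {z | 1 - κ ≤ ‖z‖}, ‖g z‖ₑ ^ s ≤
      ENNReal.ofReal κ * ∫⁻ ζ, ‖g ζ‖ₑ ^ s ∂(tau (En n)) := by
  have hgc : ContinuousOn (fun z => ‖g z‖ₑ ^ s) (ball 0 R) :=
    (ENNReal.continuous_rpow_const.comp_continuousOn hg.continuousOn.enorm)
  have hSm : MeasurableSet (ball (0 : En n) 1 ∩ {z | 1 - κ ≤ ‖z‖}) :=
    measurableSet_ball.inter (measurableSet_le measurable_const measurable_norm)
  have hFm : Measurable ((ball (0 : En n) 1 ∩ {z | 1 - κ ≤ ‖z‖}).indicator fun z => ‖g z‖ₑ ^ s) :=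
    ContinuousOn.measurable_indicator hSm
      (hgc.mono (inter_subset_left.trans (ball_subset_ball hR.le)))
  rw [← lintegral_indicator hSm]
  have : ∀ z, ((ball (0 : En n) 1 ∩ {z | 1 - κ ≤ ‖z‖}).indicator fun z => ‖g z‖ₑ ^ s) z =
      (ball (0 : En n) 1).indicator ((ball (0 : En n) 1 ∩ {z | 1 - κ ≤ ‖z‖}).indicator fun z => ‖g z‖ₑ ^ s) z := by
    intro z; rw [indicator_indicator, ← inter_assoc, inter_self]
  rw [lintegral_congr this, lintegral_indicator measurableSet_ball, lintegral_polar_ball hFm]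
  calc _ ≤ ∫⁻ r in Ioo (0 : ℝ) 1, (Icc (1 - κ) 1).indicator (fun _ => ∫⁻ ζ, ‖g ζ‖ₑ ^ s ∂(tau (En n))) r := by
        refine setLIntegral_mono' measurableSet_Ioo fun r hr => ?_
        have hnorm : ∀ ζ : En n, ‖ζ‖ = 1 → ‖r • ζ‖ = r := fun ζ hζ => by
          rw [norm_smul, hζ, Real.norm_of_nonneg hr.1.le, mul_one]
        by_cases hrκ : 1 - κ ≤ r
        · rw [indicator_of_mem (show r ∈ Icc (1 - κ) 1 from ⟨hrκ, hr.2.le⟩)]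
          have h1 : ENNReal.ofReal (r ^ (Module.finrank ℝ (En n) - 1)) ≤ 1 := by
            rw [← ENNReal.ofReal_one]; exact ENNReal.ofReal_le_ofReal (pow_le_one₀ hr.1.le hr.2.le)
          refine (mul_le_of_le_one_left zero_le h1).trans ?_
          refine le_trans (lintegral_mono fun ζ => indicator_le_self _ _ _) ?_
          have := lintegral_mono_dilate hg hs hr.1.le hr.2.le hR
          simpa using this
        · have : ∫⁻ ζ, (ball (0 : En n) 1 ∩ {z | 1 - κ ≤ ‖z‖}).indicator (fun z => ‖g z‖ₑ ^ s) (r • ζ) ∂(tau (En n)) = 0 := by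
            rw [← lintegral_zero (μ := tau (En n))]
            refine lintegral_congr_ae ?_
            filter_upwards [tau_ae_norm (E := En n)] with ζ hζ
            refine indicator_of_notMem (fun h => hrκ ?_) _
            have h2 : 1 - κ ≤ ‖r • ζ‖ := h.2
            rwa [hnorm ζ hζ] at h2
          rw [this, mul_zero]; exact zero_le
    _ ≤ ∫⁻ r, (Icc (1 - κ) 1).indicator (fun _ => ∫⁻ ζ, ‖g ζ‖ₑ ^ s ∂(tau (En n))) r := setLIntegral_le_lintegral _ _
    _ = _ := by
        rw [lintegral_indicator measurableSet_Icc, lintegral_const, Measure.restrict_apply_univ, Real.volume_Icc, mul_comm]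
        congr 2; ring

lemma growth_aux (hg : DifferentiableOn ℂ g (ball 0 R)) (hR : 1 < R) (hs : 0 < s) {κ : ℝ} (hκ : 0 ≤ κ) {c σ : ℝ} (hc : 0 < c)
    (hσ : 0 < σ) {a η : En n} (hη : ‖η‖ = 1)
    (h : ∀ w : En n, ‖w‖ < 1 → ‖a + ani c σ η w‖ < 1 ∧ 1 - κ ≤ ‖a + ani c σ η w‖) :
    ENNReal.ofReal (c ^ (2 * n) * σ ^ (n + 1)) * volume (ball (0 : En n) 1) * ‖g a‖ₑ ^ s ≤
      ENNReal.ofReal κ * ∫⁻ ζ, ‖g ζ‖ₑ ^ s ∂(tau (En n)) := by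
  set L : En n →L[ℂ] En n := LinearMap.toContinuousLinearMap (ani c σ η) with hL
  have hd : DifferentiableOn ℂ (fun w => g (a + ani c σ η w)) (ball 0 1) := by
    refine hg.comp (f := fun w => a + L w) (by fun_prop) fun w hw => ?_
    have := (h w (by simpa using hw)).1
    exact ball_subset_ball hR.le (mem_ball_zero_iff.2 this)
  have h1 := sub_mean_ball hd hs
  simp only [map_zero, add_zero] at h1
  refine le_trans ?_ (lintegral_shell_le hg hR hs hκ)
  have hdet : ((L.restrictScalars ℝ).det : ℝ) = c ^ (2 * n) * σ ^ (n + 1) := ani_det hσ.le hη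
  have hdet0 : 0 < c ^ (2 * n) * σ ^ (n + 1) := by positivity
  have hinj : InjOn (fun w => a + ani c σ η w) (ball (0 : En n) 1) := by
    intro x _ y _ hxy
    have hu : IsUnit (LinearMap.det ((ani c σ η).restrictScalars ℝ)) := by
      rw [ani_det hσ.le hη]; exact hdet0.ne'.isUnit
    have := (LinearMap.isUnit_iff_isUnit_det _).2 hu
    have hi := ((Module.End.isUnit_iff _).1 this).1
    exact hi (by simpa using hxy)
  have cv := lintegral_image_eq_lintegral_abs_det_fderiv_mul volume (measurableSet_ball (x := (0 : En n)) (ε := 1))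
    (f := fun w => a + ani c σ η w) (f' := fun _ => L.restrictScalars ℝ)
    (fun w _ => ((L.restrictScalars ℝ).hasFDerivAt.const_add a).hasFDerivWithinAt) hinj (fun z => ‖g z‖ₑ ^ s)
  rw [hdet, abs_of_pos hdet0, lintegral_const_mul' _ _ ENNReal.ofReal_ne_top] at cv
  rw [mul_assoc]
  refine (mul_le_mul_right h1 _).trans (cv.symm.le.trans (lintegral_mono_set ?_))
  rintro _ ⟨w, hw, rfl⟩
  have := h w (by simpa using hw)
  exact ⟨by simpa using this.1, this.2⟩

/-- Pointwise growth of holomorphic functions in terms of their boundary integral means. -/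
lemma exists_growth (n : ℕ) [NeZero n] : ∃ C : ℝ, 0 < C ∧ ∀ (g : En n → ℂ) (R s : ℝ), DifferentiableOn ℂ g (ball 0 R) → 1 < R → 0 < s →
    ∀ a : En n, ‖a‖ < 1 → ‖g a‖ₑ ^ s ≤ ENNReal.ofReal (C / (1 - ‖a‖) ^ n) * ∫⁻ ζ, ‖g ζ‖ₑ ^ s ∂(tau (En n)) := by
  set V := (volume (ball (0 : En n) 1)).toReal
  have hV' : volume (ball (0 : En n) 1) ≠ ⊤ := measure_ball_lt_top.ne
  have hV : 0 < V := ENNReal.toReal_pos (measure_ball_pos _ _ one_pos).ne' hV'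
  have conv : ∀ (x : ℝ) (κ : ℝ) (X Y : ℝ≥0∞), 0 < x → ENNReal.ofReal x * volume (ball (0 : En n) 1) * X ≤ ENNReal.ofReal κ * Y →
      X ≤ ENNReal.ofReal (κ / (x * V)) * Y := by
    intro x κ X Y hx h
    rw [← ENNReal.ofReal_toReal hV', ← ENNReal.ofReal_mul hx.le] at h
    have hxV : 0 < x * V := by positivity
    have h2 := mul_le_mul_right h (ENNReal.ofReal (x * V))⁻¹
    rw [← mul_assoc, ENNReal.inv_mul_cancel (by simpa using hxV) ENNReal.ofReal_ne_top, one_mul, ← mul_assoc,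
      ← ENNReal.ofReal_inv_of_pos hxV, ← ENNReal.ofReal_mul (by positivity)] at h2
    rwa [div_eq_inv_mul]
  refine ⟨8 ^ (2 * n) / V, by positivity, fun g R s hg hR hs a ha => ?_⟩
  by_cases ha2 : ‖a‖ ≤ 1 / 2
  · obtain ⟨η, hη⟩ := exists_norm_eq (En n) (zero_le_one (α := ℝ))
    have := growth_aux hg hR hs (κ := 1) (by norm_num) (c := 1 / 2) (σ := 1) (by norm_num) one_pos (a := a) hη ?_
    · refine (conv _ _ _ _ (by positivity) this).trans ?_
      refine mul_le_mul_left (ENNReal.ofReal_le_ofReal ?_) _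
      have e : (1 : ℝ) / ((1 / 2) ^ (2 * n) * 1 ^ (n + 1) * V) = 2 ^ (2 * n) / V / 1 := by
        rw [one_div_pow]; field_simp; simp
      rw [e]
      have h1 : (0 : ℝ) < (1 - ‖a‖) ^ n := pow_pos (by linarith) n
      gcongr
      · norm_num
      · exact pow_le_one₀ (by linarith) (by linarith [norm_nonneg a])
    · intro w hw
      rw [ani_apply]
      have : ‖(((1 / 2 : ℝ) * √1 : ℝ) : ℂ) • (w + (((√1 - 1 : ℝ) : ℂ) * inner ℂ η w) • η)‖ = ‖w‖ / 2 := by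
        simp [norm_smul]; ring
      refine ⟨(norm_add_le _ _).trans_lt ?_, by simp⟩
      rw [this]; linarith
  · push Not at ha2
    have ha0 : 0 < ‖a‖ := by linarith
    set δ := 1 - ‖a‖ with hδ
    have hδ0 : 0 < δ := by rw [hδ]; linarith
    set η := ‖a‖⁻¹ • a with hηd
    have hη : ‖η‖ = 1 := by rw [hηd, norm_smul, norm_inv, norm_norm, inv_mul_cancel₀ ha0.ne']
    have hae : a = (1 - (2 * δ) / 2 : ℝ) • η := by
      rw [hηd, smul_smul, hδ]
      rw [show (1 - 2 * (1 - ‖a‖) / 2) * ‖a‖⁻¹ = 1 by field_simp; ring, one_smul]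
    have := growth_aux hg hR hs (κ := 5 / 8 * (2 * δ)) (by positivity) (c := 1 / 8) (σ := 2 * δ) (by norm_num) (by positivity) (a := a) hη ?_
    · refine (conv _ _ _ _ (by positivity) this).trans ?_
      refine mul_le_mul_left (ENNReal.ofReal_le_ofReal ?_) _
      rw [div_div, div_le_div_iff₀ (by positivity) (by positivity), one_div_pow, mul_pow]
      have h2 : (1 : ℝ) ≤ 2 ^ n := one_le_pow₀ (by norm_num)
      have e : (8 : ℝ) ^ (2 * n) * (1 / 8 ^ (2 * n) * (2 ^ (n + 1) * δ ^ (n + 1)) * V) = 2 ^ n * (2 * (δ * (δ ^ n * V))) := by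
        rw [pow_succ, pow_succ]; field_simp
      rw [e]
      have : 0 < δ * (δ ^ n * V) := by positivity
      calc 5 / 8 * (2 * δ) * (V * δ ^ n) ≤ 1 * (2 * (δ * (δ ^ n * V))) := by nlinarith
        _ ≤ _ := by gcongr
    · intro w hw
      have := ellipsoid_bounds (h := 2 * δ) (by positivity) (by rw [hδ]; linarith) hη hw
      rw [← hae] at this
      exact ⟨this.1, this.2.1⟩

end Growth

section Peak
variable {n : ℕ} {a z : En n}

/-- A holomorphic function of modulus at most one on the ball, peaking near `a`. -/
def FF (a z : En n) : ℂ := ((1 - ‖a‖ : ℝ) : ℂ) / (1 - inner ℂ a z)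

lemma norm_FF (ha : ‖a‖ ≤ 1) : ‖FF a z‖ = (1 - ‖a‖) / dk z a := by
  rw [FF, norm_div, dk, Complex.norm_of_nonneg (by linarith)]

lemma one_sub_mul_le_dk (a z : En n) : 1 - ‖z‖ * ‖a‖ ≤ dk z a := by
  unfold dk
  have h1 := norm_inner_le_norm (𝕜 := ℂ) a z
  have := norm_sub_norm_le (1 : ℂ) (inner ℂ a z)
  rw [norm_one] at this
  linarith [mul_comm ‖a‖ ‖z‖]

lemma delta_le_dk (hz : ‖z‖ ≤ 1) : 1 - ‖a‖ ≤ dk z a := by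
  rw [dk_comm]; exact one_sub_le_dk hz

lemma norm_FF_le (ha : ‖a‖ < 1) (hz : ‖z‖ ≤ 1) : ‖FF a z‖ ≤ 1 := by
  have := delta_le_dk (a := a) hz
  rw [norm_FF ha.le]
  exact div_le_one_of_le₀ this (dk_nonneg _ _)

lemma norm_FF_self (ha : ‖a‖ < 1) : 1 / 2 ≤ ‖FF a a‖ := by
  have h : dk a a ≤ 2 * (1 - ‖a‖) := by
    unfold dk
    have : (1 : ℂ) - inner ℂ a a = ((1 - ‖a‖ ^ 2 : ℝ) : ℂ) := by
      rw [inner_self_eq_norm_sq_to_K]; simp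
    rw [this, Complex.norm_of_nonneg (by nlinarith [norm_nonneg a])]
    nlinarith [norm_nonneg a]
  have h0 : 0 < dk a a := by linarith [delta_le_dk (a := a) ha.le]
  rw [norm_FF ha.le, le_div_iff₀ h0]
  linarith

lemma one_sub_inner_ne (ha : ‖a‖ < 1) (hz : ‖z‖ < 2 / (1 + ‖a‖)) : (1 : ℂ) - inner ℂ a z ≠ 0 := by
  have h1 := one_sub_mul_le_dk a z
  have h2 : ‖z‖ * ‖a‖ < 1 := by
    rw [lt_div_iff₀ (by positivity)] at hz
    nlinarith [norm_nonneg z, norm_nonneg a]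
  intro h
  rw [dk, h, norm_zero] at h1
  linarith

lemma one_lt_radius (ha : ‖a‖ < 1) : 1 < 2 / (1 + ‖a‖) := by
  rw [lt_div_iff₀ (by positivity)]; linarith

lemma hasFDerivAt_FF (ha : ‖a‖ < 1) (hz : ‖z‖ < 2 / (1 + ‖a‖)) :
    HasFDerivAt (FF a) ((((1 - ‖a‖ : ℝ) : ℂ) / (1 - inner ℂ a z) ^ 2) • innerSL ℂ a) z := by
  have h0 := one_sub_inner_ne ha hz
  have h1 : HasFDerivAt (fun z : En n => (1 : ℂ) - inner ℂ a z) (-(innerSL ℂ a)) z := by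
    have := ((innerSL ℂ a).hasFDerivAt (x := z)).const_sub 1
    simpa using this
  have h2 := ((hasDerivAt_inv h0).comp_hasFDerivAt z h1).const_mul (((1 - ‖a‖ : ℝ) : ℂ))
  refine (h2.congr_fderiv ?_).congr_of_eventuallyEq (Eventually.of_forall fun x => by simp [FF, div_eq_mul_inv])
  ext v
  simp
  field_simp

lemma differentiableOn_FF (ha : ‖a‖ < 1) : DifferentiableOn ℂ (FF a) (ball 0 (2 / (1 + ‖a‖))) :=
  fun z hz => (hasFDerivAt_FF ha (by simpa using hz)).differentiableAt.differentiableWithinAt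

lemma differentiableOn_mul_FF {g : En n → ℂ} {R : ℝ} (ha : ‖a‖ < 1) (hg : DifferentiableOn ℂ g (ball 0 R)) (k : ℕ) :
    DifferentiableOn ℂ (fun z => g z * FF a z ^ k) (ball 0 (min R (2 / (1 + ‖a‖)))) :=
  (hg.mono (ball_subset_ball (min_le_left _ _))).mul
    (((differentiableOn_FF ha).mono (ball_subset_ball (min_le_right _ _))).pow k)

end Peak

section Boundary
variable {n : ℕ}

/-- The boundary density `|g| ^ s`, extended by zero off the sphere. -/
def bd (g : En n → ℂ) (s : ℝ) : En n → ℝ≥0∞ := (sphere 0 1).indicator fun ζ => ‖g ζ‖ₑ ^ s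

lemma bd_ae (g : En n → ℂ) (s : ℝ) : bd g s =ᵐ[tau (En n)] fun ζ => ‖g ζ‖ₑ ^ s := by
  filter_upwards [tau_ae_norm (E := En n)] with ζ hζ
  simp [bd, indicator, hζ]

lemma measurable_bd {g : En n → ℂ} {R : ℝ} (hg : DifferentiableOn ℂ g (ball 0 R)) (hR : 1 < R) (s : ℝ) : Measurable (bd g s) :=
  ContinuousOn.measurable_indicator isClosed_sphere.measurableSet
    (ENNReal.continuous_rpow_const.comp_continuousOn
      (hg.continuousOn.mono (sphere_subset_closedBall.trans (closedBall_subset_ball hR))).enorm)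

lemma dk_le_of_dk_le {a ζ ζ0 : En n} (ha : ‖a‖ < 1) (hζ : ‖ζ‖ ≤ 1) (hζ0 : ‖ζ0‖ = 1) :
    dk ζ ζ0 ≤ 2 * (dk ζ a + dk a ζ0 + 2 * (1 - ‖a‖)) := by
  by_cases h : a = 0
  · subst h
    have := dk_le_two hζ hζ0.le
    have h1 : dk ζ (0 : En n) = 1 := by simp [dk]
    have := dk_nonneg (0 : En n) ζ0
    rw [h1]; simp; linarith
  · have hn : ‖‖a‖⁻¹ • a‖ = 1 := by
      rw [norm_smul, norm_inv, norm_norm, inv_mul_cancel₀ (norm_ne_zero_iff.2 h)]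
    have h1 := dk_triangle hζ hζ0.le hn
    have h2 := dk_normalize h ha.le hζ
    have h3 := dk_normalize h ha.le hζ0.le
    rw [dk_comm _ ζ, dk_comm a ζ] at h2
    linarith

lemma exists_kernel_le_MM (n : ℕ) {K : ℝ} (hK : 0 ≤ K) : ∃ C : ℝ, 0 < C ∧ ∀ (U : En n → ℝ≥0∞) (a ζ0 : En n), Measurable U → ‖a‖ < 1 →
    ‖ζ0‖ = 1 → dk a ζ0 ≤ K * (1 - ‖a‖) →
    ∫⁻ ζ, U ζ * ENNReal.ofReal (((1 - ‖a‖) / dk ζ a) ^ (n + 1)) ∂(tau (En n)) ≤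
      ENNReal.ofReal (C * (1 - ‖a‖) ^ n) * MM U ζ0 := by
  set C1 : ℝ := 2 * (K + 4) with hC1
  refine ⟨2 * C1 ^ n, by positivity, fun U a ζ0 hU ha hζ0 hK' => ?_⟩
  set δ := 1 - ‖a‖ with hδ
  have hδ0 : 0 < δ := by rw [hδ]; linarith
  have key : ∀ᵐ ζ ∂(tau (En n)), U ζ * ENNReal.ofReal ((δ / dk ζ a) ^ (n + 1)) ≤
      ∑' j : ℕ, ENNReal.ofReal ((1 / 2 ^ j) ^ (n + 1)) * (KB ζ0 (C1 * 2 ^ j * δ)).indicator U ζ := by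
    filter_upwards [tau_ae_norm (E := En n)] with ζ hζ
    have hd := delta_le_dk (a := a) hζ.le
    have hd0 : 0 < dk ζ a := by linarith
    obtain ⟨j, hj1, hj2⟩ := exists_nat_pow_near (one_le_div hδ0 |>.2 hd) (one_lt_two)
    rw [le_div_iff₀ hδ0] at hj1
    rw [div_lt_iff₀ hδ0, pow_succ] at hj2
    refine le_trans ?_ (ENNReal.le_tsum j)
    have hmem : ζ ∈ KB ζ0 (C1 * 2 ^ j * δ) := by
      have h1 := dk_le_of_dk_le ha hζ.le hζ0
      have h2 : (1 : ℝ) ≤ 2 ^ j := one_le_pow₀ (by norm_num)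
      show dk ζ ζ0 < _
      rw [← hδ] at h1
      have h3 : (K + 2) * δ * 1 ≤ (K + 2) * δ * 2 ^ j := by gcongr
      rw [hC1]; nlinarith
    rw [indicator_of_mem hmem, mul_comm]
    refine mul_le_mul_left (ENNReal.ofReal_le_ofReal (pow_le_pow_left₀ (by positivity) ?_ _)) _
    rw [div_le_div_iff₀ hd0 (by positivity)]
    linarith
  refine (lintegral_mono_ae key).trans ?_
  rw [lintegral_tsum fun j => ((hU.indicator (measurableSet_KB _ _)).const_mul _).aemeasurable]
  have hsum : ∀ j : ℕ, ∫⁻ ζ, ENNReal.ofReal ((1 / 2 ^ j) ^ (n + 1)) * (KB ζ0 (C1 * 2 ^ j * δ)).indicator U ζ ∂(tau (En n)) ≤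
      ENNReal.ofReal ((1 / 2) ^ j * (C1 ^ n * δ ^ n)) * MM U ζ0 := by
    intro j
    rw [lintegral_const_mul' _ _ ENNReal.ofReal_ne_top, lintegral_indicator (measurableSet_KB _ _)]
    have hp : 0 < C1 * 2 ^ j * δ := by positivity
    refine (mul_le_mul_right (le_MM U hζ0 hp (by rw [dk_self hζ0]; exact hp)) _).trans (le_of_eq ?_)
    rw [← mul_assoc, ← ENNReal.ofReal_mul (by positivity)]
    congr 2
    rw [mul_pow, mul_pow, pow_succ, one_div, one_div, inv_pow, inv_pow]
    field_simp
  refine (ENNReal.tsum_le_tsum hsum).trans ?_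
  rw [ENNReal.tsum_mul_right]
  refine mul_le_mul_left (le_of_eq ?_) _
  have hs : HasSum (fun j : ℕ => (1 / 2 : ℝ) ^ j * (C1 ^ n * δ ^ n)) (2 * (C1 ^ n * δ ^ n)) := hasSum_geometric_two.mul_right _
  rw [← ENNReal.ofReal_tsum_of_nonneg (fun j => by positivity) hs.summable, hs.tsum_eq, mul_assoc]

end Boundary

section Growth2

lemma enorm_mul_pow_rpow {x y : ℂ} {k : ℕ} {s : ℝ} (hs : 0 ≤ s) : ‖x * y ^ k‖ₑ ^ s = ‖x‖ₑ ^ s * ENNReal.ofReal (‖y‖ ^ (k * s)) := by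
  rw [enorm_mul, ENNReal.mul_rpow_of_nonneg _ _ hs, enorm_pow, ← ENNReal.rpow_natCast, ← ENNReal.rpow_mul,
    ← ofReal_norm y, ENNReal.ofReal_rpow_of_nonneg (norm_nonneg _) (by positivity)]

lemma lintegral_FF_le_MM (n : ℕ) {K : ℝ} (hK : 0 ≤ K) : ∃ C : ℝ, 0 < C ∧ ∀ (g : En n → ℂ) (R s : ℝ) (k : ℕ) (a ζ0 : En n),
    DifferentiableOn ℂ g (ball 0 R) → 1 < R → 0 < s → (n + 1 : ℝ) ≤ k * s → ‖a‖ < 1 →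
    ‖ζ0‖ = 1 → dk a ζ0 ≤ K * (1 - ‖a‖) →
    ∫⁻ ζ, ‖g ζ * FF a ζ ^ k‖ₑ ^ s ∂(tau (En n)) ≤ ENNReal.ofReal (C * (1 - ‖a‖) ^ n) * MM (bd g s) ζ0 := by
  obtain ⟨C, hC, h⟩ := exists_kernel_le_MM n hK
  refine ⟨C, hC, fun g R s k a ζ0 hg hR hs hk ha hζ0 hd => le_trans (lintegral_mono_ae ?_)
    (h (bd g s) a ζ0 (measurable_bd hg hR s) ha hζ0 hd)⟩
  filter_upwards [bd_ae g s, tau_ae_norm (E := En n)] with ζ h1 h2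
  rw [enorm_mul_pow_rpow hs.le, h1]
  gcongr
  have h3 := norm_FF_le ha h2.le
  rw [← norm_FF ha.le]
  by_cases h0 : ‖FF a ζ‖ = 0
  · rw [h0, Real.zero_rpow (by linarith [(Nat.cast_nonneg n : (0 : ℝ) ≤ n)])]; simp
  · rw [← Real.rpow_natCast]
    exact Real.rpow_le_rpow_of_exponent_ge (lt_of_le_of_ne (norm_nonneg _) (Ne.symm h0)) h3 (by push_cast; exact hk)

/-- Values in admissible regions are dominated by the maximal function of the boundary values. -/
lemma exists_le_MM (n : ℕ) [NeZero n] {K s : ℝ} (hK : 0 ≤ K) (hs : 0 < s) : ∃ C : ℝ, 0 < C ∧ ∀ (g : En n → ℂ) (R : ℝ) (a ζ0 : En n),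
    DifferentiableOn ℂ g (ball 0 R) → 1 < R → ‖a‖ < 1 → ‖ζ0‖ = 1 → dk a ζ0 ≤ K * (1 - ‖a‖) →
    ‖g a‖ₑ ^ s ≤ ENNReal.ofReal C * MM (bd g s) ζ0 := by
  obtain ⟨C1, hC1, hgr⟩ := exists_growth n
  obtain ⟨C2, hC2, hMM⟩ := lintegral_FF_le_MM n hK
  obtain ⟨k, hk⟩ := exists_nat_ge ((n + 1 : ℝ) / s)
  rw [div_le_iff₀ hs] at hk
  refine ⟨2 ^ (k * s) * (C1 * C2), by positivity, fun g R a ζ0 hg hR ha hζ0 hd => ?_⟩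
  have hδ : 0 < 1 - ‖a‖ := by linarith
  have h1 := hgr _ _ s (differentiableOn_mul_FF ha hg k) (lt_min hR (one_lt_radius ha)) hs a ha
  have h2 := h1.trans (mul_le_mul_right (hMM g R s k a ζ0 hg hR hs hk ha hζ0 hd) _)
  rw [enorm_mul_pow_rpow hs.le, ← mul_assoc, ← ENNReal.ofReal_mul (by positivity)] at h2
  have h3 : ENNReal.ofReal ((1 / 2) ^ (k * s)) ≤ ENNReal.ofReal (‖FF a a‖ ^ (k * s)) :=
    ENNReal.ofReal_le_ofReal (Real.rpow_le_rpow (by norm_num) (norm_FF_self ha) (by positivity))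
  have h4 := (mul_le_mul_right h3 (‖g a‖ₑ ^ s)).trans h2
  have h5 := mul_le_mul_right h4 (ENNReal.ofReal (2 ^ (k * s)))
  have e : (2 : ℝ) ^ (k * s) * (1 / 2) ^ (k * s) = 1 := by
    rw [← Real.mul_rpow (by norm_num) (by norm_num)]; norm_num
  rw [mul_comm (‖g a‖ₑ ^ s), ← mul_assoc, ← mul_assoc, ← ENNReal.ofReal_mul (by positivity), e, ENNReal.ofReal_one, one_mul,
    ← ENNReal.ofReal_mul (by positivity)] at h5
  refine h5.trans (mul_le_mul_left (ENNReal.ofReal_le_ofReal (le_of_eq ?_)) _)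
  field_simp

end Growth2

section QuadForm
variable {n : ℕ}

lemma clm_quad_add_le {z : En n} (hz : ‖z‖ ≤ 1) (l m : En n →L[ℂ] ℂ) :
    ‖l + m‖ ^ 2 - ‖(l + m) z‖ ^ 2 ≤ 2 * (‖l‖ ^ 2 - ‖l z‖ ^ 2) + 2 * (‖m‖ ^ 2 - ‖m z‖ ^ 2) := by
  have hp : ∀ x y : ℂ, ‖x + y‖ ^ 2 + ‖x - y‖ ^ 2 = 2 * (‖x‖ ^ 2 + ‖y‖ ^ 2) := fun x y => by
    have := parallelogram_law_with_norm ℂ x y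
    nlinarith
  have h1 : ‖l + m‖ ^ 2 + ‖l - m‖ ^ 2 = 2 * (‖l‖ ^ 2 + ‖m‖ ^ 2) := by
    rw [norm_sq_clm, norm_sq_clm, norm_sq_clm, norm_sq_clm, ← Finset.sum_add_distrib, ← Finset.sum_add_distrib, Finset.mul_sum]
    exact Finset.sum_congr rfl fun i _ => hp _ _
  have h2 := hp (l z) (m z)
  have h3 : ‖(l - m) z‖ ^ 2 ≤ ‖l - m‖ ^ 2 := by
    gcongr
    exact ((l - m).le_opNorm z).trans (mul_le_of_le_one_right (norm_nonneg _) hz)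
  rw [sub_apply] at h3
  rw [add_apply]
  linarith

end QuadForm

section Tent
variable {n : ℕ} {g : En n → ℂ} {R : ℝ} {a z : En n}

lemma N2_FF_le (ha : ‖a‖ < 1) (hz : ‖z‖ < 1) : N2 (FF a) z ≤ 2 * ‖FF a z‖ ^ 3 / (1 - ‖a‖) := by
  have hz' := hz.trans (one_lt_radius ha)
  have hδ : 0 < 1 - ‖a‖ := by linarith
  have hd : 0 < dk z a := by linarith [delta_le_dk (a := a) hz.le]
  rw [N2, (hasFDerivAt_FF ha hz').fderiv, norm_FF ha.le]
  have h1 : ‖(((1 - ‖a‖ : ℝ) : ℂ) / (1 - inner ℂ a z) ^ 2)‖ = (1 - ‖a‖) / dk z a ^ 2 := by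
    rw [norm_div, norm_pow, Complex.norm_of_nonneg hδ.le, dk]
  have h2 : ‖((((1 - ‖a‖ : ℝ) : ℂ) / (1 - inner ℂ a z) ^ 2) • innerSL ℂ a : En n →L[ℂ] ℂ)‖ = (1 - ‖a‖) / dk z a ^ 2 * ‖a‖ := by
    rw [norm_smul, h1, innerSL_apply_norm]
  have h3 : ‖((((1 - ‖a‖ : ℝ) : ℂ) / (1 - inner ℂ a z) ^ 2) • innerSL ℂ a : En n →L[ℂ] ℂ) z‖ = (1 - ‖a‖) / dk z a ^ 2 * ‖inner ℂ a z‖ := by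
    simp only [smul_apply, smul_eq_mul, norm_mul, h1]; simp
  rw [h2, h3]
  have h4 : 1 - ‖inner ℂ a z‖ ≤ dk z a := by
    have := norm_sub_norm_le (1 : ℂ) (inner ℂ a z)
    rwa [norm_one] at this
  have h5 : ‖a‖ ^ 2 - ‖inner ℂ a z‖ ^ 2 ≤ 2 * dk z a := by
    nlinarith [norm_nonneg a, norm_nonneg (inner ℂ a z), sq_nonneg (1 - ‖inner ℂ a z‖)]
  have e : ((1 - ‖a‖) / dk z a ^ 2 * ‖a‖) ^ 2 - ((1 - ‖a‖) / dk z a ^ 2 * ‖inner ℂ a z‖) ^ 2 =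
      (1 - ‖a‖) ^ 2 / dk z a ^ 4 * (‖a‖ ^ 2 - ‖inner ℂ a z‖ ^ 2) := by ring
  rw [e]
  refine (mul_le_mul_of_nonneg_left h5 (by positivity)).trans (le_of_eq ?_)
  field_simp

lemma N2_mul_FF_le (hg : DifferentiableOn ℂ g (ball 0 R)) (hR : 1 < R) (ha : ‖a‖ < 1) (hz : ‖z‖ < 1) (k : ℕ) :
    ‖FF a z‖ ^ (2 * (k + 1)) * N2 g z ≤ 2 * N2 (fun w => g w * FF a w ^ (k + 1)) z +
      4 * (k + 1) ^ 2 * ‖FF a z‖ / (1 - ‖a‖) * ‖g z * FF a z ^ (k + 1)‖ ^ 2 := by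
  have hz' := hz.trans (one_lt_radius ha)
  have hδ : 0 < 1 - ‖a‖ := by linarith
  have hdg : HasFDerivAt g (fderiv ℂ g z) z :=
    (hg.differentiableAt (isOpen_ball.mem_nhds (by simpa using hz.trans hR))).hasFDerivAt
  have hdF := (hasFDerivAt_FF ha hz').differentiableAt.hasFDerivAt
  set DF := fderiv ℂ (FF a) z with hDF
  have hdG : fderiv ℂ (fun w => g w * FF a w ^ (k + 1)) z =
      FF a z ^ (k + 1) • fderiv ℂ g z + (g z * ((k + 1) * FF a z ^ k)) • DF := by
    have := (hdg.mul (hdF.pow (k + 1))).fderiv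
    refine this.trans ?_
    ext v
    simp
    ring
  have hN : ∀ (c : ℂ) (l : En n →L[ℂ] ℂ), ‖c • l‖ ^ 2 - ‖(c • l) z‖ ^ 2 = ‖c‖ ^ 2 * (‖l‖ ^ 2 - ‖l z‖ ^ 2) := fun c l => by
    rw [smul_apply, norm_smul, norm_smul]; ring
  have e : FF a z ^ (k + 1) • fderiv ℂ g z = fderiv ℂ (fun w => g w * FF a w ^ (k + 1)) z +
      (-(g z * ((k + 1) * FF a z ^ k))) • DF := by
    rw [hdG]; module
  have h1 := clm_quad_add_le hz.le (fderiv ℂ (fun w => g w * FF a w ^ (k + 1)) z) ((-(g z * ((k + 1) * FF a z ^ k))) • DF)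
  rw [← e, hN, hN] at h1
  have h2 := N2_FF_le ha hz
  unfold N2 at h2 ⊢
  have h3 := mul_le_mul_of_nonneg_left h2 (sq_nonneg ‖-(g z * ((k + 1) * FF a z ^ k))‖)
  have e1 : ‖FF a z ^ (k + 1)‖ ^ 2 = ‖FF a z‖ ^ (2 * (k + 1)) := by rw [norm_pow, ← pow_mul, mul_comm]
  have e3 : ‖((k : ℂ) + 1)‖ = (k : ℝ) + 1 := by
    have : ((k : ℂ) + 1) = ((k + 1 : ℝ) : ℂ) := by push_cast; rfl
    rw [this, Complex.norm_of_nonneg (by positivity)]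
  have e2 : ‖-(g z * ((k + 1) * FF a z ^ k))‖ ^ 2 * (2 * ‖FF a z‖ ^ 3 / (1 - ‖a‖)) * 2 =
      4 * (k + 1) ^ 2 * ‖FF a z‖ / (1 - ‖a‖) * ‖g z * FF a z ^ (k + 1)‖ ^ 2 := by
    rw [norm_neg, norm_mul, norm_mul, norm_mul, norm_pow, norm_pow, e3]; ring
  rw [e1] at h1
  rw [← e2]
  linarith

lemma enorm_rpow_sub_two_mul {x : ℂ} {s : ℝ} (hs : 0 < s) : ‖x‖ₑ ^ (s - 2) * ENNReal.ofReal (‖x‖ ^ 2) ≤ ‖x‖ₑ ^ s := by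
  by_cases h : x = 0
  · simp [h, hs]
  · rw [ENNReal.ofReal_pow (norm_nonneg _), ofReal_norm, ← ENNReal.rpow_two, ← ENNReal.rpow_add _ _ (by simpa using h) enorm_ne_top]
    simp

lemma enorm_mul_rpow_sub {x y : ℂ} (hy : y ≠ 0) (s : ℝ) : ‖x * y‖ₑ ^ s = ‖x‖ₑ ^ s * ENNReal.ofReal (‖y‖ ^ s) := by
  rw [enorm_mul, ENNReal.mul_rpow_of_ne_top enorm_ne_top enorm_ne_top,
    ← ofReal_norm y, ENNReal.ofReal_rpow_of_pos (norm_pos_iff.2 hy)]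

lemma lintegral_radial_le {δ s : ℝ} (hδ : 0 < δ) (hs : 0 < s) :
    ∫⁻ r in Ioo (0 : ℝ) 1, ENNReal.ofReal ((2 * δ / ((1 - r) + δ)) ^ (s + 1) / δ) ≤ ENNReal.ofReal (2 ^ (s + 1) / s) := by
  have hd : ∀ x ∈ Icc (0 : ℝ) 1, HasDerivAt (fun r : ℝ => 2 ^ (s + 1) * δ ^ s / s * ((1 - r) + δ) ^ (-s))
      ((2 * δ / ((1 - x) + δ)) ^ (s + 1) / δ) x := by
    intro x hx
    have hp : 0 < (1 - x) + δ := by linarith [hx.2]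
    have h1 : HasDerivAt (fun r : ℝ => (1 - r) + δ) (-1) x := ((hasDerivAt_id x).const_sub 1).add_const δ
    refine ((h1.rpow_const (p := -s) (Or.inl hp.ne')).const_mul _).congr_deriv ?_
    rw [Real.div_rpow (by positivity) hp.le, Real.mul_rpow (by norm_num) hδ.le, Real.rpow_add_one hδ.ne',
      show -s - 1 = -(s + 1) by ring, Real.rpow_neg hp.le]
    field_simp
  refine (lintegral_deriv_le (fun x hx => (hd x hx).continuousAt.continuousWithinAt) (fun x hx => hd x ⟨hx.1.le, hx.2.le⟩)
    fun x hx => ?_).trans (ENNReal.ofReal_le_ofReal ?_)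
  · have hp : 0 < (1 - x) + δ := by linarith [hx.2]
    positivity
  · have : 0 ≤ 2 ^ (s + 1) * δ ^ s / s * ((1 - 0) + δ) ^ (-s) := by positivity
    refine (sub_le_self _ this).trans (le_of_eq ?_)
    rw [sub_self, zero_add, Real.rpow_neg hδ.le]
    field_simp

lemma lintegral_mul_FF_le [NeZero n] (hg : DifferentiableOn ℂ g (ball 0 R)) (hR : 1 < R) (ha : ‖a‖ < 1) {s : ℝ} (hs : 0 < s) (k : ℕ) :
    ∫⁻ z in ball 0 1, ENNReal.ofReal (‖FF a z‖ / (1 - ‖a‖)) * ‖g z * FF a z ^ (k + 1)‖ₑ ^ s ≤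
      ENNReal.ofReal (2 ^ (s + 1) / s) * ∫⁻ ζ, ‖g ζ * FF a ζ ^ k‖ₑ ^ s ∂(tau (En n)) := by
  set δ := 1 - ‖a‖ with hδ
  have hδ0 : 0 < δ := by rw [hδ]; linarith
  set h : En n → ℂ := fun z => g z * FF a z ^ k with hh
  have hdh := differentiableOn_mul_FF ha hg k
  set R' := min R (2 / (1 + ‖a‖))
  have hR' : 1 < R' := lt_min hR (one_lt_radius ha)
  have hsub : ball (0 : En n) 1 ⊆ ball 0 R' := ball_subset_ball hR'.le
  have hm : Measurable ((ball (0 : En n) 1).indicator fun z => ‖h z‖ₑ ^ s) :=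
    ContinuousOn.measurable_indicator measurableSet_ball
      (ENNReal.continuous_rpow_const.comp_continuousOn (hdh.continuousOn.mono hsub).enorm)
  set ρ : En n → ℝ≥0∞ := fun z => ENNReal.ofReal ((2 * δ / ((1 - ‖z‖) + δ)) ^ (s + 1) / δ) with hρ
  have hρm : Measurable ρ := by
    refine ENNReal.measurable_ofReal.comp ?_
    exact ((measurable_const.div ((measurable_const.sub measurable_norm).add_const _)).pow_const _).div_const _
  calc _ ≤ ∫⁻ z in ball 0 1, ρ z * (ball (0 : En n) 1).indicator (fun z => ‖h z‖ₑ ^ s) z := by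
        refine setLIntegral_mono' measurableSet_ball fun z hz => ?_
        rw [indicator_of_mem hz]
        have hz1 : ‖z‖ < 1 := by simpa using hz
        have e : g z * FF a z ^ (k + 1) = h z * FF a z ^ 1 := by rw [hh]; ring
        rw [e, enorm_mul_pow_rpow hs.le, mul_left_comm, ← ENNReal.ofReal_mul (by positivity), mul_comm]
        refine mul_le_mul_left (ENNReal.ofReal_le_ofReal ?_) _
        have hd : 0 < dk z a := by linarith [delta_le_dk (a := a) hz1.le]
        have hF : ‖FF a z‖ ≤ 2 * δ / ((1 - ‖z‖) + δ) := by
          have hp : 0 < (1 - ‖z‖) + δ := by linarith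
          rw [norm_FF ha.le, div_le_div_iff₀ hd hp]
          have := one_sub_mul_le_dk a z
          have h3 : 1 - ‖z‖ + δ ≤ 2 * dk z a := by
            rw [hδ]; nlinarith [norm_nonneg z, norm_nonneg a]
          nlinarith
        calc ‖FF a z‖ / δ * ‖FF a z‖ ^ (((1 : ℕ) : ℝ) * s) = ‖FF a z‖ ^ (s + 1) / δ := by
              rw [Nat.cast_one, one_mul, Real.rpow_add_one' (norm_nonneg _) (by positivity)]; ring
          _ ≤ _ := by gcongr
    _ = ∫⁻ r in Ioo (0 : ℝ) 1, ENNReal.ofReal (r ^ (Module.finrank ℝ (En n) - 1)) *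
          ∫⁻ ζ, ρ (r • ζ) * (ball (0 : En n) 1).indicator (fun z => ‖h z‖ₑ ^ s) (r • ζ) ∂(tau (En n)) :=
        lintegral_polar_ball (hρm.mul hm)
    _ ≤ ∫⁻ r in Ioo (0 : ℝ) 1, ENNReal.ofReal ((2 * δ / ((1 - r) + δ)) ^ (s + 1) / δ) * ∫⁻ ζ, ‖h ζ‖ₑ ^ s ∂(tau (En n)) := by
        refine setLIntegral_mono' measurableSet_Ioo fun r hr => ?_
        have h1 : ENNReal.ofReal (r ^ (Module.finrank ℝ (En n) - 1)) ≤ 1 := by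
          rw [← ENNReal.ofReal_one]; exact ENNReal.ofReal_le_ofReal (pow_le_one₀ hr.1.le hr.2.le)
        refine (mul_le_of_le_one_left zero_le h1).trans ?_
        have h2 := lintegral_mono_dilate hdh hs hr.1.le hr.2.le hR'
        simp only [one_smul] at h2
        refine le_trans ?_ (mul_le_mul_right h2 _)
        rw [← lintegral_const_mul' _ _ ENNReal.ofReal_ne_top]
        refine lintegral_mono_ae ?_
        filter_upwards [tau_ae_norm (E := En n)] with ζ hζ
        have : ‖r • ζ‖ = r := by rw [norm_smul, hζ, Real.norm_of_nonneg hr.1.le, mul_one]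
        simp only [hρ, this]
        exact mul_le_mul_right (indicator_le_self _ _ _) _
    _ ≤ _ := by
        rw [lintegral_mul_const _ (by fun_prop)]
        exact mul_le_mul_left (lintegral_radial_le hδ0 hs) _

/-- The density of the energy of `|g| ^ (s / 2)`. -/
def EE (g : En n → ℂ) (s : ℝ) (z : En n) : ℝ≥0∞ := ‖g z‖ₑ ^ (s - 2) * ENNReal.ofReal (N2 g z)

lemma exists_tent_aux (n : ℕ) [NeZero n] {s : ℝ} (hs : 0 < s) (k : ℕ) : ∃ C : ℝ, 0 < C ∧ ∀ (g : En n → ℂ) (R : ℝ) (a : En n),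
    DifferentiableOn ℂ g (ball 0 R) → 1 < R → ‖a‖ < 1 →
    ∫⁻ z in ball 0 1, ENNReal.ofReal (‖FF a z‖ ^ ((k + 1) * s)) * EE g s z ≤
      ENNReal.ofReal C * ∫⁻ ζ, ‖g ζ * FF a ζ ^ k‖ₑ ^ s ∂(tau (En n)) := by
  set C0 : ℝ := 2 * n / (4 * (s / 2) * min (s / 2) 1) with hC0
  have hC0' : 0 ≤ C0 := by positivity
  refine ⟨2 * C0 + 4 * (k + 1) ^ 2 * (2 ^ (s + 1) / s), by positivity, fun g R a hg hR ha => ?_⟩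
  set δ := 1 - ‖a‖ with hδ
  have hδ0 : 0 < δ := by rw [hδ]; linarith
  set G : En n → ℂ := fun z => g z * FF a z ^ (k + 1) with hG
  have hdG := differentiableOn_mul_FF ha hg (k + 1)
  set R' := min R (2 / (1 + ‖a‖))
  have hR' : 1 < R' := lt_min hR (one_lt_radius ha)
  have hF1 := lintegral_N2_le hdG hR' hs
  have hF2 := lintegral_mul_FF_le hg hR ha hs k
  have hmono : ∫⁻ ζ, ‖G ζ‖ₑ ^ s ∂(tau (En n)) ≤ ∫⁻ ζ, ‖g ζ * FF a ζ ^ k‖ₑ ^ s ∂(tau (En n)) := by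
    refine lintegral_mono_ae ?_
    filter_upwards [tau_ae_norm (E := En n)] with ζ hζ
    refine ENNReal.rpow_le_rpow ?_ hs.le
    have e : G ζ = g ζ * FF a ζ ^ k * FF a ζ := by rw [hG]; ring
    rw [e, enorm_mul]
    refine mul_le_of_le_one_right zero_le ?_
    rw [← ofReal_norm, ← ENNReal.ofReal_one]
    exact ENNReal.ofReal_le_ofReal (norm_FF_le ha hζ.le)
  set I := ∫⁻ ζ, ‖g ζ * FF a ζ ^ k‖ₑ ^ s ∂(tau (En n))
  have hmeas : AEMeasurable (fun z => ENNReal.ofReal (4 * (k + 1) ^ 2) * (ENNReal.ofReal (‖FF a z‖ / δ) * ‖G z‖ₑ ^ s))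
      (volume.restrict (ball (0 : En n) 1)) := by
    have hFc : ContinuousOn (FF a) (ball (0 : En n) 1) := (differentiableOn_FF ha).continuousOn.mono (ball_subset_ball (one_lt_radius ha).le)
    have hGc : ContinuousOn G (ball (0 : En n) 1) := hdG.continuousOn.mono (ball_subset_ball hR'.le)
    refine (AEMeasurable.mul ?_ ?_).const_mul _
    · exact (ENNReal.continuous_ofReal.comp_continuousOn (hFc.norm.div_const δ)).aemeasurable measurableSet_ball
    · exact (ENNReal.continuous_rpow_const.comp_continuousOn hGc.enorm).aemeasurable measurableSet_ball
  calc _ ≤ ∫⁻ z in ball 0 1, (ENNReal.ofReal 2 * (‖G z‖ₑ ^ (s - 2) * ENNReal.ofReal (N2 G z)) +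
          ENNReal.ofReal (4 * (k + 1) ^ 2) * (ENNReal.ofReal (‖FF a z‖ / δ) * ‖G z‖ₑ ^ s)) := by
        refine setLIntegral_mono' measurableSet_ball fun z hz => ?_
        have hz1 : ‖z‖ < 1 := by simpa using hz
        have hd : 0 < dk z a := by linarith [delta_le_dk (a := a) hz1.le]
        have hF0 : 0 < ‖FF a z‖ := by rw [norm_FF ha.le]; positivity
        have h1 := ENNReal.ofReal_le_ofReal (N2_mul_FF_le hg hR ha hz1 k)
        rw [ENNReal.ofReal_add (by have := N2_nonneg (g := G) hz1.le; positivity) (by positivity)] at h1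
        have h2 := mul_le_mul_right h1 (‖G z‖ₑ ^ (s - 2))
        have e0 : ‖G z‖ₑ ^ (s - 2) = ‖g z‖ₑ ^ (s - 2) * ENNReal.ofReal (‖FF a z ^ (k + 1)‖ ^ (s - 2)) :=
          enorm_mul_rpow_sub (pow_ne_zero _ (norm_pos_iff.1 hF0)) _
        have e1 : ENNReal.ofReal (‖FF a z‖ ^ ((k + 1) * s)) * EE g s z =
            ‖G z‖ₑ ^ (s - 2) * ENNReal.ofReal (‖FF a z‖ ^ (2 * (k + 1)) * N2 g z) := by
          have e2 : ‖FF a z‖ ^ ((k + 1) * s) = ‖FF a z ^ (k + 1)‖ ^ (s - 2) * ‖FF a z‖ ^ (2 * (k + 1)) := by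
            rw [norm_pow, ← Real.rpow_natCast, ← Real.rpow_natCast, ← Real.rpow_mul (norm_nonneg _), ← Real.rpow_add hF0]
            congr 1; push_cast; ring
          rw [e0, EE, e2, ENNReal.ofReal_mul (by positivity), ENNReal.ofReal_mul (by positivity)]
          ring
        rw [e1]
        refine h2.trans ?_
        rw [mul_add]
        refine add_le_add (le_of_eq ?_) ?_
        · rw [ENNReal.ofReal_mul (by norm_num), mul_left_comm]
        · rw [mul_div_assoc, ENNReal.ofReal_mul (by positivity), ENNReal.ofReal_mul (by positivity), mul_left_comm, mul_assoc]
          exact mul_le_mul_right (mul_le_mul_right (enorm_rpow_sub_two_mul hs) _) _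
    _ = ENNReal.ofReal 2 * (∫⁻ z in ball 0 1, ‖G z‖ₑ ^ (s - 2) * ENNReal.ofReal (N2 G z)) +
          ENNReal.ofReal (4 * (k + 1) ^ 2) * ∫⁻ z in ball 0 1, ENNReal.ofReal (‖FF a z‖ / δ) * ‖G z‖ₑ ^ s := by
        rw [lintegral_add_right' _ hmeas, lintegral_const_mul' _ _ ENNReal.ofReal_ne_top, lintegral_const_mul' _ _ ENNReal.ofReal_ne_top]
    _ ≤ ENNReal.ofReal 2 * (ENNReal.ofReal C0 * I) + ENNReal.ofReal (4 * (k + 1) ^ 2) * (ENNReal.ofReal (2 ^ (s + 1) / s) * I) := by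
        gcongr
        exact hF1.trans (mul_le_mul_right hmono _)
    _ = _ := by
        rw [← mul_assoc, ← mul_assoc, ← ENNReal.ofReal_mul (by norm_num), ← ENNReal.ofReal_mul (by positivity), ← add_mul,
          ← ENNReal.ofReal_add (by positivity) (by positivity)]

/-- Carleson-type tent estimate for the energy measure. -/
lemma exists_tent (n : ℕ) [NeZero n] {K K' s : ℝ} (hK : 0 ≤ K) (hK' : 0 < K') (hs : 0 < s) :
    ∃ C : ℝ, 0 < C ∧ ∀ (g : En n → ℂ) (R : ℝ) (a ζ0 : En n),
    DifferentiableOn ℂ g (ball 0 R) → 1 < R → ‖a‖ < 1 → ‖ζ0‖ = 1 → dk a ζ0 ≤ K * (1 - ‖a‖) →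
    ∫⁻ z in ball 0 1 ∩ KB a (K' * (1 - ‖a‖)), EE g s z ≤ ENNReal.ofReal (C * (1 - ‖a‖) ^ n) * MM (bd g s) ζ0 := by
  obtain ⟨C2, hC2, hMM⟩ := lintegral_FF_le_MM n hK
  obtain ⟨k, hk⟩ := exists_nat_ge ((n + 1 : ℝ) / s)
  rw [div_le_iff₀ hs] at hk
  obtain ⟨C1, hC1, h1⟩ := exists_tent_aux n hs k
  refine ⟨K' ^ ((k + 1) * s) * (C1 * C2), by positivity, fun g R a ζ0 hg hR ha hζ0 hd => ?_⟩
  set δ := 1 - ‖a‖ with hδ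
  have hδ0 : 0 < δ := by rw [hδ]; linarith
  calc _ ≤ ∫⁻ z in ball 0 1 ∩ KB a (K' * δ), ENNReal.ofReal (K' ^ ((k + 1) * s)) *
          (ENNReal.ofReal (‖FF a z‖ ^ ((k + 1) * s)) * EE g s z) := by
        refine setLIntegral_mono' (measurableSet_ball.inter (measurableSet_KB _ _)) fun z hz => ?_
        have hz1 : ‖z‖ < 1 := by simpa using hz.1
        have hz2 : dk z a < K' * δ := hz.2
        have hd : 0 < dk z a := by linarith [delta_le_dk (a := a) hz1.le]
        rw [← mul_assoc, ← ENNReal.ofReal_mul (by positivity), ← Real.mul_rpow hK'.le (norm_nonneg _)]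
        have : 1 ≤ (K' * ‖FF a z‖) ^ ((k + 1) * s) := by
          refine Real.one_le_rpow ?_ (by positivity)
          rw [norm_FF ha.le, ← mul_div_assoc, le_div_iff₀ hd]; linarith
        exact le_mul_of_one_le_left zero_le (by rw [← ENNReal.ofReal_one]; exact ENNReal.ofReal_le_ofReal this)
    _ ≤ ENNReal.ofReal (K' ^ ((k + 1) * s)) * ∫⁻ z in ball 0 1, ENNReal.ofReal (‖FF a z‖ ^ ((k + 1) * s)) * EE g s z := by
        rw [lintegral_const_mul' _ _ ENNReal.ofReal_ne_top]
        exact mul_le_mul_right (lintegral_mono_set inter_subset_left) _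
    _ ≤ ENNReal.ofReal (K' ^ ((k + 1) * s)) * (ENNReal.ofReal C1 * (ENNReal.ofReal (C2 * δ ^ n) * MM (bd g s) ζ0)) := by
        gcongr
        exact (h1 g R a hg hR ha).trans (mul_le_mul_right (hMM g R s k a ζ0 hg hR hs hk ha hζ0 hd) _)
    _ = _ := by
        rw [← mul_assoc, ← mul_assoc, ← ENNReal.ofReal_mul (by positivity), ← ENNReal.ofReal_mul (by positivity)]
        congr 2; ring

end Tent

section Area
variable {n : ℕ} {g : En n → ℂ} {R : ℝ}

/-- The energy density, extended by zero off the unit ball. -/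
def EB (g : En n → ℂ) (s : ℝ) : En n → ℝ≥0∞ := (ball 0 1).indicator (EE g s)

/-- The truncated admissible region. -/
def Rg (α ρ : ℝ) (ζ : En n) : Set (En n) := {z | ‖z‖ < ρ ∧ dk z ζ < α / 2 * (1 - ‖z‖ ^ 2)}

/-- The weight `(1 - ‖z‖) ^ (-n)`. -/
def wt (z : En n) : ℝ≥0∞ := ENNReal.ofReal ((1 - ‖z‖) ^ n)⁻¹

/-- The square of the area function. -/
def AA (g : En n → ℂ) (s α ρ : ℝ) (ζ : En n) : ℝ≥0∞ := ∫⁻ z in Rg α ρ ζ, wt z * EB g s z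

lemma measurable_wt : Measurable (wt : En n → ℝ≥0∞) :=
  ENNReal.measurable_ofReal.comp ((measurable_const.sub measurable_norm).pow_const n).inv

lemma measurable_EB (hg : DifferentiableOn ℂ g (ball 0 1)) (s : ℝ) : Measurable (EB g s) := by
  have h1 : Measurable ((ball (0 : En n) 1).indicator fun z => ‖g z‖ₑ ^ (s - 2)) :=
    ContinuousOn.measurable_indicator measurableSet_ball
      (ENNReal.continuous_rpow_const.comp_continuousOn hg.continuousOn.enorm)
  have h2 : Measurable ((ball (0 : En n) 1).indicator fun z => ENNReal.ofReal (N2 g z)) :=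
    ContinuousOn.measurable_indicator measurableSet_ball
      (ENNReal.continuous_ofReal.comp_continuousOn (continuousOn_N2 isOpen_ball hg))
  have : EB g s = fun z => (ball (0 : En n) 1).indicator (fun z => ‖g z‖ₑ ^ (s - 2)) z *
      (ball (0 : En n) 1).indicator (fun z => ENNReal.ofReal (N2 g z)) z := by
    ext z
    by_cases hz : z ∈ ball (0 : En n) 1
    · simp only [EB, indicator_of_mem hz, EE]
    · simp only [EB, indicator_of_notMem hz, mul_zero]
  rw [this]
  exact h1.mul h2

lemma isOpen_region (α ρ : ℝ) : IsOpen {p : En n × En n | ‖p.1‖ < ρ ∧ dk p.1 p.2 < α / 2 * (1 - ‖p.1‖ ^ 2)} :=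
  IsOpen.inter (s := {p : En n × En n | ‖p.1‖ < ρ}) (isOpen_lt (by fun_prop) continuous_const)
    (isOpen_lt continuous_dk (by fun_prop : Continuous fun p : En n × En n => α / 2 * (1 - ‖p.1‖ ^ 2)))

lemma isOpen_Rg (α ρ : ℝ) (ζ : En n) : IsOpen (Rg α ρ ζ) :=
  (isOpen_region α ρ).preimage (f := fun z => (z, ζ)) (by fun_prop)

lemma measurable_region_indicator (α ρ : ℝ) {f : En n × En n → ℝ≥0∞} (hf : Measurable f) :
    Measurable ({p : En n × En n | ‖p.1‖ < ρ ∧ dk p.1 p.2 < α / 2 * (1 - ‖p.1‖ ^ 2)}.indicator f) :=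
  hf.indicator (isOpen_region α ρ).measurableSet

lemma lintegral_Rg (α ρ : ℝ) (f : En n → ℝ≥0∞) (ζ : En n) : ∫⁻ z in Rg α ρ ζ, f z =
    ∫⁻ z, {p : En n × En n | ‖p.1‖ < ρ ∧ dk p.1 p.2 < α / 2 * (1 - ‖p.1‖ ^ 2)}.indicator (fun p => f p.1) (z, ζ) := by
  rw [← lintegral_indicator (isOpen_Rg α ρ ζ).measurableSet]
  rfl

lemma measurable_AA (hg : DifferentiableOn ℂ g (ball 0 1)) (s α ρ : ℝ) : Measurable (AA g s α ρ) := by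
  unfold AA
  simp_rw [lintegral_Rg]
  exact Measurable.lintegral_prod_left'
    (measurable_region_indicator α ρ ((measurable_wt.mul (measurable_EB hg s)).comp measurable_fst))

lemma lintegral_AA_mul (hg : DifferentiableOn ℂ g (ball 0 1)) (s α ρ : ℝ) {φ : En n → ℝ≥0∞} (hφ : Measurable φ) :
    ∫⁻ ζ, AA g s α ρ ζ * φ ζ ∂(tau (En n)) =
      ∫⁻ z in ball 0 ρ, (wt z * ∫⁻ ζ in {ζ | dk z ζ < α / 2 * (1 - ‖z‖ ^ 2)}, φ ζ ∂(tau (En n))) * EB g s z := by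
  have hm := measurable_region_indicator α ρ ((measurable_wt.mul (measurable_EB hg s)).comp measurable_fst)
  set S := {p : En n × En n | ‖p.1‖ < ρ ∧ dk p.1 p.2 < α / 2 * (1 - ‖p.1‖ ^ 2)}
  have h1 : ∀ ζ, AA g s α ρ ζ * φ ζ = ∫⁻ z, S.indicator (fun p => wt p.1 * EB g s p.1) (z, ζ) * φ ζ := fun ζ => by
    rw [AA, lintegral_Rg, lintegral_mul_const]
    exact hm.comp (measurable_id.prodMk measurable_const)
  simp_rw [h1]
  rw [lintegral_lintegral_swap (Measurable.aemeasurable ?_), ← lintegral_indicator measurableSet_ball]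
  · refine lintegral_congr fun z => ?_
    have hms : MeasurableSet {ζ : En n | dk z ζ < α / 2 * (1 - ‖z‖ ^ 2)} :=
      (isOpen_lt (continuous_dk.comp (by fun_prop : Continuous fun ζ : En n => (z, ζ))) continuous_const).measurableSet
    by_cases hz : ‖z‖ < ρ
    · rw [indicator_of_mem (by simpa using hz), ← lintegral_indicator hms, mul_right_comm, ← lintegral_const_mul _ (hφ.indicator hms)]
      refine lintegral_congr fun ζ => ?_
      by_cases h : dk z ζ < α / 2 * (1 - ‖z‖ ^ 2)
      · rw [indicator_of_mem (show (z, ζ) ∈ S from ⟨hz, h⟩), indicator_of_mem (show ζ ∈ {ζ : En n | dk z ζ < α / 2 * (1 - ‖z‖ ^ 2)} from h)]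
      · rw [indicator_of_notMem (fun h' : (z, ζ) ∈ S => h h'.2), indicator_of_notMem (show ζ ∉ {ζ : En n | dk z ζ < α / 2 * (1 - ‖z‖ ^ 2)} from h),
          zero_mul, mul_zero]
    · rw [indicator_of_notMem (by simpa using hz), ← lintegral_zero (μ := tau (En n))]
      refine lintegral_congr fun ζ => ?_
      rw [indicator_of_notMem (fun h' : (z, ζ) ∈ S => hz h'.1), zero_mul]
  · exact (hm.comp (measurable_snd.prodMk measurable_fst)).mul (hφ.comp measurable_fst)

/-- A unit vector in the direction of `z`. -/
lemma exists_direction [NeZero n] (z : En n) : ∃ η : En n, ‖η‖ = 1 ∧ z = ‖z‖ • η := by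
  by_cases h : z = 0
  · obtain ⟨η, hη⟩ := exists_norm_eq (En n) (zero_le_one (α := ℝ))
    exact ⟨η, hη, by simp [h]⟩
  · have h0 := norm_ne_zero_iff.2 h
    exact ⟨‖z‖⁻¹ • z, by rw [norm_smul, norm_inv, norm_norm, inv_mul_cancel₀ h0], by rw [smul_smul, mul_inv_cancel₀ h0, one_smul]⟩

lemma dk_direction {z η w : En n} (hη : ‖η‖ = 1) (hz : z = ‖z‖ • η) (hz1 : ‖z‖ ≤ 1) (hw : ‖w‖ ≤ 1) : dk η w ≤ dk z w + (1 - ‖z‖) := by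
  have e : (1 : ℂ) - inner ℂ w η = (1 - inner ℂ w z) - (1 - ‖z‖ : ℝ) * inner ℂ w η := by
    have : inner ℂ w z = (‖z‖ : ℂ) * inner ℂ w η := by
      conv_lhs => rw [hz]
      rw [RCLike.real_smul_eq_coe_smul (K := ℂ), inner_smul_right]; simp
    rw [this]; push_cast; ring
  have h2 : ‖inner ℂ w η‖ ≤ 1 := (norm_inner_le_norm w η).trans (by rw [hη, mul_one]; exact hw)
  unfold dk
  rw [e]
  refine (norm_sub_le _ _).trans ?_
  rw [norm_mul, Complex.norm_of_nonneg (by linarith)]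
  nlinarith

/-- Duality estimate for measures satisfying a tent condition relative to `V`. -/
lemma exists_duality (n : ℕ) [NeZero n] {α : ℝ} (hα : 1 < α) : ∃ C : ℝ, 0 < C ∧ ∀ (C0 : ℝ) (μ : Measure (En n)) (V φ : En n → ℝ≥0∞), 0 < C0 → SFinite μ →
    Measurable V → Measurable φ →
    (∀ a ζ0 : En n, ‖a‖ < 1 → ‖ζ0‖ = 1 → dk a ζ0 ≤ (α + 2) * (1 - ‖a‖) →
      μ (ball 0 1 ∩ KB a ((18 * (α + 1) + 1) * (1 - ‖a‖))) ≤ ENNReal.ofReal (C0 * (1 - ‖a‖) ^ n) * V ζ0) →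
    ∫⁻ z in ball 0 1, (wt z * ∫⁻ ζ in {ζ | dk z ζ < α / 2 * (1 - ‖z‖ ^ 2)}, φ ζ ∂(tau (En n))) ∂μ ≤
      ENNReal.ofReal (C * C0) * ∫⁻ ζ, MM φ ζ * V ζ ∂(tau (En n)) := by
  obtain ⟨c, hc, hlow⟩ := exists_le_tau_KB n
  refine ⟨(α + 1) ^ n / c, by positivity, fun C0 μ V φ hC0 hμ hV hφ hT => ?_⟩
  set Q : ℝ := (α + 1) ^ n with hQ
  have hQ0 : 0 < Q := by positivity
  set h : En n → ℝ≥0∞ := fun z => wt z * ∫⁻ ζ in {ζ | dk z ζ < α / 2 * (1 - ‖z‖ ^ 2)}, φ ζ ∂(tau (En n)) with hh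
  choose dir hdir1 hdir2 using fun z : En n => exists_direction z
  have hMM : ∀ z ξ : En n, ‖z‖ < 1 → ξ ∈ KB (dir z) ((α + 1) * (1 - ‖z‖)) → h z ≤ ENNReal.ofReal Q * MM φ ξ := by
    intro z ξ hz hξ
    have hδ : 0 < 1 - ‖z‖ := by linarith
    have h1 : ∫⁻ ζ in {ζ | dk z ζ < α / 2 * (1 - ‖z‖ ^ 2)}, φ ζ ∂(tau (En n)) ≤
        ∫⁻ ζ in KB (dir z) ((α + 1) * (1 - ‖z‖)), φ ζ ∂(tau (En n)) := by
      refine lintegral_mono_set' ?_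
      filter_upwards [tau_ae_norm (E := En n)] with ζ hζ hd
      have hd : dk z ζ < α / 2 * (1 - ‖z‖ ^ 2) := hd
      show dk ζ (dir z) < _
      rw [dk_comm]
      have := dk_direction (hdir1 z) (hdir2 z) hz.le hζ.le
      have h5 : α / 2 * (1 - ‖z‖ ^ 2) ≤ α * (1 - ‖z‖) := by
        rw [show α / 2 * (1 - ‖z‖ ^ 2) = α * (1 - ‖z‖) * ((1 + ‖z‖) / 2) by ring]
        exact mul_le_of_le_one_right (by positivity) (by linarith)
      linarith
    refine (mul_le_mul_right (h1.trans (le_MM φ (hdir1 z) (by positivity) hξ)) _).trans (le_of_eq ?_)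
    rw [wt, ← mul_assoc, ← ENNReal.ofReal_mul (by positivity)]
    congr 2
    rw [mul_pow]; field_simp; rfl
  have hlevel : ∀ s : ℝ, (μ.restrict (ball 0 1)) {z | ENNReal.ofReal s < h z} ≤
      ENNReal.ofReal (C0 / c) * ((tau (En n)).withDensity V) {ξ | ENNReal.ofReal s < ENNReal.ofReal Q * MM φ ξ} := by
    intro s
    obtain ⟨u, hut, huc, hud, hcov⟩ := vitali_KB
      ((fun z => (dir z, (α + 1) * (1 - ‖z‖))) '' {z : En n | ‖z‖ < 1 ∧ ENNReal.ofReal s < h z}) (α + 1) (by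
        rintro _ ⟨z, ⟨hz1, hz2⟩, rfl⟩
        have : 0 < 1 - ‖z‖ := by linarith
        exact ⟨hdir1 z, by positivity, by nlinarith [norm_nonneg z]⟩)
    set δ : En n × ℝ → ℝ := fun b => b.2 / (α + 1) with hδd
    set pt : En n × ℝ → En n := fun b => (1 - δ b) • b.1 with hpt
    have hb : ∀ b ∈ u, ‖b.1‖ = 1 ∧ 0 < δ b ∧ δ b ≤ 1 ∧ ‖pt b‖ = 1 - δ b ∧ b.2 = (α + 1) * δ b ∧
        ∀ ξ ∈ KB b.1 (δ b), ENNReal.ofReal s < ENNReal.ofReal Q * MM φ ξ := by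
      intro b hbu
      obtain ⟨z, ⟨hz1, hz2⟩, rfl⟩ := hut hbu
      have hδz : δ (dir z, (α + 1) * (1 - ‖z‖)) = 1 - ‖z‖ := by
        simp only [hδd]; field_simp
      refine ⟨hdir1 z, by rw [hδz]; linarith, by rw [hδz]; linarith [norm_nonneg z], ?_, by rw [hδz], fun ξ hξ => ?_⟩
      · simp only [hpt]
        rw [hδz, sub_sub_cancel, ← hdir2 z]
      · refine hz2.trans_le (hMM z ξ hz1 ?_)
        rw [hδz] at hξ
        have hξ : dk ξ (dir z) < 1 - ‖z‖ := hξ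
        show dk ξ (dir z) < _
        nlinarith
    have hsub : {z | ENNReal.ofReal s < h z} ∩ ball 0 1 ⊆ ⋃ b ∈ u, ball 0 1 ∩ KB (pt b) ((18 * (α + 1) + 1) * (1 - ‖pt b‖)) := by
      rintro z ⟨hz2, hz⟩
      have hz1 : ‖z‖ < 1 := by simpa using hz
      obtain ⟨b, hbu, -, hzb⟩ := hcov _ ⟨z, ⟨hz1, hz2⟩, rfl⟩
      obtain ⟨hb1, hb2, hb3, hb4, hb5, -⟩ := hb b hbu
      refine mem_biUnion hbu ⟨hz, ?_⟩
      have h1 : dk z b.1 < 18 * b.2 := by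
        refine hzb z hz1.le ?_
        show dk z (dir z) < (α + 1) * (1 - ‖z‖)
        have := dk_smul_le (z := dir z) (w := dir z) (norm_nonneg z) hz1.le
        rw [← hdir2 z, dk_self (hdir1 z)] at this
        nlinarith
      show dk z (pt b) < _
      rw [dk_comm, hb4]
      have h2 := dk_smul_le (z := b.1) (w := z) (r := 1 - δ b) (by linarith) (by linarith)
      have h3 := dk_nonneg b.1 z
      rw [dk_comm] at h1
      nlinarith
    have htent : ∀ b ∈ u, μ (ball 0 1 ∩ KB (pt b) ((18 * (α + 1) + 1) * (1 - ‖pt b‖))) ≤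
        ENNReal.ofReal (C0 / c) * ((tau (En n)).withDensity V) (KB b.1 (δ b) ∩ sphere 0 1) := by
      intro b hbu
      obtain ⟨hb1, hb2, hb3, hb4, hb5, -⟩ := hb b hbu
      have hdn : 0 < δ b ^ n := by positivity
      have hpoint : ∀ ζ0 ∈ KB b.1 (δ b) ∩ sphere 0 1, μ (ball 0 1 ∩ KB (pt b) ((18 * (α + 1) + 1) * (1 - ‖pt b‖))) ≤
          ENNReal.ofReal (C0 * δ b ^ n) * V ζ0 := by
        rintro ζ0 ⟨h1, h2⟩
        have := hT (pt b) ζ0 (by rw [hb4]; linarith) (by simpa using h2) ?_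
        · rwa [hb4, sub_sub_cancel] at this ⊢
        · have h3 := dk_smul_le (z := b.1) (w := ζ0) (r := 1 - δ b) (by linarith) (by linarith)
          have h1 : dk ζ0 b.1 < δ b := h1
          rw [dk_comm] at h1
          rw [hb4]
          have h4 := dk_nonneg b.1 ζ0
          nlinarith
      set X := μ (ball 0 1 ∩ KB (pt b) ((18 * (α + 1) + 1) * (1 - ‖pt b‖)))
      have hms : MeasurableSet (KB b.1 (δ b) ∩ sphere (0 : En n) 1) := (measurableSet_KB _ _).inter isClosed_sphere.measurableSet
      have h1 : ∫⁻ ζ in KB b.1 (δ b) ∩ sphere 0 1, X ∂(tau (En n)) ≤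
          ∫⁻ ζ in KB b.1 (δ b) ∩ sphere 0 1, ENNReal.ofReal (C0 * δ b ^ n) * V ζ ∂(tau (En n)) :=
        setLIntegral_mono' hms hpoint
      rw [lintegral_const, lintegral_const_mul _ hV, Measure.restrict_apply_univ] at h1
      have h2 : ENNReal.ofReal (c * δ b ^ n) ≤ tau (En n) (KB b.1 (δ b) ∩ sphere 0 1) := by
        refine (hlow b.1 (δ b) hb1 hb2 (by linarith)).trans (measure_mono_ae ?_)
        filter_upwards [tau_ae_norm (E := En n)] with ζ hζ h
        exact ⟨h, by simpa using hζ⟩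
      have h3 := (mul_le_mul_right h2 X).trans h1
      have h4 := mul_le_mul_right h3 (ENNReal.ofReal (c * δ b ^ n)⁻¹)
      rw [mul_comm X, ← mul_assoc, ← mul_assoc, ← ENNReal.ofReal_mul (by positivity), ← ENNReal.ofReal_mul (by positivity),
        inv_mul_cancel₀ (by positivity), ENNReal.ofReal_one, one_mul] at h4
      rw [withDensity_apply _ hms]
      refine h4.trans (mul_le_mul_left (ENNReal.ofReal_le_ofReal (le_of_eq ?_)) _)
      field_simp
    rw [Measure.restrict_apply' measurableSet_ball]
    calc _ ≤ μ (⋃ b ∈ u, ball 0 1 ∩ KB (pt b) ((18 * (α + 1) + 1) * (1 - ‖pt b‖))) := measure_mono hsub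
      _ ≤ ∑' b : u, μ (ball 0 1 ∩ KB (pt b) ((18 * (α + 1) + 1) * (1 - ‖pt b‖))) := measure_biUnion_le μ huc _
      _ ≤ ∑' b : u, ENNReal.ofReal (C0 / c) * ((tau (En n)).withDensity V) (KB b.1.1 (δ b) ∩ sphere 0 1) :=
          ENNReal.tsum_le_tsum fun b => htent b b.2
      _ = ENNReal.ofReal (C0 / c) * ((tau (En n)).withDensity V) (⋃ b ∈ u, KB b.1 (δ b) ∩ sphere 0 1) := by
          rw [ENNReal.tsum_mul_left, measure_biUnion huc]
          · intro b hbu b' hbu' hne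
            refine (hud hbu hbu' hne).mono ?_ ?_
            · intro ξ hξ
              obtain ⟨-, hb2, -, -, hb5, -⟩ := hb b hbu
              have h1 : dk ξ b.1 < δ b := hξ.1
              refine ⟨?_, hξ.2⟩
              show dk ξ b.1 < b.2
              nlinarith
            · intro ξ hξ
              obtain ⟨-, hb2, -, -, hb5, -⟩ := hb b' hbu'
              have h1 : dk ξ b'.1 < δ b' := hξ.1
              refine ⟨?_, hξ.2⟩
              show dk ξ b'.1 < b'.2
              nlinarith
          · exact fun b _ => (measurableSet_KB _ _).inter isClosed_sphere.measurableSet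
      _ ≤ _ := by
          refine mul_le_mul_right (measure_mono ?_) _
          refine iUnion₂_subset fun b hbu ξ hξ => (hb b hbu).2.2.2.2.2 ξ hξ.1
  have hhm : Measurable h := by
    refine measurable_wt.mul ?_
    have hS : MeasurableSet {p : En n × En n | dk p.1 p.2 < α / 2 * (1 - ‖p.1‖ ^ 2)} :=
      (isOpen_lt continuous_dk (by fun_prop)).measurableSet
    have := (((hφ.comp measurable_snd).indicator hS).lintegral_prod_right' (ν := tau (En n)))
    convert this using 2 with z
    have hms : MeasurableSet {ζ : En n | dk z ζ < α / 2 * (1 - ‖z‖ ^ 2)} :=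
      (isOpen_lt (continuous_dk.comp (by fun_prop : Continuous fun ζ : En n => (z, ζ))) continuous_const).measurableSet
    rw [← lintegral_indicator hms]
    rfl
  have hMm : Measurable fun ξ => ENNReal.ofReal Q * MM φ ξ := (measurable_MM φ).const_mul _
  have L1 := lintegral_rpow_layer (μ.restrict (ball 0 1)) one_pos hhm
  have L2 := lintegral_rpow_layer ((tau (En n)).withDensity V) one_pos hMm
  simp only [ENNReal.rpow_one] at L1 L2
  calc _ ≤ ENNReal.ofReal (C0 / c) * ∫⁻ ξ, ENNReal.ofReal Q * MM φ ξ ∂((tau (En n)).withDensity V) := by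
        rw [L1, L2, ← lintegral_const_mul' _ _ ENNReal.ofReal_ne_top]
        refine lintegral_mono fun s => ?_
        rw [mul_left_comm]
        exact mul_le_mul_right (hlevel s) _
    _ = _ := by
        rw [lintegral_withDensity_eq_lintegral_mul _ hV hMm, show Q / c * C0 = C0 / c * Q by ring,
          ENNReal.ofReal_mul (by positivity), mul_assoc,
          ← lintegral_const_mul' (ENNReal.ofReal Q) _ ENNReal.ofReal_ne_top]
        congr 1
        refine lintegral_congr fun ξ => ?_
        simp only [Pi.mul_apply]
        ring

end Area

section AreaUpper
variable {n : ℕ} {g : En n → ℂ} {R : ℝ}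

lemma lintegral_le_of_tendsto {X : Type*} [MeasurableSpace X] {μ : Measure X} {f : ℕ → X → ℝ≥0∞} {F : X → ℝ≥0∞} {B : ℝ≥0∞}
    (hf : ∀ k, AEMeasurable (f k) μ) (h : ∀ᵐ x ∂μ, Tendsto (fun k => f k x) atTop (𝓝 (F x)))
    (hB : ∀ᶠ k in atTop, ∫⁻ x, f k x ∂μ ≤ B) : ∫⁻ x, F x ∂μ ≤ B := by
  calc ∫⁻ x, F x ∂μ = ∫⁻ x, liminf (fun k => f k x) atTop ∂μ := lintegral_congr_ae (by
        filter_upwards [h] with x hx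
        exact hx.liminf_eq.symm)
    _ ≤ liminf (fun k => ∫⁻ x, f k x ∂μ) atTop := lintegral_liminf_le' hf
    _ ≤ B := liminf_le_of_frequently_le' hB.frequently

lemma ENNReal.le_rpow_of_le_mul_rpow {X A : ℝ≥0∞} {r : ℝ} (hr : 1 < r) (hX : X ≠ ⊤) (h : X ≤ A * X ^ (1 - 1 / r)) : X ≤ A ^ r := by
  have hr0 : 0 < r := by linarith
  rcases eq_or_ne X 0 with h0 | h0
  · rw [h0]; exact zero_le
  · have hp0 : X ^ (1 - 1 / r) ≠ 0 := by
      rw [Ne, ENNReal.rpow_eq_zero_iff]; push Not; exact ⟨fun h => (h0 h).elim, fun h => (hX h).elim⟩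
    have hpt : X ^ (1 - 1 / r) ≠ ⊤ := ENNReal.rpow_ne_top_of_ne_zero h0 hX
    have e : X = X ^ (1 / r) * X ^ (1 - 1 / r) := by
      rw [← ENNReal.rpow_add _ _ h0 hX]; simp
    have h1 : X ^ (1 / r) ≤ A := by
      rw [e] at h
      rw [← e] at h
      rwa [← ENNReal.mul_le_mul_iff_left hp0 hpt, ← e]
    calc X = (X ^ (1 / r)) ^ r := by rw [← ENNReal.rpow_mul, one_div, inv_mul_cancel₀ hr0.ne', ENNReal.rpow_one]
      _ ≤ A ^ r := ENNReal.rpow_le_rpow h1 hr0.le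

lemma measurable_cone_average (α : ℝ) {φ : En n → ℝ≥0∞} (hφ : Measurable φ) :
    Measurable fun z => wt z * ∫⁻ ζ in {ζ | dk z ζ < α / 2 * (1 - ‖z‖ ^ 2)}, φ ζ ∂(tau (En n)) := by
  refine measurable_wt.mul ?_
  have hS : MeasurableSet {p : En n × En n | dk p.1 p.2 < α / 2 * (1 - ‖p.1‖ ^ 2)} :=
    (isOpen_lt continuous_dk (by fun_prop)).measurableSet
  have := (((hφ.comp measurable_snd).indicator hS).lintegral_prod_right' (ν := tau (En n)))
  convert this using 2 with z
  have hms : MeasurableSet {ζ : En n | dk z ζ < α / 2 * (1 - ‖z‖ ^ 2)} :=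
    (isOpen_lt (continuous_dk.comp (by fun_prop : Continuous fun ζ : En n => (z, ζ))) continuous_const).measurableSet
  rw [← lintegral_indicator hms]
  rfl

/-- Area function estimate for exponents larger than one. -/
lemma exists_area_le_of_one_lt (n : ℕ) [NeZero n] {α s r : ℝ} (hα : 1 < α) (hs : 0 < s) (hr : 1 < r) : ∃ C : ℝ, 0 < C ∧
    ∀ (g : En n → ℂ) (R : ℝ), DifferentiableOn ℂ g (ball 0 R) → 1 < R →
      ∫⁻ ζ, AA g s α 1 ζ ^ r ∂(tau (En n)) ≤ ENNReal.ofReal C * ∫⁻ ζ, ‖g ζ‖ₑ ^ (s * r) ∂(tau (En n)) := by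
  obtain ⟨C0, hC0, htent⟩ := exists_tent n (K := α + 2) (K' := 18 * (α + 1) + 1) (by linarith) (by linarith) hs
  obtain ⟨C1, hC1, hdual⟩ := exists_duality n hα
  have hr0 : 0 < r := by linarith
  have hr1 : 0 < r - 1 := by linarith
  set r' := r / (r - 1) with hr'
  have hr'1 : 1 < r' := by rw [hr', lt_div_iff₀ hr1]; linarith
  have hc : r'.HolderConjugate r := by
    refine (Real.holderConjugate_iff).2 ⟨hr'1, ?_⟩
    rw [hr']; field_simp; ring
  obtain ⟨C2, hC2, hM2⟩ := strong_MM n hr'1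
  obtain ⟨C3, hC3, hM3⟩ := strong_MM n hr
  set D : ℝ≥0∞ := ENNReal.ofReal (C1 * C0) * ENNReal.ofReal C2 ^ (1 / r') * ENNReal.ofReal C3 ^ (1 / r) with hD
  have hDt : D ≠ ⊤ := by
    refine ENNReal.mul_ne_top (ENNReal.mul_ne_top ENNReal.ofReal_ne_top (ENNReal.rpow_ne_top_of_nonneg (by positivity) ENNReal.ofReal_ne_top))
      (ENNReal.rpow_ne_top_of_nonneg (by positivity) ENNReal.ofReal_ne_top)
  have hDr : D ^ r ≠ ⊤ := ENNReal.rpow_ne_top_of_nonneg hr0.le hDt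
  refine ⟨(D ^ r).toReal + 1, by positivity, fun g R hg hR => ?_⟩
  have hg1 : DifferentiableOn ℂ g (ball 0 1) := hg.mono (ball_subset_ball hR.le)
  set U := bd g s with hU
  have hUm : Measurable U := measurable_bd hg hR s
  have hAm := measurable_AA hg1 s α 1
  have hY : ∫⁻ ζ, U ζ ^ r ∂(tau (En n)) = ∫⁻ ζ, ‖g ζ‖ₑ ^ (s * r) ∂(tau (En n)) := by
    refine lintegral_congr_ae ?_
    filter_upwards [bd_ae g s] with ζ hζ
    rw [hU, hζ, ENNReal.rpow_mul]
  rw [← hY]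
  have key : ∀ N : ℕ, ∫⁻ ζ, (min (AA g s α 1 ζ) N) ^ r ∂(tau (En n)) ≤ D ^ r * ∫⁻ ζ, U ζ ^ r ∂(tau (En n)) := by
    intro N
    set W : En n → ℝ≥0∞ := fun ζ => min (AA g s α 1 ζ) N with hW
    have hWm : Measurable W := hAm.min measurable_const
    set φ : En n → ℝ≥0∞ := fun ζ => W ζ ^ (r - 1) with hφ
    have hφm : Measurable φ := hWm.pow_const _
    set X := ∫⁻ ζ, W ζ ^ r ∂(tau (En n)) with hX
    have hXt : X ≠ ⊤ := by
      refine ne_top_of_le_ne_top ?_ (lintegral_mono fun ζ => ENNReal.rpow_le_rpow (min_le_right _ (N : ℝ≥0∞)) hr0.le)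
      rw [lintegral_const]
      exact ENNReal.mul_ne_top (ENNReal.rpow_ne_top_of_nonneg hr0.le (ENNReal.natCast_ne_top N)) (measure_ne_top _ _)
    have h1 : X ≤ ∫⁻ ζ, AA g s α 1 ζ * φ ζ ∂(tau (En n)) := by
      refine lintegral_mono fun ζ => ?_
      have : W ζ ^ r = W ζ * φ ζ := by
        rw [hφ]
        conv_lhs => rw [show r = 1 + (r - 1) by ring, ENNReal.rpow_add_of_nonneg _ _ zero_le_one hr1.le, ENNReal.rpow_one]
      show W ζ ^ r ≤ _
      rw [this]
      exact mul_le_mul_left (min_le_left _ _) _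
    have h2 : ∫⁻ ζ, AA g s α 1 ζ * φ ζ ∂(tau (En n)) ≤ ENNReal.ofReal (C1 * C0) * ∫⁻ ζ, MM φ ζ * MM U ζ ∂(tau (En n)) := by
      have := hdual C0 ((volume : Measure (En n)).withDensity (EB g s)) (MM U) φ hC0 inferInstance (measurable_MM U) hφm ?_
      · rw [setLIntegral_withDensity_eq_setLIntegral_mul _ (measurable_EB hg1 s) (measurable_cone_average α hφm) measurableSet_ball] at this
        rw [lintegral_AA_mul hg1 s α 1 hφm]
        refine le_trans (le_of_eq (lintegral_congr fun z => ?_)) this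
        rw [Pi.mul_apply, mul_comm]
      · intro a ζ0 ha hζ0 hd
        have hms : MeasurableSet (ball (0 : En n) 1 ∩ KB a ((18 * (α + 1) + 1) * (1 - ‖a‖))) := measurableSet_ball.inter (measurableSet_KB _ _)
        rw [withDensity_apply _ hms]
        refine le_trans (le_of_eq (setLIntegral_congr_fun hms fun z hz => ?_)) (htent g R a ζ0 hg hR ha hζ0 hd)
        exact indicator_of_mem hz.1 _
    have h3 : ∫⁻ ζ, MM φ ζ * MM U ζ ∂(tau (En n)) ≤ (ENNReal.ofReal C2 * X) ^ (1 / r') * (ENNReal.ofReal C3 * ∫⁻ ζ, U ζ ^ r ∂(tau (En n))) ^ (1 / r) := by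
      refine (ENNReal.lintegral_mul_le_Lp_mul_Lq _ hc (measurable_MM φ).aemeasurable (measurable_MM U).aemeasurable).trans ?_
      refine mul_le_mul' (ENNReal.rpow_le_rpow ?_ (by positivity)) (ENNReal.rpow_le_rpow (hM3 U hUm) (by positivity))
      refine (hM2 φ hφm).trans (le_of_eq ?_)
      congr 1
      refine lintegral_congr fun ζ => ?_
      rw [hφ]
      simp only
      rw [← ENNReal.rpow_mul]
      congr 1
      rw [hr']; field_simp
    have h4 := ENNReal.le_rpow_of_le_mul_rpow (A := D * (∫⁻ ζ, U ζ ^ r ∂(tau (En n))) ^ (1 / r)) hr hXt (by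
      refine (h1.trans (h2.trans (mul_le_mul_right h3 _))).trans (le_of_eq ?_)
      rw [ENNReal.mul_rpow_of_nonneg _ _ (by positivity : (0 : ℝ) ≤ 1 / r'), ENNReal.mul_rpow_of_nonneg _ _ (by positivity : (0 : ℝ) ≤ 1 / r),
        show 1 / r' = 1 - 1 / r by rw [hr']; field_simp, hD, show 1 / r' = 1 - 1 / r by rw [hr']; field_simp]
      ring)
    rwa [ENNReal.mul_rpow_of_nonneg _ _ hr0.le, ← ENNReal.rpow_mul, one_div, inv_mul_cancel₀ hr0.ne', ENNReal.rpow_one] at h4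
  refine le_trans (lintegral_le_of_tendsto (f := fun N ζ => (min (AA g s α 1 ζ) (N : ℕ)) ^ r) (fun N => ((hAm.min measurable_const).pow_const _).aemeasurable)
    (ae_of_all _ fun ζ => ?_) (Eventually.of_forall key)) (mul_le_mul_left ?_ _)
  · have : Tendsto (fun N : ℕ => min (AA g s α 1 ζ) (N : ℝ≥0∞)) atTop (𝓝 (min (AA g s α 1 ζ) ⊤)) :=
      tendsto_const_nhds.min ENNReal.tendsto_nat_nhds_top
    rw [min_top_right] at this
    exact (ENNReal.continuous_rpow_const.tendsto _).comp this
  · rw [ENNReal.ofReal_add ENNReal.toReal_nonneg zero_le_one, ENNReal.ofReal_toReal hDr]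
    exact le_self_add

end AreaUpper

section AreaUpper
variable {n : ℕ} {g : En n → ℂ} {R : ℝ}

lemma ENNReal.rpow_sub_le_mul {x M : ℝ≥0∞} {s s' k : ℝ} (hx : x ≠ ⊤) (hM : M ≠ 0) (hxM : x ≤ M) (h : s' ≤ s) :
    x ^ (s - k) ≤ M ^ (s - s') * x ^ (s' - k) := by
  rcases eq_or_lt_of_le h with rfl | h
  · simp
  rcases eq_or_ne x 0 with rfl | h0
  · rcases lt_or_ge 0 (s - k) with h1 | h1
    · rw [ENNReal.zero_rpow_of_pos h1]; exact zero_le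
    · rw [ENNReal.zero_rpow_of_neg (by linarith : s' - k < 0), ENNReal.mul_top]
      · exact le_top
      · rw [Ne, ENNReal.rpow_eq_zero_iff]; push Not
        exact ⟨fun h => (hM h).elim, fun _ => by linarith⟩
  · rw [show s - k = (s - s') + (s' - k) by ring, ENNReal.rpow_add _ _ h0 hx]
    exact mul_le_mul_left (ENNReal.rpow_le_rpow hxM (by linarith)) _

lemma AA_le_mul {s s' α ρ : ℝ} {ζ : En n} {M : ℝ≥0∞} (hg : DifferentiableOn ℂ g (ball 0 1)) (h : s' ≤ s) (hM : ∀ z ∈ Rg α ρ ζ, ‖z‖ < 1 → ‖g z‖ₑ ≤ M) :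
    AA g s α ρ ζ ≤ M ^ (s - s') * AA g s' α ρ ζ := by
  have key : ∀ z ∈ Rg α ρ ζ, EB g s z ≤ M ^ (s - s') * EB g s' z := by
    intro z hz
    by_cases hz1 : z ∈ ball (0 : En n) 1
    · simp only [EB, indicator_of_mem hz1, EE]
      have hz1' : ‖z‖ < 1 := by simpa using hz1
      rw [← mul_assoc]
      rcases eq_or_ne M 0 with rfl | hM0
      · have hN : N2 g z = 0 := by
          have hev : g =ᶠ[𝓝 z] fun _ => 0 := by
            filter_upwards [((isOpen_Rg α ρ ζ).inter isOpen_ball).mem_nhds ⟨hz, hz1⟩] with w hw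
            have := hM w hw.1 (by simpa using hw.2)
            simpa using this
          simp [N2, hev.fderiv_eq]
        simp [hN]
      · exact mul_le_mul_left (ENNReal.rpow_sub_le_mul enorm_ne_top hM0 (hM z hz hz1') h) _
    · simp only [EB, indicator_of_notMem hz1, zero_le]
  have hT : ∀ z ∈ Rg α ρ ζ, wt z * EB g s z ≤ M ^ (s - s') * (wt z * EB g s' z) := fun z hz => by
    rw [mul_left_comm]
    exact mul_le_mul_right (key z hz) _
  unfold AA
  have hm : Measurable fun z => wt z * EB g s' z := measurable_wt.mul (measurable_EB hg s')
  rw [← lintegral_const_mul _ hm]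
  exact setLIntegral_mono' (isOpen_Rg α ρ ζ).measurableSet hT

lemma mul_sub_norm_sq_le {α x : ℝ} (hα : 0 ≤ α) (hx : x ≤ 1) : α / 2 * (1 - x ^ 2) ≤ α * (1 - x) := by
  rw [show α / 2 * (1 - x ^ 2) = α * (1 - x) * ((1 + x) / 2) by ring]
  exact mul_le_of_le_one_right (mul_nonneg hα (by linarith)) (by linarith)

lemma lintegral_bd_rpow (g : En n → ℂ) (s r : ℝ) :
    ∫⁻ ζ, bd g s ζ ^ r ∂(tau (En n)) = ∫⁻ ζ, ‖g ζ‖ₑ ^ (s * r) ∂(tau (En n)) := by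
  refine lintegral_congr_ae ?_
  filter_upwards [bd_ae g s] with ζ hζ
  rw [hζ, ENNReal.rpow_mul]

/-- The area function is controlled by the boundary values. -/
lemma exists_area_le (n : ℕ) [NeZero n] {α p t : ℝ} (hα : 1 < α) (hp : 0 < p) (ht : 0 < t) : ∃ C : ℝ, 0 < C ∧
    ∀ (g : En n → ℂ) (R : ℝ), DifferentiableOn ℂ g (ball 0 R) → 1 < R →
      ∫⁻ ζ, AA g (2 * t) α 1 ζ ^ (p / 2) ∂(tau (En n)) ≤ ENNReal.ofReal C * ∫⁻ ζ, ‖g ζ‖ₑ ^ (p * t) ∂(tau (En n)) := by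
  rcases lt_or_ge 2 p with h2 | h2
  · obtain ⟨C, hC, h⟩ := exists_area_le_of_one_lt n (s := 2 * t) (r := p / 2) hα (by positivity) (by linarith)
    refine ⟨C, hC, fun g R hg hR => ?_⟩
    have := h g R hg hR
    rwa [show 2 * t * (p / 2) = p * t by ring] at this
  set σ := p * t / 2 with hσ
  have hσ0 : 0 < σ := by positivity
  obtain ⟨C1, hC1, h1⟩ := exists_area_le_of_one_lt n (s := σ) (r := 2) hα hσ0 (by norm_num)
  obtain ⟨C2, hC2, hM⟩ := exists_le_MM n (K := α) (by linarith) hσ0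
  obtain ⟨C3, hC3, hM3⟩ := strong_MM n (r := 2) (by norm_num)
  set θ := p / 4 with hθ
  have hθ0 : 0 < θ := by positivity
  have hθ1 : θ < 1 := by rw [hθ]; linarith
  have hc : (1 / (1 - θ)).HolderConjugate (1 / θ) := by
    refine (Real.holderConjugate_iff).2 ⟨by rw [lt_div_iff₀ (by linarith)]; linarith, by field_simp; ring⟩
  set D : ℝ≥0∞ := (ENNReal.ofReal C2 ^ (2 : ℝ) * ENNReal.ofReal C3) ^ (1 - θ) * ENNReal.ofReal C1 ^ θ with hD
  have hDt : D ≠ ⊤ := by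
    refine ENNReal.mul_ne_top (ENNReal.rpow_ne_top_of_nonneg (by linarith) (ENNReal.mul_ne_top
      (ENNReal.rpow_ne_top_of_nonneg (by norm_num) ENNReal.ofReal_ne_top) ENNReal.ofReal_ne_top))
      (ENNReal.rpow_ne_top_of_nonneg hθ0.le ENNReal.ofReal_ne_top)
  refine ⟨D.toReal + 1, by positivity, fun g R hg hR => ?_⟩
  have hg1 : DifferentiableOn ℂ g (ball 0 1) := hg.mono (ball_subset_ball hR.le)
  set U := bd g σ with hU
  have hUm : Measurable U := measurable_bd hg hR σ
  set Y := ∫⁻ ζ, ‖g ζ‖ₑ ^ (p * t) ∂(tau (En n)) with hY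
  have hUY : ∫⁻ ζ, U ζ ^ (2 : ℝ) ∂(tau (En n)) = Y := by
    rw [hU, lintegral_bd_rpow, hσ, div_mul_cancel₀ _ (two_ne_zero)]
  have hA2 : ∫⁻ ζ, AA g σ α 1 ζ ^ (2 : ℝ) ∂(tau (En n)) ≤ ENNReal.ofReal C1 * Y := by
    have := h1 g R hg hR
    rwa [hσ, div_mul_cancel₀ _ (two_ne_zero), ← hσ] at this
  have hpt : ∀ᵐ ζ ∂(tau (En n)), AA g (2 * t) α 1 ζ ^ (p / 2) ≤
      (ENNReal.ofReal C2 * MM U ζ) ^ (2 * (1 - θ)) * AA g σ α 1 ζ ^ (2 * θ) := by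
    filter_upwards [tau_ae_norm (E := En n)] with ζ hζ
    have h3 := AA_le_mul (s := 2 * t) (s' := σ) (α := α) (ρ := 1) (ζ := ζ) (M := (ENNReal.ofReal C2 * MM U ζ) ^ (1 / σ)) hg1
      (by rw [hσ]; nlinarith) (fun z hz hz1 => ?_)
    · refine (ENNReal.rpow_le_rpow h3 (by positivity)).trans (le_of_eq ?_)
      rw [ENNReal.mul_rpow_of_nonneg _ _ (by positivity), ← ENNReal.rpow_mul, ← ENNReal.rpow_mul]
      congr 2
      · rw [hσ, hθ]; field_simp; ring
      · rw [hθ]; ring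
    · have h4 : dk z ζ < α / 2 * (1 - ‖z‖ ^ 2) := hz.2
      have h5 := hM g R z ζ hg hR hz1 hζ (h4.le.trans (mul_sub_norm_sq_le (by linarith) hz1.le))
      calc ‖g z‖ₑ = (‖g z‖ₑ ^ σ) ^ (1 / σ) := by
            rw [← ENNReal.rpow_mul, one_div, mul_inv_cancel₀ hσ0.ne', ENNReal.rpow_one]
        _ ≤ _ := ENNReal.rpow_le_rpow h5 (by positivity)
  have hMm : Measurable fun ζ => ENNReal.ofReal C2 * MM U ζ := (measurable_MM U).const_mul _
  have hAm := measurable_AA hg1 σ α 1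
  calc _ ≤ ∫⁻ ζ, (ENNReal.ofReal C2 * MM U ζ) ^ (2 * (1 - θ)) * AA g σ α 1 ζ ^ (2 * θ) ∂(tau (En n)) := lintegral_mono_ae hpt
    _ ≤ (∫⁻ ζ, (ENNReal.ofReal C2 * MM U ζ) ^ (2 : ℝ) ∂(tau (En n))) ^ (1 - θ) * (∫⁻ ζ, AA g σ α 1 ζ ^ (2 : ℝ) ∂(tau (En n))) ^ θ := by
        refine (ENNReal.lintegral_mul_le_Lp_mul_Lq _ hc (hMm.pow_const _).aemeasurable (hAm.pow_const _).aemeasurable).trans (le_of_eq ?_)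
        have h1θ : 1 - θ ≠ 0 := by linarith
        simp_rw [← ENNReal.rpow_mul]
        rw [one_div_one_div, one_div_one_div, mul_one_div, mul_one_div, mul_div_cancel_right₀ _ h1θ, mul_div_cancel_right₀ _ hθ0.ne']
    _ ≤ (ENNReal.ofReal C2 ^ (2 : ℝ) * (ENNReal.ofReal C3 * Y)) ^ (1 - θ) * (ENNReal.ofReal C1 * Y) ^ θ := by
        refine mul_le_mul' (ENNReal.rpow_le_rpow ?_ (by linarith)) (ENNReal.rpow_le_rpow hA2 hθ0.le)
        simp_rw [ENNReal.mul_rpow_of_nonneg _ _ (by norm_num : (0 : ℝ) ≤ 2)]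
        rw [lintegral_const_mul _ ((measurable_MM U).pow_const _), ← hUY]
        exact mul_le_mul_right (hM3 U hUm) _
    _ = D * Y := by
        rw [← mul_assoc, ENNReal.mul_rpow_of_nonneg _ _ (by linarith : 0 ≤ 1 - θ), ENNReal.mul_rpow_of_nonneg _ _ hθ0.le, hD]
        have : Y ^ (1 - θ) * Y ^ θ = Y := by
          rw [← ENNReal.rpow_add_of_nonneg _ _ (by linarith) hθ0.le]; simp
        conv_rhs => rw [← this]
        ring
    _ ≤ _ := by
        refine mul_le_mul_left ?_ _
        rw [ENNReal.ofReal_add ENNReal.toReal_nonneg zero_le_one, ENNReal.ofReal_toReal hDt]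
        exact le_self_add

end AreaUpper

section Dilate
variable {n : ℕ} {g : En n → ℂ} {R : ℝ}

lemma smul_mem_ball_inv {ρ : ℝ} (hρ : 0 < ρ) {z : En n} (hz : z ∈ ball (0 : En n) ρ⁻¹) : ρ • z ∈ ball (0 : En n) 1 := by
  rw [mem_ball_zero_iff] at hz ⊢
  rw [norm_smul, Real.norm_of_nonneg hρ.le]
  calc ρ * ‖z‖ < ρ * ρ⁻¹ := by gcongr
    _ = 1 := mul_inv_cancel₀ hρ.ne'

lemma differentiableOn_dilate (hg : DifferentiableOn ℂ g (ball 0 1)) {ρ : ℝ} (hρ : 0 < ρ) :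
    DifferentiableOn ℂ (fun z => g (ρ • z)) (ball 0 ρ⁻¹) := by
  refine hg.comp (fun z _ => ?_) fun z hz => smul_mem_ball_inv hρ hz
  have e : (fun z : En n => ρ • z) = fun z => (ρ : ℂ) • z := funext fun z => RCLike.real_smul_eq_coe_smul (K := ℂ) ρ z
  change DifferentiableWithinAt ℂ (fun z : En n => ρ • z) _ _
  rw [e]
  exact (differentiable_id.const_smul (ρ : ℂ)).differentiableAt.differentiableWithinAt

lemma fderiv_dilate (hg : DifferentiableOn ℂ g (ball 0 1)) {ρ : ℝ} (hρ : 0 < ρ) {z : En n} (hz : z ∈ ball (0 : En n) ρ⁻¹) :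
    fderiv ℂ (fun z => g (ρ • z)) z = (ρ : ℂ) • fderiv ℂ g (ρ • z) := by
  have h1 : HasFDerivAt (fun z : En n => (ρ : ℂ) • z) ((ρ : ℂ) • ContinuousLinearMap.id ℂ (En n)) z :=
    (hasFDerivAt_id z).const_smul (ρ : ℂ)
  have h2 := (hg.differentiableAt (isOpen_ball.mem_nhds (smul_mem_ball_inv hρ hz))).hasFDerivAt
  have e : ∀ z : En n, ρ • z = (ρ : ℂ) • z := fun z => RCLike.real_smul_eq_coe_smul (K := ℂ) ρ z
  rw [e] at h2 ⊢
  simp_rw [e]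
  have h3 : fderiv ℂ (fun z => g ((ρ : ℂ) • z)) z = _ := (h2.comp z h1).fderiv
  rw [h3]
  ext v; simp

lemma N2_dilate (hg : DifferentiableOn ℂ g (ball 0 1)) {ρ : ℝ} (hρ : 0 < ρ) {z : En n} (hz : z ∈ ball (0 : En n) ρ⁻¹) :
    N2 (fun z => g (ρ • z)) z = ρ ^ 2 * (‖fderiv ℂ g (ρ • z)‖ ^ 2 - ‖fderiv ℂ g (ρ • z) z‖ ^ 2) := by
  rw [N2, fderiv_dilate hg hρ hz, norm_smul, Complex.norm_of_nonneg hρ.le, smul_apply, norm_smul, Complex.norm_of_nonneg hρ.le]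
  ring

/-- Lower semicontinuity of the energy density under dilations. -/
lemma EB_le_liminf (hg : DifferentiableOn ℂ g (ball 0 1)) (s : ℝ) {ρ : ℕ → ℝ} (h0 : ∀ k, 0 < ρ k) (h1 : ∀ k, ρ k < 1)
    (hlim : Tendsto ρ atTop (𝓝 1)) (z : En n) : EB g s z ≤ liminf (fun k => EB (fun z => g (ρ k • z)) s z) atTop := by
  by_cases hz : z ∈ ball (0 : En n) 1
  swap
  · rw [EB, indicator_of_notMem hz]; exact zero_le
  simp only [EB, indicator_of_mem hz]
  have hzk : ∀ k, z ∈ ball (0 : En n) (ρ k)⁻¹ := fun k =>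
    ball_subset_ball ((one_le_inv₀ (h0 k)).2 (h1 k).le) hz
  have hl : Tendsto (fun k => ρ k • z) atTop (𝓝 z) := by
    simpa using hlim.smul_const z
  have hgc : Tendsto (fun k => g (ρ k • z)) atTop (𝓝 (g z)) :=
    ((hg.continuousOn.continuousAt (isOpen_ball.mem_nhds hz)).tendsto).comp hl
  have hfc : Tendsto (fun k => fderiv ℂ g (ρ k • z)) atTop (𝓝 (fderiv ℂ g z)) :=
    (((differentiableOn_fderiv_of_isOpen isOpen_ball hg).continuousOn.continuousAt (isOpen_ball.mem_nhds hz)).tendsto).comp hl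
  have hN : Tendsto (fun k => N2 (fun z => g (ρ k • z)) z) atTop (𝓝 (N2 g z)) := by
    simp_rw [fun k => N2_dilate hg (h0 k) (hzk k)]
    have : N2 g z = 1 ^ 2 * (‖fderiv ℂ g z‖ ^ 2 - ‖fderiv ℂ g z z‖ ^ 2) := by rw [N2]; ring
    rw [this]
    exact (hlim.pow 2).mul ((hfc.norm.pow 2).sub (((((ContinuousLinearMap.apply ℂ ℂ z).continuous.tendsto _).comp hfc).norm).pow 2))
  rcases eq_or_ne (ENNReal.ofReal (N2 g z)) 0 with h | h
  · rw [EE, h, mul_zero]; exact zero_le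
  · refine le_of_eq (Tendsto.liminf_eq ?_).symm
    exact ENNReal.Tendsto.mul ((ENNReal.continuous_rpow_const.tendsto _).comp hgc.enorm) (Or.inr ENNReal.ofReal_ne_top)
      ((ENNReal.continuous_ofReal.tendsto _).comp hN) (Or.inl h)

lemma exists_dilation_seq : ∃ ρ : ℕ → ℝ, (∀ k, 0 < ρ k) ∧ (∀ k, ρ k < 1) ∧ Tendsto ρ atTop (𝓝 1) := by
  refine ⟨fun k => 1 - 1 / ((k : ℝ) + 2), fun k => ?_, fun k => ?_, ?_⟩
  · have : 1 / ((k : ℝ) + 2) < 1 := by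
      rw [div_lt_one (by positivity)]; linarith [(k.cast_nonneg : (0 : ℝ) ≤ k)]
    linarith
  · have : 0 < 1 / ((k : ℝ) + 2) := by positivity
    linarith
  · have h := tendsto_one_div_add_atTop_nhds_zero_nat (𝕜 := ℝ)
    have h2 := (h.comp (tendsto_add_atTop_nat 1)).const_sub 1
    rw [sub_zero] at h2
    refine h2.congr fun k => ?_
    simp only [Function.comp]
    push_cast
    ring

/-- The area function of a function in the Hardy space. -/
lemma exists_area_le_of_bound (n : ℕ) [NeZero n] {α p t : ℝ} (hα : 1 < α) (hp : 0 < p) (ht : 0 < t) : ∃ C : ℝ, 0 < C ∧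
    ∀ (g : En n → ℂ) (B : ℝ≥0∞), DifferentiableOn ℂ g (ball 0 1) →
      (∀ ρ ∈ Ioo (0 : ℝ) 1, ∫⁻ ζ, ‖g (ρ • ζ)‖ₑ ^ (p * t) ∂(tau (En n)) ≤ B) →
      ∫⁻ ζ, AA g (2 * t) α 1 ζ ^ (p / 2) ∂(tau (En n)) ≤ ENNReal.ofReal C * B := by
  obtain ⟨C, hC, h⟩ := exists_area_le n hα hp ht
  refine ⟨C, hC, fun g B hg hB => ?_⟩
  obtain ⟨ρ, h0, h1, hlim⟩ := exists_dilation_seq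
  set G : ℕ → En n → ℂ := fun k z => g (ρ k • z) with hG
  have hGd : ∀ k, DifferentiableOn ℂ (G k) (ball 0 (ρ k)⁻¹) := fun k => differentiableOn_dilate hg (h0 k)
  have hR : ∀ k, 1 < (ρ k)⁻¹ := fun k => (one_lt_inv₀ (h0 k)).2 (h1 k)
  have hGd1 : ∀ k, DifferentiableOn ℂ (G k) (ball 0 1) := fun k => (hGd k).mono (ball_subset_ball (hR k).le)
  have hA : ∀ ζ, AA g (2 * t) α 1 ζ ≤ liminf (fun k => AA (G k) (2 * t) α 1 ζ) atTop := by
    intro ζ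
    unfold AA
    refine le_trans (lintegral_mono fun z => ?_) (lintegral_liminf_le fun k => measurable_wt.mul (measurable_EB (hGd1 k) _))
    have h2 := EB_le_liminf hg (2 * t) h0 h1 hlim z
    have h3 : wt z ≠ ⊤ := ENNReal.ofReal_ne_top
    refine (mul_le_mul_right h2 (wt z)).trans ?_
    exact (Monotone.map_liminf_of_continuousAt (f := fun x => wt z * x) (fun a b hab => mul_le_mul_right hab _) _
      (ENNReal.continuous_const_mul h3).continuousAt).le
  have hmono : Monotone fun x : ℝ≥0∞ => x ^ (p / 2) := fun a b hab => ENNReal.rpow_le_rpow hab (by positivity)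
  calc _ ≤ ∫⁻ ζ, liminf (fun k => AA (G k) (2 * t) α 1 ζ ^ (p / 2)) atTop ∂(tau (En n)) := by
        refine lintegral_mono fun ζ => (hmono (hA ζ)).trans ?_
        exact (hmono.map_liminf_of_continuousAt _ ENNReal.continuous_rpow_const.continuousAt).le
    _ ≤ liminf (fun k => ∫⁻ ζ, AA (G k) (2 * t) α 1 ζ ^ (p / 2) ∂(tau (En n))) atTop :=
        lintegral_liminf_le fun k => (measurable_AA (hGd1 k) _ _ _).pow_const _
    _ ≤ _ := liminf_le_of_frequently_le' (Frequently.of_forall fun k =>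
        (h (G k) _ (hGd k) (hR k)).trans (mul_le_mul_right (hB (ρ k) ⟨h0 k, h1 k⟩) _))

end Dilate

section Growth

lemma ofReal_sub_le_lintegral {T T' : ℝ → ℝ} {a b : ℝ} (hab : a ≤ b) (hc : ContinuousOn T (Icc a b))
    (hd : ∀ x ∈ Ioo a b, HasDerivAt T (T' x) x) :
    ENNReal.ofReal (T b - T a) ≤ ∫⁻ x in Ioo a b, ENNReal.ofReal (T' x) := by
  have e : ∫⁻ x in Ioo a b, ENNReal.ofReal (T' x) = ∫⁻ x in Ioo a b, ENNReal.ofReal (deriv T x) :=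
    setLIntegral_congr_fun measurableSet_Ioo fun x hx => by rw [(hd x hx).deriv]
  rw [e]
  by_cases ht : ∫⁻ x in Ioo a b, ENNReal.ofReal (deriv T x) = ⊤
  · rw [ht]; exact le_top
  set φ : ℝ → ℝ := fun x => max (deriv T x) 0 with hφ
  have hφm : Measurable φ := (measurable_deriv T).max measurable_const
  have hφ0 : ∀ x, 0 ≤ φ x := fun x => le_max_right _ _
  have hφe : ∀ x, ENNReal.ofReal (φ x) = ENNReal.ofReal (deriv T x) := fun x => by
    rcases le_total (deriv T x) 0 with h | h
    · simp only [hφ, max_eq_right h, ENNReal.ofReal_zero, ENNReal.ofReal_of_nonpos h]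
    · simp only [hφ, max_eq_left h]
  have hφi : IntegrableOn φ (Ioo a b) := by
    refine ⟨hφm.aestronglyMeasurable, ?_⟩
    rw [hasFiniteIntegral_iff_ofReal (ae_of_all _ hφ0)]
    simp_rw [hφe]
    exact lt_top_iff_ne_top.2 ht
  have hφi' : IntegrableOn φ (Icc a b) := by rwa [integrableOn_Icc_iff_integrableOn_Ioo]
  have h1 : T b - T a ≤ ∫ y in a..b, φ y :=
    intervalIntegral.sub_le_integral_of_hasDeriv_right_of_le hab hc (fun x hx => (hd x hx).hasDerivWithinAt) hφi'
      (fun x hx => by rw [← (hd x hx).deriv]; exact le_max_left _ _)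
  rw [intervalIntegral.integral_of_le hab, integral_Ioc_eq_integral_Ioo] at h1
  refine (ENNReal.ofReal_le_ofReal h1).trans (le_of_eq ?_)
  rw [ofReal_integral_eq_lintegral_ofReal hφi (ae_of_all _ hφ0)]
  simp_rw [hφe]

variable {E : Type*} [NormedAddCommGroup E] [InnerProductSpace ℝ E] [FiniteDimensional ℝ E]
  [MeasurableSpace E] [BorelSpace E] [InnerProductSpace ℂ E] [IsScalarTower ℝ ℂ E]

/-- Growth of spherical means in terms of the weighted radial Laplacian. -/
lemma ofReal_Mm_le {U : E → ℝ} (hU : ContDiffOn ℝ 2 U (ball 0 1)) {r0 r1 b S : ℝ} (h0 : 0 < r0) (h1 : r0 < r1) (hb : r1 ≤ b) (hb1 : b < 1)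
    (hS : ∀ r ∈ Icc r0 r1, 0 ≤ Mm U r ∧ Mm U r ≤ S) :
    ENNReal.ofReal (Mm U b) ≤ ENNReal.ofReal ((1 + 1 / ((r1 - r0) * r0)) * S) +
      ∫⁻ r in Ioo r0 b, ENNReal.ofReal (r0⁻¹ ^ 2 * (1 - r)) * ENNReal.ofReal (∫ ζ, levi U (r • ζ) (r • ζ) ∂(tau E)) := by
  have hU1 : ContDiffOn ℝ 1 U (ball 0 1) := hU.of_le (by norm_num)
  have hMd : ∀ r, 0 < r → r < 1 → HasDerivAt (Mm U) (pp U r / r) r := fun r h h' =>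
    hasDerivAt_Mm hU1 (by rwa [abs_of_pos h]) h.ne'
  have hpd : ∀ r, 0 < r → r < 1 → HasDerivAt (pp U) ((∫ ζ, levi U (r • ζ) (r • ζ) ∂(tau E)) / r) r := fun r h h' =>
    hasDerivAt_pp hU (by rwa [abs_of_pos h]) h.ne'
  obtain ⟨r, hr, hre⟩ := exists_hasDerivAt_eq_slope (Mm U) (fun r => pp U r / r) h1
    (fun x hx => (hMd x (by linarith [hx.1]) (by linarith [hx.2])).continuousAt.continuousWithinAt)
    (fun x hx => hMd x (by linarith [hx.1]) (by linarith [hx.2]))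
  have hr0 : 0 < r := by linarith [hr.1]
  have hrb : r ≤ b := by linarith [hr.2]
  have hb0 : 0 < b := by linarith
  have hS0 : 0 ≤ S := (hS r0 ⟨le_rfl, h1.le⟩).1.trans (hS r0 ⟨le_rfl, h1.le⟩).2
  set T : ℝ → ℝ := fun x => Mm U x + pp U x * (Real.log b - Real.log x) with hT
  have hTd : ∀ x, 0 < x → x < 1 → HasDerivAt T ((∫ ζ, levi U (x • ζ) (x • ζ) ∂(tau E)) / x * (Real.log b - Real.log x)) x := by
    intro x hx hx1
    have h := (hMd x hx hx1).add ((hpd x hx hx1).mul ((Real.hasDerivAt_log hx.ne').const_sub (Real.log b)))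
    refine h.congr_deriv ?_
    field_simp
    ring
  have hTr : T r ≤ (1 + 1 / ((r1 - r0) * r0)) * S := by
    have e1 : pp U r = r * ((Mm U r1 - Mm U r0) / (r1 - r0)) := by
      rw [← hre]; field_simp
    have e2 : |Mm U r1 - Mm U r0| ≤ S := by
      have ha := hS r1 ⟨h1.le, le_rfl⟩
      have hb := hS r0 ⟨le_rfl, h1.le⟩
      rw [abs_le]; constructor <;> linarith
    have e3 : 0 ≤ Real.log b - Real.log r := sub_nonneg.2 (Real.log_le_log hr0 hrb)
    have e4 : Real.log b - Real.log r ≤ 1 / r0 := by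
      rw [← Real.log_div hb0.ne' hr0.ne']
      refine (Real.log_le_sub_one_of_pos (by positivity)).trans ?_
      have : b / r ≤ 1 / r0 := by
        gcongr
        exact hr.1.le
      linarith
    have e5 : |pp U r * (Real.log b - Real.log r)| ≤ S / (r1 - r0) * (1 / r0) := by
      rw [abs_mul, abs_of_nonneg e3, e1, abs_mul, abs_of_pos hr0, abs_div, abs_of_pos (by linarith : 0 < r1 - r0)]
      have h5 : |Mm U r1 - Mm U r0| / (r1 - r0) ≤ S / (r1 - r0) := by gcongr
      have h6 : 0 ≤ |Mm U r1 - Mm U r0| / (r1 - r0) := div_nonneg (abs_nonneg _) (by linarith)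
      have h7 : r * (|Mm U r1 - Mm U r0| / (r1 - r0)) ≤ S / (r1 - r0) := by nlinarith [hr.2]
      gcongr
    have e6 := (le_abs_self _).trans e5
    have e7 := (hS r ⟨hr.1.le, hr.2.le⟩).2
    have e8 : (1 + 1 / ((r1 - r0) * r0)) * S = S + S / (r1 - r0) * (1 / r0) := by
      have : r1 - r0 ≠ 0 := by linarith
      field_simp
    rw [e8]
    simp only [hT]
    linarith
  have hTb : T b = Mm U b := by simp [hT]
  have key := ofReal_sub_le_lintegral hrb (T := T)
    (fun x hx => (hTd x (by linarith [hx.1]) (by linarith [hx.2])).continuousAt.continuousWithinAt)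
    (fun x hx => hTd x (by linarith [hx.1]) (by linarith [hx.2]))
  calc ENNReal.ofReal (Mm U b) ≤ ENNReal.ofReal (T r) + ENNReal.ofReal (T b - T r) := by
        rw [← hTb]
        refine le_trans (ENNReal.ofReal_le_ofReal (by linarith)) ENNReal.ofReal_add_le
    _ ≤ _ := by
        refine add_le_add (ENNReal.ofReal_le_ofReal hTr) (key.trans ?_)
        refine (setLIntegral_mono' measurableSet_Ioo fun x hx => ?_).trans (lintegral_mono_set (Ioo_subset_Ioo_left hr.1.le))
        have hx0 : 0 < x := hr0.trans hx.1
        have hr0x : r0 ≤ x := hr.1.le.trans hx.1.le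
        have f1 : 0 ≤ Real.log b - Real.log x := sub_nonneg.2 (Real.log_le_log hx0 hx.2.le)
        have f2 : Real.log b - Real.log x ≤ (1 - x) / x := by
          rw [← Real.log_div hb0.ne' hx0.ne']
          refine (Real.log_le_sub_one_of_pos (by positivity)).trans ?_
          rw [sub_div, div_self hx0.ne']
          gcongr
        have f3 : (Real.log b - Real.log x) / x ≤ r0⁻¹ ^ 2 * (1 - x) := by
          have hx1 : 0 ≤ 1 - x := by linarith [hx.2]
          calc (Real.log b - Real.log x) / x ≤ ((1 - x) / x) / x := by gcongr
            _ = (x⁻¹) ^ 2 * (1 - x) := by field_simp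
            _ ≤ _ := by gcongr
        rw [div_mul_comm, ENNReal.ofReal_mul (by positivity)]
        exact mul_le_mul_left (ENNReal.ofReal_le_ofReal f3) _

end Growth

section Truncation

lemma hasDerivAt_posPart_pow (k : ℕ) (x : ℝ) :
    HasDerivAt (fun x : ℝ => (max x 0) ^ (k + 2)) ((k + 2) * (max x 0) ^ (k + 1)) x := by
  rcases lt_trichotomy x 0 with h | h | h
  · have e : (fun x : ℝ => (max x 0) ^ (k + 2)) =ᶠ[𝓝 x] fun _ => 0 := by
      filter_upwards [Iio_mem_nhds h] with y hy
      rw [max_eq_right (le_of_lt hy)]; simp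
    refine ((hasDerivAt_const x (0 : ℝ)).congr_of_eventuallyEq e).congr_deriv ?_
    rw [max_eq_right h.le]; simp
  · subst h
    rw [hasDerivAt_iff_tendsto_slope]
    have hc : Continuous fun x : ℝ => (max x 0) ^ (k + 1) := by fun_prop
    have h1 := hc.tendsto 0
    simp only [max_self, ne_eq, Nat.add_eq_zero_iff, one_ne_zero, and_false, not_false_eq_true, zero_pow, mul_zero] at h1 ⊢
    refine (h1.mono_left nhdsWithin_le_nhds).congr' ?_
    filter_upwards [self_mem_nhdsWithin] with y hy
    have hy0 : y ≠ 0 := hy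
    rw [slope_def_field, eq_div_iff (by simpa using hy0)]
    simp only [max_self, ne_eq, Nat.add_eq_zero_iff, OfNat.ofNat_ne_zero, and_false, not_false_eq_true, zero_pow, sub_zero]
    rcases le_total y 0 with h | h
    · rw [max_eq_right h]; simp
    · rw [max_eq_left h]; ring
  · have e : (fun x : ℝ => (max x 0) ^ (k + 2)) =ᶠ[𝓝 x] fun x => x ^ (k + 2) := by
      filter_upwards [Ioi_mem_nhds h] with y hy
      rw [max_eq_left (le_of_lt hy)]
    refine ((hasDerivAt_pow (k + 2) x).congr_of_eventuallyEq e).congr_deriv ?_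
    rw [max_eq_left h.le]; push_cast; rfl

lemma contDiff_posPart_cube : ContDiff ℝ 2 fun x : ℝ => (max x 0) ^ 3 := by
  have h1 : deriv (fun x : ℝ => (max x 0) ^ 3) = fun x => 3 * (max x 0) ^ 2 := by
    ext x; rw [(hasDerivAt_posPart_pow 1 x).deriv]; norm_num
  have h2 : deriv (fun x : ℝ => (max x 0) ^ 2) = fun x => 2 * max x 0 := by
    ext x; rw [(hasDerivAt_posPart_pow 0 x).deriv]; norm_num
  rw [show (2 : WithTop ℕ∞) = 1 + 1 by norm_num, contDiff_succ_iff_deriv]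
  refine ⟨fun x => (hasDerivAt_posPart_pow 1 x).differentiableAt, by simp, ?_⟩
  rw [h1]
  refine contDiff_const.mul ?_
  rw [contDiff_one_iff_deriv, h2]
  exact ⟨fun x => (hasDerivAt_posPart_pow 0 x).differentiableAt, by fun_prop⟩

/-- A concave `C²` truncation, increasing from `0` at `0` to the constant value `1` beyond `1`. -/
def trunc (y : ℝ) : ℝ := 1 - (max (1 - y) 0) ^ 3

lemma contDiff_trunc : ContDiff ℝ 2 trunc := by
  unfold trunc
  exact contDiff_const.sub (contDiff_posPart_cube.comp (contDiff_const.sub contDiff_id))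

lemma hasDerivAt_trunc (y : ℝ) : HasDerivAt trunc (3 * (max (1 - y) 0) ^ 2) y := by
  have h := ((hasDerivAt_posPart_pow 1 (1 - y)).comp y ((hasDerivAt_id y).const_sub 1)).const_sub 1
  refine h.congr_deriv ?_
  norm_num

lemma hasDerivAt_trunc_deriv (y : ℝ) :
    HasDerivAt (fun y : ℝ => 3 * (max (1 - y) 0) ^ 2) (-(6 * max (1 - y) 0)) y := by
  have h := ((hasDerivAt_posPart_pow 0 (1 - y)).comp y ((hasDerivAt_id y).const_sub 1)).const_mul 3
  refine h.congr_deriv ?_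
  norm_num; ring

lemma trunc_nonneg {y : ℝ} (hy : 0 ≤ y) : 0 ≤ trunc y := by
  have : (max (1 - y) 0) ^ 3 ≤ 1 := pow_le_one₀ (le_max_right _ _) (max_le (by linarith) zero_le_one)
  unfold trunc; linarith

lemma trunc_le {y : ℝ} (hy : 0 ≤ y) : trunc y ≤ 3 * y := by
  unfold trunc
  rcases le_total y 1 with h | h
  · rw [max_eq_left (by linarith)]
    nlinarith [mul_nonneg hy hy, mul_nonneg (mul_nonneg hy hy) (by linarith : (0 : ℝ) ≤ 3 - y)]
  · rw [max_eq_right (by linarith)]; norm_num; linarith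

lemma trunc_of_one_le {y : ℝ} (hy : 1 ≤ y) : trunc y = 1 := by
  unfold trunc; rw [max_eq_right (by linarith)]; norm_num

/-- A `C²` function vanishing for `x ≤ L` and at least `1` for `x ≥ 2L`. -/
def ramp (L x : ℝ) : ℝ := (max (x / L - 1) 0) ^ 3

lemma contDiff_ramp (L : ℝ) : ContDiff ℝ 2 (ramp L) := by
  unfold ramp
  exact contDiff_posPart_cube.comp ((contDiff_id.div_const L).sub contDiff_const)

lemma hasDerivAt_ramp (L x : ℝ) : HasDerivAt (ramp L) (3 * (max (x / L - 1) 0) ^ 2 / L) x := by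
  have h := ((hasDerivAt_posPart_pow 1 (x / L - 1)).comp x (((hasDerivAt_id x).div_const L).sub_const 1))
  refine h.congr_deriv ?_
  norm_num; ring

lemma hasDerivAt_ramp_deriv (L x : ℝ) :
    HasDerivAt (fun x : ℝ => 3 * (max (x / L - 1) 0) ^ 2 / L) (6 * max (x / L - 1) 0 / L ^ 2) x := by
  have h := (((hasDerivAt_posPart_pow 0 (x / L - 1)).comp x (((hasDerivAt_id x).div_const L).sub_const 1)).const_mul 3).div_const L
  refine h.congr_deriv ?_
  norm_num; ring

lemma ramp_nonneg (L x : ℝ) : 0 ≤ ramp L x := by unfold ramp; positivity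

lemma ramp_of_le {L x : ℝ} (hL : 0 < L) (h : x ≤ L) : ramp L x = 0 := by
  have : x / L ≤ 1 := (div_le_one hL).2 h
  unfold ramp; rw [max_eq_right (by linarith)]; norm_num

lemma one_le_ramp {L x : ℝ} (hL : 0 < L) (h : 2 * L ≤ x) : 1 ≤ ramp L x := by
  have : 2 ≤ x / L := (le_div_iff₀ hL).2 h
  unfold ramp; rw [max_eq_left (by linarith)]
  exact one_le_pow₀ (by linarith)

variable {E : Type*} [NormedAddCommGroup E] [NormedSpace ℝ E] [NormedSpace ℂ E] [IsScalarTower ℝ ℂ E]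

lemma levi_trunc_ramp_le {f H : E → ℂ} {z v : E} {L c : ℝ} (hL : 0 < L) (hc : 0 < c)
    (hf : ContDiffAt ℂ 2 f z) (hH : ContDiffAt ℂ 2 H z) (hH0 : 0 ≤ (H z).re) :
    levi (fun w => trunc (ramp L (‖f w‖ ^ 2) + (((c⁻¹ : ℝ) : ℂ) * H w).re)) z v ≤
      {w | (L ≤ ‖f w‖ ^ 2 ∧ ‖f w‖ ^ 2 ≤ 2 * L) ∧ (H w).re < c}.indicator
        (fun w => 180 / L * ‖fderiv ℂ f w v‖ ^ 2) z := by
  have hHc : ContDiffAt ℂ 2 (fun w => ((c⁻¹ : ℝ) : ℂ) * H w) z := contDiffAt_const.mul hH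
  have hre : ContDiffAt ℝ 2 (fun w => (((c⁻¹ : ℝ) : ℂ) * H w).re) z :=
    Complex.reCLM.contDiff.contDiffAt.comp z (hHc.restrict_scalars ℝ)
  have hU : ContDiffAt ℝ 2 (fun w => ramp L (‖f w‖ ^ 2)) z :=
    (contDiff_ramp L).contDiffAt.comp z ((hf.restrict_scalars ℝ).norm_sq ℝ)
  have h1 := levi_comp_le (v := v) (hU.add hre) contDiff_trunc hasDerivAt_trunc
    (hasDerivAt_trunc_deriv _) (by have := le_max_right (1 - (ramp L (‖f z‖ ^ 2) + (((c⁻¹ : ℝ) : ℂ) * H z).re)) 0; linarith)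
  refine h1.trans ?_
  rw [levi_add hU hre, levi_re hHc, add_zero, levi_normSq hf v hU (Eventually.of_forall fun x => hasDerivAt_ramp L x)
    (hasDerivAt_ramp_deriv L _)]
  set x := ‖f z‖ ^ 2
  set D := ‖fderiv ℂ f z v‖ ^ 2
  have hD : 0 ≤ D := by positivity
  have hre' : (((c⁻¹ : ℝ) : ℂ) * H z).re = (H z).re / c := by
    rw [Complex.re_ofReal_mul]; ring
  have hre0 : 0 ≤ (((c⁻¹ : ℝ) : ℂ) * H z).re := by rw [hre']; positivity
  have hr0 := ramp_nonneg L x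
  by_cases hz : z ∈ {w | (L ≤ ‖f w‖ ^ 2 ∧ ‖f w‖ ^ 2 ≤ 2 * L) ∧ (H w).re < c}
  · rw [indicator_of_mem hz]
    obtain ⟨⟨ha, hb⟩, _⟩ : (L ≤ x ∧ x ≤ 2 * L) ∧ (H z).re < c := hz
    have e1 : 1 ≤ x / L := (one_le_div hL).2 ha
    have e2 : x / L ≤ 2 := (div_le_iff₀ hL).2 hb
    rw [max_eq_left (by linarith : 0 ≤ x / L - 1)]
    have e3 : 4 * (3 * (x / L - 1) ^ 2 / L + x * (6 * (x / L - 1) / L ^ 2)) =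
        (12 * (x / L - 1) ^ 2 + 24 * (x / L) * (x / L - 1)) / L := by
      field_simp; ring
    rw [e3]
    set y := x / L
    have e4 : 12 * (y - 1) ^ 2 + 24 * y * (y - 1) ≤ 60 := by nlinarith
    have e5 : 0 ≤ 12 * (y - 1) ^ 2 + 24 * y * (y - 1) := by nlinarith
    have e6 : (max (1 - (ramp L x + (((c⁻¹ : ℝ) : ℂ) * H z).re)) 0) ^ 2 ≤ 1 :=
      pow_le_one₀ (le_max_right _ _) (max_le (by linarith) zero_le_one)
    have e7 : 0 ≤ (max (1 - (ramp L x + (((c⁻¹ : ℝ) : ℂ) * H z).re)) 0) ^ 2 := by positivity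
    calc _ ≤ 3 * 1 * ((12 * (y - 1) ^ 2 + 24 * y * (y - 1)) / L * D) := by
          gcongr
      _ ≤ 3 * 1 * (60 / L * D) := by gcongr
      _ = _ := by ring
  · rw [indicator_of_notMem hz]
    have hz' : ¬ ((L ≤ x ∧ x ≤ 2 * L) ∧ (H z).re < c) := hz
    by_cases ha : L ≤ x
    · have h2 : 1 ≤ ramp L x + (((c⁻¹ : ℝ) : ℂ) * H z).re := by
        by_cases hb : x ≤ 2 * L
        · have : c ≤ (H z).re := by
            by_contra hcon; exact hz' ⟨⟨ha, hb⟩, not_le.1 hcon⟩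
          rw [hre']
          have := (one_le_div hc).2 this
          linarith
        · have := one_le_ramp hL (not_le.1 hb).le
          linarith
      rw [max_eq_right (by linarith : 1 - (ramp L x + (((c⁻¹ : ℝ) : ℂ) * H z).re) ≤ 0)]
      simp
    · have h2 : x / L - 1 ≤ 0 := by
        have := (div_le_one hL).2 (not_le.1 ha).le
        linarith
      rw [max_eq_right h2]; simp

end Truncation

section Herglotz

/-- The Herglotz integral of the indicator of `X`. -/
def herg (X : Set ℂ) (w : ℂ) : ℂ := ∫ u in X, (u + w) / (u - w) ∂(tau ℂ)

lemma one_sub_le_norm_sub {u w : ℂ} (hu : ‖u‖ = 1) : 1 - ‖w‖ ≤ ‖u - w‖ := by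
  have := norm_sub_norm_le u w
  rwa [hu] at this

lemma measurable_herg_kernel (w : ℂ) : Measurable fun u : ℂ => (u + w) / (u - w) := by fun_prop

lemma norm_herg_kernel_le {u w : ℂ} (hu : ‖u‖ = 1) (hw : ‖w‖ < 1) :
    ‖(u + w) / (u - w)‖ ≤ 2 / (1 - ‖w‖) := by
  rw [norm_div]
  have h1 : ‖u + w‖ ≤ 2 := by have := norm_add_le u w; rw [hu] at this; linarith
  exact div_le_div₀ (by norm_num) h1 (by linarith) (one_sub_le_norm_sub hu)

lemma ae_restrict_tau_norm (X : Set ℂ) : ∀ᵐ u ∂((tau ℂ).restrict X), ‖u‖ = 1 :=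
  ae_restrict_of_ae tau_ae_norm

lemma integrable_herg {w : ℂ} (hw : ‖w‖ < 1) (X : Set ℂ) :
    Integrable (fun u : ℂ => (u + w) / (u - w)) ((tau ℂ).restrict X) := by
  refine Integrable.of_bound (measurable_herg_kernel w).aestronglyMeasurable (2 / (1 - ‖w‖)) ?_
  filter_upwards [ae_restrict_tau_norm X] with u hu using norm_herg_kernel_le hu hw

lemma differentiableOn_herg (X : Set ℂ) : DifferentiableOn ℂ (herg X) (ball 0 1) := by
  intro w0 hw0
  have hw0' : ‖w0‖ < 1 := by simpa using hw0
  set ε := (1 - ‖w0‖) / 2 with hε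
  have hε0 : 0 < ε := by rw [hε]; linarith
  have hb : ∀ w ∈ ball w0 ε, ‖w‖ < 1 - ε := by
    intro w hw
    have h1 : ‖w - w0‖ < ε := by simpa [dist_eq_norm] using hw
    have := norm_sub_norm_le w w0
    linarith
  have h := hasDerivAt_integral_of_dominated_loc_of_deriv_le (𝕜 := ℂ) (μ := (tau ℂ).restrict X)
    (F := fun w u => (u + w) / (u - w)) (F' := fun w u => 2 * u / (u - w) ^ 2) (x₀ := w0) (s := ball w0 ε)
    (bound := fun _ => 2 / ε ^ 2) (ball_mem_nhds _ hε0)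
    (Eventually.of_forall fun w => (measurable_herg_kernel w).aestronglyMeasurable)
    (integrable_herg hw0' X) (show Measurable fun u : ℂ => 2 * u / (u - w0) ^ 2 by fun_prop).aestronglyMeasurable ?_ (integrable_const _) ?_
  · exact h.2.differentiableAt.differentiableWithinAt
  · filter_upwards [ae_restrict_tau_norm X] with u hu w hw
    have h2 := one_sub_le_norm_sub (w := w) hu
    have h3 := hb w hw
    rw [norm_div, norm_mul, norm_pow, hu]
    simp only [Complex.norm_ofNat, mul_one]
    gcongr
    linarith
  · filter_upwards [ae_restrict_tau_norm X] with u hu w hw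
    have h2 := one_sub_le_norm_sub (w := w) hu
    have h3 := hb w hw
    have h4 : u - w ≠ 0 := norm_pos_iff.1 (by linarith)
    refine (((hasDerivAt_id w).const_add u).div ((hasDerivAt_id w).const_sub u) h4).congr_deriv ?_
    simp only [id]
    congr 1; ring

lemma herg_kernel_re {u w : ℂ} (hu : ‖u‖ = 1) :
    ((u + w) / (u - w)).re = (1 - ‖w‖ ^ 2) / ‖u - w‖ ^ 2 := by
  have hu2 : u.re * u.re + u.im * u.im = 1 := by
    rw [← Complex.normSq_apply, Complex.normSq_eq_norm_sq, hu]; norm_num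
  rw [Complex.div_re, ← add_div, ← Complex.normSq_eq_norm_sq (u - w), ← Complex.normSq_eq_norm_sq w]
  congr 1
  simp only [Complex.normSq_apply, Complex.add_re, Complex.add_im, Complex.sub_re, Complex.sub_im]
  linear_combination hu2

lemma herg_re {w : ℂ} (hw : ‖w‖ < 1) (X : Set ℂ) :
    (herg X w).re = ∫ u in X, (1 - ‖w‖ ^ 2) / ‖u - w‖ ^ 2 ∂(tau ℂ) := by
  have h := Complex.reCLM.integral_comp_comm (integrable_herg hw X)
  simp only [Complex.reCLM_apply] at h
  rw [herg, ← h]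
  refine integral_congr_ae ?_
  filter_upwards [ae_restrict_tau_norm X] with u hu using herg_kernel_re hu

lemma herg_re_nonneg {w : ℂ} (hw : ‖w‖ < 1) (X : Set ℂ) : 0 ≤ (herg X w).re := by
  rw [herg_re hw]
  refine integral_nonneg fun u => ?_
  have : 0 ≤ 1 - ‖w‖ ^ 2 := by nlinarith [norm_nonneg w]
  positivity

lemma integrable_herg_re {w : ℂ} (hw : ‖w‖ < 1) (X : Set ℂ) :
    Integrable (fun u : ℂ => (1 - ‖w‖ ^ 2) / ‖u - w‖ ^ 2) ((tau ℂ).restrict X) := by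
  refine ((integrable_herg hw X).re).congr ?_
  filter_upwards [ae_restrict_tau_norm X] with u hu using herg_kernel_re hu

lemma herg_re_le {w : ℂ} (hw : ‖w‖ < 1) (X : Set ℂ) :
    (herg X w).re ≤ 2 / (1 - ‖w‖) * (tau ℂ X).toReal := by
  have h1 : (herg X w).re ≤ ∫ u in X, 2 / (1 - ‖w‖) ∂(tau ℂ) := by
    rw [herg_re hw]
    refine integral_mono_ae (integrable_herg_re hw X) (integrable_const _) ?_
    filter_upwards [ae_restrict_tau_norm X] with u hu
    have h2 := one_sub_le_norm_sub (w := w) hu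
    have h3 : 0 < 1 - ‖w‖ := by linarith
    have h4 : 0 ≤ 1 - ‖w‖ ^ 2 := by nlinarith [norm_nonneg w]
    calc (1 - ‖w‖ ^ 2) / ‖u - w‖ ^ 2 ≤ (1 - ‖w‖ ^ 2) / (1 - ‖w‖) ^ 2 := by gcongr
      _ = (1 + ‖w‖) / (1 - ‖w‖) := by field_simp; ring
      _ ≤ 2 / (1 - ‖w‖) := by gcongr; linarith
  rw [integral_const, smul_eq_mul, measureReal_restrict_apply_univ, mul_comm] at h1
  exact h1

lemma exists_le_herg_re {κ : ℝ} (hκ : 0 < κ) (hκ1 : κ ≤ 1) :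
    ∃ c : ℝ, 0 < c ∧ ∀ (X : Set ℂ) (w : ℂ), w ≠ 0 → ‖w‖ < 1 →
      (∀ u : ℂ, ‖u‖ = 1 → ‖u - ‖w‖⁻¹ • w‖ < κ * (1 - ‖w‖) → u ∈ X) → c ≤ (herg X w).re := by
  obtain ⟨c0, hc0, h0⟩ := exists_le_tau_ball ℂ
  have hfr : Module.finrank ℝ ℂ - 1 = 1 := by rw [Complex.finrank_real_complex]
  refine ⟨c0 * κ / (1 + κ) ^ 2, by positivity, fun X w hw0 hw hX => ?_⟩
  have hw0' : 0 < ‖w‖ := norm_pos_iff.2 hw0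
  have hd : 0 < 1 - ‖w‖ := by linarith
  set η : ℂ := ‖w‖⁻¹ • w with hη
  have hη1 : ‖η‖ = 1 := by rw [hη, norm_smul, norm_inv, norm_norm, inv_mul_cancel₀ hw0'.ne']
  have hrpos : 0 < κ * (1 - ‖w‖) := by positivity
  have hr1 : κ * (1 - ‖w‖) ≤ 1 := by nlinarith
  have h1 := h0 η (κ * (1 - ‖w‖)) hη1 hrpos hr1
  rw [hfr, pow_one] at h1
  have h2 : tau ℂ (ball η (κ * (1 - ‖w‖))) ≤ tau ℂ (X ∩ ball η (κ * (1 - ‖w‖))) := by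
    refine measure_mono_ae ?_
    filter_upwards [tau_ae_norm (E := ℂ)] with u hu hu2
    exact ⟨hX u hu (by rw [← dist_eq_norm]; exact hu2), hu2⟩
  have h3 : c0 * (κ * (1 - ‖w‖)) ≤ (tau ℂ (X ∩ ball η (κ * (1 - ‖w‖)))).toReal :=
    (ENNReal.ofReal_le_iff_le_toReal (measure_ne_top _ _)).1 (h1.trans h2)
  have h4 : 0 ≤ 1 - ‖w‖ ^ 2 := by nlinarith
  have hwη : ‖η - w‖ = 1 - ‖w‖ := norm_inv_smul_sub hw0 hw.le
  have h5 : ∫ u in X, (ball η (κ * (1 - ‖w‖))).indicator (fun _ => (1 - ‖w‖) / ((1 + κ) * (1 - ‖w‖)) ^ 2) u ∂(tau ℂ)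
      ≤ (herg X w).re := by
    rw [herg_re hw]
    refine integral_mono_ae ((integrable_const _).indicator measurableSet_ball) (integrable_herg_re hw X) ?_
    filter_upwards [ae_restrict_tau_norm X] with u hu
    by_cases hub : u ∈ ball η (κ * (1 - ‖w‖))
    · rw [indicator_of_mem hub]
      have h6 : ‖u - η‖ < κ * (1 - ‖w‖) := by simpa [dist_eq_norm] using hub
      have h7 : ‖u - w‖ ≤ (1 + κ) * (1 - ‖w‖) := by
        have : u - w = (u - η) + (η - w) := by ring
        rw [this]
        refine (norm_add_le _ _).trans ?_
        rw [hwη]; linarith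
      have h8 : 0 < ‖u - w‖ := lt_of_lt_of_le hd (one_sub_le_norm_sub hu)
      have h9 : 1 - ‖w‖ ≤ 1 - ‖w‖ ^ 2 := by nlinarith
      gcongr
    · rw [indicator_of_notMem hub]; positivity
  refine le_trans ?_ h5
  rw [integral_indicator measurableSet_ball, integral_const, smul_eq_mul,
    measureReal_restrict_apply_univ, measureReal_restrict_apply measurableSet_ball, inter_comm]
  change _ ≤ (tau ℂ (X ∩ ball η (κ * (1 - ‖w‖)))).toReal * _
  calc c0 * κ / (1 + κ) ^ 2 = c0 * (κ * (1 - ‖w‖)) * ((1 - ‖w‖) / ((1 + κ) * (1 - ‖w‖)) ^ 2) := by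
        field_simp
    _ ≤ _ := by gcongr

lemma ofReal_integral_le {α : Type*} [MeasurableSpace α] {μ : Measure α} (f : α → ℝ) :
    ENNReal.ofReal (∫ x, f x ∂μ) ≤ ∫⁻ x, ENNReal.ofReal (f x) ∂μ := by
  by_cases hf : Integrable f μ
  · rw [integral_eq_lintegral_pos_part_sub_lintegral_neg_part hf]
    exact (ENNReal.ofReal_le_ofReal (sub_le_self _ ENNReal.toReal_nonneg)).trans ENNReal.ofReal_toReal_le
  · rw [integral_undef hf]; simp

end Herglotz

/-- A one-variable good-`λ` estimate. -/
lemma exists_slice_le {κ r0 r1 : ℝ} (hκ : 0 < κ) (hκ1 : κ ≤ 1) (h0 : 0 < r0) (h01 : r0 < r1) (h1 : r1 < 1) :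
    ∃ C : ℝ, 0 < C ∧ ∀ (f : ℂ → ℂ) (X Z : Set ℂ) (L ρ : ℝ), DifferentiableOn ℂ f (ball 0 1) → 0 < L →
      r1 ≤ ρ → ρ < 1 → (∀ w : ℂ, ‖w‖ ≤ r1 → ‖f w‖ ^ 2 ≤ L) →
      (∀ w : ℂ, r0 ≤ ‖w‖ → ‖w‖ < 1 → w ∉ Z → ∀ u : ℂ, ‖u‖ = 1 → ‖u - ‖w‖⁻¹ • w‖ < κ * (1 - ‖w‖) → u ∈ X) →
      tau ℂ {u | 2 * L ≤ ‖f (ρ • u)‖ ^ 2} ≤ ENNReal.ofReal C * tau ℂ X +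
        ENNReal.ofReal (C / L) * ∫⁻ r in Ioo r0 ρ, ENNReal.ofReal (1 - r) *
          ∫⁻ u, (Z ∩ {w | L ≤ ‖f w‖ ^ 2 ∧ ‖f w‖ ^ 2 ≤ 2 * L}).indicator
            (fun w => ENNReal.ofReal (‖fderiv ℂ f w w‖ ^ 2)) (r • u) ∂(tau ℂ) := by
  obtain ⟨c, hc, hcX⟩ := exists_le_herg_re hκ hκ1
  set A := 1 + 1 / ((r1 - r0) * r0) with hA
  have hr10 : 0 < r1 - r0 := by linarith
  have hA0 : 0 < A := by positivity
  set T := (tau ℂ univ).toReal with hT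
  have hT0 : 0 ≤ T := ENNReal.toReal_nonneg
  have h1r : 0 < 1 - r1 := by linarith
  set C := A * (T * (3 * (2 / (1 - r1) / c))) + r0⁻¹ ^ 2 * 180 with hC
  refine ⟨C, by positivity, fun f X Z L ρ hf hL hρ1 hρ hfL hXZ => ?_⟩
  set W : ℂ → ℝ := fun w => trunc (ramp L (‖f w‖ ^ 2) + (((c⁻¹ : ℝ) : ℂ) * herg X w).re) with hW
  have hre' : ∀ w, (((c⁻¹ : ℝ) : ℂ) * herg X w).re = (herg X w).re / c := fun w => by
    rw [Complex.re_ofReal_mul]; ring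
  have hf2 := contDiffOn_two_of_isOpen isOpen_ball hf
  have hH2 := contDiffOn_two_of_isOpen isOpen_ball (differentiableOn_herg X)
  have hWc : ContDiffOn ℝ 2 W (ball 0 1) := by
    refine contDiff_trunc.comp_contDiffOn (ContDiffOn.add ?_ ?_)
    · exact (contDiff_ramp L).comp_contDiffOn ((hf2.restrict_scalars ℝ).norm_sq ℝ)
    · exact Complex.reCLM.contDiff.comp_contDiffOn ((contDiffOn_const.mul hH2).restrict_scalars ℝ)
  have hn : ∀ r : ℝ, 0 < r → ∀ u : ℂ, ‖u‖ = 1 → ‖r • u‖ = r := fun r hr u hu => by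
    rw [norm_smul, hu, Real.norm_of_nonneg hr.le, mul_one]
  have hW0 : ∀ w, ‖w‖ < 1 → 0 ≤ W w := fun w hw => by
    have := herg_re_nonneg hw X
    have := ramp_nonneg L (‖f w‖ ^ 2)
    exact trunc_nonneg (by rw [hre']; positivity)
  have hWi : ∀ r : ℝ, 0 < r → r < 1 → Integrable (fun u => W (r • u)) (tau ℂ) := fun r hr hr1 => by
    refine ContinuousOn.integrable_tau (hWc.continuousOn.comp (by fun_prop) ?_)
    intro u hu
    have hu' : ‖u‖ = 1 := by simpa using hu
    have := hn r hr u hu'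
    simp only [mem_ball, dist_zero_right]; rw [this]; exact hr1
  have hS : ∀ r ∈ Icc r0 r1, 0 ≤ Mm W r ∧ Mm W r ≤ T * (3 * (2 / (1 - r1) * (tau ℂ X).toReal / c)) := by
    intro r hr
    have hr0 : 0 < r := by linarith [hr.1]
    have hr1 : r < 1 := by linarith [hr.2]
    constructor
    · refine integral_nonneg_of_ae ?_
      filter_upwards [tau_ae_norm (E := ℂ)] with u hu
      exact hW0 _ (by rw [hn r hr0 u hu]; exact hr1)
    · have h2 : Mm W r ≤ ∫ u, 3 * (2 / (1 - r1) * (tau ℂ X).toReal / c) ∂(tau ℂ) := by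
        refine integral_mono_ae (hWi r hr0 hr1) (integrable_const _) ?_
        filter_upwards [tau_ae_norm (E := ℂ)] with u hu
        have h3 := hn r hr0 u hu
        have h4 : ‖r • u‖ < 1 := by rw [h3]; exact hr1
        have h5 := herg_re_le h4 X
        have h6 := herg_re_nonneg h4 X
        have h7 : (herg X (r • u)).re ≤ 2 / (1 - r1) * (tau ℂ X).toReal := by
          refine h5.trans ?_
          rw [h3]
          have := hr.2
          gcongr
        simp only [hW]
        rw [ramp_of_le hL (hfL _ (by rw [h3]; exact hr.2)), zero_add, hre']
        refine (trunc_le (by positivity)).trans ?_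
        gcongr
      rw [integral_const, smul_eq_mul] at h2
      exact h2
  have key := ofReal_Mm_le hWc h0 h01 hρ1 hρ hS
  have hρ0 : 0 < ρ := by linarith
  have hleft : tau ℂ {u | 2 * L ≤ ‖f (ρ • u)‖ ^ 2} ≤ ENNReal.ofReal (Mm W ρ) := by
    have e : ENNReal.ofReal (Mm W ρ) = ∫⁻ u, ENNReal.ofReal (W (ρ • u)) ∂(tau ℂ) := by
      refine ofReal_integral_eq_lintegral_ofReal (hWi ρ hρ0 hρ) ?_
      filter_upwards [tau_ae_norm (E := ℂ)] with u hu
      exact hW0 _ (by rw [hn ρ hρ0 u hu]; exact hρ)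
    rw [e]
    have h2 : AEMeasurable (fun u => ENNReal.ofReal (W (ρ • u))) (tau ℂ) :=
      (hWi ρ hρ0 hρ).1.aemeasurable.ennreal_ofReal
    have h3 := mul_meas_ge_le_lintegral₀ h2 1
    rw [one_mul] at h3
    refine le_trans (measure_mono_ae ?_) h3
    filter_upwards [tau_ae_norm (E := ℂ)] with u hu hu2
    have h4 : ‖ρ • u‖ < 1 := by rw [hn ρ hρ0 u hu]; exact hρ
    have h5 := herg_re_nonneg h4 X
    have h6 := one_le_ramp hL hu2
    have h7 : W (ρ • u) = 1 := trunc_of_one_le (by rw [hre']; have : 0 ≤ (herg X (ρ • u)).re / c := by positivity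
                                                   linarith)
    change 1 ≤ ENNReal.ofReal (W (ρ • u))
    rw [h7]; simp
  refine hleft.trans (key.trans (add_le_add ?_ ?_))
  · have h2 : A * (T * (3 * (2 / (1 - r1) * (tau ℂ X).toReal / c))) ≤ C * (tau ℂ X).toReal := by
      have h3 : A * (T * (3 * (2 / (1 - r1) * (tau ℂ X).toReal / c))) =
        (A * (T * (3 * (2 / (1 - r1) / c)))) * (tau ℂ X).toReal := by ring
      rw [h3]
      have : 0 ≤ r0⁻¹ ^ 2 * 180 := by positivity
      gcongr
      rw [hC]; linarith
    refine (ENNReal.ofReal_le_ofReal h2).trans ?_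
    rw [ENNReal.ofReal_mul (by positivity), ENNReal.ofReal_toReal (measure_ne_top _ _)]
  · rw [← lintegral_const_mul' _ _ ENNReal.ofReal_ne_top]
    refine setLIntegral_mono' measurableSet_Ioo fun r hr => ?_
    have hr0 : 0 < r := by linarith [hr.1]
    have hr1 : r < 1 := by linarith [hr.2]
    have h2 : ENNReal.ofReal (∫ ζ, levi W (r • ζ) (r • ζ) ∂(tau ℂ)) ≤ ENNReal.ofReal (180 / L) *
        ∫⁻ u, (Z ∩ {w | L ≤ ‖f w‖ ^ 2 ∧ ‖f w‖ ^ 2 ≤ 2 * L}).indicator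
            (fun w => ENNReal.ofReal (‖fderiv ℂ f w w‖ ^ 2)) (r • u) ∂(tau ℂ) := by
      refine (ofReal_integral_le _).trans ?_
      rw [← lintegral_const_mul' _ _ ENNReal.ofReal_ne_top]
      refine lintegral_mono_ae ?_
      filter_upwards [tau_ae_norm (E := ℂ)] with u hu
      have h3 := hn r hr0 u hu
      set w := r • u with hw
      have h4 : ‖w‖ < 1 := by rw [h3]; exact hr1
      have h4' : w ∈ ball (0 : ℂ) 1 := by simpa using h4
      have h5 := levi_trunc_ramp_le (v := w) hL hc ((hf2 w h4').contDiffAt (isOpen_ball.mem_nhds h4'))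
        ((hH2 w h4').contDiffAt (isOpen_ball.mem_nhds h4')) (herg_re_nonneg h4 X)
      refine (ENNReal.ofReal_le_ofReal h5).trans ?_
      by_cases hm : w ∈ {w | (L ≤ ‖f w‖ ^ 2 ∧ ‖f w‖ ^ 2 ≤ 2 * L) ∧ (herg X w).re < c}
      · rw [indicator_of_mem hm]
        have hm2 : w ∈ Z ∩ {w | L ≤ ‖f w‖ ^ 2 ∧ ‖f w‖ ^ 2 ≤ 2 * L} := by
          refine ⟨?_, hm.1⟩
          by_contra hZ
          have h6 := hcX X w (norm_pos_iff.1 (by rw [h3]; exact hr0)) h4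
            (hXZ w (by rw [h3]; exact hr.1.le) h4 hZ)
          exact absurd hm.2 (not_lt.2 h6)
        rw [indicator_of_mem hm2, ENNReal.ofReal_mul (by positivity)]
      · rw [indicator_of_notMem hm]; simp
    refine (mul_le_mul_right h2 _).trans ?_
    rw [← mul_assoc, ← mul_assoc, ← ENNReal.ofReal_mul (by have : 0 < 1 - r := by linarith
                                                           positivity),
      ← ENNReal.ofReal_mul (by positivity)]
    refine mul_le_mul_left (ENNReal.ofReal_le_ofReal ?_) _
    have h3 : r0⁻¹ ^ 2 * (1 - r) * (180 / L) = (r0⁻¹ ^ 2 * 180) / L * (1 - r) := by ring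
    rw [h3]
    have h4 : 0 ≤ 1 - r := by linarith
    have h5 : 0 ≤ A * (T * (3 * (2 / (1 - r1) / c))) := by positivity
    gcongr
    rw [hC]; linarith

section Slices
variable {n : ℕ}

lemma dk_slice_le {ζ η : En n} {w u : ℂ} (hζ : ‖ζ‖ = 1) (hu : ‖u‖ = 1) (hη : ‖η‖ = 1) :
    dk (w • ζ) η ≤ ‖u - w‖ + ‖w‖ * dk η (u • ζ) := by
  have huc : u * (starRingEnd ℂ) u = 1 := by
    rw [Complex.mul_conj, Complex.normSq_eq_norm_sq, hu]; norm_num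
  have hzz : (inner ℂ η (u • ζ) : ℂ) = u * inner ℂ η ζ := inner_smul_right _ _ _
  have h1 : (1 : ℂ) - inner ℂ η (w • ζ) =
      (starRingEnd ℂ) u * (u - w) + w * (starRingEnd ℂ) u * (1 - inner ℂ η (u • ζ)) := by
    rw [hzz, inner_smul_right]
    linear_combination (-1 + w * inner ℂ η ζ) * huc
  rw [dk_comm η]
  unfold dk
  rw [h1]
  refine (norm_add_le _ _).trans ?_
  rw [norm_mul, norm_mul, norm_mul, RCLike.norm_conj, hu, one_mul, mul_one]

lemma norm_sub_le_of_norm_inv_smul_sub {u w : ℂ} {κ : ℝ} (hw0 : w ≠ 0) (hw : ‖w‖ < 1)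
    (h : ‖u - ‖w‖⁻¹ • w‖ < κ * (1 - ‖w‖)) : ‖u - w‖ < (1 + κ) * (1 - ‖w‖) := by
  have : u - w = (u - ‖w‖⁻¹ • w) + (‖w‖⁻¹ • w - w) := by ring
  rw [this]
  refine (norm_add_le _ _).trans_lt ?_
  rw [norm_inv_smul_sub hw0 hw.le]; linarith

/-- Integration of slices through the origin. -/
lemma lintegral_slices {H : En n → ℝ≥0∞} (hH : Measurable H) :
    ∫⁻ ζ, ∫⁻ u : ℂ, H (u • ζ) ∂(tau ℂ) ∂(tau (En n)) = tau ℂ univ * ∫⁻ ζ, H ζ ∂(tau (En n)) := by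
  have hm : Measurable fun p : En n × ℂ => H (p.2 • p.1) :=
    hH.comp (continuous_snd.smul continuous_fst).measurable
  rw [lintegral_lintegral_swap hm.aemeasurable]
  have : ∀ᵐ u ∂(tau ℂ), ∫⁻ ζ, H (u • ζ) ∂(tau (En n)) = ∫⁻ ζ, H ζ ∂(tau (En n)) := by
    filter_upwards [tau_ae_norm (E := ℂ)] with u hu
    have hu0 : u ≠ 0 := norm_pos_iff.1 (by rw [hu]; norm_num)
    let R : En n ≃ₗᵢ[ℝ] En n :=
      { (LinearEquiv.smulOfNeZero ℂ (En n) u hu0).restrictScalars ℝ with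
        norm_map' := fun z => by
          change ‖u • z‖ = ‖z‖
          rw [norm_smul, hu, one_mul] }
    exact (tau_isometry R).lintegral_comp hH
  rw [lintegral_congr_ae this, lintegral_const, mul_comm]

lemma slice_differentiableOn {g : En n → ℂ} (hg : DifferentiableOn ℂ g (ball 0 1)) {ζ : En n} (hζ : ‖ζ‖ = 1) :
    DifferentiableOn ℂ (fun w : ℂ => g (w • ζ)) (ball 0 1) := by
  refine hg.comp (by fun_prop) fun w hw => ?_
  simpa [norm_smul, hζ] using hw

lemma fderiv_slice {g : En n → ℂ} (hg : DifferentiableOn ℂ g (ball 0 1)) {ζ : En n} (hζ : ‖ζ‖ = 1)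
    {w : ℂ} (hw : ‖w‖ < 1) : fderiv ℂ (fun w : ℂ => g (w • ζ)) w w = fderiv ℂ g (w • ζ) (w • ζ) := by
  have hm : w • ζ ∈ ball (0 : En n) 1 := by simpa [norm_smul, hζ] using hw
  have h1 : HasFDerivAt (fun w : ℂ => w • ζ) ((ContinuousLinearMap.id ℂ ℂ).smulRight ζ) w :=
    (hasFDerivAt_id w).smul_const ζ
  have h2 := ((hg _ hm).differentiableAt (isOpen_ball.mem_nhds hm)).hasFDerivAt.comp w h1
  have h3 : fderiv ℂ (fun w : ℂ => g (w • ζ)) w = _ := h2.fderiv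
  rw [h3]; simp

lemma norm_radial_sq_mul_le (g : En n → ℂ) {z : En n} (hz : ‖z‖ ≤ 1) :
    ‖fderiv ℂ g z z‖ ^ 2 * (1 - ‖z‖) ≤ N2 g z := by
  have h1 : ‖fderiv ℂ g z z‖ ≤ ‖fderiv ℂ g z‖ * ‖z‖ := (fderiv ℂ g z).le_opNorm z
  have h2 : ‖fderiv ℂ g z z‖ ^ 2 ≤ ‖fderiv ℂ g z‖ ^ 2 * ‖z‖ ^ 2 := by
    rw [← mul_pow]; gcongr
  unfold N2
  have h0 := norm_nonneg z
  have hD : 0 ≤ ‖fderiv ℂ g z‖ ^ 2 := by positivity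
  nlinarith [mul_nonneg hD (mul_nonneg (sq_nonneg (1 - ‖z‖)) (by linarith : 0 ≤ 1 + ‖z‖)), mul_nonneg h0 (sub_nonneg.2 hz), mul_le_mul_of_nonneg_left h2 (by linarith : 0 ≤ 2 - ‖z‖), mul_nonneg hD (sub_nonneg.2 hz), mul_nonneg hD h0]

lemma measurable_radial (g : En n → ℂ) : Measurable fun z => fderiv ℂ g z z := by
  have h : Continuous fun p : (En n →L[ℂ] ℂ) × En n => p.1 p.2 := isBoundedBilinearMap_apply.continuous
  exact h.measurable.comp ((measurable_fderiv ℂ g).prodMk measurable_id)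

lemma le_rpow_mul_of_level {t L : ℝ} (ht : 0 < t) (hL : 0 < L) {x : ℂ} (h1 : L ≤ ‖x‖ ^ 2) (h2 : ‖x‖ ^ 2 ≤ 2 * L) :
    ENNReal.ofReal (L ^ (t - 1)) ≤ ENNReal.ofReal (max 1 (2 ^ (1 - t))) * ‖x‖ₑ ^ (2 * t - 2) := by
  have hx2 : 0 < ‖x‖ ^ 2 := lt_of_lt_of_le hL h1
  have hx : 0 < ‖x‖ := by
    rcases (norm_nonneg x).eq_or_lt with h | h
    · rw [← h] at hx2; norm_num at hx2
    · exact h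
  have e : ‖x‖ₑ ^ (2 * t - 2) = ENNReal.ofReal ((‖x‖ ^ 2) ^ (t - 1)) := by
    rw [← ofReal_norm, ENNReal.ofReal_rpow_of_pos hx, ← Real.rpow_natCast_mul hx.le]
    congr 2; push_cast; ring
  rw [e, ← ENNReal.ofReal_mul (by positivity)]
  refine ENNReal.ofReal_le_ofReal ?_
  rcases le_total 1 t with h | h
  · have := Real.rpow_le_rpow hL.le h1 (by linarith : 0 ≤ t - 1)
    have h3 := le_max_left (1 : ℝ) (2 ^ (1 - t))
    have h4 : 0 ≤ (‖x‖ ^ 2) ^ (t - 1) := by positivity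
    nlinarith
  · have h5 := Real.rpow_le_rpow_of_nonpos hx2 h2 (by linarith : t - 1 ≤ 0)
    have h3 := le_max_right (1 : ℝ) (2 ^ (1 - t))
    have h4 : 0 ≤ (‖x‖ ^ 2) ^ (t - 1) := by positivity
    have h6 : (2 : ℝ) ^ (1 - t) * (2 * L) ^ (t - 1) = L ^ (t - 1) := by
      rw [Real.mul_rpow (by norm_num) hL.le, ← mul_assoc, ← Real.rpow_add (by norm_num)]
      simp
    calc L ^ (t - 1) = (2 : ℝ) ^ (1 - t) * (2 * L) ^ (t - 1) := h6.symm
      _ ≤ 2 ^ (1 - t) * (‖x‖ ^ 2) ^ (t - 1) := by gcongr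
      _ ≤ _ := by gcongr

end Slices

lemma tau_complex_univ_ne_zero : tau ℂ univ ≠ 0 := by
  obtain ⟨c, hc, h⟩ := exists_le_tau_ball ℂ
  have h1 := h 1 1 (by simp) one_pos le_rfl
  intro h0
  have h2 : tau ℂ (ball 1 1) ≤ 0 := h0 ▸ measure_mono (subset_univ _)
  have h3 := h1.trans h2
  simp at h3
  linarith

/-- Annular regions in polar coordinates. -/
lemma lintegral_annulus_le {n : ℕ} [NeZero n] {r0 ρ : ℝ} (h0 : 0 < r0) (hρ : ρ < 1) {G : En n → ℝ≥0∞} (hG : Measurable G) :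
    ∫⁻ r in Ioo r0 ρ, ENNReal.ofReal (1 - r) * ∫⁻ ζ, G (r • ζ) ∂(tau (En n)) ≤
      ENNReal.ofReal (r0 ^ (2 * n - 1))⁻¹ * ∫⁻ z in ball 0 ρ, ENNReal.ofReal (1 - ‖z‖) * G z := by
  have hm : Measurable ((ball (0 : En n) ρ).indicator fun z => ENNReal.ofReal (1 - ‖z‖) * G z) :=
    (Measurable.mul (by fun_prop) hG).indicator measurableSet_ball
  have h1 : ∫⁻ z in ball 0 ρ, ENNReal.ofReal (1 - ‖z‖) * G z =
      ∫⁻ z in ball 0 1, (ball (0 : En n) ρ).indicator (fun z => ENNReal.ofReal (1 - ‖z‖) * G z) z := by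
    rw [lintegral_indicator measurableSet_ball, Measure.restrict_restrict measurableSet_ball,
      inter_eq_left.2 (ball_subset_ball hρ.le)]
  rw [h1, lintegral_polar_ball hm, finrank_En, ← lintegral_const_mul' _ _ ENNReal.ofReal_ne_top]
  refine le_trans ?_ (lintegral_mono_set (Ioo_subset_Ioo h0.le hρ.le))
  refine setLIntegral_mono' measurableSet_Ioo fun r hr => ?_
  have hr0 : 0 < r := h0.trans hr.1
  have h2 : ∫⁻ ζ, (ball (0 : En n) ρ).indicator (fun z => ENNReal.ofReal (1 - ‖z‖) * G z) (r • ζ) ∂(tau (En n)) =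
      ENNReal.ofReal (1 - r) * ∫⁻ ζ, G (r • ζ) ∂(tau (En n)) := by
    rw [← lintegral_const_mul' _ _ ENNReal.ofReal_ne_top]
    refine lintegral_congr_ae ?_
    filter_upwards [tau_ae_norm (E := En n)] with ζ hζ
    have h3 : ‖r • ζ‖ = r := by rw [norm_smul, hζ, Real.norm_of_nonneg hr0.le, mul_one]
    rw [indicator_of_mem (by simp [h3, hr.2]), h3]
  rw [h2, ← mul_assoc, ← ENNReal.ofReal_mul (by positivity)]
  refine le_mul_of_one_le_left (zero_le) ?_
  rw [ENNReal.one_le_ofReal, inv_mul_eq_div]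
  exact (one_le_div (by positivity)).2 (pow_le_pow_left₀ h0.le hr.1.le _)

/-- The one-variable estimate integrated over all slices through the origin. -/
lemma exists_slice_integrated (n : ℕ) [NeZero n] {κ r0 r1 : ℝ} (hκ : 0 < κ) (hκ1 : κ ≤ 1) (h0 : 0 < r0)
    (h01 : r0 < r1) (h1 : r1 < 1) :
    ∃ C : ℝ, 0 < C ∧ ∀ (g : En n → ℂ) (O Z : Set (En n)) (L ρ : ℝ), DifferentiableOn ℂ g (ball 0 1) → Measurable g →
      MeasurableSet O → MeasurableSet Z → 0 < L → r1 ≤ ρ → ρ < 1 → (∀ z, ‖z‖ ≤ r1 → ‖g z‖ ^ 2 ≤ L) →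
      (∀ (ζ : En n) (w : ℂ), ‖ζ‖ = 1 → r0 ≤ ‖w‖ → ‖w‖ < 1 → w • ζ ∉ Z → ∀ u : ℂ, ‖u‖ = 1 →
        ‖u - ‖w‖⁻¹ • w‖ < κ * (1 - ‖w‖) → u • ζ ∈ O) →
      tau (En n) {ζ | 2 * L ≤ ‖g (ρ • ζ)‖ ^ 2} ≤ ENNReal.ofReal C * tau (En n) O +
        ENNReal.ofReal (C / L) * ∫⁻ z in ball 0 ρ, ENNReal.ofReal (1 - ‖z‖) *
          (Z ∩ {z | L ≤ ‖g z‖ ^ 2 ∧ ‖g z‖ ^ 2 ≤ 2 * L}).indicator (fun z => ENNReal.ofReal (‖fderiv ℂ g z z‖ ^ 2)) z := by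
  obtain ⟨C, hC, hs⟩ := exists_slice_le hκ hκ1 h0 h01 h1
  refine ⟨C + C * (r0 ^ (2 * n - 1))⁻¹, by positivity, fun g O Z L ρ hg hgm hO hZ hL hρ1 hρ hgL hgeo => ?_⟩
  have hnm : Measurable fun z => ‖g z‖ ^ 2 := (measurable_norm.comp hgm).pow_const 2
  set G : En n → ℝ≥0∞ := (Z ∩ {z | L ≤ ‖g z‖ ^ 2 ∧ ‖g z‖ ^ 2 ≤ 2 * L}).indicator
    (fun z => ENNReal.ofReal (‖fderiv ℂ g z z‖ ^ 2)) with hGdef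
  have hG : Measurable G := by
    refine Measurable.indicator (ENNReal.measurable_ofReal.comp ((measurable_norm.comp (measurable_radial g)).pow_const 2))
      (hZ.inter ?_)
    exact (measurableSet_le measurable_const hnm).inter (measurableSet_le hnm measurable_const)
  set T := tau ℂ univ with hT
  have hT0 : T ≠ 0 := tau_complex_univ_ne_zero
  have hTt : T ≠ ⊤ := measure_ne_top _ _
  have hpt : ∀ ζ : En n, ‖ζ‖ = 1 →
      ∫⁻ u : ℂ, {ζ : En n | 2 * L ≤ ‖g (ρ • ζ)‖ ^ 2}.indicator 1 (u • ζ) ∂(tau ℂ) ≤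
      ENNReal.ofReal C * ∫⁻ u : ℂ, O.indicator 1 (u • ζ) ∂(tau ℂ) +
        ENNReal.ofReal (C / L) * ∫⁻ r in Ioo r0 ρ, ENNReal.ofReal (1 - r) * ∫⁻ u : ℂ, G (r • u • ζ) ∂(tau ℂ) := by
    intro ζ hζ
    have hcs : Measurable fun u : ℂ => u • ζ := (continuous_id.smul continuous_const).measurable
    have h2 := hs (fun w => g (w • ζ)) {u | u • ζ ∈ O} {w | w • ζ ∈ Z} L ρ (slice_differentiableOn hg hζ) hL hρ1 hρ
      (fun w hw => hgL _ (by rw [norm_smul, hζ, mul_one]; exact hw))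
      (fun w hw0 hw1 hwZ u hu hd => hgeo ζ w hζ hw0 hw1 hwZ u hu hd)
    have e1 : ∫⁻ u : ℂ, {ζ : En n | 2 * L ≤ ‖g (ρ • ζ)‖ ^ 2}.indicator 1 (u • ζ) ∂(tau ℂ) =
        tau ℂ {u | 2 * L ≤ ‖g ((ρ • u) • ζ)‖ ^ 2} := by
      rw [← lintegral_indicator_one]
      · refine lintegral_congr fun u => ?_
        simp only [indicator_apply, mem_ofPred_eq, smul_assoc, Pi.one_apply]
      · simp_rw [smul_assoc]
        exact measurableSet_le measurable_const (hnm.comp (hcs.const_smul ρ))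
    have e2 : ∫⁻ u : ℂ, O.indicator 1 (u • ζ) ∂(tau ℂ) = tau ℂ {u | u • ζ ∈ O} := by
      rw [← lintegral_indicator_one (show MeasurableSet {u : ℂ | u • ζ ∈ O} from hcs hO)]
      rfl
    rw [e1, e2]
    refine h2.trans (add_le_add le_rfl (mul_le_mul_right (setLIntegral_mono' measurableSet_Ioo fun r hr => mul_le_mul_right ?_ _) _))
    refine le_of_eq (lintegral_congr_ae ?_)
    filter_upwards [tau_ae_norm (E := ℂ)] with u hu
    have hr0 : 0 < r := h0.trans hr.1
    have h3 : ‖r • u‖ < 1 := by rw [norm_smul, hu, Real.norm_of_nonneg hr0.le, mul_one]; exact hr.2.trans hρ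
    have h4 := fderiv_slice hg hζ h3
    classical
    simp only [hGdef, indicator_apply, mem_inter_iff, mem_ofPred_eq]
    rw [h4, smul_assoc]
  have hm1 : Measurable ({ζ : En n | 2 * L ≤ ‖g (ρ • ζ)‖ ^ 2}.indicator (1 : En n → ℝ≥0∞)) :=
    measurable_one.indicator (measurableSet_le measurable_const (hnm.comp (measurable_id.const_smul ρ)))
  have hm2 : Measurable (O.indicator (1 : En n → ℝ≥0∞)) := measurable_one.indicator hO
  have hmG3 : Measurable fun p : (En n × ℝ) × ℂ => G (p.1.2 • p.2 • p.1.1) := by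
    have : Continuous fun p : (En n × ℝ) × ℂ => p.1.2 • p.2 • p.1.1 := by fun_prop
    exact hG.comp this.measurable
  have hmG2 : Measurable fun p : En n × ℝ => ENNReal.ofReal (1 - p.2) * ∫⁻ u : ℂ, G (p.2 • u • p.1) ∂(tau ℂ) :=
    Measurable.mul (by fun_prop) hmG3.lintegral_prod_right'
  have hmO : Measurable fun ζ : En n => ENNReal.ofReal C * ∫⁻ u : ℂ, O.indicator (1 : En n → ℝ≥0∞) (u • ζ) ∂(tau ℂ) := by
    refine measurable_const.mul (Measurable.lintegral_prod_right' (f := fun p : En n × ℂ => O.indicator (1 : En n → ℝ≥0∞) (p.2 • p.1)) ?_)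
    exact hm2.comp (continuous_snd.smul continuous_fst).measurable
  have hle := lintegral_mono_ae (μ := tau (En n)) (by filter_upwards [tau_ae_norm (E := En n)] with ζ hζ using hpt ζ hζ)
  rw [lintegral_slices hm1, lintegral_add_left hmO, lintegral_const_mul' _ _ ENNReal.ofReal_ne_top,
    lintegral_slices hm2, lintegral_const_mul' _ _ ENNReal.ofReal_ne_top,
    lintegral_lintegral_swap hmG2.aemeasurable] at hle
  have e3 : ∫⁻ r in Ioo r0 ρ, ∫⁻ ζ, ENNReal.ofReal (1 - r) * ∫⁻ u : ℂ, G (r • u • ζ) ∂(tau ℂ) ∂(tau (En n)) =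
      T * ∫⁻ r in Ioo r0 ρ, ENNReal.ofReal (1 - r) * ∫⁻ ζ, G (r • ζ) ∂(tau (En n)) := by
    rw [← lintegral_const_mul' _ _ hTt]
    refine lintegral_congr fun r => ?_
    rw [lintegral_const_mul' _ _ ENNReal.ofReal_ne_top, lintegral_slices (H := fun z => G (r • z)) (hG.comp (measurable_id.const_smul r))]
    ring
  rw [e3, lintegral_indicator_one hO, lintegral_indicator_one
    (show MeasurableSet {ζ : En n | 2 * L ≤ ‖g (ρ • ζ)‖ ^ 2} from
      measurableSet_le measurable_const (hnm.comp (measurable_id.const_smul ρ)))] at hle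
  have h5 : tau (En n) {ζ | 2 * L ≤ ‖g (ρ • ζ)‖ ^ 2} ≤ ENNReal.ofReal C * tau (En n) O +
      ENNReal.ofReal (C / L) * ∫⁻ r in Ioo r0 ρ, ENNReal.ofReal (1 - r) * ∫⁻ ζ, G (r • ζ) ∂(tau (En n)) := by
    rw [← ENNReal.mul_le_mul_iff_right hT0 hTt]
    refine hle.trans (le_of_eq ?_)
    ring
  refine h5.trans (add_le_add (mul_le_mul_left (ENNReal.ofReal_le_ofReal (by
    have : 0 ≤ C * (r0 ^ (2 * n - 1))⁻¹ := by positivity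
    linarith)) _) ?_)
  refine (mul_le_mul_right (lintegral_annulus_le h0 hρ hG) _).trans ?_
  rw [← mul_assoc, ← ENNReal.ofReal_mul (by positivity)]
  refine mul_le_mul_left (ENNReal.ofReal_le_ofReal ?_) _
  rw [div_mul_eq_mul_div]
  gcongr
  linarith

section

variable {n : ℕ} {g : En n → ℂ}

/-- Boundary points near a point `u • ζ` see the nearby point `w • ζ` in their approach region. -/
lemma dk_slice_lt {α κ : ℝ} (hα : 1 < α) (hκ : 2 * κ ≤ (α - 1) / 2) (hκ0 : 0 < κ) {ζ η : En n} {w u : ℂ} (hζ : ‖ζ‖ = 1)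
    (hu : ‖u‖ = 1) (hη : ‖η‖ = 1) (hw : α⁻¹ ≤ ‖w‖) (hw1 : ‖w‖ < 1) (hd : ‖u - ‖w‖⁻¹ • w‖ < κ * (1 - ‖w‖))
    (h : dk η (u • ζ) < κ * (1 - ‖w‖)) : dk (w • ζ) η < α / 2 * (1 - ‖w • ζ‖ ^ 2) := by
  have hα0 : 0 < α := by linarith
  have hw0 : w ≠ 0 := norm_pos_iff.1 (lt_of_lt_of_le (by positivity) hw)
  have h1 := dk_slice_le (w := w) hζ hu hη
  have h2 := norm_sub_le_of_norm_inv_smul_sub hw0 hw1 hd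
  have h3 : ‖w‖ * dk η (u • ζ) ≤ κ * (1 - ‖w‖) :=
    (mul_le_of_le_one_left (dk_nonneg _ _) hw1.le).trans h.le
  rw [norm_smul, hζ, mul_one]
  have h4 : 1 ≤ α * ‖w‖ := by
    have := mul_le_mul_of_nonneg_left hw hα0.le
    rwa [mul_inv_cancel₀ hα0.ne'] at this
  have h5 : (1 + 2 * κ) * (1 - ‖w‖) ≤ (α + α * ‖w‖) / 2 * (1 - ‖w‖) :=
    mul_le_mul_of_nonneg_right (by linarith) (by linarith)
  nlinarith

/-- If the cone average of the indicator of `Oᶜ` over `w • ζ` is small, then nearby boundary points lie in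
a superlevel set of the maximal function of the indicator of `O`. -/
lemma lt_MM_of_average_lt {c κ α : ℝ} (hc : ∀ (η : En n) (δ : ℝ), ‖η‖ = 1 → 0 < δ → δ ≤ 4 →
      ENNReal.ofReal (c * δ ^ n) ≤ tau (En n) (KB η δ)) (hc0 : 0 < c)
    (hα : 1 < α) (hκ : 2 * κ ≤ (α - 1) / 2) (hκ0 : 0 < κ) (hκ1 : κ ≤ 1) {O : Set (En n)} (hO : MeasurableSet O)
    {ζ : En n} {w u : ℂ} (hζ : ‖ζ‖ = 1) (hu : ‖u‖ = 1) (hw : α⁻¹ ≤ ‖w‖) (hw1 : ‖w‖ < 1)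
    (hd : ‖u - ‖w‖⁻¹ • w‖ < κ * (1 - ‖w‖))
    (hZ : wt (w • ζ) * ∫⁻ η in {η | dk (w • ζ) η < α / 2 * (1 - ‖w • ζ‖ ^ 2)}, Oᶜ.indicator 1 η ∂(tau (En n)) <
      ENNReal.ofReal (c * κ ^ n / 2)) :
    ENNReal.ofReal (c / 2) < MM (O.indicator 1) (u • ζ) := by
  by_contra! hle
  have hx : 0 < 1 - ‖w‖ := by linarith
  set δ := κ * (1 - ‖w‖) with hδ
  have hδ0 : 0 < δ := by positivity
  have hδ4 : δ ≤ 4 := by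
    have := norm_nonneg w
    have : δ ≤ 1 * 1 := mul_le_mul hκ1 (by linarith) hx.le zero_le_one
    linarith
  have hη : ‖u • ζ‖ = 1 := by rw [norm_smul, hu, hζ, one_mul]
  have h1 := hc _ δ hη hδ0 hδ4
  have h2 := le_MM (O.indicator 1) hη hδ0 (ζ := u • ζ) (by rw [dk_self hη]; exact hδ0)
  rw [lintegral_indicator_one hO, Measure.restrict_apply hO] at h2
  have h3 : tau (En n) (Oᶜ ∩ KB (u • ζ) δ) < ENNReal.ofReal (c * δ ^ n / 2) := by
    rw [lintegral_indicator_one hO.compl, Measure.restrict_apply hO.compl] at hZ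
    have h4 : tau (En n) (Oᶜ ∩ KB (u • ζ) δ) ≤
        tau (En n) (Oᶜ ∩ {η | dk (w • ζ) η < α / 2 * (1 - ‖w • ζ‖ ^ 2)}) := by
      refine measure_mono_ae ?_
      filter_upwards [tau_ae_norm (E := En n)] with η hη hm
      exact ⟨hm.1, dk_slice_lt hα hκ hκ0 hζ hu hη hw hw1 hd hm.2⟩
    refine h4.trans_lt ?_
    have hwt : wt (w • ζ) = (ENNReal.ofReal ((1 - ‖w‖) ^ n))⁻¹ := by
      rw [wt, norm_smul, hζ, mul_one, ENNReal.ofReal_inv_of_pos (by positivity)]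
    rw [hwt] at hZ
    have hp : ENNReal.ofReal ((1 - ‖w‖) ^ n) ≠ 0 := by
      rw [Ne, ENNReal.ofReal_eq_zero, not_le]; positivity
    have h5 := ENNReal.mul_lt_mul_right hp ENNReal.ofReal_ne_top hZ
    rw [← mul_assoc, ENNReal.mul_inv_cancel hp ENNReal.ofReal_ne_top, one_mul, ← ENNReal.ofReal_mul (by positivity)] at h5
    refine h5.trans_le (ENNReal.ofReal_le_ofReal (le_of_eq ?_))
    rw [hδ, mul_pow]; ring
  have h6 : tau (En n) (KB (u • ζ) δ) = tau (En n) (O ∩ KB (u • ζ) δ) + tau (En n) (Oᶜ ∩ KB (u • ζ) δ) := by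
    rw [← measure_inter_add_sdiff (KB (u • ζ) δ) hO, inter_comm, sdiff_eq, inter_comm (KB (u • ζ) δ) Oᶜ]
  have h7 : tau (En n) (O ∩ KB (u • ζ) δ) ≤ ENNReal.ofReal (c * δ ^ n / 2) := by
    refine h2.trans ((mul_le_mul_right hle _).trans (le_of_eq ?_))
    rw [← ENNReal.ofReal_mul (by positivity)]
    congr 1; ring
  have h8 : tau (En n) (KB (u • ζ) δ) < ENNReal.ofReal (c * δ ^ n / 2) + ENNReal.ofReal (c * δ ^ n / 2) := by
    rw [h6]
    exact ENNReal.add_lt_add_of_le_of_lt (measure_ne_top _ _) h7 h3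
  rw [← ENNReal.ofReal_add (by positivity) (by positivity), add_halves] at h8
  exact absurd h1 (not_le.2 h8)

/-- On the level shell, the radial derivative is controlled by the area integrand. -/
lemma radial_level_le {t L : ℝ} (ht : 0 < t) (hL : 0 < L) {z : En n} (hz : ‖z‖ < 1)
    (h1 : L ≤ ‖g z‖ ^ 2) (h2 : ‖g z‖ ^ 2 ≤ 2 * L) :
    ENNReal.ofReal (1 - ‖z‖) * ENNReal.ofReal (‖fderiv ℂ g z z‖ ^ 2) ≤
      ENNReal.ofReal (max 1 (2 ^ (1 - t)) * L ^ (1 - t)) * EB g (2 * t) z := by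
  have hLt : 0 < L ^ (1 - t) := Real.rpow_pos_of_pos hL _
  have h3 : ENNReal.ofReal (1 - ‖z‖) * ENNReal.ofReal (‖fderiv ℂ g z z‖ ^ 2) ≤ ENNReal.ofReal (N2 g z) := by
    rw [← ENNReal.ofReal_mul (by linarith), mul_comm]
    exact ENNReal.ofReal_le_ofReal (norm_radial_sq_mul_le g hz.le)
  have h4 : (1 : ℝ≥0∞) ≤ ENNReal.ofReal (max 1 (2 ^ (1 - t)) * L ^ (1 - t)) * ‖g z‖ₑ ^ (2 * t - 2) := by
    have h5 := mul_le_mul_right (le_rpow_mul_of_level ht hL h1 h2) (ENNReal.ofReal (L ^ (1 - t)))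
    rw [← ENNReal.ofReal_mul hLt.le, ← Real.rpow_add hL, show 1 - t + (t - 1) = 0 by ring, Real.rpow_zero,
      ENNReal.ofReal_one, ← mul_assoc, ← ENNReal.ofReal_mul hLt.le, mul_comm (L ^ (1 - t))] at h5
    exact h5
  refine h3.trans ?_
  rw [EB, indicator_of_mem (by simpa using hz), EE, ← mul_assoc]
  exact le_mul_of_one_le_left zero_le h4

/-- The good-`λ` inequality between radial dilations and the area function. -/
lemma exists_good_lambda (n : ℕ) [NeZero n] {α t : ℝ} (hα : 1 < α) (ht : 0 < t) :
    ∃ C : ℝ, 0 < C ∧ ∀ (g : En n → ℂ) (L ρ : ℝ), DifferentiableOn ℂ g (ball 0 1) → Measurable g → 0 < L →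
      (1 + α⁻¹) / 2 ≤ ρ → ρ < 1 → (∀ z, ‖z‖ ≤ (1 + α⁻¹) / 2 → ‖g z‖ ^ 2 ≤ L) →
      tau (En n) {ζ | 2 * L ≤ ‖g (ρ • ζ)‖ ^ 2} ≤
        ENNReal.ofReal C * tau (En n) {ζ | ENNReal.ofReal (L ^ t) < AA g (2 * t) α ρ ζ} +
        ENNReal.ofReal (C / L ^ t) * ∫⁻ ζ, AA g (2 * t) α ρ ζ *
          {ζ | ENNReal.ofReal (L ^ t) < AA g (2 * t) α ρ ζ}ᶜ.indicator 1 ζ ∂(tau (En n)) := by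
  have hα0 : 0 < α := by linarith
  have hinv : α⁻¹ < 1 := inv_lt_one_of_one_lt₀ hα
  set κ := min 1 ((α - 1) / 4) with hκd
  have hκ0 : 0 < κ := lt_min one_pos (by linarith)
  have hκ1 : κ ≤ 1 := min_le_left _ _
  have hκ : 2 * κ ≤ (α - 1) / 2 := by have := min_le_right 1 ((α - 1) / 4); linarith
  obtain ⟨c, hc0, hc⟩ := exists_le_tau_KB n
  obtain ⟨C1, hC1, hw⟩ := weak_MM n
  obtain ⟨C, hC, hs⟩ := exists_slice_integrated n hκ0 hκ1 (r0 := α⁻¹) (r1 := (1 + α⁻¹) / 2) (by positivity)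
    (by linarith) (by linarith)
  set c' := c * κ ^ n / 2 with hc'
  have hc'0 : 0 < c' := by positivity
  set M : ℝ := max 1 (2 ^ (1 - t)) with hM
  have hM0 : 0 < M := lt_of_lt_of_le one_pos (le_max_left _ _)
  refine ⟨C * (C1 / (c / 2)) + C * (M / c'), by positivity, fun g L ρ hg hgm hL hρ1 hρ hgL => ?_⟩
  have hLt : 0 < L ^ t := Real.rpow_pos_of_pos hL _
  have hL1 : 0 < L ^ (1 - t) := Real.rpow_pos_of_pos hL _
  set O := {ζ | ENNReal.ofReal (L ^ t) < AA g (2 * t) α ρ ζ} with hOd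
  have hO : MeasurableSet O := measurableSet_lt measurable_const (measurable_AA hg _ _ _)
  set φ : En n → ℝ≥0∞ := Oᶜ.indicator 1 with hφd
  have hφ : Measurable φ := measurable_one.indicator hO.compl
  set V : En n → ℝ≥0∞ := fun z => wt z * ∫⁻ η in {η | dk z η < α / 2 * (1 - ‖z‖ ^ 2)}, φ η ∂(tau (En n)) with hV
  have hVm : Measurable V := measurable_cone_average α hφ
  have hZ : MeasurableSet {z | ENNReal.ofReal c' ≤ V z} := measurableSet_le measurable_const hVm
  have h1 := hs g {ζ | ENNReal.ofReal (c / 2) < MM (O.indicator 1) ζ} {z | ENNReal.ofReal c' ≤ V z} L ρ hg hgm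
    (isOpen_lt_MM _ _).measurableSet hZ hL hρ1 hρ hgL
    (fun ζ w hζ hw0 hw1 hwZ u hu hd =>
      lt_MM_of_average_lt hc hc0 hα hκ hκ0 hκ1 hO hζ hu hw0 hw1 hd (not_le.1 hwZ))
  have h2 := hw (O.indicator 1) (c / 2) (by positivity)
  rw [lintegral_indicator_one hO] at h2
  have h3 : ∫⁻ z in ball 0 ρ, ENNReal.ofReal (1 - ‖z‖) * ({z | ENNReal.ofReal c' ≤ V z} ∩
        {z | L ≤ ‖g z‖ ^ 2 ∧ ‖g z‖ ^ 2 ≤ 2 * L}).indicator (fun z => ENNReal.ofReal (‖fderiv ℂ g z z‖ ^ 2)) z ≤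
      ENNReal.ofReal (M / c' * L ^ (1 - t)) * ∫⁻ ζ, AA g (2 * t) α ρ ζ * φ ζ ∂(tau (En n)) := by
    rw [lintegral_AA_mul hg _ _ _ hφ, ← lintegral_const_mul' _ _ ENNReal.ofReal_ne_top]
    refine setLIntegral_mono' measurableSet_ball fun z hz => ?_
    have hz1 : ‖z‖ < 1 := by
      have : ‖z‖ < ρ := by simpa using hz
      linarith
    by_cases hm : z ∈ {z | ENNReal.ofReal c' ≤ V z} ∩ {z | L ≤ ‖g z‖ ^ 2 ∧ ‖g z‖ ^ 2 ≤ 2 * L}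
    · rw [indicator_of_mem hm]
      have h4 := radial_level_le (g := g) ht hL hz1 hm.2.1 hm.2.2
      have h5 : (1 : ℝ≥0∞) ≤ ENNReal.ofReal c'⁻¹ * V z := by
        have hVz : ENNReal.ofReal c' ≤ V z := hm.1
        have := mul_le_mul_right hVz (ENNReal.ofReal c'⁻¹)
        rwa [← ENNReal.ofReal_mul (by positivity), inv_mul_cancel₀ hc'0.ne', ENNReal.ofReal_one] at this
      rw [← hM] at h4
      refine h4.trans ((le_mul_of_one_le_left zero_le h5).trans (le_of_eq ?_))
      rw [show M / c' * L ^ (1 - t) = c'⁻¹ * (M * L ^ (1 - t)) by ring,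
        ENNReal.ofReal_mul (p := c'⁻¹) (by positivity)]
      change _ = _ * (V z * _)
      ring
    · rw [indicator_of_notMem hm, mul_zero]; exact zero_le
  refine h1.trans (add_le_add ?_ ?_)
  · refine (mul_le_mul_right h2 _).trans ?_
    rw [← mul_assoc, ← ENNReal.ofReal_mul hC.le]
    refine mul_le_mul_left (ENNReal.ofReal_le_ofReal ?_) _
    have : 0 ≤ C * (M / c') := by positivity
    linarith
  · refine (mul_le_mul_right h3 _).trans ?_
    rw [← mul_assoc, ← ENNReal.ofReal_mul (by positivity)]
    refine mul_le_mul_left (ENNReal.ofReal_le_ofReal ?_) _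
    have h6 : C / L * (M / c' * L ^ (1 - t)) = C * (M / c') / L ^ t := by
      rw [Real.rpow_sub hL, Real.rpow_one]
      field_simp
    rw [h6]
    have : 0 ≤ C * (C1 / (c / 2)) := by positivity
    gcongr
    linarith

end

section

variable {n : ℕ} {g : En n → ℂ}

lemma lintegral_Ioi_rpow {a b : ℝ} (ha : a < -1) (hb : 0 < b) :
    ∫⁻ s in Ioi b, ENNReal.ofReal (s ^ a) = ENNReal.ofReal (-b ^ (a + 1) / (a + 1)) := by
  rw [← integral_Ioi_rpow_of_lt ha hb, ofReal_integral_eq_lintegral_ofReal (integrableOn_Ioi_rpow_of_lt ha hb)]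
  exact ae_restrict_of_forall_mem measurableSet_Ioi fun s hs => Real.rpow_nonneg (hb.trans hs).le _

lemma mul_lintegral_tail_le {m t : ℝ} (hm : 0 < m) (hmt : m < t) (a : ℝ≥0∞) :
    a * ∫⁻ s in Ioi (0 : ℝ), ENNReal.ofReal (m * s ^ (m - 1 - t)) *
      {s : ℝ | ENNReal.ofReal (s ^ t) < a}ᶜ.indicator 1 s ≤ ENNReal.ofReal (m / (t - m)) * a ^ (m / t) := by
  have ht : 0 < t := hm.trans hmt
  rcases eq_or_ne a 0 with rfl | ha0
  · simp
  rcases eq_or_ne a ⊤ with rfl | hat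
  · have : {s : ℝ | ENNReal.ofReal (s ^ t) < ⊤}ᶜ = ∅ := by
      ext s; simp
    rw [this]; simp
  obtain ⟨x, hx, rfl⟩ : ∃ x : ℝ, 0 < x ∧ a = ENNReal.ofReal x :=
    ⟨a.toReal, ENNReal.toReal_pos ha0 hat, (ENNReal.ofReal_toReal hat).symm⟩
  set b := x ^ (1 / t) with hb
  have hb0 : 0 < b := Real.rpow_pos_of_pos hx _
  have h1 : ∫⁻ s in Ioi (0 : ℝ), ENNReal.ofReal (m * s ^ (m - 1 - t)) *
      {s : ℝ | ENNReal.ofReal (s ^ t) < ENNReal.ofReal x}ᶜ.indicator 1 s ≤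
      ∫⁻ s in Ioi b, ENNReal.ofReal (m * s ^ (m - 1 - t)) := by
    rw [setLIntegral_congr (Ioi_ae_eq_Ici (a := b)), ← lintegral_indicator measurableSet_Ici,
      ← lintegral_indicator measurableSet_Ioi]
    refine lintegral_mono fun s => ?_
    by_cases hs : s ∈ Ioi (0 : ℝ)
    · have hs0 : 0 < s := hs
      rw [indicator_of_mem hs]
      by_cases hsm : s ∈ {s : ℝ | ENNReal.ofReal (s ^ t) < ENNReal.ofReal x}ᶜ
      · have hsx : x ≤ s ^ t := by
          have h2 : ¬ ENNReal.ofReal (s ^ t) < ENNReal.ofReal x := hsm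
          rw [not_lt, ENNReal.ofReal_le_ofReal_iff (by positivity)] at h2
          exact h2
        have : s ∈ Ici b := by
          rw [mem_Ici, hb]
          have h3 := Real.rpow_le_rpow hx.le hsx (by positivity : 0 ≤ 1 / t)
          rwa [← Real.rpow_mul hs0.le, mul_one_div_cancel ht.ne', Real.rpow_one] at h3
        rw [indicator_of_mem this, indicator_of_mem hsm]
        simp
      · rw [indicator_of_notMem hsm]; simp
    · rw [indicator_of_notMem hs]; exact zero_le
  refine (mul_le_mul_right h1 _).trans (le_of_eq ?_)
  simp_rw [ENNReal.ofReal_mul hm.le]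
  rw [lintegral_const_mul' _ _ ENNReal.ofReal_ne_top, lintegral_Ioi_rpow (by linarith) hb0,
    ENNReal.ofReal_rpow_of_pos hx, ← ENNReal.ofReal_mul hm.le, ← ENNReal.ofReal_mul hx.le,
    ← ENNReal.ofReal_mul (by have : 0 < t - m := by linarith
                             positivity)]
  congr 1
  have h2 : b ^ (m - 1 - t + 1) = x ^ (m / t) / x := by
    rw [hb, ← Real.rpow_mul hx.le, ← Real.rpow_sub_one hx.ne']
    congr 1; field_simp; ring
  rw [h2]
  have h3 : m - 1 - t + 1 ≠ 0 := by linarith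
  have h4 : t - m ≠ 0 := by linarith
  field_simp
  ring

/-- Integrating a good-`λ` inequality. -/
lemma lintegral_rpow_le_of_good_lambda {X : Type*} [MeasurableSpace X] {μ : Measure X} [IsFiniteMeasure μ]
    {m t C L0 : ℝ} (hm : 0 < m) (hmt : m < t) (hC : 0 < C) (hL0 : 0 < L0) {h : X → ℝ} (hh : Measurable h)
    {A : X → ℝ≥0∞} (hA : Measurable A)
    (H : ∀ L : ℝ, L0 ≤ L → μ {x | 2 * L ≤ h x} ≤ ENNReal.ofReal C * μ {x | ENNReal.ofReal (L ^ t) < A x} +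
      ENNReal.ofReal (C / L ^ t) * ∫⁻ x, A x * {x | ENNReal.ofReal (L ^ t) < A x}ᶜ.indicator 1 x ∂μ) :
    ∫⁻ x, ENNReal.ofReal (h x / 2) ^ m ∂μ ≤ ENNReal.ofReal (L0 ^ m) * μ univ +
      ENNReal.ofReal (C + C * (m / (t - m))) * ∫⁻ x, A x ^ (m / t) ∂μ := by
  have ht : 0 < t := hm.trans hmt
  have htm : 0 < t - m := by linarith
  have hF : Measurable fun x => ENNReal.ofReal (h x / 2) := ENNReal.measurable_ofReal.comp (hh.div_const 2)
  have hB : Measurable fun x => A x ^ (1 / t) := hA.pow_const _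
  rw [lintegral_rpow_layer μ hm hF]
  set P : ℝ → ℝ≥0∞ := fun s => ENNReal.ofReal (m * s ^ (m - 1)) * μ univ with hP
  set S : Set (ℝ × X) := {q | ENNReal.ofReal (q.1 ^ t) < A q.2} with hS
  have hSm : MeasurableSet S :=
    measurableSet_lt (ENNReal.measurable_ofReal.comp (measurable_fst.pow_const t)) (hA.comp measurable_snd)
  set W : ℝ → X → ℝ≥0∞ := fun s x => ENNReal.ofReal (m * s ^ (m - 1 - t)) * (A x * Sᶜ.indicator 1 (s, x)) with hW
  have hWm : Measurable (Function.uncurry W) := by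
    refine Measurable.mul (ENNReal.measurable_ofReal.comp ((measurable_fst.pow_const _).const_mul m)) ?_
    exact (hA.comp measurable_snd).mul (measurable_one.indicator hSm.compl)
  have hpt : ∀ s ∈ Ioi (0 : ℝ), ENNReal.ofReal (m * s ^ (m - 1)) * μ {x | ENNReal.ofReal s < ENNReal.ofReal (h x / 2)} ≤
      (Ioo 0 L0).indicator P s + (ENNReal.ofReal C * (ENNReal.ofReal (m * s ^ (m - 1)) *
        μ {x | ENNReal.ofReal s < A x ^ (1 / t)}) + ENNReal.ofReal C * ∫⁻ x, W s x ∂μ) := by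
    intro s hs
    have hs0 : 0 < s := hs
    rcases lt_or_ge s L0 with hsL | hsL
    · rw [indicator_of_mem (show s ∈ Ioo 0 L0 from ⟨hs0, hsL⟩)]
      exact le_add_right (mul_le_mul_right (measure_mono (subset_univ _)) _)
    · have hs1 : μ {x | ENNReal.ofReal s < ENNReal.ofReal (h x / 2)} ≤ μ {x | 2 * s ≤ h x} := by
        refine measure_mono fun x hx => ?_
        have h1 := ENNReal.lt_ofReal_iff_toReal_lt ENNReal.ofReal_ne_top |>.1 hx
        rw [ENNReal.toReal_ofReal hs0.le] at h1
        change 2 * s ≤ h x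
        linarith
      refine le_add_left ((mul_le_mul_right (hs1.trans (H s hsL)) _).trans ?_)
      rw [mul_add]
      refine add_le_add (le_of_eq ?_) (le_of_eq ?_)
      · have : {x | ENNReal.ofReal (s ^ t) < A x} = {x | ENNReal.ofReal s < A x ^ (1 / t)} := by
          ext x
          change ENNReal.ofReal (s ^ t) < A x ↔ ENNReal.ofReal s < A x ^ (1 / t)
          rw [← ENNReal.ofReal_rpow_of_pos hs0, one_div, ENNReal.lt_rpow_inv_iff ht]
        rw [this]; ring
      · rw [hW]
        simp only
        rw [lintegral_const_mul' _ _ ENNReal.ofReal_ne_top, ← mul_assoc, ← mul_assoc, ← ENNReal.ofReal_mul (by positivity),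
          ← ENNReal.ofReal_mul hC.le]
        congr 2
        rw [Real.rpow_sub hs0 (m - 1) t]; ring
  refine (setLIntegral_mono' measurableSet_Ioi hpt).trans ?_
  have hPm : Measurable P := (ENNReal.measurable_ofReal.comp ((measurable_id.pow_const _).const_mul m)).mul_const _
  have hWi : Measurable fun s => ∫⁻ x, W s x ∂μ := hWm.lintegral_prod_right'
  rw [lintegral_add_left (hPm.indicator measurableSet_Ioo), lintegral_add_right _ (hWi.const_mul _),
    lintegral_const_mul' _ _ ENNReal.ofReal_ne_top, lintegral_const_mul' _ _ ENNReal.ofReal_ne_top,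
    ← lintegral_rpow_layer μ hm hB, lintegral_lintegral_swap hWm.aemeasurable]
  have e1 : ∫⁻ s in Ioi (0 : ℝ), (Ioo 0 L0).indicator P s = ENNReal.ofReal (L0 ^ m) * μ univ := by
    rw [lintegral_indicator measurableSet_Ioo, Measure.restrict_restrict measurableSet_Ioo,
      inter_eq_left.2 Ioo_subset_Ioi_self, hP, lintegral_mul_const' _ _ (measure_ne_top _ _), lintegral_rpow_Ioo hm hL0.le]
  have e2 : ∀ x, (A x ^ (1 / t)) ^ m = A x ^ (m / t) := fun x => by
    rw [← ENNReal.rpow_mul]; congr 1; ring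
  have e3 : ∫⁻ x, (∫⁻ s in Ioi (0 : ℝ), W s x) ∂μ ≤ ENNReal.ofReal (m / (t - m)) * ∫⁻ x, A x ^ (m / t) ∂μ := by
    rw [← lintegral_const_mul' _ _ ENNReal.ofReal_ne_top]
    refine lintegral_mono fun x => le_trans (le_of_eq ?_) (mul_lintegral_tail_le hm hmt (A x))
    rw [← lintegral_const_mul]
    · refine lintegral_congr fun s => ?_
      simp only [hW]
      rw [mul_left_comm]
      rfl
    · refine Measurable.mul (ENNReal.measurable_ofReal.comp ((measurable_id.pow_const _).const_mul m)) ?_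
      exact measurable_one.indicator (measurableSet_lt
        (ENNReal.measurable_ofReal.comp (measurable_id.pow_const t)) measurable_const).compl
  rw [e1]
  simp_rw [e2]
  refine add_le_add le_rfl ((add_le_add le_rfl (mul_le_mul_right e3 _)).trans (le_of_eq ?_))
  rw [ENNReal.ofReal_add hC.le (by positivity), ENNReal.ofReal_mul hC.le]
  ring

end

section

variable {n : ℕ} {g : En n → ℂ}

lemma EB_congr {f g : En n → ℂ} (h : EqOn f g (ball 0 1)) (s : ℝ) : EB f s = EB g s := by
  refine indicator_congr fun z hz => ?_
  have h1 : f =ᶠ[𝓝 z] g := by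
    filter_upwards [isOpen_ball.mem_nhds hz] with w hw using h hw
  rw [EE, EE, N2, N2, h hz, h1.fderiv_eq]

lemma AA_congr {f g : En n → ℂ} (h : EqOn f g (ball 0 1)) (s α ρ : ℝ) : AA f s α ρ = AA g s α ρ := by
  ext ζ
  rw [AA, AA, EB_congr h]

/-- Integral means are controlled by the area function for small exponents. -/
lemma exists_mean_le_area [NeZero n] {α p t : ℝ} (hα : 1 < α) (hp : 0 < p) (hp2 : p < 2) (ht : 0 < t)
    (hg : DifferentiableOn ℂ g (ball 0 1)) :
    ∃ C : ℝ, 0 < C ∧ ∀ ρ : ℝ, (1 + α⁻¹) / 2 ≤ ρ → ρ < 1 →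
      ∫⁻ ζ, ‖g (ρ • ζ)‖ₑ ^ (p * t) ∂(tau (En n)) ≤
        ENNReal.ofReal C * (1 + ∫⁻ ζ, AA g (2 * t) α ρ ζ ^ (p / 2) ∂(tau (En n))) := by
  obtain ⟨C, hC, H⟩ := exists_good_lambda n hα ht
  have hinv : α⁻¹ < 1 := inv_lt_one_of_one_lt₀ hα
  have hinv0 : 0 < α⁻¹ := by positivity
  set G : En n → ℂ := (ball 0 1).indicator g with hGd
  have hGg : EqOn G g (ball 0 1) := fun z hz => indicator_of_mem hz _
  have hG : DifferentiableOn ℂ G (ball 0 1) := hg.congr hGg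
  have hGm : Measurable G := ContinuousOn.measurable_indicator measurableSet_ball hg.continuousOn
  set r1 := (1 + α⁻¹) / 2 with hr1
  have hr1' : r1 < 1 := by linarith
  obtain ⟨M, hM⟩ := (isCompact_closedBall (0 : En n) r1).exists_bound_of_continuousOn
    (hG.continuousOn.mono (closedBall_subset_ball hr1'))
  set L0 := M ^ 2 + 1 with hL0
  have hL0' : 0 < L0 := by positivity
  set m := p * t / 2 with hm
  have hm0 : 0 < m := by positivity
  have hmt : m < t := by nlinarith
  set T := (tau (En n) univ).toReal with hT
  set D := 2 ^ m * (L0 ^ m * T + (C + C * (m / (t - m)))) with hD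
  have htm : 0 < t - m := by linarith
  have hL0m : 0 < L0 ^ m := Real.rpow_pos_of_pos hL0' _
  have h2m : (0 : ℝ) < 2 ^ m := Real.rpow_pos_of_pos two_pos _
  refine ⟨D, by positivity, fun ρ hρ1 hρ => ?_⟩
  have hh : Measurable fun ζ => ‖G (ρ • ζ)‖ ^ 2 :=
    (measurable_norm.comp (hGm.comp (measurable_id.const_smul ρ))).pow_const 2
  have h1 := lintegral_rpow_le_of_good_lambda (μ := tau (En n)) hm0 hmt hC hL0' hh (measurable_AA hG (2 * t) α ρ)
    (fun L hL => H G L ρ hG hGm (hL0'.trans_le hL) hρ1 hρ (fun z hz => by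
      have h2 := hM z (by simpa using hz)
      have h3 := norm_nonneg (G z)
      have h4 : ‖G z‖ ^ 2 ≤ M ^ 2 := by gcongr
      linarith))
  rw [AA_congr hGg, show m / t = p / 2 by rw [hm]; field_simp] at h1
  have h2 : ∫⁻ ζ, ‖g (ρ • ζ)‖ₑ ^ (p * t) ∂(tau (En n)) =
      ENNReal.ofReal (2 ^ m) * ∫⁻ ζ, ENNReal.ofReal (‖G (ρ • ζ)‖ ^ 2 / 2) ^ m ∂(tau (En n)) := by
    rw [← lintegral_const_mul' _ _ ENNReal.ofReal_ne_top]
    refine lintegral_congr_ae ?_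
    filter_upwards [tau_ae_norm (E := En n)] with ζ hζ
    have hz : ρ • ζ ∈ ball (0 : En n) 1 := by
      rw [mem_ball_zero_iff, norm_smul, hζ, mul_one, Real.norm_eq_abs, abs_lt]
      constructor <;> linarith
    rw [hGg hz, ← ENNReal.ofReal_rpow_of_pos two_pos, ← ENNReal.mul_rpow_of_nonneg _ _ hm0.le,
      ← ENNReal.ofReal_mul zero_le_two, mul_div_cancel₀ _ two_ne_zero, ← ofReal_norm,
      ENNReal.ofReal_pow (norm_nonneg _), ← ENNReal.rpow_natCast, ← ENNReal.rpow_mul]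
    congr 1
    rw [hm]; push_cast; ring
  rw [h2]
  refine (mul_le_mul_right h1 _).trans ?_
  have hTu : tau (En n) univ = ENNReal.ofReal T := (ENNReal.ofReal_toReal (measure_ne_top _ _)).symm
  have hT0 : 0 ≤ T := ENNReal.toReal_nonneg
  rw [hTu, ← ENNReal.ofReal_mul hL0m.le, mul_add, mul_add, mul_one, ← mul_assoc, ← ENNReal.ofReal_mul h2m.le,
    ← ENNReal.ofReal_mul h2m.le]
  have h5 : 0 ≤ C + C * (m / (t - m)) := by positivity
  have h6 : 0 ≤ L0 ^ m * T := by positivity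
  refine add_le_add (ENNReal.ofReal_le_ofReal ?_) (mul_le_mul_left (ENNReal.ofReal_le_ofReal ?_) _)
  · exact mul_le_mul_of_nonneg_left (by linarith) h2m.le
  · exact mul_le_mul_of_nonneg_left (by linarith) h2m.le

end

section

variable {n : ℕ} {g : En n → ℂ}

lemma le_of_le_add_mul_succ {x : ℕ → ℝ} {θ a b c : ℝ} (hθ0 : 0 ≤ θ) (hθ : θ < 1)
    (h1 : ∀ j, x j ≤ c + θ * x (j + 1)) (h2 : ∀ j : ℕ, x j ≤ a + b * j) : x 0 ≤ c / (1 - θ) := by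
  have h3 : 0 < 1 - θ := by linarith
  have h4 : ∀ j : ℕ, x 0 - c / (1 - θ) ≤ θ ^ j * (x j - c / (1 - θ)) := by
    intro j
    induction j with
    | zero => simp
    | succ j ih =>
      refine ih.trans ?_
      rw [pow_succ, mul_assoc]
      refine mul_le_mul_of_nonneg_left ?_ (pow_nonneg hθ0 j)
      have e : c = c / (1 - θ) * (1 - θ) := (div_mul_cancel₀ _ h3.ne').symm
      have := h1 j
      nlinarith
  have h5 : ∀ j : ℕ, x 0 - c / (1 - θ) ≤ (a - c / (1 - θ)) * θ ^ j + b * (j * θ ^ j) := fun j => by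
    refine (h4 j).trans ?_
    have := mul_le_mul_of_nonneg_left (sub_le_sub_right (h2 j) (c / (1 - θ))) (pow_nonneg hθ0 j)
    refine this.trans (le_of_eq (by ring))
  have h6 : Tendsto (fun j : ℕ => (a - c / (1 - θ)) * θ ^ j + b * (j * θ ^ j)) atTop (𝓝 ((a - c / (1 - θ)) * 0 + b * 0)) :=
    ((tendsto_pow_atTop_nhds_zero_of_lt_one hθ0 hθ).const_mul _).add
      ((tendsto_self_mul_const_pow_of_lt_one hθ0 hθ).const_mul _)
  have h7 := ge_of_tendsto' h6 h5
  simp only [mul_zero, add_zero] at h7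
  linarith

/-- Values in a truncated approach region are controlled by the maximal function of a slightly larger dilation. -/
lemma exists_le_MM_dilate (n : ℕ) [NeZero n] {α s : ℝ} (hα : 1 < α) (hs : 0 < s) :
    ∃ C : ℝ, 0 < C ∧ ∀ (g : En n → ℂ) (ρ : ℝ) (ζ z : En n), DifferentiableOn ℂ g (ball 0 1) → 0 < ρ → ρ < 1 →
      ‖ζ‖ = 1 → z ∈ Rg α ρ ζ → ‖g z‖ₑ ^ s ≤ ENNReal.ofReal C * MM (bd (fun w => g (((1 + ρ) / 2) • w)) s) ζ := by
  obtain ⟨C, hC, h⟩ := exists_le_MM n (K := 2 * (α + 2)) (by linarith) hs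
  refine ⟨C, hC, fun g ρ ζ z hg h0 h1 hζ hz => ?_⟩
  set r := (1 + ρ) / 2 with hr
  have hr0 : 0 < r := by linarith
  have hr1 : r < 1 := by linarith
  have hri : 1 < r⁻¹ := (one_lt_inv₀ hr0).2 hr1
  have hzρ : ‖z‖ < ρ := hz.1
  have hzd : dk z ζ < α / 2 * (1 - ‖z‖ ^ 2) := hz.2
  have hz0 := norm_nonneg z
  have hna : ‖r⁻¹ • z‖ = r⁻¹ * ‖z‖ := by rw [norm_smul, Real.norm_of_nonneg (by positivity)]
  have hcz : r⁻¹ * ‖z‖ * r = ‖z‖ := by field_simp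
  have h2 : 1 - ‖z‖ ≤ 2 * (1 - r⁻¹ * ‖z‖) := by
    have h3 : 0 ≤ (2 * (1 - r⁻¹ * ‖z‖) - (1 - ‖z‖)) * r := by
      have : (2 * (1 - r⁻¹ * ‖z‖) - (1 - ‖z‖)) * r = 2 * r - 2 * (r⁻¹ * ‖z‖ * r) - (1 - ‖z‖) * r := by ring
      rw [this, hcz]
      nlinarith [sq_nonneg (1 - r)]
    have := nonneg_of_mul_nonneg_left h3 hr0
    linarith
  have h3 : dk (r⁻¹ • z) ζ ≤ dk z ζ + (r⁻¹ - 1) := by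
    have e : (1 : ℂ) - inner ℂ ζ (r⁻¹ • z) = (1 - inner ℂ ζ z) - ((r⁻¹ - 1 : ℝ) : ℂ) * inner ℂ ζ z := by
      rw [RCLike.real_smul_eq_coe_smul (K := ℂ), inner_smul_right]; push_cast; simp; ring
    unfold dk
    rw [e]
    refine (norm_sub_le _ _).trans (add_le_add le_rfl ?_)
    rw [norm_mul, Complex.norm_real, Real.norm_of_nonneg (by linarith)]
    refine mul_le_of_le_one_right (by linarith) ?_
    have := norm_inner_le_norm (𝕜 := ℂ) ζ z
    rw [hζ, one_mul] at this
    linarith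
  have h4 : r⁻¹ - 1 ≤ 2 * (1 - ‖z‖) := by
    have h5 : r⁻¹ ≤ 2 := by
      rw [inv_le_comm₀ hr0 two_pos]; linarith
    have h6 : r⁻¹ - 1 = r⁻¹ * (1 - r) := by field_simp
    rw [h6]
    exact mul_le_mul h5 (by linarith) (by linarith) zero_le_two
  have h5 := mul_sub_norm_sq_le (α := α) (by linarith) (show ‖z‖ ≤ 1 by linarith)
  have h6 := h (fun w => g (r • w)) r⁻¹ (r⁻¹ • z) ζ (differentiableOn_dilate hg hr0) hri
    (by rw [hna]; linarith) hζ (by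
      rw [hna]
      have : (α + 2) * (1 - ‖z‖) ≤ (α + 2) * (2 * (1 - r⁻¹ * ‖z‖)) := mul_le_mul_of_nonneg_left h2 (by linarith)
      linarith)
  simp only [smul_smul, mul_inv_cancel₀ hr0.ne', one_smul] at h6
  exact h6

/-- Area functions at the exponent `p t` are controlled by Hölder's inequality. -/
lemma exists_lintegral_AA_le (n : ℕ) [NeZero n] {α p t : ℝ} (hα : 1 < α) (hp : 1 < p) (ht : 0 < t) :
    ∃ C : ℝ, 0 < C ∧ ∀ (g : En n → ℂ) (ρ : ℝ), DifferentiableOn ℂ g (ball 0 1) → 0 < ρ → ρ < 1 →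
      ∫⁻ ζ, AA g (2 * (p * t)) α ρ ζ ^ (1 / 2 : ℝ) ∂(tau (En n)) ≤
        ENNReal.ofReal C * (∫⁻ ζ, ‖g (((1 + ρ) / 2) • ζ)‖ₑ ^ (p * t) ∂(tau (En n))) ^ (1 - 1 / p) *
          (∫⁻ ζ, AA g (2 * t) α ρ ζ ^ (p / 2) ∂(tau (En n))) ^ (1 / p) := by
  have hp0 : 0 < p := by linarith
  have hp1 : 0 < p - 1 := by linarith
  obtain ⟨C1, hC1, h1⟩ := exists_le_MM_dilate n hα (s := p * t / 2) (by positivity)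
  obtain ⟨C2, hC2, h2⟩ := strong_MM n one_lt_two
  have hθ : 0 < 1 - 1 / p := by rw [sub_pos, div_lt_one hp0]; exact hp
  refine ⟨C1 ^ (2 * (1 - 1 / p)) * C2 ^ (1 - 1 / p), by positivity, fun g ρ hg hρ0 hρ => ?_⟩
  set r := (1 + ρ) / 2 with hr
  have hr0 : 0 < r := by linarith
  have hri : 1 < r⁻¹ := (one_lt_inv₀ hr0).2 (by linarith)
  set U := bd (fun w => g (r • w)) (p * t / 2) with hU
  have hUm : Measurable U := measurable_bd (differentiableOn_dilate hg hr0) hri _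
  have hpt : ∀ᵐ ζ ∂(tau (En n)), AA g (2 * (p * t)) α ρ ζ ^ (1 / 2 : ℝ) ≤
      ((fun ζ => (ENNReal.ofReal C1 * MM U ζ) ^ (2 * (1 - 1 / p))) * (fun ζ => AA g (2 * t) α ρ ζ ^ (1 / 2 : ℝ))) ζ := by
    filter_upwards [tau_ae_norm (E := En n)] with ζ hζ
    have h3 := AA_le_mul (s := 2 * (p * t)) (s' := 2 * t) (α := α) (ρ := ρ) (ζ := ζ)
      (M := (ENNReal.ofReal C1 * MM U ζ) ^ (1 / (p * t / 2))) hg (by nlinarith) (fun z hz _ => by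
        have h4 := h1 g ρ ζ z hg hρ0 hρ hζ hz
        have h5 := ENNReal.rpow_le_rpow h4 (by positivity : 0 ≤ 1 / (p * t / 2))
        rwa [← ENNReal.rpow_mul, mul_one_div_cancel (by positivity), ENNReal.rpow_one] at h5)
    refine (ENNReal.rpow_le_rpow h3 (by norm_num)).trans (le_of_eq ?_)
    rw [ENNReal.mul_rpow_of_nonneg _ _ (by norm_num), ← ENNReal.rpow_mul, ← ENNReal.rpow_mul]
    simp only [Pi.mul_apply]
    congr 2
    field_simp
  refine (lintegral_mono_ae hpt).trans ?_
  have hAm := measurable_AA hg (2 * t) α ρ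
  refine (ENNReal.lintegral_mul_le_Lp_mul_Lq _ (p := p / (p - 1)) (q := p)
    (Real.holderConjugate_iff.2 ⟨by rw [lt_div_iff₀ hp1]; linarith, by field_simp; ring⟩)
    (((measurable_MM U).const_mul _).pow_const _).aemeasurable (hAm.pow_const _).aemeasurable).trans ?_
  have e1 : ∀ ζ, (AA g (2 * t) α ρ ζ ^ (1 / 2 : ℝ)) ^ p = AA g (2 * t) α ρ ζ ^ (p / 2) := fun ζ => by
    rw [← ENNReal.rpow_mul]; congr 1; ring
  have e2 : ∀ ζ, ((ENNReal.ofReal C1 * MM U ζ) ^ (2 * (1 - 1 / p))) ^ (p / (p - 1)) =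
      ENNReal.ofReal (C1 ^ (2 : ℝ)) * MM U ζ ^ (2 : ℝ) := fun ζ => by
    rw [← ENNReal.rpow_mul, show 2 * (1 - 1 / p) * (p / (p - 1)) = 2 by field_simp,
      ENNReal.mul_rpow_of_nonneg _ _ zero_le_two, ENNReal.ofReal_rpow_of_pos hC1]
  simp_rw [e1, e2]
  refine mul_le_mul_left ?_ _
  rw [lintegral_const_mul' _ _ ENNReal.ofReal_ne_top, show 1 / (p / (p - 1)) = 1 - 1 / p by field_simp]
  have h3 := h2 U hUm
  rw [hU, lintegral_bd_rpow, div_mul_cancel₀ _ two_ne_zero, ← hU] at h3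
  refine (ENNReal.rpow_le_rpow (mul_le_mul_right h3 _) hθ.le).trans (le_of_eq ?_)
  rw [ENNReal.mul_rpow_of_nonneg _ _ hθ.le, ENNReal.mul_rpow_of_nonneg _ _ hθ.le, ← mul_assoc,
    ENNReal.ofReal_mul (by positivity), ENNReal.ofReal_rpow_of_pos (by positivity), ENNReal.ofReal_rpow_of_pos hC2,
    ← Real.rpow_mul hC1.le]

end

section

variable {n : ℕ} {g : En n → ℂ}

lemma AA_mono (g : En n → ℂ) (s α : ℝ) {ρ ρ' : ℝ} (h : ρ ≤ ρ') (ζ : En n) : AA g s α ρ ζ ≤ AA g s α ρ' ζ :=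
  lintegral_mono_set fun z hz => ⟨lt_of_lt_of_le (show ‖z‖ < ρ from hz.1) h, hz.2⟩

lemma ENNReal.rpow_le_one_add_rpow {a b : ℝ} (ha : 0 ≤ a) (hab : a ≤ b) (x : ℝ≥0∞) : x ^ a ≤ 1 + x ^ b := by
  rcases le_total x 1 with h | h
  · exact le_add_right (ENNReal.rpow_le_one h ha)
  · exact le_add_left (ENNReal.rpow_le_rpow_of_exponent_le h hab)

/-- Bounded means of order `t` give polynomial growth of the means of any other order. -/
lemma exists_mean_growth [NeZero n] {p t r1 D : ℝ} (hp : 0 < p) (ht : 0 < t) (hr1 : 0 < r1)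
    (hg : DifferentiableOn ℂ g (ball 0 1))
    (hD : ∀ ρ : ℝ, r1 ≤ ρ → ρ < 1 → ∫⁻ ζ, ‖g (ρ • ζ)‖ₑ ^ t ∂(tau (En n)) ≤ ENNReal.ofReal D) :
    ∃ K : ℝ, 1 ≤ K ∧ ∀ ρ : ℝ, r1 ≤ ρ → ρ < 1 →
      ∫⁻ ζ, ‖g (ρ • ζ)‖ₑ ^ (p * t) ∂(tau (En n)) ≤ ENNReal.ofReal (K * ((1 - ρ)⁻¹) ^ (n * p)) := by
  obtain ⟨C, hC, h⟩ := exists_growth n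
  set T := (tau (En n) univ).toReal with hT
  have hTu : tau (En n) univ = ENNReal.ofReal T := (ENNReal.ofReal_toReal (measure_ne_top _ _)).symm
  have hT0 : 0 ≤ T := ENNReal.toReal_nonneg
  set D' := max D 0 with hD'
  have hD0 : 0 ≤ D' := le_max_right _ _
  refine ⟨1 + (C * 2 ^ n * D') ^ p * T, by
    have : 0 ≤ (C * 2 ^ n * D') ^ p * T := by positivity
    linarith, fun ρ hρ1 hρ => ?_⟩
  have hρ0 : 0 < ρ := hr1.trans_le hρ1
  have h1ρ : 0 < 1 - ρ := by linarith
  set r := (1 + ρ) / 2 with hr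
  have hr0 : 0 < r := by linarith
  have hri : 1 < r⁻¹ := (one_lt_inv₀ hr0).2 (by linarith)
  have hpt : ∀ᵐ ζ ∂(tau (En n)), ‖g (ρ • ζ)‖ₑ ^ (p * t) ≤ ENNReal.ofReal ((C * 2 ^ n * D') ^ p * ((1 - ρ)⁻¹) ^ (n * p)) := by
    filter_upwards [tau_ae_norm (E := En n)] with ζ hζ
    have hna : ‖(r⁻¹ * ρ) • ζ‖ = r⁻¹ * ρ := by rw [norm_smul, hζ, mul_one, Real.norm_of_nonneg (by positivity)]
    have h2 : (1 - ρ) / 2 ≤ 1 - r⁻¹ * ρ := by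
      have h3 : 1 - r⁻¹ * ρ = r⁻¹ * ((1 - ρ) / 2) := by
        rw [show (1 - ρ) / 2 = r - ρ by rw [hr]; ring]; field_simp
      rw [h3]
      exact le_mul_of_one_le_left (by linarith) hri.le
    have h3 := h (fun w => g (r • w)) r⁻¹ t (differentiableOn_dilate hg hr0) hri ht ((r⁻¹ * ρ) • ζ) (by rw [hna]; linarith)
    simp only [smul_smul, ← mul_assoc, mul_inv_cancel₀ hr0.ne', one_mul, hna] at h3
    have h4 : ‖g (ρ • ζ)‖ₑ ^ t ≤ ENNReal.ofReal (C * 2 ^ n * D' * ((1 - ρ)⁻¹) ^ n) := by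
      refine h3.trans ((mul_le_mul_right (hD r (by linarith) (by linarith)) _).trans ?_)
      rw [← ENNReal.ofReal_mul (by have : 0 < 1 - r⁻¹ * ρ := by linarith
                                   positivity)]
      refine ENNReal.ofReal_le_ofReal ?_
      have h5 : C / (1 - r⁻¹ * ρ) ^ n ≤ C * 2 ^ n * ((1 - ρ)⁻¹) ^ n := by
        calc C / (1 - r⁻¹ * ρ) ^ n ≤ C / ((1 - ρ) / 2) ^ n := by gcongr
          _ = _ := by rw [div_pow, inv_pow]; field_simp
      have h5' : 0 ≤ C / (1 - r⁻¹ * ρ) ^ n := by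
        have : 0 < 1 - r⁻¹ * ρ := by linarith
        positivity
      calc C / (1 - r⁻¹ * ρ) ^ n * D ≤ C / (1 - r⁻¹ * ρ) ^ n * D' := mul_le_mul_of_nonneg_left (le_max_left _ _) h5'
        _ ≤ C * 2 ^ n * ((1 - ρ)⁻¹) ^ n * D' := mul_le_mul_of_nonneg_right h5 hD0
        _ = _ := by ring
    rw [mul_comm p t, ENNReal.rpow_mul]
    refine (ENNReal.rpow_le_rpow h4 hp.le).trans (le_of_eq ?_)
    rw [ENNReal.ofReal_rpow_of_nonneg (by positivity) hp.le, Real.mul_rpow (by positivity) (by positivity),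
      Real.rpow_mul (by positivity), Real.rpow_natCast]
  refine (lintegral_mono_ae hpt).trans ?_
  rw [lintegral_const, hTu, ← ENNReal.ofReal_mul (by positivity)]
  refine ENNReal.ofReal_le_ofReal ?_
  have : 0 ≤ ((1 - ρ)⁻¹) ^ (n * p) := by positivity
  nlinarith

/-- Integral means are controlled by the area function for large exponents. -/
lemma exists_mean_le_of_area_of_one_lt [NeZero n] {α p t : ℝ} (hα : 1 < α) (hp : 1 < p) (ht : 0 < t)
    (hg : DifferentiableOn ℂ g (ball 0 1))
    (hA : ∫⁻ ζ, AA g (2 * t) α 1 ζ ^ (p / 2) ∂(tau (En n)) < ⊤) :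
    ∃ C : ℝ, ∀ ρ : ℝ, (1 + α⁻¹) / 2 ≤ ρ → ρ < 1 →
      ∫⁻ ζ, ‖g (ρ • ζ)‖ₑ ^ (p * t) ∂(tau (En n)) ≤ ENNReal.ofReal C := by
  have hp0 : 0 < p := by linarith
  have hinv : α⁻¹ < 1 := inv_lt_one_of_one_lt₀ hα
  have hinv0 : 0 < α⁻¹ := by positivity
  set r1 := (1 + α⁻¹) / 2 with hr1
  have hr10 : 0 < r1 := by linarith
  set B := ∫⁻ ζ, AA g (2 * t) α 1 ζ ^ (p / 2) ∂(tau (En n)) with hB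
  -- means of order `t`
  obtain ⟨C0, hC0, h0⟩ := exists_mean_le_area (p := 1) hα one_pos one_lt_two ht hg
  have hD : ∀ ρ : ℝ, r1 ≤ ρ → ρ < 1 → ∫⁻ ζ, ‖g (ρ • ζ)‖ₑ ^ t ∂(tau (En n)) ≤
      ENNReal.ofReal (ENNReal.ofReal C0 * (1 + (tau (En n) univ + B))).toReal := by
    intro ρ hρ1 hρ
    rw [ENNReal.ofReal_toReal (ENNReal.mul_ne_top ENNReal.ofReal_ne_top (ENNReal.add_ne_top.2 ⟨ENNReal.one_ne_top,
      ENNReal.add_ne_top.2 ⟨measure_ne_top _ _, hA.ne⟩⟩))]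
    have h2 := h0 ρ hρ1 hρ
    rw [one_mul] at h2
    refine h2.trans (mul_le_mul_right (add_le_add le_rfl ?_) _)
    have h3 : ∀ ζ, AA g (2 * t) α ρ ζ ^ (1 / 2 : ℝ) ≤ 1 + AA g (2 * t) α 1 ζ ^ (p / 2) := fun ζ =>
      (ENNReal.rpow_le_rpow (AA_mono g _ _ hρ.le ζ) (by norm_num)).trans
        (ENNReal.rpow_le_one_add_rpow (by norm_num) (by linarith) _)
    refine (lintegral_mono h3).trans (le_of_eq ?_)
    rw [lintegral_add_left measurable_const, lintegral_const, one_mul]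
  obtain ⟨K, hK, hgrow⟩ := exists_mean_growth hp0 ht hr10 hg hD
  obtain ⟨C1, hC1, h1⟩ := exists_mean_le_area (p := 1) hα one_pos one_lt_two (t := p * t) (by positivity) hg
  obtain ⟨C2, hC2, h2⟩ := exists_lintegral_AA_le n hα hp ht
  set N : ℝ → ℝ := fun ρ => (∫⁻ ζ, ‖g (ρ • ζ)‖ₑ ^ (p * t) ∂(tau (En n))).toReal with hN
  have hNe : ∀ ρ : ℝ, r1 ≤ ρ → ρ < 1 → ∫⁻ ζ, ‖g (ρ • ζ)‖ₑ ^ (p * t) ∂(tau (En n)) = ENNReal.ofReal (N ρ) :=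
    fun ρ hρ1 hρ => (ENNReal.ofReal_toReal ((hgrow ρ hρ1 hρ).trans_lt ENNReal.ofReal_lt_top).ne).symm
  have hN0 : ∀ ρ, 0 ≤ N ρ := fun ρ => ENNReal.toReal_nonneg
  set θ := 1 - 1 / p with hθd
  have hθ0 : 0 < θ := by rw [hθd, sub_pos, div_lt_one hp0]; exact hp
  have hθ1 : θ < 1 := by have : 0 < 1 / p := by positivity
                         linarith
  set b := (B ^ (1 / p)).toReal with hb
  have hb0 : 0 ≤ b := ENNReal.toReal_nonneg
  have hBb : B ^ (1 / p) = ENNReal.ofReal b :=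
    (ENNReal.ofReal_toReal (ENNReal.rpow_ne_top_of_nonneg (by positivity) hA.ne)).symm
  have hrec : ∀ ρ : ℝ, r1 ≤ ρ → ρ < 1 → N ρ ≤ C1 * (1 + C2 * N ((1 + ρ) / 2) ^ θ * b) := by
    intro ρ hρ1 hρ
    have h3 := h1 ρ hρ1 hρ
    rw [one_mul] at h3
    have h4 := h2 g ρ hg (hr10.trans_le hρ1) hρ
    have h5 : (∫⁻ ζ, AA g (2 * t) α ρ ζ ^ (p / 2) ∂(tau (En n))) ^ (1 / p) ≤ ENNReal.ofReal b := by
      rw [← hBb]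
      refine ENNReal.rpow_le_rpow (lintegral_mono fun ζ => ENNReal.rpow_le_rpow (AA_mono g _ _ hρ.le ζ) (by positivity))
        (by positivity)
    rw [hNe _ (by linarith) (by linarith)] at h4
    have h6 := h3.trans (mul_le_mul_right (add_le_add le_rfl (h4.trans (mul_le_mul_right h5 _))) _)
    have hNθ := Real.rpow_nonneg (hN0 ((1 + ρ) / 2)) θ
    rw [hNe ρ hρ1 hρ, ENNReal.ofReal_rpow_of_nonneg (hN0 _) hθ0.le, ← ENNReal.ofReal_mul hC2.le,
      ← ENNReal.ofReal_mul (by positivity), ← ENNReal.ofReal_one, ← ENNReal.ofReal_add zero_le_one (by positivity),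
      ← ENNReal.ofReal_mul hC1.le, ENNReal.ofReal_le_ofReal_iff (by positivity)] at h6
    exact h6
  set Q := C1 * (1 + C2 * b) + 1 with hQ
  have hQ1 : 1 ≤ Q := by
    have : 0 ≤ C1 * (1 + C2 * b) := by positivity
    linarith
  refine ⟨Real.exp (Real.log Q / (1 - θ)), fun ρ hρ1 hρ => ?_⟩
  have h1ρ : 0 < 1 - ρ := by linarith
  rw [hNe ρ hρ1 hρ]
  refine ENNReal.ofReal_le_ofReal ?_
  set R : ℕ → ℝ := fun j => 1 - (1 - ρ) / 2 ^ j with hR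
  have hRl : ∀ j, ρ ≤ R j := fun j => by
    have : (1 - ρ) / 2 ^ j ≤ 1 - ρ := div_le_self h1ρ.le (one_le_pow₀ one_le_two)
    simp only [hR]; linarith
  have hRu : ∀ j, R j < 1 := fun j => by
    have : 0 < (1 - ρ) / 2 ^ j := by positivity
    simp only [hR]; linarith
  have hRs : ∀ j, (1 + R j) / 2 = R (j + 1) := fun j => by
    simp only [hR]; rw [pow_succ]; field_simp; ring
  have hmax : ∀ j, 0 < max 1 (N (R j)) := fun j => lt_of_lt_of_le one_pos (le_max_left _ _)
  have h3 := le_of_le_add_mul_succ (x := fun j => Real.log (max 1 (N (R j)))) (θ := θ) (c := Real.log Q)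
    (a := Real.log K + n * p * Real.log (1 - ρ)⁻¹) (b := n * p * Real.log 2) hθ0.le hθ1 (fun j => by
      rw [← Real.log_rpow (hmax _), ← Real.log_mul (by linarith) (Real.rpow_pos_of_pos (hmax _) _).ne']
      refine Real.log_le_log (hmax _) ?_
      have h4 := hrec (R j) (hρ1.trans (hRl j)) (hRu j)
      rw [hRs] at h4
      have h5 : N (R (j + 1)) ^ θ ≤ max 1 (N (R (j + 1))) ^ θ := Real.rpow_le_rpow (hN0 _) (le_max_right _ _) hθ0.le
      have h6 : 1 ≤ max 1 (N (R (j + 1))) ^ θ := Real.one_le_rpow (le_max_left _ _) hθ0.le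
      set X := max 1 (N (R (j + 1))) ^ θ
      refine max_le (by nlinarith) (h4.trans ?_)
      calc C1 * (1 + C2 * N (R (j + 1)) ^ θ * b) ≤ C1 * (X + C2 * X * b) := by gcongr
        _ = C1 * (1 + C2 * b) * X := by ring
        _ ≤ Q * X := by gcongr; linarith) (fun j => by
      have h4 : N (R j) ≤ K * ((1 - R j)⁻¹) ^ (n * p) := by
        have := hgrow (R j) (hρ1.trans (hRl j)) (hRu j)
        rw [hNe _ (hρ1.trans (hRl j)) (hRu j), ENNReal.ofReal_le_ofReal_iff
          (by have := hRu j; have : 0 < 1 - R j := by linarith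
              positivity)] at this
        exact this
      have h5 : (1 - R j)⁻¹ = (1 - ρ)⁻¹ * 2 ^ j := by
        simp only [hR]; rw [sub_sub_cancel, inv_div, div_eq_mul_inv, mul_comm]
      have h6 : 1 ≤ ((1 - R j)⁻¹) ^ (n * p) := by
        refine Real.one_le_rpow ?_ (by positivity)
        rw [one_le_inv₀ (by have := hRu j; linarith)]
        have := hRl j
        linarith
      have h7 : max 1 (N (R j)) ≤ K * ((1 - R j)⁻¹) ^ (n * p) := max_le (by nlinarith) h4
      refine (Real.log_le_log (hmax _) h7).trans (le_of_eq ?_)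
      have h8 : 0 < (1 - ρ)⁻¹ * 2 ^ j := by positivity
      rw [h5, Real.log_mul (by linarith) (Real.rpow_pos_of_pos h8 _).ne', Real.log_rpow h8,
        Real.log_mul (by positivity) (by positivity), Real.log_pow]
      ring)
  have h4 : R 0 = ρ := by simp [hR]
  simp only [h4] at h3
  refine (le_max_right 1 _).trans ?_
  rw [← Real.exp_log (lt_of_lt_of_le one_pos (le_max_left 1 (N ρ)))]
  exact Real.exp_le_exp.2 h3

/-- Finiteness of the area integral bounds the integral means. -/
lemma exists_mean_le_of_area [NeZero n] {α p t : ℝ} (hα : 1 < α) (hp : 0 < p) (ht : 0 < t)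
    (hg : DifferentiableOn ℂ g (ball 0 1))
    (hA : ∫⁻ ζ, AA g (2 * t) α 1 ζ ^ (p / 2) ∂(tau (En n)) < ⊤) :
    ∃ C : ℝ, ∀ ρ : ℝ, (1 + α⁻¹) / 2 ≤ ρ → ρ < 1 →
      ∫⁻ ζ, ‖g (ρ • ζ)‖ₑ ^ (p * t) ∂(tau (En n)) ≤ ENNReal.ofReal C := by
  rcases lt_or_ge 1 p with h | h
  · exact exists_mean_le_of_area_of_one_lt hα h ht hg hA
  obtain ⟨C, hC, h1⟩ := exists_mean_le_area hα hp (by linarith) ht hg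
  refine ⟨(ENNReal.ofReal C * (1 + ∫⁻ ζ, AA g (2 * t) α 1 ζ ^ (p / 2) ∂(tau (En n)))).toReal, fun ρ hρ1 hρ => ?_⟩
  rw [ENNReal.ofReal_toReal (ENNReal.mul_ne_top ENNReal.ofReal_ne_top (ENNReal.add_ne_top.2 ⟨ENNReal.one_ne_top, hA.ne⟩))]
  refine (h1 ρ hρ1 hρ).trans (mul_le_mul_right (add_le_add le_rfl (lintegral_mono fun ζ => ?_)) _)
  exact ENNReal.rpow_le_rpow (AA_mono g _ _ hρ.le ζ) (by positivity)

end

section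

variable {n : ℕ} {g : En n → ℂ}

/-- The derivative at the origin of the automorphism `mob z`, for `z ≠ 0`. -/
def mobDeriv (z : En n) : En n →L[ℂ] En n :=
  -((Real.sqrt (1 - ‖z‖ ^ 2) : ℂ) • ContinuousLinearMap.id ℂ (En n) +
    ((((1 - ‖z‖ ^ 2) - Real.sqrt (1 - ‖z‖ ^ 2)) / ‖z‖ ^ 2 : ℝ) : ℂ) • (innerSL ℂ z).smulRight z)

lemma hasFDerivAt_mob {z : En n} (hz : z ≠ 0) : HasFDerivAt (mob z) (mobDeriv z) 0 := by
  have hz0 : (‖z‖ : ℂ) ≠ 0 := by exact_mod_cast (norm_pos_iff.2 hz).ne'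
  set s : ℂ := (Real.sqrt (1 - ‖z‖ ^ 2) : ℂ) with hs
  have e : mob z = fun w => ((1 : ℂ) - innerSL ℂ z w)⁻¹ •
      ((z - (innerSL ℂ z w / (‖z‖ : ℂ) ^ 2) • z) - s • (w - (innerSL ℂ z w / (‖z‖ : ℂ) ^ 2) • z)) := by
    funext w
    rw [mob, if_neg hz, herm_eq_inner, herm_eq_inner, inner_self_eq_norm_sq_to_K]
    rfl
  have hl : HasFDerivAt (fun w => innerSL ℂ z w) (innerSL ℂ z) (0 : En n) := (innerSL ℂ z).hasFDerivAt
  have h1 : HasFDerivAt (fun w => ((1 : ℂ) - innerSL ℂ z w)⁻¹) (innerSL ℂ z) (0 : En n) := by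
    have h2 : HasDerivAt (fun x : ℂ => (1 - x)⁻¹) 1 (innerSL ℂ z 0) := by
      have h3 : HasDerivAt (fun x : ℂ => 1 - x) (-1) (innerSL ℂ z 0) :=
        (hasDerivAt_id _).const_sub 1
      exact (h3.fun_inv (by simp)).congr_deriv (by simp)
    exact (h2.comp_hasFDerivAt (0 : En n) hl).congr_fderiv (by simp)
  have h2 : HasFDerivAt (fun w => (innerSL ℂ z w / (‖z‖ : ℂ) ^ 2) • z)
      ((((‖z‖ : ℂ) ^ 2)⁻¹ • innerSL ℂ z).smulRight z) (0 : En n) := by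
    simp_rw [div_eq_inv_mul]
    exact ((hl.const_mul _).smul_const z)
  have h3 := h1.smul ((h2.const_sub z).sub (((hasFDerivAt_id (0 : En n)).sub h2).const_smul s))
  rw [e]
  refine h3.congr_fderiv ?_
  ext1 w
  have hz2 : ((‖z‖ : ℂ) ^ 2) ≠ 0 := pow_ne_zero 2 hz0
  simp only [mobDeriv, map_zero, zero_div, zero_smul, sub_zero, smul_zero, inv_one, one_smul,
    add_apply, sub_apply, neg_apply, smul_apply, ContinuousLinearMap.smulRight_apply,
    ContinuousLinearMap.id_apply, smul_eq_mul, Pi.sub_apply, Pi.smul_apply, id_eq]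
  rw [← hs]
  push_cast
  rw [← hs]
  match_scalars
  all_goals field_simp
  all_goals ring

lemma mobDeriv_apply (z w : En n) : mobDeriv z w = -((Real.sqrt (1 - ‖z‖ ^ 2) : ℂ) • w +
    (((((1 - ‖z‖ ^ 2) - Real.sqrt (1 - ‖z‖ ^ 2)) / ‖z‖ ^ 2 : ℝ) : ℂ) * inner ℂ z w) • z) := by
  simp [mobDeriv, smul_smul]

lemma inner_mobDeriv (z v w : En n) : inner ℂ v (mobDeriv z w) = inner ℂ (mobDeriv z v) w := by
  simp only [mobDeriv_apply, inner_neg_right, inner_neg_left, inner_add_right, inner_add_left,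
    inner_smul_right, inner_smul_left, map_mul, Complex.conj_ofReal, inner_conj_symm]
  ring

lemma norm_mobDeriv_sq {z : En n} (hz : z ≠ 0) (hz1 : ‖z‖ < 1) (v : En n) :
    ‖mobDeriv z v‖ ^ 2 = (1 - ‖z‖ ^ 2) * (‖v‖ ^ 2 - ‖inner ℂ z v‖ ^ 2) := by
  have hz0 : ‖z‖ ≠ 0 := (norm_pos_iff.2 hz).ne'
  have hn : 0 ≤ 1 - ‖z‖ ^ 2 := by nlinarith [norm_nonneg z]
  have hs := Real.sq_sqrt hn
  set s : ℝ := Real.sqrt (1 - ‖z‖ ^ 2)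
  rw [mobDeriv_apply, norm_neg, @norm_add_sq ℂ, norm_smul, norm_smul, norm_mul, mul_pow, mul_pow,
    mul_pow, inner_smul_left, inner_smul_right, Complex.conj_ofReal, Complex.norm_real,
    Complex.norm_real, Real.norm_eq_abs, Real.norm_eq_abs, sq_abs, sq_abs]
  set c : ℝ := ((1 - ‖z‖ ^ 2) - s) / ‖z‖ ^ 2 with hc
  have h1 : (s : ℂ) * ((c * inner ℂ z v) * inner ℂ v z) = ((s * c * ‖inner ℂ z v‖ ^ 2 : ℝ) : ℂ) := by
    rw [← inner_conj_symm v z]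
    have := Complex.mul_conj' (inner ℂ z v)
    push_cast
    rw [← this]
    ring
  rw [h1]
  have h2 : (RCLike.re ((s * c * ‖inner ℂ z v‖ ^ 2 : ℝ) : ℂ)) = s * c * ‖inner ℂ z v‖ ^ 2 :=
    Complex.ofReal_re _
  rw [h2]
  have hcz : c * ‖z‖ ^ 2 = (1 - ‖z‖ ^ 2) - s := by
    rw [hc]; field_simp
  have hcc : 2 * s * c + c * (c * ‖z‖ ^ 2) = -(1 - ‖z‖ ^ 2) := by
    rw [hcz]
    have hm : (2 * s * c + c * ((1 - ‖z‖ ^ 2) - s)) * ‖z‖ ^ 2 = -(1 - ‖z‖ ^ 2) * ‖z‖ ^ 2 := by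
      calc _ = (c * ‖z‖ ^ 2) * ((1 - ‖z‖ ^ 2) + s) := by ring
        _ = (1 - ‖z‖ ^ 2) ^ 2 - s ^ 2 := by rw [hcz]; ring
        _ = _ := by rw [hs]; ring
    exact mul_right_cancel₀ (pow_ne_zero 2 hz0) hm
  rw [hs]
  linear_combination ‖inner ℂ z v‖ ^ 2 * hcc

lemma invGrad_sq {z : En n} (hz1 : ‖z‖ < 1) (hg : DifferentiableAt ℂ g z) :
    invGrad g z ^ 2 = (1 - ‖z‖ ^ 2) * N2 g z := by
  by_cases hz : z = 0
  · subst hz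
    have h1 : HasFDerivAt (fun w : En n => g (mob 0 w))
        ((fderiv ℂ g 0).comp (-ContinuousLinearMap.id ℂ (En n))) 0 := by
      have h2 : HasFDerivAt (fun w : En n => mob 0 w) (-ContinuousLinearMap.id ℂ (En n)) 0 := by
        have e : (fun w : En n => mob 0 w) = fun w => -w := by
          funext w
          simp [mob]
        rw [e]
        exact (hasFDerivAt_id (0 : En n)).fun_neg
      have h3 : HasFDerivAt g (fderiv ℂ g 0) (mob (0 : En n) 0) := by
        have : mob (0 : En n) 0 = 0 := by simp [mob]
        rw [this]
        exact hg.hasFDerivAt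
      exact h3.comp (0 : En n) h2
    rw [invGrad, (h1.restrictScalars ℝ).fderiv, ContinuousLinearMap.norm_restrictScalars]
    simp [N2]
  · have h0 : mob z 0 = z := by simp [mob, hz, herm]
    have h1 : HasFDerivAt (fun w : En n => g (mob z w)) ((fderiv ℂ g z).comp (mobDeriv z)) 0 := by
      have h3 : HasFDerivAt g (fderiv ℂ g z) (mob z 0) := by
        rw [h0]
        exact hg.hasFDerivAt
      exact h3.comp (0 : En n) (hasFDerivAt_mob hz)
    rw [invGrad, (h1.restrictScalars ℝ).fderiv, ContinuousLinearMap.norm_restrictScalars]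
    obtain ⟨v, hv⟩ := (InnerProductSpace.toDual ℂ (En n)).surjective (fderiv ℂ g z)
    have h2 : (fderiv ℂ g z).comp (mobDeriv z) = InnerProductSpace.toDual ℂ (En n) (mobDeriv z v) := by
      ext1 w
      rw [← hv]
      simp [inner_mobDeriv]
    rw [h2, LinearIsometryEquiv.norm_map, norm_mobDeriv_sq hz hz1, N2, ← hv,
      LinearIsometryEquiv.norm_map, InnerProductSpace.toDual_apply_apply, norm_inner_symm]

end

lemma lintegral_rpow_lt_top_of_le {X : Type*} [MeasurableSpace X] {μ ν : Measure X} {F G : X → ℝ≥0∞}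
    {C c : ℝ≥0∞} {r : ℝ} (hr : 0 < r) (hC : C ≠ ⊤) (hc : c ≠ ⊤) (hμ : μ ≤ C • ν)
    (hFG : ∀ x, F x ≤ c * G x) (h : ∫⁻ x, G x ^ r ∂ν < ⊤) : ∫⁻ x, F x ^ r ∂μ < ⊤ := by
  have hcr : c ^ r ≠ ⊤ := ENNReal.rpow_ne_top_of_nonneg hr.le hc
  calc ∫⁻ x, F x ^ r ∂μ ≤ ∫⁻ x, c ^ r * G x ^ r ∂(C • ν) := by
        refine lintegral_mono' hμ fun x => ?_
        rw [← ENNReal.mul_rpow_of_nonneg _ _ hr.le]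
        exact ENNReal.rpow_le_rpow (hFG x) hr.le
    _ = C * (c ^ r * ∫⁻ x, G x ^ r ∂ν) := by
        rw [lintegral_smul_measure, lintegral_const_mul' _ _ hcr, smul_eq_mul]
    _ < ⊤ := ENNReal.mul_lt_top hC.lt_top (ENNReal.mul_lt_top hcr.lt_top h)

lemma Gam_eq_Rg {n : ℕ} (α : ℝ) (ζ : En n) : Gam α ζ = Rg α 1 ζ := by
  ext z
  have h1 : z ∈ Gam α ζ ↔ z ∈ ball (0 : En n) 1 ∧ ‖(1 : ℂ) - herm z ζ‖ < α / 2 * (1 - ‖z‖ ^ 2) :=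
    Iff.rfl
  have h2 : z ∈ Rg α 1 ζ ↔ ‖z‖ < 1 ∧ dk z ζ < α / 2 * (1 - ‖z‖ ^ 2) := Iff.rfl
  rw [h1, h2, mem_ball_zero_iff, herm_eq_inner, dk]

lemma weight_eq {n : ℕ} {g : En n → ℂ} (hg : DifferentiableOn ℂ g (ball 0 1)) (t : ℝ) {z : En n}
    (hz : ‖z‖ < 1) :
    ENNReal.ofReal ((1 - ‖z‖ ^ 2) ^ (-(n + 1 : ℝ))) *
      ((‖g z‖₊ : ℝ≥0∞) ^ (2 * t - 2) * ENNReal.ofReal (invGrad g z ^ 2)) =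
    ENNReal.ofReal ((1 - ‖z‖ ^ 2) ^ n)⁻¹ * EB g (2 * t) z := by
  have h0 : 0 < 1 - ‖z‖ ^ 2 := by nlinarith [norm_nonneg z]
  have hm : z ∈ ball (0 : En n) 1 := mem_ball_zero_iff.2 hz
  have e : (1 - ‖z‖ ^ 2) ^ (-(n + 1 : ℝ)) * (1 - ‖z‖ ^ 2) = ((1 - ‖z‖ ^ 2) ^ n)⁻¹ := by
    rw [Real.rpow_neg h0.le, show ((n : ℝ) + 1) = ((n + 1 : ℕ) : ℝ) by push_cast; ring,
      Real.rpow_natCast, pow_succ]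
    field_simp
  rw [EB, indicator_of_mem hm, EE, invGrad_sq hz (hg.differentiableAt (isOpen_ball.mem_nhds hm)),
    ENNReal.ofReal_mul h0.le, ← e, ENNReal.ofReal_mul (by positivity), enorm_eq_nnnorm]
  ring

lemma inner_area_eq {n : ℕ} {g : En n → ℂ} (hg : DifferentiableOn ℂ g (ball 0 1)) (t α : ℝ) (ζ : En n) :
    ∫⁻ z in Gam α ζ, (‖g z‖₊ : ℝ≥0∞) ^ (2 * t - 2) * ENNReal.ofReal (invGrad g z ^ 2) ∂(lamN n) =
    (volume (Bn n))⁻¹ * ∫⁻ z in Rg α 1 ζ, ENNReal.ofReal ((1 - ‖z‖ ^ 2) ^ n)⁻¹ * EB g (2 * t) z := by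
  have hR : MeasurableSet (Rg α 1 ζ) := (isOpen_Rg α 1 ζ).measurableSet
  have hRB : Rg α 1 ζ ⊆ Bn n := fun z hz => mem_ball_zero_iff.2 hz.1
  have hw : Measurable fun z : En n => ENNReal.ofReal ((1 - ‖z‖ ^ 2) ^ (-(n + 1 : ℝ))) := by fun_prop
  have e : (lamN n).restrict (Rg α 1 ζ) = (volume (Bn n))⁻¹ • (volume.restrict (Rg α 1 ζ)).withDensity
      (fun z : En n => ENNReal.ofReal ((1 - ‖z‖ ^ 2) ^ (-(n + 1 : ℝ)))) := by
    rw [lamN, volN, restrict_withDensity hR, Measure.restrict_smul, Measure.restrict_restrict hR,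
      inter_eq_left.2 hRB, withDensity_smul_measure]
  rw [Gam_eq_Rg, e, lintegral_smul_measure, smul_eq_mul,
    lintegral_withDensity_eq_lintegral_mul_non_measurable _ hw (Eventually.of_forall fun _ => ENNReal.ofReal_lt_top)]
  congr 1
  exact setLIntegral_congr_fun hR fun z hz => weight_eq hg t hz.1

lemma pow_inv_le_wt {n : ℕ} {z : En n} (hz : ‖z‖ < 1) : ENNReal.ofReal ((1 - ‖z‖ ^ 2) ^ n)⁻¹ ≤ wt z := by
  have h0 : 0 < 1 - ‖z‖ := by linarith
  refine ENNReal.ofReal_le_ofReal (inv_anti₀ (pow_pos h0 n) (pow_le_pow_left₀ h0.le ?_ n))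
  nlinarith [norm_nonneg z]

lemma wt_le_pow_inv {n : ℕ} {z : En n} (hz : ‖z‖ < 1) :
    wt z ≤ ENNReal.ofReal (2 ^ n) * ENNReal.ofReal ((1 - ‖z‖ ^ 2) ^ n)⁻¹ := by
  have h0 : 0 < 1 - ‖z‖ := by linarith
  have h1 : 0 < 1 - ‖z‖ ^ 2 := by nlinarith [norm_nonneg z]
  rw [← ENNReal.ofReal_mul (by positivity)]
  refine ENNReal.ofReal_le_ofReal ?_
  rw [← div_eq_mul_inv, le_div_iff₀ (by positivity), ← div_eq_inv_mul, ← div_pow]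
  refine pow_le_pow_left₀ (by positivity) ?_ n
  rw [div_le_iff₀ h0]
  nlinarith [norm_nonneg z]

lemma inner_area_le {n : ℕ} {g : En n → ℂ} (hg : DifferentiableOn ℂ g (ball 0 1)) (t α : ℝ) (ζ : En n) :
    ∫⁻ z in Gam α ζ, (‖g z‖₊ : ℝ≥0∞) ^ (2 * t - 2) * ENNReal.ofReal (invGrad g z ^ 2) ∂(lamN n) ≤
    (volume (Bn n))⁻¹ * AA g (2 * t) α 1 ζ := by
  rw [inner_area_eq hg]
  exact mul_le_mul_right (setLIntegral_mono' (isOpen_Rg α 1 ζ).measurableSet fun z hz =>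
    mul_le_mul_left (pow_inv_le_wt hz.1) _) _

lemma le_inner_area {n : ℕ} {g : En n → ℂ} (hg : DifferentiableOn ℂ g (ball 0 1)) (t α : ℝ) (ζ : En n) :
    AA g (2 * t) α 1 ζ ≤ (ENNReal.ofReal (2 ^ n) * volume (Bn n)) *
      ∫⁻ z in Gam α ζ, (‖g z‖₊ : ℝ≥0∞) ^ (2 * t - 2) * ENNReal.ofReal (invGrad g z ^ 2) ∂(lamN n) := by
  have hv0 : volume (Bn n) ≠ 0 := (measure_ball_pos volume _ one_pos).ne'
  have hv : volume (Bn n) ≠ ⊤ := measure_ball_lt_top.ne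
  rw [inner_area_eq hg, mul_assoc, ← mul_assoc (volume (Bn n)), ENNReal.mul_inv_cancel hv0 hv, one_mul,
    ← lintegral_const_mul' _ _ ENNReal.ofReal_ne_top]
  refine setLIntegral_mono' (isOpen_Rg α 1 ζ).measurableSet fun z hz => ?_
  rw [← mul_assoc]
  exact mul_le_mul_left (wt_le_pow_inv hz.1) _

/-- For `g` holomorphic on `B_n`, `0 < p, t < ∞` and an aperture `α > 1`:
`g ∈ H^{pt}` iff
`∫_{S_n} ( ∫_{Γ_α(ζ)} |g|^{2t-2} |∇̃g|² dλ_n )^{p/2} dσ < ∞`. -/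
theorem stmt9 (n : ℕ) (hn : 1 ≤ n) (p t α : ℝ) (hp : 0 < p) (ht : 0 < t) (hα : 1 < α)
    (g : En n → ℂ) (hg : DifferentiableOn ℂ g (Bn n)) :
    hNorm n (p * t) g < ⊤ ↔
      ∫⁻ ζ, (∫⁻ z in Gam α ζ,
          (‖g z‖₊ : ℝ≥0∞) ^ (2 * t - 2) *
            ENNReal.ofReal (invGrad g z ^ 2) ∂(lamN n)) ^ (p / 2) ∂(sigmaS n) < ⊤ := by
  have : NeZero n := ⟨by omega⟩
  have hg' : DifferentiableOn ℂ g (ball 0 1) := hg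
  have hpt : 0 < p * t := mul_pos hp ht
  have hp2 : 0 < p / 2 := by positivity
  obtain ⟨C, hC, -, h1, h2⟩ := sigmaS_tau n
  have hv0 : volume (Bn n) ≠ 0 := (measure_ball_pos volume _ one_pos).ne'
  have hv : volume (Bn n) ≠ ⊤ := measure_ball_lt_top.ne
  rw [hNorm, ENNReal.rpow_lt_top_iff_of_pos (by positivity)]
  constructor
  · intro h
    refine lintegral_rpow_lt_top_of_le hp2 hC (ENNReal.inv_ne_top.2 hv0) h1 (inner_area_le hg' t α) ?_
    obtain ⟨D, -, hD⟩ := exists_area_le_of_bound n hα hp ht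
    refine (hD g _ hg' fun ρ hρ => ?_).trans_lt
      (ENNReal.mul_lt_top ENNReal.ofReal_lt_top (ENNReal.mul_lt_top hC.lt_top h))
    refine (lintegral_mono' h2 le_rfl).trans ?_
    rw [lintegral_smul_measure, smul_eq_mul]
    refine mul_le_mul_right ?_ _
    exact le_iSup₂ (f := fun r (_ : r ∈ Ioo (0 : ℝ) 1) =>
      ∫⁻ ζ, (‖g (r • ζ)‖₊ : ℝ≥0∞) ^ (p * t) ∂(sigmaS n)) ρ hρ
  · intro h
    have hA : ∫⁻ ζ, AA g (2 * t) α 1 ζ ^ (p / 2) ∂(tau (En n)) < ⊤ :=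
      lintegral_rpow_lt_top_of_le hp2 hC (ENNReal.mul_ne_top ENNReal.ofReal_ne_top hv) h2
        (le_inner_area hg' t α) h
    obtain ⟨D, hD⟩ := exists_mean_le_of_area hα hp ht hg' hA
    have hα' : α⁻¹ < 1 := inv_lt_one_of_one_lt₀ hα
    refine (iSup₂_le fun r hr => ?_ : _ ≤ C * ENNReal.ofReal D).trans_lt
      (ENNReal.mul_lt_top hC.lt_top ENNReal.ofReal_lt_top)
    refine (lintegral_mono' h1 le_rfl).trans ?_
    rw [lintegral_smul_measure, smul_eq_mul]
    refine mul_le_mul_right ?_ _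
    refine (lintegral_mono_dilate hg' hpt hr.1.le (le_max_left r ((1 + α⁻¹) / 2))
      (max_lt hr.2 (by linarith))).trans ?_
    exact hD _ (le_max_right _ _) (max_lt hr.2 (by linarith))

end
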